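/- Main theorem: Let 1 < p ≠ 2 < ∞, ε > 0, and let T : ℓ_p(ℓ_2) → L_p[0,1] be an isomorphism onto its range. Then there is a subspace Y ⊂ ℓ_p(ℓ_2), (1+ε)-isomorphic to ℓ_p(ℓ_2), such that T restricted to Y is a (1+ε)-isomorphism and T(Y) is complemented in L_p[0,1] by a projection of norm at most (1+ε)γ_p if p > 2, and at most (1+ε)γ_{p/(p-1)} if 1 < p < 2. -/

import Mathlib

open MeasureTheory ProbabilityTheory
open scoped ENNReal

/-- Lebesgue measure on `[0,1]`. -/
noncomputable def μ01 : Measure ℝ := volume.restrict (Set.Icc (0 : ℝ) 1)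

/-- `γ_r`, the `L_r` norm of a standard Gaussian variable. -/
noncomputable def gaussNorm (r : ℝ) : ℝ :=
  (∫ x, |x| ^ r ∂(gaussianReal 0 1)) ^ (1 / r)

/-- The space `ℓ_p(ℓ_2)`. -/
noncomputable abbrev lpl2 (p : ℝ) := lp (fun _ : ℕ => lp (fun _ : ℕ => ℝ) 2) (ENNReal.ofReal p)

set_option linter.unusedSectionVars false

/-- Second order Taylor behaviour of order `r` used in the Lindeberg replacement argument. -/
structure TaylorBound (r : ℝ) (ψ ψ1 ψ2 : ℝ → ℝ) : Prop where
  cont : Continuous ψ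
  cont1 : Continuous ψ1
  cont2 : Continuous ψ2
  growth : ∃ C : ℝ, 0 < C ∧ ∀ t, |ψ t| ≤ C * (1 + |t|) ^ r ∧ |ψ1 t| ≤ C * (1 + |t|) ^ r ∧
    |ψ2 t| ≤ C * (1 + |t|) ^ (r - 2)
  taylor : ∀ η : ℝ, 0 < η → ∃ C : ℝ, 0 ≤ C ∧ ∃ κ : ℝ, 0 < κ ∧ ∀ t h : ℝ,
    |ψ (t + h) - ψ t - ψ1 t * h - 1 / 2 * ψ2 t * h ^ 2| ≤
      η * h ^ 2 * (1 + |t|) ^ (r - 2) + C * (if κ < |h| then |h| ^ r else 0)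

lemma taylor_remainder_le {ψ ψ1 ψ2 : ℝ → ℝ} (h0 : ∀ t, HasDerivAt ψ (ψ1 t) t)
    (h1 : ∀ t, HasDerivAt ψ1 (ψ2 t) t) (t h D : ℝ)
    (hD : ∀ s, |s| ≤ |h| → |ψ2 (t + s) - ψ2 t| ≤ D) :
    |ψ (t + h) - ψ t - ψ1 t * h - 1 / 2 * ψ2 t * h ^ 2| ≤ D * h ^ 2 := by
  have hconv : Convex ℝ {s : ℝ | |s| ≤ |h|} := by
    have : {s : ℝ | |s| ≤ |h|} = Set.Icc (-|h|) |h| := by ext s; simp [abs_le]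
    rw [this]; exact convex_Icc _ _
  have hz : (0 : ℝ) ∈ {s : ℝ | |s| ≤ |h|} := by simp
  have hh : h ∈ {s : ℝ | |s| ≤ |h|} := by simp
  have g1 : ∀ s, |s| ≤ |h| → |ψ1 (t + s) - ψ1 t - ψ2 t * s| ≤ D * |h| := by
    intro s hs
    have := hconv.norm_image_sub_le_of_norm_hasDerivWithin_le
      (f := fun s => ψ1 (t + s) - ψ2 t * s) (f' := fun s => ψ2 (t + s) - ψ2 t) (C := D)
      (fun x _ => (((h1 (t + x)).comp_const_add t x).sub
        (by simpa using (hasDerivAt_id x).const_mul (ψ2 t))).hasDerivWithinAt)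
      (fun x hx => by simpa using hD x hx) hz (y := s) hs
    simp only [add_zero, mul_zero, sub_zero, Real.norm_eq_abs] at this
    have h2 : D * |s| ≤ D * |h| :=
      mul_le_mul_of_nonneg_left hs ((abs_nonneg _).trans (hD 0 (by simp)))
    refine le_trans (le_of_eq ?_) (this.trans h2)
    congr 1; ring
  have := hconv.norm_image_sub_le_of_norm_hasDerivWithin_le
      (f := fun s => ψ (t + s) - ψ1 t * s - 1 / 2 * ψ2 t * s ^ 2)
      (f' := fun s => ψ1 (t + s) - ψ1 t - ψ2 t * s) (C := D * |h|)
      (fun x _ => by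
        have := ((((h0 (t + x)).comp_const_add t x).sub
          ((hasDerivAt_id x).const_mul (ψ1 t))).sub
          (((hasDerivAt_id x).pow 2).const_mul (1 / 2 * ψ2 t)))
        refine HasDerivAt.hasDerivWithinAt ?_
        convert this using 1
        · ext s; simp
        · simp; ring)
      (fun x hx => by simpa using g1 x hx) hz (y := h) hh
  simp only [add_zero, mul_zero, sub_zero, Real.norm_eq_abs] at this
  calc _ = |ψ (t + h) - ψ1 t * h - 1 / 2 * ψ2 t * h ^ 2 - (ψ t - 1 / 2 * ψ2 t * 0 ^ 2)| := by
        congr 1; ring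
    _ ≤ D * |h| * |h| := this
    _ = D * h ^ 2 := by rw [mul_assoc, abs_mul_abs_self, sq]

lemma taylor_of_deriv_bounds {r : ℝ} (hr : 2 ≤ r) {ψ ψ1 ψ2 ψ3 : ℝ → ℝ}
    (h0 : ∀ t, HasDerivAt ψ (ψ1 t) t) (h1 : ∀ t, HasDerivAt ψ1 (ψ2 t) t)
    (h2 : ∀ t, HasDerivAt ψ2 (ψ3 t) t) {C : ℝ} (hC : 0 < C)
    (b2 : ∀ t, |ψ2 t| ≤ C * (1 + |t|) ^ (r - 2))
    (b3 : ∀ t, |ψ3 t| * (1 + |t|) ≤ C * (1 + |t|) ^ (r - 2)) (η : ℝ) (hη : 0 < η) :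
    ∃ C : ℝ, 0 ≤ C ∧ ∃ κ : ℝ, 0 < κ ∧ ∀ t h : ℝ,
    |ψ (t + h) - ψ t - ψ1 t * h - 1 / 2 * ψ2 t * h ^ 2| ≤
      η * h ^ 2 * (1 + |t|) ^ (r - 2) + C * (if κ < |h| then |h| ^ r else 0) := by
  have hr2 : 0 ≤ r - 2 := by linarith
  have h2r : (0 : ℝ) < 2 ^ (r - 2) := by positivity
  obtain ⟨κ, hκ, hκ2, hκη⟩ : ∃ κ : ℝ, 0 < κ ∧ κ ≤ 1 / 2 ∧ C * 2 ^ (r - 2) * 2 * κ ≤ η := by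
    refine ⟨min (1 / 2) (η / (C * 2 ^ (r - 2) * 2)), by positivity, min_le_left _ _, ?_⟩
    calc _ ≤ C * 2 ^ (r - 2) * 2 * (η / (C * 2 ^ (r - 2) * 2)) := by
          gcongr; exact min_le_right _ _
      _ = η := by field_simp
  refine ⟨2 * C * (1 / κ + 1) ^ (r - 2), by positivity, κ, hκ, fun t h => ?_⟩
  have hN : 0 < 1 + |t| := by positivity
  rcases le_or_gt |h| (κ * (1 + |t|)) with hc | hc
  · have hkey : ∀ s, |s| ≤ |h| → |ψ2 (t + s) - ψ2 t| ≤ η * (1 + |t|) ^ (r - 2) := by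
      intro s hs
      have hconv : Convex ℝ {s : ℝ | |s| ≤ |h|} := by
        have : {s : ℝ | |s| ≤ |h|} = Set.Icc (-|h|) |h| := by ext s; simp [abs_le]
        rw [this]; exact convex_Icc _ _
      have := hconv.norm_image_sub_le_of_norm_hasDerivWithin_le
        (f := fun s => ψ2 (t + s)) (f' := fun s => ψ3 (t + s))
        (C := C * 2 ^ (r - 2) * 2 * (1 + |t|) ^ (r - 2) / (1 + |t|))
        (fun x _ => ((h2 (t + x)).comp_const_add t x).hasDerivWithinAt)
        (fun x hx => by
          have hx' : |x| ≤ κ * (1 + |t|) := le_trans hx hc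
          have hx2 : |x| ≤ 1 / 2 * (1 + |t|) :=
            hx'.trans (by gcongr)
          have e1 : |t| ≤ |t + x| + |x| := by simpa using abs_sub (t + x) x
          have e2 : |t + x| ≤ |t| + |x| := abs_add_le _ _
          have e3 : (1 + |t + x|) ^ (r - 2) ≤ 2 ^ (r - 2) * (1 + |t|) ^ (r - 2) := by
            rw [← Real.mul_rpow (by norm_num) hN.le]
            exact Real.rpow_le_rpow (by positivity) (by linarith) hr2
          rw [Real.norm_eq_abs, le_div_iff₀ hN]
          calc |ψ3 (t + x)| * (1 + |t|) ≤ |ψ3 (t + x)| * (2 * (1 + |t + x|)) := by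
                gcongr; linarith
            _ = 2 * (|ψ3 (t + x)| * (1 + |t + x|)) := by ring
            _ ≤ 2 * (C * (1 + |t + x|) ^ (r - 2)) :=
              mul_le_mul_of_nonneg_left (b3 _) (by norm_num)
            _ ≤ 2 * (C * (2 ^ (r - 2) * (1 + |t|) ^ (r - 2))) := by gcongr
            _ = _ := by ring)
        (x := 0) (by simp) (y := s) hs
      simp only [add_zero, sub_zero, Real.norm_eq_abs] at this
      refine this.trans ?_
      calc _ ≤ C * 2 ^ (r - 2) * 2 * (1 + |t|) ^ (r - 2) / (1 + |t|) * (κ * (1 + |t|)) := by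
            gcongr; exact hs.trans hc
        _ = (C * 2 ^ (r - 2) * 2 * κ) * (1 + |t|) ^ (r - 2) := by field_simp
        _ ≤ _ := by gcongr
    have := taylor_remainder_le h0 h1 t h _ hkey
    have h3 : 0 ≤ 2 * C * (1 / κ + 1) ^ (r - 2) * (if κ < |h| then |h| ^ r else 0) := by
      split_ifs <;> positivity
    linarith
  · have hh : κ < |h| := by nlinarith [abs_nonneg t]
    have hh0 : 0 < |h| := hκ.trans hh
    have hN2 : 1 + |t| ≤ 1 / κ * |h| := by
      rw [one_div, ← div_eq_inv_mul, le_div_iff₀ hκ]; linarith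
    have hb : ∀ s, |s| ≤ |h| → |ψ2 (t + s)| ≤ C * ((1 / κ + 1) ^ (r - 2) * |h| ^ (r - 2)) := by
      intro s hs
      refine (b2 _).trans ?_
      rw [← Real.mul_rpow (by positivity) hh0.le]
      gcongr
      have := abs_add_le t s
      linarith
    have hkey : ∀ s, |s| ≤ |h| → |ψ2 (t + s) - ψ2 t| ≤
        2 * C * (1 / κ + 1) ^ (r - 2) * |h| ^ (r - 2) := by
      intro s hs
      have e1 := hb s hs
      have e2 := hb 0 (by simp)
      rw [add_zero] at e2
      have := abs_sub (ψ2 (t + s)) (ψ2 t)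
      linarith
    have := taylor_remainder_le h0 h1 t h _ hkey
    rw [if_pos hh]
    have e4 : |h| ^ r = |h| ^ (r - 2) * h ^ 2 := by
      rw [← sq_abs h, ← Real.rpow_natCast, ← Real.rpow_add hh0]; congr 1; simp
    rw [e4]
    have : 0 ≤ η * h ^ 2 * (1 + |t|) ^ (r - 2) := by positivity
    linarith

/-- The smooth regularisation of `|t| ^ p`. -/
noncomputable def smoothPow (p δ t : ℝ) : ℝ := (δ ^ 2 + t ^ 2) ^ (p / 2)

lemma hasDerivAt_sq_add_rpow {δ : ℝ} (hδ : 0 < δ) (a t : ℝ) :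
    HasDerivAt (fun t : ℝ => (δ ^ 2 + t ^ 2) ^ a) (2 * a * t * (δ ^ 2 + t ^ 2) ^ (a - 1)) t := by
  have h : HasDerivAt (fun t : ℝ => δ ^ 2 + t ^ 2) (2 * t) t := by
    simpa using (hasDerivAt_pow 2 t).const_add (δ ^ 2)
  have := h.rpow_const (p := a) (Or.inl (by positivity))
  convert this using 1
  ring

lemma sq_add_rpow_le {δ p r : ℝ} (hδ : 0 < δ) (hpr : p ≤ r) (hδ1 : δ ≤ 1) (k : ℝ) :
    ∃ C : ℝ, 0 < C ∧ ∀ t : ℝ, (δ ^ 2 + t ^ 2) ^ ((p - k) / 2) ≤ C * (1 + |t|) ^ (r - k) := by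
  have key : ∀ t : ℝ, (δ ^ 2 + t ^ 2) ^ ((p - k) / 2) = (√(δ ^ 2 + t ^ 2)) ^ (p - k) := by
    intro t
    rw [Real.sqrt_eq_rpow, ← Real.rpow_mul (by positivity)]; congr 1; ring
  have up : ∀ t : ℝ, √(δ ^ 2 + t ^ 2) ≤ 1 + |t| := by
    intro t
    apply Real.sqrt_le_iff.2 ⟨by positivity, ?_⟩
    nlinarith [abs_nonneg t, sq_abs t]
  have lo : ∀ t : ℝ, δ / 2 * (1 + |t|) ≤ √(δ ^ 2 + t ^ 2) := by
    intro t
    apply Real.le_sqrt_of_sq_le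
    have : (1 + |t|) ^ 2 ≤ 2 * (1 + t ^ 2) := by nlinarith [sq_nonneg (1 - |t|), sq_abs t]
    nlinarith [sq_nonneg t, mul_le_mul_of_nonneg_left this (sq_nonneg δ),
      mul_nonneg (sq_nonneg t) (sub_nonneg.2 hδ1),
      mul_nonneg (sq_nonneg t) (mul_nonneg (sub_nonneg.2 hδ1) hδ.le)]
  have le2 : ∀ t : ℝ, (1 + |t|) ^ (p - k) ≤ (1 + |t|) ^ (r - k) := fun t =>
    Real.rpow_le_rpow_of_exponent_le (by linarith [abs_nonneg t]) (by linarith)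
  rcases le_or_gt 0 (p - k) with h | h
  · refine ⟨1, one_pos, fun t => ?_⟩
    rw [key, one_mul]
    exact (Real.rpow_le_rpow (Real.sqrt_nonneg _) (up t) h).trans (le2 t)
  · refine ⟨(δ / 2) ^ (p - k), by positivity, fun t => ?_⟩
    rw [key]
    calc _ ≤ (δ / 2 * (1 + |t|)) ^ (p - k) :=
          Real.rpow_le_rpow_of_nonpos (by positivity) (lo t) h.le
      _ = (δ / 2) ^ (p - k) * (1 + |t|) ^ (p - k) := Real.mul_rpow (by positivity) (by positivity)
      _ ≤ _ := mul_le_mul_of_nonneg_left (le2 t) (by positivity)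

lemma taylorBound_smoothPow {p r δ : ℝ} (hpr : p ≤ r) (hr : 2 ≤ r) (hδ : 0 < δ)
    (hδ1 : δ ≤ 1) : ∃ ψ1 ψ2, TaylorBound r (smoothPow p δ) ψ1 ψ2 := by
  have hpos : ∀ t : ℝ, 0 < δ ^ 2 + t ^ 2 := fun t => by positivity
  have habs : ∀ t : ℝ, |t| ≤ (δ ^ 2 + t ^ 2) ^ (1 / 2 : ℝ) := by
    intro t
    rw [← Real.sqrt_eq_rpow]
    apply Real.le_sqrt_of_sq_le
    rw [sq_abs]; nlinarith
  let ψ1 : ℝ → ℝ := fun t => p * t * (δ ^ 2 + t ^ 2) ^ (p / 2 - 1)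
  let ψ2 : ℝ → ℝ := fun t => p * (δ ^ 2 + t ^ 2) ^ (p / 2 - 1) +
    p * t * ((p - 2) * t * (δ ^ 2 + t ^ 2) ^ (p / 2 - 2))
  let ψ3 : ℝ → ℝ := fun t => 3 * p * (p - 2) * t * (δ ^ 2 + t ^ 2) ^ (p / 2 - 2) +
    p * (p - 2) * (p - 4) * t ^ 3 * (δ ^ 2 + t ^ 2) ^ (p / 2 - 3)
  have h0 : ∀ t, HasDerivAt (smoothPow p δ) (ψ1 t) t := fun t => by
    refine (hasDerivAt_sq_add_rpow hδ (p / 2) t).congr_deriv ?_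
    simp only [ψ1]; ring
  have h1 : ∀ t, HasDerivAt ψ1 (ψ2 t) t := fun t => by
    refine (((hasDerivAt_id t).const_mul p).mul
      (hasDerivAt_sq_add_rpow hδ (p / 2 - 1) t)).congr_deriv ?_
    simp only [ψ2, id]
    rw [show p / 2 - 1 - 1 = p / 2 - 2 by ring]; ring
  have h2 : ∀ t, HasDerivAt ψ2 (ψ3 t) t := fun t => by
    have e := ((hasDerivAt_sq_add_rpow hδ (p / 2 - 1) t).const_mul p).add
      (((hasDerivAt_pow 2 t).const_mul (p * (p - 2))).mul
        (hasDerivAt_sq_add_rpow hδ (p / 2 - 2) t))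
    have e2 : ψ2 = (fun y => p * (δ ^ 2 + y ^ 2) ^ (p / 2 - 1)) +
        (fun x => p * (p - 2) * x ^ 2) * fun t => (δ ^ 2 + t ^ 2) ^ (p / 2 - 2) := by
      ext x; simp only [ψ2, Pi.add_apply, Pi.mul_apply]; ring
    rw [e2]
    refine e.congr_deriv ?_
    simp only [ψ3]
    rw [show p / 2 - 1 - 1 = p / 2 - 2 by ring, show p / 2 - 2 - 1 = p / 2 - 3 by ring]
    push_cast; ring
  obtain ⟨C0, hC0, b0⟩ := sq_add_rpow_le hδ hpr hδ1 0
  obtain ⟨C1, hC1, b1⟩ := sq_add_rpow_le hδ hpr hδ1 1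
  obtain ⟨C2, hC2, b2⟩ := sq_add_rpow_le hδ hpr hδ1 2
  obtain ⟨C3, hC3, b3⟩ := sq_add_rpow_le hδ hpr hδ1 3
  have s1 : ∀ t, |t| * (δ ^ 2 + t ^ 2) ^ (p / 2 - 1) ≤ (δ ^ 2 + t ^ 2) ^ ((p - 1) / 2) := by
    intro t
    calc _ ≤ (δ ^ 2 + t ^ 2) ^ (1 / 2 : ℝ) * (δ ^ 2 + t ^ 2) ^ (p / 2 - 1) := by
          gcongr; exact habs t
      _ = _ := by rw [← Real.rpow_add (hpos t)]; congr 1; ring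
  have s2 : ∀ t, t ^ 2 * (δ ^ 2 + t ^ 2) ^ (p / 2 - 2) ≤ (δ ^ 2 + t ^ 2) ^ ((p - 2) / 2) := by
    intro t
    calc _ ≤ (δ ^ 2 + t ^ 2) ^ (1 : ℝ) * (δ ^ 2 + t ^ 2) ^ (p / 2 - 2) := by
          rw [Real.rpow_one]; gcongr; nlinarith [sq_nonneg δ]
      _ = _ := by rw [← Real.rpow_add (hpos t)]; congr 1; ring
  have s3 : ∀ t, |t| * (δ ^ 2 + t ^ 2) ^ (p / 2 - 2) ≤ (δ ^ 2 + t ^ 2) ^ ((p - 3) / 2) := by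
    intro t
    calc _ ≤ (δ ^ 2 + t ^ 2) ^ (1 / 2 : ℝ) * (δ ^ 2 + t ^ 2) ^ (p / 2 - 2) := by
          gcongr; exact habs t
      _ = _ := by rw [← Real.rpow_add (hpos t)]; congr 1; ring
  have s4 : ∀ t, |t| ^ 3 * (δ ^ 2 + t ^ 2) ^ (p / 2 - 3) ≤ (δ ^ 2 + t ^ 2) ^ ((p - 3) / 2) := by
    intro t
    calc _ ≤ ((δ ^ 2 + t ^ 2) ^ (1 / 2 : ℝ)) ^ 3 * (δ ^ 2 + t ^ 2) ^ (p / 2 - 3) := by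
          gcongr; exact habs t
      _ = _ := by
          rw [← Real.rpow_natCast, ← Real.rpow_mul (hpos t).le, ← Real.rpow_add (hpos t)]
          congr 1; push_cast; ring
  have hp2 : ∀ t, |ψ2 t| ≤ (|p| * C2 + |p * (p - 2)| * C2) * (1 + |t|) ^ (r - 2) := by
    intro t
    have e1 : |ψ2 t| ≤ |p| * (δ ^ 2 + t ^ 2) ^ ((p - 2) / 2) +
        |p * (p - 2)| * (t ^ 2 * (δ ^ 2 + t ^ 2) ^ (p / 2 - 2)) := by
      refine (abs_add_le _ _).trans (add_le_add ?_ ?_)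
      · rw [abs_mul, abs_of_nonneg (Real.rpow_nonneg (hpos t).le _), sub_div, div_self two_ne_zero]
      · rw [show p * t * ((p - 2) * t * (δ ^ 2 + t ^ 2) ^ (p / 2 - 2)) =
          p * (p - 2) * (t ^ 2 * (δ ^ 2 + t ^ 2) ^ (p / 2 - 2)) by ring, abs_mul,
          abs_of_nonneg (mul_nonneg (sq_nonneg t) (Real.rpow_nonneg (hpos t).le _))]
    have e2 := mul_le_mul_of_nonneg_left (b2 t) (abs_nonneg p)
    have e3 := mul_le_mul_of_nonneg_left ((s2 t).trans (b2 t)) (abs_nonneg (p * (p - 2)))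
    linarith
  have hp3 : ∀ t, |ψ3 t| * (1 + |t|) ≤
      (|3 * p * (p - 2)| * C3 + |p * (p - 2) * (p - 4)| * C3) * (1 + |t|) ^ (r - 2) := by
    intro t
    have e1 : |ψ3 t| ≤ |3 * p * (p - 2)| * (|t| * (δ ^ 2 + t ^ 2) ^ (p / 2 - 2)) +
        |p * (p - 2) * (p - 4)| * (|t| ^ 3 * (δ ^ 2 + t ^ 2) ^ (p / 2 - 3)) := by
      refine (abs_add_le _ _).trans (add_le_add ?_ ?_)
      · rw [mul_assoc, abs_mul, abs_mul t, abs_of_nonneg (Real.rpow_nonneg (hpos t).le _)]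
      · rw [mul_assoc, abs_mul, abs_mul (t ^ 3), abs_of_nonneg (Real.rpow_nonneg (hpos t).le _),
          abs_pow]
    have e2 := mul_le_mul_of_nonneg_left ((s3 t).trans (b3 t)) (abs_nonneg (3 * p * (p - 2)))
    have e3 := mul_le_mul_of_nonneg_left ((s4 t).trans (b3 t))
      (abs_nonneg (p * (p - 2) * (p - 4)))
    have e4 : (1 + |t|) ^ (r - 2) = (1 + |t|) ^ (r - 3) * (1 + |t|) := by
      conv_rhs => rw [← Real.rpow_one (1 + |t|), ← Real.rpow_mul (by positivity),
        ← Real.rpow_add (by positivity)]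
      congr 1; ring
    rw [e4, ← mul_assoc]
    gcongr
    linarith
  refine ⟨ψ1, ψ2, ⟨continuous_iff_continuousAt.2 fun t => (h0 t).continuousAt,
    continuous_iff_continuousAt.2 fun t => (h1 t).continuousAt,
    continuous_iff_continuousAt.2 fun t => (h2 t).continuousAt,
    ⟨C0 + |p| * C1 + (|p| * C2 + |p * (p - 2)| * C2), by positivity, fun t => ⟨?_, ?_, ?_⟩⟩, ?_⟩⟩
  · have := b0 t
    rw [sub_zero, sub_zero] at this
    rw [smoothPow, abs_of_nonneg (Real.rpow_nonneg (hpos t).le _)]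
    refine this.trans (mul_le_mul_of_nonneg_right ?_ (by positivity))
    have : 0 ≤ |p| * C1 := by positivity
    have : 0 ≤ |p| * C2 + |p * (p - 2)| * C2 := by positivity
    linarith
  · calc |ψ1 t| = |p| * (|t| * (δ ^ 2 + t ^ 2) ^ (p / 2 - 1)) := by
          simp only [ψ1]
          rw [mul_assoc, abs_mul, abs_mul, abs_of_nonneg (Real.rpow_nonneg (hpos t).le _)]
      _ ≤ |p| * (C1 * (1 + |t|) ^ (r - 1)) :=
          mul_le_mul_of_nonneg_left ((s1 t).trans (b1 t)) (abs_nonneg p)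
      _ ≤ |p| * (C1 * (1 + |t|) ^ r) := by
          gcongr
          · linarith [abs_nonneg t]
          · linarith
      _ = |p| * C1 * (1 + |t|) ^ r := by ring
      _ ≤ _ := by
          refine mul_le_mul_of_nonneg_right ?_ (by positivity)
          have : 0 ≤ |p| * C2 + |p * (p - 2)| * C2 := by positivity
          linarith
  · refine (hp2 t).trans (mul_le_mul_of_nonneg_right ?_ (by positivity))
    have : 0 ≤ |p| * C1 := by positivity
    linarith
  · refine taylor_of_deriv_bounds hr h0 h1 h2 (C := |p| * C2 + |p * (p - 2)| * C2 +
      (|3 * p * (p - 2)| * C3 + |p * (p - 2) * (p - 4)| * C3) + 1) (by positivity) ?_ ?_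
    · intro t
      refine (hp2 t).trans (mul_le_mul_of_nonneg_right ?_ (by positivity))
      have : 0 ≤ |3 * p * (p - 2)| * C3 + |p * (p - 2) * (p - 4)| * C3 := by positivity
      linarith
    · intro t
      refine (hp3 t).trans (mul_le_mul_of_nonneg_right ?_ (by positivity))
      have : 0 ≤ |p| * C2 + |p * (p - 2)| * C2 := by positivity
      linarith

lemma abs_rpow_le_smoothPow {p δ : ℝ} (hp : 0 ≤ p) (t : ℝ) : |t| ^ p ≤ smoothPow p δ t := by
  have : |t| ^ p = (t ^ 2) ^ (p / 2) := by
    rw [← sq_abs, ← Real.rpow_natCast, ← Real.rpow_mul (abs_nonneg t)]; congr 1; push_cast; ring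
  rw [this, smoothPow]
  gcongr
  nlinarith [sq_nonneg δ]

lemma smoothPow_le {p δ : ℝ} (hp : 0 ≤ p) (hδ : 0 ≤ δ) (t : ℝ) :
    smoothPow p δ t ≤ (δ + |t|) ^ p := by
  have : (δ + |t|) ^ p = ((δ + |t|) ^ 2) ^ (p / 2) := by
    rw [← Real.rpow_natCast, ← Real.rpow_mul (by positivity)]; congr 1; push_cast; ring
  rw [this, smoothPow]
  gcongr
  nlinarith [sq_abs t, mul_nonneg hδ (abs_nonneg t)]

/-- Gaussian smoothing `E ψ(y + c g)`. -/
noncomputable def gP (ψ : ℝ → ℝ) (y c : ℝ) : ℝ := ∫ g, ψ (y + c * g) ∂(gaussianReal 0 1)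

lemma integrable_comb {Ω : Type*} [MeasurableSpace Ω] {μ : Measure Ω} {f₀ f₁ f₂ f₃ : Ω → ℝ}
    (h₀ : Integrable f₀ μ) (h₁ : Integrable f₁ μ) (h₂ : Integrable f₂ μ) (h₃ : Integrable f₃ μ)
    (a b : ℝ) : Integrable (fun x => f₀ x - f₁ x - a * f₂ x - b * f₃ x) μ :=
  ((h₀.sub h₁).sub (h₂.const_mul a)).sub (h₃.const_mul b)

lemma integral_comb {Ω : Type*} [MeasurableSpace Ω] {μ : Measure Ω} {f₀ f₁ f₂ f₃ : Ω → ℝ}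
    (h₀ : Integrable f₀ μ) (h₁ : Integrable f₁ μ) (h₂ : Integrable f₂ μ) (h₃ : Integrable f₃ μ)
    (a b : ℝ) : ∫ x, (f₀ x - f₁ x - a * f₂ x - b * f₃ x) ∂μ =
      ∫ x, f₀ x ∂μ - ∫ x, f₁ x ∂μ - a * ∫ x, f₂ x ∂μ - b * ∫ x, f₃ x ∂μ := by
  have e₀ := integral_sub h₀ h₁
  have e₁ := integral_sub (h₀.sub h₁) (h₂.const_mul a)
  have e₂ := integral_sub ((h₀.sub h₁).sub (h₂.const_mul a)) (h₃.const_mul b)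
  simp only [Pi.sub_apply] at e₀ e₁ e₂
  rw [e₂, e₁, e₀, integral_const_mul, integral_const_mul]

lemma integrable_abs_rpow_gaussian {s : ℝ} (hs : 0 ≤ s) :
    Integrable (fun g : ℝ => |g| ^ s) (gaussianReal 0 1) := by
  rcases hs.eq_or_lt with rfl | hs
  · simp
  have h : MemLp (id : ℝ → ℝ) (ENNReal.ofReal s) (gaussianReal 0 1) :=
    memLp_id_gaussianReal' _ ENNReal.ofReal_ne_top
  have := h.integrable_norm_rpow (by simpa using hs) ENNReal.ofReal_ne_top
  simpa [ENNReal.toReal_ofReal hs.le] using this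

lemma add_rpow_le_two_rpow {a b s : ℝ} (ha : 0 ≤ a) (hb : 0 ≤ b) (hs : 0 ≤ s) :
    (a + b) ^ s ≤ 2 ^ s * (a ^ s + b ^ s) := by
  have h : (a + b) ^ s ≤ (2 * max a b) ^ s :=
    Real.rpow_le_rpow (by positivity) (by linarith [le_max_left a b, le_max_right a b]) hs
  rw [Real.mul_rpow (by norm_num) (by positivity)] at h
  refine h.trans (mul_le_mul_of_nonneg_left ?_ (by positivity))
  have := Real.rpow_nonneg ha s
  have := Real.rpow_nonneg hb s
  rcases max_choice a b with h | h <;> rw [h] <;> linarith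

lemma integrable_one_add_rpow_gaussian {s : ℝ} (hs : 0 ≤ s) (y c : ℝ) :
    Integrable (fun g : ℝ => (1 + |y + c * g|) ^ s) (gaussianReal 0 1) := by
  have hI : Integrable (fun g : ℝ => 2 ^ s * ((1 + |y|) ^ s + |c| ^ s * |g| ^ s))
      (gaussianReal 0 1) :=
    ((integrable_const _).add ((integrable_abs_rpow_gaussian hs).const_mul (|c| ^ s))).const_mul _
  refine hI.mono' (by fun_prop) (Filter.Eventually.of_forall fun g => ?_)
  rw [Real.norm_of_nonneg (by positivity), ← Real.mul_rpow (abs_nonneg _) (abs_nonneg _),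
    ← abs_mul]
  refine le_trans (Real.rpow_le_rpow (by positivity) ?_ hs)
    (add_rpow_le_two_rpow (by positivity) (abs_nonneg _) hs)
  linarith [abs_add_le y (c * g)]

lemma integrable_growth_gaussian {ψ : ℝ → ℝ} (hψ : Continuous ψ) {C s : ℝ} (hs : 0 ≤ s)
    (hb : ∀ t, |ψ t| ≤ C * (1 + |t|) ^ s) (y c : ℝ) :
    Integrable (fun g : ℝ => ψ (y + c * g)) (gaussianReal 0 1) :=
  ((integrable_one_add_rpow_gaussian hs y c).const_mul C).mono'
    (by fun_prop) (Filter.Eventually.of_forall fun g => hb _)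

lemma map_prod_gaussian (s b : ℝ) :
    ((gaussianReal 0 1).prod (gaussianReal 0 1)).map (fun z : ℝ × ℝ => s * z.1 + b * z.2) =
      (gaussianReal 0 1).map (fun g => √(s ^ 2 + b ^ 2) * g) := by
  have h1 : ((gaussianReal 0 1).prod (gaussianReal 0 1)).map
      (fun z : ℝ × ℝ => s * z.1 + b * z.2) =
      ((gaussianReal 0 1).map (s * ·)).conv ((gaussianReal 0 1).map (b * ·)) := by
    rw [Measure.conv, Measure.map_prod_map _ _ (by fun_prop) (by fun_prop),
      Measure.map_map (by fun_prop) (by fun_prop)]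
    rfl
  rw [h1, gaussianReal_map_const_mul, gaussianReal_map_const_mul, gaussianReal_conv_gaussianReal,
    gaussianReal_map_const_mul]
  congr 1
  · ring
  · ext
    simp only [mul_one, NNReal.coe_add, NNReal.coe_mk]
    rw [Real.sq_sqrt (by positivity)]

lemma integral_gaussian_add {φ : ℝ → ℝ} (hφ : Continuous φ) {C r : ℝ} (hr : 0 ≤ r)
    (hb : ∀ t, |φ t| ≤ C * (1 + |t|) ^ r) (s b : ℝ) :
    ∫ g, ∫ g', φ (s * g + b * g') ∂(gaussianReal 0 1) ∂(gaussianReal 0 1) =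
      ∫ g, φ (√(s ^ 2 + b ^ 2) * g) ∂(gaussianReal 0 1) := by
  have hφg : Integrable φ (((gaussianReal 0 1).prod (gaussianReal 0 1)).map
      (fun z : ℝ × ℝ => s * z.1 + b * z.2)) := by
    rw [map_prod_gaussian, integrable_map_measure hφ.aestronglyMeasurable (by fun_prop)]
    simpa [Function.comp_def] using integrable_growth_gaussian hφ hr hb 0 (√(s ^ 2 + b ^ 2))
  rw [integrable_map_measure hφ.aestronglyMeasurable (by fun_prop)] at hφg
  rw [← integral_map (f := φ) (φ := fun g => √(s ^ 2 + b ^ 2) * g) (by fun_prop)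
    hφ.aestronglyMeasurable,
    ← map_prod_gaussian, integral_map (by fun_prop) hφ.aestronglyMeasurable,
    ← Function.comp_def φ, integral_prod _ hφg]
  rfl

lemma integral_gaussian_id : ∫ g, g ∂(gaussianReal 0 1) = 0 := by
  simp

lemma integral_gaussian_sq : ∫ g, g ^ 2 ∂(gaussianReal 0 1) = 1 := by
  have := variance_id_gaussianReal (μ := 0) (v := 1)
  rw [variance_of_integral_eq_zero (by fun_prop) (by simp)] at this
  simpa using this

lemma young_rpow {r : ℝ} (hr : 2 ≤ r) : ∃ C : ℝ, 0 < C ∧ ∀ x y : ℝ,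
    (1 + x ^ 2) * (1 + |y|) ^ (r - 2) ≤ C * (1 + |x| ^ r + (r - 2) * |y| ^ r) := by
  rcases hr.eq_or_lt with rfl | hr
  · exact ⟨1, one_pos, fun x y => by simp⟩
  refine ⟨2 ^ r * (2 + 1 / (r - 2)), by have : 0 < r - 2 := by linarith
                                        positivity, fun x y => ?_⟩
  have h1 : (1 + x ^ 2) ≤ (1 + |x|) ^ (2 : ℝ) := by
    rw [Real.rpow_two]; nlinarith [abs_nonneg x, sq_abs x]
  have h2 : (1 + |x|) ^ (2 : ℝ) * (1 + |y|) ^ (r - 2) ≤ (1 + |x|) ^ r + (1 + |y|) ^ r := by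
    have e : ∀ z : ℝ, (1 + |z|) ^ r = (1 + |z|) ^ (2 : ℝ) * (1 + |z|) ^ (r - 2) := fun z => by
      rw [← Real.rpow_add (by positivity)]; congr 1; ring
    rcases le_total |x| |y| with h | h
    · rw [e y]
      have : (1 + |x|) ^ (2 : ℝ) ≤ (1 + |y|) ^ (2 : ℝ) := by gcongr
      have := mul_le_mul_of_nonneg_right this (show 0 ≤ (1 + |y|) ^ (r - 2) by positivity)
      have : 0 ≤ (1 + |x|) ^ r := by positivity
      linarith
    · rw [e x]
      have : (1 + |y|) ^ (r - 2) ≤ (1 + |x|) ^ (r - 2) :=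
        Real.rpow_le_rpow (by positivity) (by linarith) (by linarith)
      have := mul_le_mul_of_nonneg_left this (show 0 ≤ (1 + |x|) ^ (2 : ℝ) by positivity)
      have : 0 ≤ (1 + |y|) ^ r := by positivity
      linarith
  have h3 := add_rpow_le_two_rpow zero_le_one (abs_nonneg x) (show 0 ≤ r by linarith)
  have h4 := add_rpow_le_two_rpow zero_le_one (abs_nonneg y) (show 0 ≤ r by linarith)
  rw [Real.one_rpow] at h3 h4
  have h5 := mul_le_mul_of_nonneg_right h1 (show 0 ≤ (1 + |y|) ^ (r - 2) by positivity)
  refine h5.trans (h2.trans ?_)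
  have hr2 : 0 < r - 2 := by linarith
  have hx : 0 ≤ |x| ^ r := by positivity
  have hy : 0 ≤ |y| ^ r := by positivity
  have key : (1 + |x| ^ r) + (1 + |y| ^ r) ≤
      (2 + 1 / (r - 2)) * (1 + |x| ^ r + (r - 2) * |y| ^ r) := by
    have e1 : (1 / (r - 2)) * ((r - 2) * |y| ^ r) = |y| ^ r := by field_simp
    have e2 : 0 ≤ 1 / (r - 2) := by positivity
    have e3 : 0 ≤ (r - 2) * |y| ^ r := by positivity
    nlinarith [mul_nonneg e2 hx]
  calc _ ≤ 2 ^ r * ((1 + |x| ^ r) + (1 + |y| ^ r)) := by linarith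
    _ ≤ _ := by rw [mul_assoc]; exact mul_le_mul_of_nonneg_left key (by positivity)

lemma gP_growth {ψ : ℝ → ℝ} (hψ : Continuous ψ) {C s M : ℝ} (hC : 0 ≤ C) (hs : 0 ≤ s)
    (hb : ∀ t, |ψ t| ≤ C * (1 + |t|) ^ s) (y c : ℝ) (hc : |c| ≤ M) :
    |gP ψ y c| ≤ C * (∫ g, (1 + M * |g|) ^ s ∂(gaussianReal 0 1)) * (1 + |y|) ^ s := by
  have hM : 0 ≤ M := (abs_nonneg c).trans hc
  have hI : Integrable (fun g : ℝ => (1 + M * |g|) ^ s) (gaussianReal 0 1) := by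
    simpa [abs_mul, abs_of_nonneg hM] using integrable_one_add_rpow_gaussian hs 0 M
  calc |gP ψ y c| ≤ ∫ g, |ψ (y + c * g)| ∂(gaussianReal 0 1) := abs_integral_le_integral_abs
    _ ≤ ∫ g, C * ((1 + M * |g|) ^ s * (1 + |y|) ^ s) ∂(gaussianReal 0 1) := by
        refine integral_mono (integrable_growth_gaussian hψ hs hb y c).abs
          ((hI.mul_const _).const_mul _) fun g => (hb _).trans ?_
        refine mul_le_mul_of_nonneg_left ?_ hC
        rw [← Real.mul_rpow (by positivity) (by positivity)]
        refine Real.rpow_le_rpow (by positivity) ?_ hs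
        have h1 := abs_add_le y (c * g)
        have h2 : |c * g| ≤ M * |g| := by rw [abs_mul]; gcongr
        nlinarith [abs_nonneg y, mul_nonneg (mul_nonneg hM (abs_nonneg g)) (abs_nonneg y)]
    _ = _ := by rw [integral_const_mul, integral_mul_const]; ring

set_option maxHeartbeats 1000000 in
lemma heat_step {r : ℝ} (hr : 2 ≤ r) {ψ ψ1 ψ2 : ℝ → ℝ} (hψ : TaylorBound r ψ ψ1 ψ2)
    {η : ℝ} (hη : 0 < η) {M : ℝ} (hM : 0 ≤ M) :
    ∃ β : ℝ, 0 < β ∧ ∃ C : ℝ, 0 ≤ C ∧ ∃ κ : ℝ, 0 < κ ∧ ∀ b s c x y : ℝ, |b| ≤ β → |s| ≤ 1 →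
      |c| ≤ M →
      |gP ψ (y + b * x) (s * c) - gP ψ y (√(s ^ 2 + b ^ 2) * c) - b * x * gP ψ1 y (s * c) -
        1 / 2 * b ^ 2 * (x ^ 2 - c ^ 2) * gP ψ2 y (s * c)| ≤
      η * b ^ 2 * (1 + |x| ^ r + (r - 2) * |y| ^ r) +
        C * (if κ < |b * x| then |b * x| ^ r else 0) := by
  obtain ⟨C0, hC0, hg⟩ := hψ.growth
  have hr0 : 0 ≤ r := by linarith
  have hr2 : 0 ≤ r - 2 := by linarith
  obtain ⟨CY, hCY, hY⟩ := young_rpow hr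
  set K := ∫ g, (1 + M * |g|) ^ (r - 2) ∂(gaussianReal 0 1) with hK
  have hK0 : 0 ≤ K := integral_nonneg fun g => by positivity
  set m := ∫ g, |g| ^ (r + 1) ∂(gaussianReal 0 1) with hm
  have hm0 : 0 ≤ m := integral_nonneg fun g => by positivity
  obtain ⟨C1, hC1, κ, hκ, hT⟩ := hψ.taylor (η / (2 * (K + 1) * (1 + M ^ 2) * CY)) (by positivity)
  set η1 := η / (2 * (K + 1) * (1 + M ^ 2) * CY) with hη1
  have hη1p : 0 < η1 := by positivity
  set D := C1 * M ^ (r + 1) * m / κ with hD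
  have hD0 : 0 ≤ D := by positivity
  refine ⟨min 1 (η / (2 * (D + 1))), by positivity, C1, hC1, κ, hκ, fun b s c x y hb hs hc => ?_⟩
  have hb1 : |b| ≤ 1 := hb.trans (min_le_left _ _)
  have hb2 : |b| ≤ η / (2 * (D + 1)) := hb.trans (min_le_right _ _)
  have hsc : |s * c| ≤ M := by
    rw [abs_mul]; nlinarith [abs_nonneg s, abs_nonneg c]
  have i0 : ∀ y c, Integrable (fun g : ℝ => ψ (y + c * g)) (gaussianReal 0 1) :=
    integrable_growth_gaussian hψ.cont hr0 (fun t => (hg t).1)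
  have i1 : ∀ y c, Integrable (fun g : ℝ => ψ1 (y + c * g)) (gaussianReal 0 1) :=
    integrable_growth_gaussian hψ.cont1 hr0 (fun t => (hg t).2.1)
  have i2 : ∀ y c, Integrable (fun g : ℝ => ψ2 (y + c * g)) (gaussianReal 0 1) :=
    integrable_growth_gaussian hψ.cont2 hr2 (fun t => (hg t).2.2)
  have iw := integrable_one_add_rpow_gaussian hr2 y (s * c)
  set W := ∫ g, (1 + |y + s * c * g|) ^ (r - 2) ∂(gaussianReal 0 1) with hW
  have hW0 : 0 ≤ W := integral_nonneg fun g => by positivity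
  have hWK : W ≤ K * (1 + |y|) ^ (r - 2) := by
    have := gP_growth (ψ := fun t => (1 + |t|) ^ (r - 2)) (by fun_prop (disch := assumption))
      zero_le_one hr2 (M := M) (fun t => by rw [abs_of_nonneg (by positivity), one_mul]) y (s * c)
      hsc
    rw [one_mul, gP, abs_of_nonneg hW0] at this
    exact this
  -- replacement of the variable `x`
  have A : |gP ψ (y + b * x) (s * c) - gP ψ y (s * c) - b * x * gP ψ1 y (s * c) -
      1 / 2 * (b * x) ^ 2 * gP ψ2 y (s * c)| ≤
      η1 * (b * x) ^ 2 * W + C1 * (if κ < |b * x| then |b * x| ^ r else 0) := by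
    have e : gP ψ (y + b * x) (s * c) - gP ψ y (s * c) - b * x * gP ψ1 y (s * c) -
      1 / 2 * (b * x) ^ 2 * gP ψ2 y (s * c) =
      ∫ g, (ψ (y + b * x + s * c * g) - ψ (y + s * c * g) - b * x * ψ1 (y + s * c * g) -
        1 / 2 * (b * x) ^ 2 * ψ2 (y + s * c * g)) ∂(gaussianReal 0 1) := by
      rw [integral_comb (i0 _ _) (i0 _ _) (i1 _ _) (i2 _ _)]
      rfl
    rw [e]
    refine abs_integral_le_integral_abs.trans ?_
    rw [show η1 * (b * x) ^ 2 * W + C1 * (if κ < |b * x| then |b * x| ^ r else 0) =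
      ∫ g, (η1 * (b * x) ^ 2 * (1 + |y + s * c * g|) ^ (r - 2) +
        C1 * (if κ < |b * x| then |b * x| ^ r else 0)) ∂(gaussianReal 0 1) by
        rw [integral_add (iw.const_mul _) (integrable_const _), integral_const_mul]; simp [hW]]
    refine integral_mono (integrable_comb (i0 _ _) (i0 _ _) (i1 _ _)
      (i2 _ _) _ _).abs ((iw.const_mul _).add (integrable_const _)) fun g => ?_
    have := hT (y + s * c * g) (b * x)
    refine le_trans (le_of_eq ?_) this
    simp only
    congr 1
    rw [show y + b * x + s * c * g = y + s * c * g + b * x by ring]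
    ring
  -- replacement of the Gaussian variable
  have Bp : ∀ t : ℝ, |gP ψ t (b * c) - ψ t - 1 / 2 * (b * c) ^ 2 * ψ2 t| ≤
      η1 * (b * c) ^ 2 * (1 + |t|) ^ (r - 2) + D * |b| ^ (r + 1) := by
    intro t
    have ig1 : Integrable (fun g : ℝ => g) (gaussianReal 0 1) :=
      (memLp_id_gaussianReal' 1 (by simp)).integrable (by simp)
    have ig2 : Integrable (fun g : ℝ => g ^ 2) (gaussianReal 0 1) := by
      simpa using integrable_abs_rpow_gaussian (s := 2) (by norm_num)
    have igr := integrable_abs_rpow_gaussian (s := r + 1) (by linarith)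
    have e : gP ψ t (b * c) - ψ t - 1 / 2 * (b * c) ^ 2 * ψ2 t =
        ∫ g, (ψ (t + b * c * g) - ψ t - ψ1 t * (b * c) * g -
          1 / 2 * ψ2 t * (b * c) ^ 2 * g ^ 2) ∂(gaussianReal 0 1) := by
      rw [integral_comb (i0 _ _) (integrable_const _) ig1 ig2, integral_gaussian_id,
        integral_gaussian_sq]
      simp [gP]; ring
    rw [e]
    refine abs_integral_le_integral_abs.trans ?_
    have e2 : η1 * (b * c) ^ 2 * (1 + |t|) ^ (r - 2) + C1 * |b * c| ^ (r + 1) * m / κ =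
        ∫ g, (η1 * (b * c) ^ 2 * (1 + |t|) ^ (r - 2) * g ^ 2 +
          C1 * |b * c| ^ (r + 1) / κ * |g| ^ (r + 1)) ∂(gaussianReal 0 1) := by
      rw [integral_add (ig2.const_mul _) (igr.const_mul _), integral_const_mul,
        integral_const_mul, integral_gaussian_sq, ← hm]
      ring
    have e3 : C1 * |b * c| ^ (r + 1) * m / κ ≤ D * |b| ^ (r + 1) := by
      rw [abs_mul, Real.mul_rpow (abs_nonneg _) (abs_nonneg _), hD]
      rw [show C1 * (|b| ^ (r + 1) * |c| ^ (r + 1)) * m / κ =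
        C1 * |c| ^ (r + 1) * m / κ * |b| ^ (r + 1) by ring]
      gcongr
    refine le_trans ?_ (add_le_add_right e3 _)
    rw [e2]
    refine integral_mono (integrable_comb (i0 _ _) (integrable_const _) ig1 ig2 _ _).abs
      ((ig2.const_mul _).add (igr.const_mul _)) fun g => ?_
    have := hT t (b * c * g)
    simp only
    calc _ = |ψ (t + b * c * g) - ψ t - ψ1 t * (b * c * g) - 1 / 2 * ψ2 t * (b * c * g) ^ 2| := by
          congr 1; ring
      _ ≤ _ := this
      _ ≤ _ := by
          refine add_le_add (le_of_eq (by ring)) ?_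
          rw [show C1 * |b * c| ^ (r + 1) / κ * |g| ^ (r + 1) =
            C1 * (|b * c| ^ (r + 1) * |g| ^ (r + 1) / κ) by ring,
            ← Real.mul_rpow (abs_nonneg _) (abs_nonneg _), ← abs_mul]
          refine mul_le_mul_of_nonneg_left ?_ hC1
          split_ifs with h
          · rw [le_div_iff₀ hκ, Real.rpow_add (hκ.trans h), Real.rpow_one]
            gcongr
          · positivity
  have B : |gP ψ y (√(s ^ 2 + b ^ 2) * c) - gP ψ y (s * c) -
      1 / 2 * (b * c) ^ 2 * gP ψ2 y (s * c)| ≤ η1 * (b * c) ^ 2 * W + D * |b| ^ (r + 1) := by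
    have hφ : Continuous fun z => ψ (y + c * z) := by have := hψ.cont; fun_prop
    have hbφ : ∀ t, |ψ (y + c * t)| ≤ (C0 * ((1 + |y|) * (1 + |c|)) ^ r) * (1 + |t|) ^ r := by
      intro t
      refine ((hg _).1).trans ?_
      rw [mul_assoc, ← Real.mul_rpow (by positivity) (by positivity)]
      refine mul_le_mul_of_nonneg_left (Real.rpow_le_rpow (by positivity) ?_ hr0) hC0.le
      have h1 := abs_add_le y (c * t)
      rw [abs_mul] at h1
      have := mul_nonneg (abs_nonneg y) (abs_nonneg c)
      have := mul_nonneg (abs_nonneg y) (abs_nonneg t)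
      have := mul_nonneg (mul_nonneg (abs_nonneg y) (abs_nonneg c)) (abs_nonneg t)
      have := abs_nonneg y
      have := abs_nonneg c
      have := abs_nonneg t
      nlinarith
    have hconv := integral_gaussian_add hφ hr0 hbφ s b
    have e0 : gP ψ y (√(s ^ 2 + b ^ 2) * c) =
        ∫ g, gP ψ (y + s * c * g) (b * c) ∂(gaussianReal 0 1) := by
      rw [gP]
      calc _ = ∫ g, ψ (y + c * (√(s ^ 2 + b ^ 2) * g)) ∂(gaussianReal 0 1) := by
            congr 1; ext g; congr 1; ring
        _ = _ := by
            rw [← hconv]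
            congr 1; ext g; rw [gP]; congr 1; ext g'; congr 1; ring
    have icomp : Integrable (fun g => gP ψ (y + s * c * g) (b * c)) (gaussianReal 0 1) := by
      have hφg : Integrable (fun z => ψ (y + c * z))
          (((gaussianReal 0 1).prod (gaussianReal 0 1)).map
          (fun z : ℝ × ℝ => s * z.1 + b * z.2)) := by
        rw [map_prod_gaussian, integrable_map_measure hφ.aestronglyMeasurable (by fun_prop)]
        simpa [Function.comp_def] using
          integrable_growth_gaussian hφ hr0 hbφ 0 (√(s ^ 2 + b ^ 2))
      rw [integrable_map_measure hφ.aestronglyMeasurable (by fun_prop)] at hφg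
      refine hφg.integral_prod_left.congr (Filter.Eventually.of_forall fun g => ?_)
      simp only [gP, Function.comp]
      congr 1; ext g'; congr 1; ring
    rw [e0]
    have e : ∫ g, gP ψ (y + s * c * g) (b * c) ∂(gaussianReal 0 1) - gP ψ y (s * c) -
        1 / 2 * (b * c) ^ 2 * gP ψ2 y (s * c) =
        ∫ g, (gP ψ (y + s * c * g) (b * c) - ψ (y + s * c * g) - 0 * 0 -
          1 / 2 * (b * c) ^ 2 * ψ2 (y + s * c * g)) ∂(gaussianReal 0 1) := by
      rw [integral_comb icomp (i0 _ _) (integrable_const _) (i2 _ _), zero_mul, sub_zero]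
      rfl
    rw [e]
    refine abs_integral_le_integral_abs.trans ?_
    rw [show η1 * (b * c) ^ 2 * W + D * |b| ^ (r + 1) =
      ∫ g, (η1 * (b * c) ^ 2 * (1 + |y + s * c * g|) ^ (r - 2) + D * |b| ^ (r + 1))
        ∂(gaussianReal 0 1) by
        rw [integral_add (iw.const_mul _) (integrable_const _), integral_const_mul]; simp [hW]]
    refine integral_mono (integrable_comb icomp (i0 _ _) (integrable_const _) (i2 _ _) _ _).abs
      ((iw.const_mul _).add (integrable_const _)) fun g => ?_
    simpa using Bp (y + s * c * g)
  have hZ := hY x y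
  set Z := 1 + |x| ^ r + (r - 2) * |y| ^ r with hZdef
  have hZ1 : 1 ≤ Z := by
    have : 0 ≤ (r - 2) * |y| ^ r := by positivity
    have : 0 ≤ |x| ^ r := by positivity
    linarith
  have hWx : η1 * (x ^ 2 + c ^ 2) * W ≤ η / 2 * Z := by
    have h1 : x ^ 2 + c ^ 2 ≤ (1 + M ^ 2) * (1 + x ^ 2) := by
      have : c ^ 2 ≤ M ^ 2 := sq_le_sq' (by linarith [(abs_le.1 hc).1]) (abs_le.1 hc).2
      nlinarith [mul_nonneg (sq_nonneg M) (sq_nonneg x)]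
    calc η1 * (x ^ 2 + c ^ 2) * W ≤
        η1 * ((1 + M ^ 2) * (1 + x ^ 2)) * ((K + 1) * (1 + |y|) ^ (r - 2)) := by
          have : W ≤ (K + 1) * (1 + |y|) ^ (r - 2) :=
            hWK.trans (mul_le_mul_of_nonneg_right (by linarith) (by positivity))
          gcongr
      _ = η1 * (1 + M ^ 2) * (K + 1) * ((1 + x ^ 2) * (1 + |y|) ^ (r - 2)) := by ring
      _ ≤ η1 * (1 + M ^ 2) * (K + 1) * (CY * Z) := by gcongr
      _ = η / 2 * Z := by rw [hη1]; field_simp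
  have hDb : D * |b| ^ (r + 1) ≤ η / 2 * b ^ 2 * Z := by
    have h1 : |b| ^ (r + 1) ≤ |b| ^ (3 : ℝ) :=
      Real.rpow_le_rpow_of_exponent_ge' (abs_nonneg _) hb1 (by norm_num) (by linarith)
    have h2 : |b| ^ (3 : ℝ) = b ^ 2 * |b| := by
      rw [show (3 : ℝ) = ((3 : ℕ) : ℝ) by norm_num, Real.rpow_natCast, pow_succ, sq_abs]
    have h3 : D * |b| ≤ η / 2 := by
      calc D * |b| ≤ (D + 1) * (η / (2 * (D + 1))) := by
            gcongr; linarith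
        _ = η / 2 := by field_simp
    calc D * |b| ^ (r + 1) ≤ D * (b ^ 2 * |b|) := by rw [← h2]; gcongr
      _ = b ^ 2 * (D * |b|) := by ring
      _ ≤ b ^ 2 * (η / 2 * Z) := by
          refine mul_le_mul_of_nonneg_left (h3.trans ?_) (sq_nonneg b)
          nlinarith
      _ = _ := by ring
  have fin := (abs_sub _ _).trans (add_le_add A B)
  refine le_trans (le_of_eq ?_) (fin.trans ?_)
  · congr 1; ring
  · have : η1 * (b * x) ^ 2 * W + η1 * (b * c) ^ 2 * W = b ^ 2 * (η1 * (x ^ 2 + c ^ 2) * W) := by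
      ring
    have h5 := mul_le_mul_of_nonneg_left hWx (sq_nonneg b)
    nlinarith

/-- A fixed nonprincipal ultrafilter on `ℕ`, as a filter. -/
noncomputable abbrev hypU : Filter ℕ := (Filter.hyperfilter ℕ : Filter ℕ)

lemma eventually_hypU_gt (k : ℕ) : ∀ᶠ m in hypU, k < m := by
  have h : ∀ᶠ m in Filter.atTop, k < m := Filter.eventually_gt_atTop k
  rw [← Nat.cofinite_eq_atTop] at h
  exact Filter.hyperfilter_le_cofinite h

/-- `P` holds for every sequence of indices that is chosen one after the other from sets in the
ultrafilter (each set depending on the earlier choices). -/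
def Gen (P : (ℕ → ℕ) → Prop) : Prop :=
  ∃ Q : ℕ → (ℕ → ℕ) → ℕ → Prop, (∀ i n, ∀ᶠ m in hypU, Q i n m) ∧
    (∀ i n n' m, (∀ j < i, n j = n' j) → Q i n m → Q i n' m) ∧
    ∀ n, (∀ i, Q i n (n i)) → P n

lemma Gen.mono {P P' : (ℕ → ℕ) → Prop} (h : Gen P) (hP : ∀ n, P n → P' n) : Gen P' := by
  obtain ⟨Q, h1, h2, h3⟩ := h
  exact ⟨Q, h1, h2, fun n hn => hP n (h3 n hn)⟩

lemma Gen.and {P P' : (ℕ → ℕ) → Prop} (h : Gen P) (h' : Gen P') :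
    Gen (fun n => P n ∧ P' n) := by
  obtain ⟨Q, h1, h2, h3⟩ := h
  obtain ⟨Q', h1', h2', h3'⟩ := h'
  exact ⟨fun i n m => Q i n m ∧ Q' i n m, fun i n => (h1 i n).and (h1' i n),
    fun i n n' m hn hq => ⟨h2 i n n' m hn hq.1, h2' i n n' m hn hq.2⟩,
    fun n hn => ⟨h3 n fun i => (hn i).1, h3' n fun i => (hn i).2⟩⟩

lemma Gen.of_step {Q : ℕ → (ℕ → ℕ) → ℕ → Prop} (h1 : ∀ i n, ∀ᶠ m in hypU, Q i n m)
    (h2 : ∀ i n n' m, (∀ j < i, n j = n' j) → Q i n m → Q i n' m) :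
    Gen (fun n => ∀ i, Q i n (n i)) := ⟨Q, h1, h2, fun _ h => h⟩

lemma Gen.of_eventually {R : ℕ → ℕ → Prop} (h : ∀ i, ∀ᶠ m in hypU, R i m) :
    Gen (fun n => ∀ i, R i (n i)) :=
  Gen.of_step (Q := fun i _ m => R i m) (fun i _ => h i) (fun _ _ _ _ _ h => h)

lemma Gen.exists {P : (ℕ → ℕ) → Prop} (h : Gen P) : ∃ n, P n := by
  obtain ⟨Q, h1, h2, h3⟩ := h
  let ext : (i : ℕ) → ((j : ℕ) → j < i → ℕ) → ℕ → ℕ := fun i p j => if hj : j < i then p j hj else 0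
  let n : ℕ → ℕ := fun i => Nat.strongRecOn i fun i p => (h1 i (ext i p)).exists.choose
  refine ⟨n, h3 n fun i => ?_⟩
  have e : n i = (h1 i (ext i fun j _ => n j)).exists.choose := by
    simp only [n]
    rw [Nat.strongRecOn_eq]
  rw [e]
  refine h2 i _ _ _ (fun j hj => ?_) (h1 i (ext i fun j _ => n j)).exists.choose_spec
  simp [ext, hj]

lemma gen_strictMono : Gen StrictMono := by
  refine (Gen.of_step (Q := fun i n m => ∀ j < i, n j < m) (fun i n => ?_) ?_).mono ?_
  · exact (Set.finite_lt_nat i).eventually_all.2 fun j _ => eventually_hypU_gt _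
  · intro i n n' m h hq j hj
    rw [← h j hj]; exact hq j hj
  · exact fun n hn => fun i j hij => hn j i hij

section simple

variable {Ω : Type*} [MeasurableSpace Ω] {ν : Measure Ω} [IsFiniteMeasure ν]

lemma integral_mul_comp_simple {β : Type*} (τ : SimpleFunc Ω β) {Z : Ω → ℝ} (hZ : Integrable Z ν)
    (h : β → ℝ) : ∫ ω, Z ω * h (τ ω) ∂ν = ∑ c ∈ τ.range, h c * ∫ ω in τ ⁻¹' {c}, Z ω ∂ν := by
  classical
  have e : ∀ ω, Z ω * h (τ ω) = ∑ c ∈ τ.range, h c * (τ ⁻¹' {c}).indicator Z ω := by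
    intro ω
    rw [Finset.sum_eq_single (τ ω)]
    · simp [mul_comm]
    · intro c _ hc
      simp [Set.indicator, hc.symm]
    · intro h; exact absurd (τ.mem_range_self ω) h
  simp_rw [e]
  rw [integral_finsetSum _ fun c _ => (hZ.indicator (τ.measurableSet_fiber c)).const_mul _]
  refine Finset.sum_congr rfl fun c _ => ?_
  rw [integral_const_mul, integral_indicator (τ.measurableSet_fiber c)]

lemma eventually_simple_test {β : Type*} (τ : SimpleFunc Ω β) {Z : ℕ → Ω → ℝ}
    (hZ : ∀ m, Integrable (Z m) ν)
    (h0 : ∀ B, MeasurableSet B → Filter.Tendsto (fun m => ∫ ω in B, Z m ω ∂ν) hypU (nhds 0))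
    (H : ℝ) {ε : ℝ} (hε : 0 < ε) :
    ∀ᶠ m in hypU, ∀ h : β → ℝ, (∀ c ∈ τ.range, |h c| ≤ H) → |∫ ω, Z m ω * h (τ ω) ∂ν| ≤ ε := by
  have ht : Filter.Tendsto (fun m => ∑ c ∈ τ.range, H * |∫ ω in τ ⁻¹' {c}, Z m ω ∂ν|) hypU
      (nhds 0) := by
    have : (0 : ℝ) = ∑ c ∈ τ.range, H * |0| := by simp
    rw [this]
    exact tendsto_finsetSum _ fun c _ => ((h0 _ (τ.measurableSet_fiber c)).abs).const_mul H
  filter_upwards [ht.eventually (ge_mem_nhds hε)] with m hm h hh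
  rw [integral_mul_comp_simple τ (hZ m)]
  refine (Finset.abs_sum_le_sum_abs _ _).trans (le_trans (Finset.sum_le_sum fun c hc => ?_) hm)
  rw [abs_mul]
  exact mul_le_mul_of_nonneg_right (hh c hc) (abs_nonneg _)

/-- Finitely many real simple functions, bundled into one. -/
def simpleTuple {i : ℕ} (Y : Fin i → SimpleFunc Ω ℝ) : SimpleFunc Ω (Fin i → ℝ) where
  toFun ω l := Y l ω
  measurableSet_fiber' v := by
    have : (fun ω l => Y l ω) ⁻¹' {v} = ⋂ l, (Y l) ⁻¹' {v l} := by
      ext ω; simp [funext_iff]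
    rw [this]
    exact MeasurableSet.iInter fun l => (Y l).measurableSet_fiber _
  finite_range' := by
    refine (Set.Finite.pi' fun l => (Y l).finite_range).subset ?_
    rintro _ ⟨ω, rfl⟩ l
    exact Set.mem_range_self ω

lemma exists_bound_range (τ : SimpleFunc Ω ℝ) : ∃ R : ℝ, 0 ≤ R ∧ ∀ ω, |τ ω| ≤ R := by
  obtain ⟨R, hR⟩ := τ.exists_forall_norm_le
  exact ⟨max R 0, le_max_right _ _, fun ω => (hR ω).trans (le_max_left _ _)⟩

lemma integrable_comp_simple {β : Type*} (τ : SimpleFunc Ω β) (h : β → ℝ) :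
    Integrable (fun ω => h (τ ω)) ν :=
  (τ.map h).integrable_of_isFiniteMeasure

lemma integrable_mul_comp_simple {β : Type*} (τ : SimpleFunc Ω β) (h : β → ℝ) {Z : Ω → ℝ}
    (hZ : Integrable Z ν) : Integrable (fun ω => Z ω * h (τ ω)) ν := by
  obtain ⟨R, _, hR⟩ := exists_bound_range (τ.map h)
  exact hZ.mul_bdd (c := R) ((τ.map h).measurable.aestronglyMeasurable)
    (Filter.Eventually.of_forall hR)

end simple

lemma young_sq_sub {r : ℝ} (hr : 2 ≤ r) {θ : ℝ} (hθ : 0 < θ) : ∃ C : ℝ, 0 ≤ C ∧ ∀ y u v : ℝ,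
    (1 + |y| + |v|) ^ (r - 2) * |u ^ 2 - v ^ 2| ≤
      θ * (1 + (r - 2) * |y| ^ r + |u| ^ r + |v| ^ r) + C * |u - v| ^ r := by
  have hr0 : 0 ≤ r := by linarith
  have hr2 : 0 ≤ r - 2 := by linarith
  -- `k` switches the variable `y` off when `r = 2`
  obtain ⟨k, hk0, hk1, hkr, D, hD, hkD⟩ : ∃ k : ℝ, 0 ≤ k ∧ k ≤ 1 ∧
      (∀ y v : ℝ, (1 + |y| + |v|) ^ (r - 2) ≤ (1 + k * |y| + |v|) ^ (r - 2)) ∧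
      ∃ D : ℝ, 1 ≤ D ∧ k ≤ D * (r - 2) := by
    rcases hr.eq_or_lt with rfl | h
    · exact ⟨0, le_rfl, zero_le_one, fun y v => by simp, 1, le_rfl, by simp⟩
    · refine ⟨1, zero_le_one, le_rfl, fun y v => by simp, max 1 (1 / (r - 2)), le_max_left _ _, ?_⟩
      have : 0 < r - 2 := by linarith
      calc (1 : ℝ) = 1 / (r - 2) * (r - 2) := by field_simp
        _ ≤ _ := by gcongr; exact le_max_right _ _
  set E := 4 ^ r * D with hE
  have hE0 : 0 < E := by positivity
  refine ⟨(E / θ) ^ (r - 1), by positivity, fun y u v => ?_⟩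
  set N := 1 + k * |y| + |u| + |v| with hN
  have hky : 0 ≤ k * |y| := by positivity
  have hN1 : 1 ≤ N := by have := abs_nonneg u; have := abs_nonneg v; linarith
  have hNr : N ^ r ≤ E * (1 + (r - 2) * |y| ^ r + |u| ^ r + |v| ^ r) := by
    have h1 : N ^ r ≤ (2 * (2 * max (max 1 (k * |y|)) (max |u| |v|))) ^ r := by
      refine Real.rpow_le_rpow (by positivity) ?_ hr0
      have := le_max_left (max 1 (k * |y|)) (max |u| |v|)
      have := le_max_right (max 1 (k * |y|)) (max |u| |v|)
      have := le_max_left 1 (k * |y|)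
      have := le_max_right 1 (k * |y|)
      have := le_max_left |u| |v|
      have := le_max_right |u| |v|
      linarith
    have h2 : (2 * (2 * max (max 1 (k * |y|)) (max |u| |v|))) ^ r =
        4 ^ r * (max (max 1 (k * |y|)) (max |u| |v|)) ^ r := by
      rw [← Real.mul_rpow (by norm_num) (by positivity)]; congr 1; ring
    have h3 : (max (max 1 (k * |y|)) (max |u| |v|)) ^ r ≤
        1 + k * |y| ^ r + |u| ^ r + |v| ^ r := by
      have a1 : 0 ≤ |u| ^ r := by positivity
      have a2 : 0 ≤ |v| ^ r := by positivity
      have a3 : 0 ≤ k * |y| ^ r := by positivity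
      have a4 : (k * |y|) ^ r ≤ k * |y| ^ r := by
        rw [Real.mul_rpow hk0 (abs_nonneg _)]
        refine mul_le_mul_of_nonneg_right ?_ (by positivity)
        calc k ^ r ≤ k ^ (1 : ℝ) := Real.rpow_le_rpow_of_exponent_ge' hk0 hk1 (by norm_num)
              (by linarith)
          _ = k := Real.rpow_one k
      rcases max_choice (max 1 (k * |y|)) (max |u| |v|) with h | h <;> rw [h]
      · rcases max_choice 1 (k * |y|) with h | h <;> rw [h]
        · rw [Real.one_rpow]; linarith
        · linarith
      · rcases max_choice |u| |v| with h | h <;> rw [h] <;> linarith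
    have h4 : k * |y| ^ r ≤ D * (r - 2) * |y| ^ r := by gcongr
    have h5 : 1 + k * |y| ^ r + |u| ^ r + |v| ^ r ≤
        D * (1 + (r - 2) * |y| ^ r + |u| ^ r + |v| ^ r) := by
      have a1 : 0 ≤ |u| ^ r := by positivity
      have a2 : 0 ≤ |v| ^ r := by positivity
      nlinarith
    calc N ^ r ≤ 4 ^ r * (1 + k * |y| ^ r + |u| ^ r + |v| ^ r) := by
          rw [h2] at h1; exact h1.trans (mul_le_mul_of_nonneg_left h3 (by positivity))
      _ ≤ 4 ^ r * (D * (1 + (r - 2) * |y| ^ r + |u| ^ r + |v| ^ r)) := by gcongr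
      _ = _ := by rw [hE]; ring
  have hmain : (1 + |y| + |v|) ^ (r - 2) * |u ^ 2 - v ^ 2| ≤ |u - v| * N ^ (r - 1) := by
    have h1 : |u ^ 2 - v ^ 2| ≤ |u - v| * N := by
      rw [show u ^ 2 - v ^ 2 = (u - v) * (u + v) by ring, abs_mul]
      gcongr
      linarith [abs_add_le u v]
    have h2 : (1 + |y| + |v|) ^ (r - 2) ≤ N ^ (r - 2) :=
      (hkr y v).trans (Real.rpow_le_rpow (by positivity) (by linarith [abs_nonneg u]) hr2)
    calc _ ≤ N ^ (r - 2) * (|u - v| * N) := by gcongr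
      _ = |u - v| * (N ^ (r - 2) * N ^ (1 : ℝ)) := by rw [Real.rpow_one]; ring
      _ = _ := by rw [← Real.rpow_add (by positivity)]; congr 2; ring
  refine hmain.trans ?_
  have hpos : 0 ≤ (E / θ) ^ (r - 1) * |u - v| ^ r := by positivity
  have hpos2 : 0 ≤ θ * (1 + (r - 2) * |y| ^ r + |u| ^ r + |v| ^ r) := by positivity
  have hN0 : 0 < N := by linarith
  rcases le_or_gt |u - v| (θ / E * N) with h | h
  · calc |u - v| * N ^ (r - 1) ≤ θ / E * N * N ^ (r - 1) := by gcongr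
      _ = θ / E * (N ^ (1 : ℝ) * N ^ (r - 1)) := by rw [Real.rpow_one]; ring
      _ = θ / E * N ^ r := by rw [← Real.rpow_add hN0]; congr 2; ring
      _ ≤ θ / E * (E * (1 + (r - 2) * |y| ^ r + |u| ^ r + |v| ^ r)) := by gcongr
      _ = θ * (1 + (r - 2) * |y| ^ r + |u| ^ r + |v| ^ r) := by field_simp
      _ ≤ _ := by linarith
  · have hw : 0 < |u - v| := lt_of_le_of_lt (by positivity) h
    have hNw : N ≤ E / θ * |u - v| := by
      have : E / θ * (θ / E * N) ≤ E / θ * |u - v| := by gcongr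
      calc N = E / θ * (θ / E * N) := by field_simp
        _ ≤ _ := this
    calc |u - v| * N ^ (r - 1) ≤ |u - v| * (E / θ * |u - v|) ^ (r - 1) := by
          gcongr; linarith
      _ = (E / θ) ^ (r - 1) * (|u - v| ^ (1 : ℝ) * |u - v| ^ (r - 1)) := by
          rw [Real.mul_rpow (by positivity) (abs_nonneg _), Real.rpow_one]; ring
      _ = (E / θ) ^ (r - 1) * |u - v| ^ r := by
          rw [← Real.rpow_add hw]; congr 2; ring
      _ ≤ _ := by linarith

lemma gP_growth' {ψ : ℝ → ℝ} (hψ : Continuous ψ) {C s : ℝ} (hC : 0 ≤ C) (hs : 0 ≤ s)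
    (hb : ∀ t, |ψ t| ≤ C * (1 + |t|) ^ s) (y c : ℝ) :
    |gP ψ y c| ≤ C * (∫ g, (1 + |g|) ^ s ∂(gaussianReal 0 1)) * (1 + |y| + |c|) ^ s := by
  have hI : Integrable (fun g : ℝ => (1 + |g|) ^ s) (gaussianReal 0 1) := by
    simpa using integrable_one_add_rpow_gaussian hs 0 1
  calc |gP ψ y c| ≤ ∫ g, |ψ (y + c * g)| ∂(gaussianReal 0 1) := abs_integral_le_integral_abs
    _ ≤ ∫ g, C * ((1 + |g|) ^ s * (1 + |y| + |c|) ^ s) ∂(gaussianReal 0 1) := by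
        refine integral_mono (integrable_growth_gaussian hψ hs hb y c).abs
          ((hI.mul_const _).const_mul _) fun g => (hb _).trans ?_
        refine mul_le_mul_of_nonneg_left ?_ hC
        rw [← Real.mul_rpow (by positivity) (by positivity)]
        refine Real.rpow_le_rpow (by positivity) ?_ hs
        have h1 := abs_add_le y (c * g)
        rw [abs_mul] at h1
        nlinarith [abs_nonneg y, abs_nonneg c, abs_nonneg g,
          mul_nonneg (abs_nonneg g) (abs_nonneg y)]
    _ = _ := by rw [integral_const_mul, integral_mul_const]; ring

section lindeberg
variable {Ω : Type*} [MeasurableSpace Ω] {ν : Measure Ω} [IsFiniteMeasure ν]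

/-- One step of the replacement, integrated. -/
lemma lindeberg_step {r : ℝ} {ψ ψ1 ψ2 : ℝ → ℝ} {η C κ : ℝ}
    {X y c : SimpleFunc Ω ℝ} {f : Ω → ℝ} (hf2 : Integrable (fun ω => f ω ^ 2) ν) {s b : ℝ}
    (hstep : ∀ ω, |gP ψ (y ω + b * X ω) (s * c ω) - gP ψ (y ω) (√(s ^ 2 + b ^ 2) * c ω)
      - b * X ω * gP ψ1 (y ω) (s * c ω) - 1 / 2 * b ^ 2 * (X ω ^ 2 - c ω ^ 2) *
        gP ψ2 (y ω) (s * c ω)| ≤ η * b ^ 2 * (1 + |X ω| ^ r + (r - 2) * |y ω| ^ r)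
      + C * (if κ < |b * X ω| then |b * X ω| ^ r else 0)) :
    |∫ ω, gP ψ (y ω + b * X ω) (s * c ω) ∂ν - ∫ ω, gP ψ (y ω) (√(s ^ 2 + b ^ 2) * c ω) ∂ν| ≤
      η * b ^ 2 * (ν.real Set.univ + ∫ ω, |X ω| ^ r ∂ν + (r - 2) * ∫ ω, |y ω| ^ r ∂ν)
      + C * ∫ ω, (if κ < |b * X ω| then |b * X ω| ^ r else 0) ∂ν
      + |b| * |∫ ω, X ω * gP ψ1 (y ω) (s * c ω) ∂ν|
      + 1 / 2 * b ^ 2 * |∫ ω, (X ω ^ 2 - f ω ^ 2) * gP ψ2 (y ω) (s * c ω) ∂ν|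
      + 1 / 2 * b ^ 2 * |∫ ω, (f ω ^ 2 - c ω ^ 2) * gP ψ2 (y ω) (s * c ω) ∂ν| := by
  have I1 : Integrable (fun ω => gP ψ (y ω + b * X ω) (s * c ω)) ν :=
    integrable_comp_simple (X.pair (y.pair c))
      (fun v => gP ψ (v.2.1 + b * v.1) (s * v.2.2))
  have I2 : Integrable (fun ω => gP ψ (y ω) (√(s ^ 2 + b ^ 2) * c ω)) ν :=
    integrable_comp_simple (y.pair c) (fun v => gP ψ v.1 (√(s ^ 2 + b ^ 2) * v.2))
  have I3 : Integrable (fun ω => X ω * gP ψ1 (y ω) (s * c ω)) ν :=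
    integrable_comp_simple (X.pair (y.pair c)) (fun v => v.1 * gP ψ1 v.2.1 (s * v.2.2))
  have I4 : Integrable (fun ω => (X ω ^ 2 - c ω ^ 2) * gP ψ2 (y ω) (s * c ω)) ν :=
    integrable_comp_simple (X.pair (y.pair c))
      (fun v => (v.1 ^ 2 - v.2.2 ^ 2) * gP ψ2 v.2.1 (s * v.2.2))
  have I5 : Integrable (fun ω => |X ω| ^ r) ν := integrable_comp_simple X (fun v => |v| ^ r)
  have I6 : Integrable (fun ω => |y ω| ^ r) ν := integrable_comp_simple y (fun v => |v| ^ r)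
  have I7 : Integrable (fun ω => if κ < |b * X ω| then |b * X ω| ^ r else 0) ν :=
    integrable_comp_simple X (fun v => if κ < |b * v| then |b * v| ^ r else 0)
  have IX2 : Integrable (fun ω => X ω ^ 2) ν := integrable_comp_simple X (fun v => v ^ 2)
  have Ic2 : Integrable (fun ω => c ω ^ 2) ν := integrable_comp_simple c (fun v => v ^ 2)
  have J1 : Integrable (fun ω => (X ω ^ 2 - f ω ^ 2) * gP ψ2 (y ω) (s * c ω)) ν :=
    integrable_mul_comp_simple (y.pair c) (fun v => gP ψ2 v.1 (s * v.2)) (IX2.sub hf2)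
  have J2 : Integrable (fun ω => (f ω ^ 2 - c ω ^ 2) * gP ψ2 (y ω) (s * c ω)) ν :=
    integrable_mul_comp_simple (y.pair c) (fun v => gP ψ2 v.1 (s * v.2)) (hf2.sub Ic2)
  have e4 : ∫ ω, (X ω ^ 2 - c ω ^ 2) * gP ψ2 (y ω) (s * c ω) ∂ν =
      ∫ ω, (X ω ^ 2 - f ω ^ 2) * gP ψ2 (y ω) (s * c ω) ∂ν +
      ∫ ω, (f ω ^ 2 - c ω ^ 2) * gP ψ2 (y ω) (s * c ω) ∂ν := by
    rw [← integral_add J1 J2]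
    congr 1; ext ω; ring
  have key := integral_comb I1 I2 I3 I4 b (1 / 2 * b ^ 2)
  have keyI := integrable_comb I1 I2 I3 I4 b (1 / 2 * b ^ 2)
  have IR : Integrable (fun ω => η * b ^ 2 * (1 + |X ω| ^ r + (r - 2) * |y ω| ^ r)
      + C * (if κ < |b * X ω| then |b * X ω| ^ r else 0)) ν :=
    ((((integrable_const 1).add I5).add (I6.const_mul _)).const_mul _).add (I7.const_mul _)
  have eR : ∫ ω, (η * b ^ 2 * (1 + |X ω| ^ r + (r - 2) * |y ω| ^ r)
      + C * (if κ < |b * X ω| then |b * X ω| ^ r else 0)) ∂ν =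
      η * b ^ 2 * (ν.real Set.univ + ∫ ω, |X ω| ^ r ∂ν + (r - 2) * ∫ ω, |y ω| ^ r ∂ν)
      + C * ∫ ω, (if κ < |b * X ω| then |b * X ω| ^ r else 0) ∂ν := by
    have K1 : Integrable (fun ω => 1 + |X ω| ^ r) ν := (integrable_const 1).add I5
    have K2 : Integrable (fun ω => (r - 2) * |y ω| ^ r) ν := I6.const_mul _
    have K3 : Integrable (fun ω => η * b ^ 2 * (1 + |X ω| ^ r + (r - 2) * |y ω| ^ r)) ν :=
      (K1.add K2).const_mul _
    rw [integral_add K3 (I7.const_mul _), integral_const_mul, integral_const_mul,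
      integral_add K1 K2, integral_add (integrable_const 1) I5, integral_const_mul]
    simp
  have hb := (abs_integral_le_integral_abs (f := fun ω =>
    gP ψ (y ω + b * X ω) (s * c ω) - gP ψ (y ω) (√(s ^ 2 + b ^ 2) * c ω)
      - b * (X ω * gP ψ1 (y ω) (s * c ω)) - 1 / 2 * b ^ 2 * ((X ω ^ 2 - c ω ^ 2) *
        gP ψ2 (y ω) (s * c ω))) (μ := ν)).trans
    (integral_mono keyI.abs IR fun ω => by
      have := hstep ω
      simp only [mul_assoc] at this ⊢
      exact this)
  rw [key, eR, e4] at hb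
  have h1 : |b * ∫ ω, X ω * gP ψ1 (y ω) (s * c ω) ∂ν| =
    |b| * |∫ ω, X ω * gP ψ1 (y ω) (s * c ω) ∂ν| := abs_mul _ _
  have hb2 : 0 ≤ 1 / 2 * b ^ 2 := by positivity
  generalize (∫ ω, X ω * gP ψ1 (y ω) (s * c ω) ∂ν) = t1 at *
  generalize (∫ ω, (X ω ^ 2 - f ω ^ 2) * gP ψ2 (y ω) (s * c ω) ∂ν) = t2 at *
  generalize (∫ ω, (f ω ^ 2 - c ω ^ 2) * gP ψ2 (y ω) (s * c ω) ∂ν) = t3 at *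
  have h2 : |1 / 2 * b ^ 2 * (t2 + t3)| ≤ 1 / 2 * b ^ 2 * |t2| + 1 / 2 * b ^ 2 * |t3| := by
    rw [abs_mul, abs_of_nonneg hb2, ← mul_add]
    exact mul_le_mul_of_nonneg_left (abs_add_le _ _) hb2
  rw [abs_le] at hb ⊢
  have h3 := abs_le.1 h1.le
  have h4 := abs_le.1 h2
  constructor <;> linarith [hb.1, hb.2, h3.1, h3.2, h4.1, h4.2]

/-- Uniformly over the coefficients, the first and second order terms are eventually small. -/
lemma eventually_test_sums {ψ : ℝ → ℝ} (hψ : Continuous ψ) {C r : ℝ} (hC : 0 ≤ C) (hr : 0 ≤ r)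
    (hb : ∀ t, |ψ t| ≤ C * (1 + |t|) ^ r) (X : ℕ → SimpleFunc Ω ℝ) (c : SimpleFunc Ω ℝ)
    {Z : ℕ → Ω → ℝ} (hZ : ∀ m, Integrable (Z m) ν)
    (h0 : ∀ B, MeasurableSet B → Filter.Tendsto (fun m => ∫ ω in B, Z m ω ∂ν) hypU (nhds 0))
    {ε : ℝ} (hε : 0 < ε) (i : ℕ) (n : ℕ → ℕ) :
    ∀ᶠ m in hypU, ∀ (b : ℕ → ℝ) (s : ℝ), (∀ l < i, |b l| ≤ 1) → |s| ≤ 1 →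
      |∫ ω, Z m ω * gP ψ (∑ l ∈ Finset.range i, b l * X (n l) ω) (s * c ω) ∂ν| ≤ ε := by
  set τ : SimpleFunc Ω (ℝ × (Fin i → ℝ)) := c.pair (simpleTuple fun l => X (n l)) with hτ
  obtain ⟨R, hR0, hR⟩ := exists_bound_range (τ.map fun v => |v.1| + ∑ l, |v.2 l|)
  set G := ∫ g, (1 + |g|) ^ r ∂(gaussianReal 0 1)
  have hG : 0 ≤ G := integral_nonneg fun g => by positivity
  filter_upwards [eventually_simple_test τ hZ h0 (C * G * (1 + R) ^ r) hε] with m hm b s hbl hs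
  have := hm (fun v => gP ψ (∑ l : Fin i, b l * v.2 l) (s * v.1)) ?_
  · refine le_of_eq_of_le ?_ this
    congr 2; ext ω
    rw [Finset.sum_range]
    rfl
  · intro v hv
    obtain ⟨ω, rfl⟩ := SimpleFunc.mem_range.1 hv
    refine (gP_growth' hψ hC hr hb _ _).trans ?_
    refine mul_le_mul_of_nonneg_left ?_ (by positivity)
    refine Real.rpow_le_rpow (by positivity) ?_ hr
    have h1 : |∑ l : Fin i, b l * (τ ω).2 l| ≤ ∑ l, |(τ ω).2 l| := by
      refine (Finset.abs_sum_le_sum_abs _ _).trans (Finset.sum_le_sum fun l _ => ?_)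
      rw [abs_mul]
      exact mul_le_of_le_one_left (abs_nonneg _) (hbl l l.2)
    have h2 : |s * (τ ω).1| ≤ |(τ ω).1| := by
      rw [abs_mul]
      exact mul_le_of_le_one_left (abs_nonneg _) hs
    have h3 := hR ω
    simp only [SimpleFunc.map_apply] at h3
    linarith [le_abs_self (|(τ ω).1| + ∑ l, |(τ ω).2 l|)]

end lindeberg

section lindeberg
variable {Ω : Type*} [MeasurableSpace Ω] {ν : Measure Ω} [IsFiniteMeasure ν]

lemma memLp_of_integrable_abs_rpow {r : ℝ} (hr : 0 < r) {f : Ω → ℝ} {μ : Measure Ω}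
    (hfm : AEStronglyMeasurable f μ)
    (hf : Integrable (fun ω => |f ω| ^ r) μ) : MemLp f (ENNReal.ofReal r) μ := by
  rw [← integrable_norm_rpow_iff hfm (by simpa using hr) (by simp)]
  simpa [ENNReal.toReal_ofReal hr.le] using hf

lemma integral_abs_sub_rpow_eq {r : ℝ} (hr : 0 < r) {f : Ω → ℝ} {μ : Measure Ω}
    (hf : MemLp f (ENNReal.ofReal r) μ) :
    eLpNorm f (ENNReal.ofReal r) μ = ENNReal.ofReal ((∫ ω, |f ω| ^ r ∂μ) ^ (1 / r)) := by
  rw [hf.eLpNorm_eq_integral_rpow_norm (by simpa using hr) (by simp),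
    ENNReal.toReal_ofReal hr.le]
  simp

lemma exists_simple_approx {r : ℝ} (hr : 0 < r) {f : Ω → ℝ} (hfm : AEStronglyMeasurable f ν)
    (hf : Integrable (fun ω => |f ω| ^ r) ν) {ε : ℝ} (hε : 0 < ε) :
    ∃ c : SimpleFunc Ω ℝ, ∫ ω, |f ω - c ω| ^ r ∂ν ≤ ε := by
  have hm := memLp_of_integrable_abs_rpow hr hfm hf
  obtain ⟨c, hc, hcm⟩ := hm.exists_simpleFunc_eLpNorm_sub_lt (by simp)
    (ε := ENNReal.ofReal (ε ^ (1 / r))) (by simpa using Real.rpow_pos_of_pos hε _)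
  refine ⟨c, ?_⟩
  have hd := hm.sub hcm
  rw [integral_abs_sub_rpow_eq hr hd, ENNReal.ofReal_lt_ofReal_iff (by positivity)] at hc
  have := (Real.rpow_lt_rpow_iff (by positivity) hε.le (by positivity)).1 hc
  simpa using this.le

lemma integrable_abs_sub_rpow_simple {r : ℝ} (hr : 0 < r) {f : Ω → ℝ}
    (hfm : AEStronglyMeasurable f ν) (hf : Integrable (fun ω => |f ω| ^ r) ν)
    (c : SimpleFunc Ω ℝ) : Integrable (fun ω => |f ω - c ω| ^ r) ν := by
  have hm := memLp_of_integrable_abs_rpow hr hfm hf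
  have hc : MemLp c (ENNReal.ofReal r) ν := c.memLp_of_isFiniteMeasure _ _
  have h := (integrable_norm_rpow_iff (hm.sub hc).1 (by simpa using hr) (by simp)).2 (hm.sub hc)
  simpa [ENNReal.toReal_ofReal hr.le] using h

lemma integral_abs_simple_le {r : ℝ} (hr : 0 < r) {f : Ω → ℝ}
    (hfm : AEStronglyMeasurable f ν) (hf : Integrable (fun ω => |f ω| ^ r) ν)
    (c : SimpleFunc Ω ℝ) (hc : ∫ ω, |f ω - c ω| ^ r ∂ν ≤ 1) :
    ∫ ω, |c ω| ^ r ∂ν ≤ 2 ^ r * (∫ ω, |f ω| ^ r ∂ν + 1) := by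
  have hi := integrable_abs_sub_rpow_simple hr hfm hf c
  calc ∫ ω, |c ω| ^ r ∂ν ≤ ∫ ω, 2 ^ r * (|f ω| ^ r + |f ω - c ω| ^ r) ∂ν := by
        refine integral_mono (integrable_comp_simple c fun v => |v| ^ r)
          ((hf.add hi).const_mul _) fun ω => ?_
        refine (Real.rpow_le_rpow (abs_nonneg _) ?_ hr.le).trans
          (add_rpow_le_two_rpow (abs_nonneg _) (abs_nonneg _) hr.le)
        have := abs_sub_abs_le_abs_sub (c ω) (f ω)
        rw [abs_sub_comm] at this
        linarith
    _ = 2 ^ r * (∫ ω, |f ω| ^ r ∂ν + ∫ ω, |f ω - c ω| ^ r ∂ν) := by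
        rw [integral_const_mul, integral_add hf hi]
    _ ≤ _ := by gcongr

lemma abs_integral_gP_zero_le {ψ : ℝ → ℝ} (hψ : Continuous ψ) {C r : ℝ} (hC : 0 ≤ C) (hr : 0 ≤ r)
    (hb : ∀ t, |ψ t| ≤ C * (1 + |t|) ^ r) (c : SimpleFunc Ω ℝ) {s : ℝ} (hs : |s| ≤ 1) :
    |∫ ω, gP ψ 0 (s * c ω) ∂ν| ≤ C * (∫ g, (1 + |g|) ^ r ∂(gaussianReal 0 1)) *
      (2 ^ r * (ν.real Set.univ + ∫ ω, |c ω| ^ r ∂ν)) := by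
  have hG : 0 ≤ ∫ g, (1 + |g|) ^ r ∂(gaussianReal 0 1) := integral_nonneg fun g => by positivity
  have Ic : Integrable (fun ω => |c ω| ^ r) ν := integrable_comp_simple c fun v => |v| ^ r
  calc |∫ ω, gP ψ 0 (s * c ω) ∂ν| ≤ ∫ ω, |gP ψ 0 (s * c ω)| ∂ν := abs_integral_le_integral_abs
    _ ≤ ∫ ω, C * (∫ g, (1 + |g|) ^ r ∂(gaussianReal 0 1)) * (2 ^ r * (1 + |c ω| ^ r)) ∂ν := by
        refine integral_mono (integrable_comp_simple c fun v => |gP ψ 0 (s * v)|)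
          ((((integrable_const 1).add Ic).const_mul _).const_mul _) fun ω => ?_
        refine (gP_growth' hψ hC hr hb _ _).trans ?_
        refine mul_le_mul_of_nonneg_left ?_ (by positivity)
        rw [abs_zero, add_zero]
        refine (Real.rpow_le_rpow (by positivity) (?_ : _ ≤ 1 + |c ω|) hr).trans
          ((add_rpow_le_two_rpow zero_le_one (abs_nonneg _) hr).trans (by simp))
        rw [abs_mul]
        linarith [mul_le_of_le_one_left (abs_nonneg (c ω)) hs]
    _ = _ := by
        rw [integral_const_mul, integral_const_mul, integral_add (integrable_const 1) Ic]
        simp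

lemma second_order_error {r : ℝ} (hr : 2 ≤ r) {ψ2 : ℝ → ℝ} (hψ : Continuous ψ2) {C : ℝ}
    (hC : 0 ≤ C) (hb : ∀ t, |ψ2 t| ≤ C * (1 + |t|) ^ (r - 2)) {f : Ω → ℝ}
    (hfm : AEStronglyMeasurable f ν) (hf : Integrable (fun ω => |f ω| ^ r) ν)
    {θ Cθ : ℝ} (hy : ∀ y u v : ℝ,
    (1 + |y| + |v|) ^ (r - 2) * |u ^ 2 - v ^ 2| ≤
      θ * (1 + (r - 2) * |y| ^ r + |u| ^ r + |v| ^ r) + Cθ * |u - v| ^ r)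
    (y c : SimpleFunc Ω ℝ) {s : ℝ} (hs : |s| ≤ 1) :
    |∫ ω, (f ω ^ 2 - c ω ^ 2) * gP ψ2 (y ω) (s * c ω) ∂ν| ≤
      C * (∫ g, (1 + |g|) ^ (r - 2) ∂(gaussianReal 0 1)) *
      (θ * (ν.real Set.univ + (r - 2) * ∫ ω, |y ω| ^ r ∂ν + ∫ ω, |f ω| ^ r ∂ν
        + ∫ ω, |c ω| ^ r ∂ν) + Cθ * ∫ ω, |f ω - c ω| ^ r ∂ν) := by
  set G := ∫ g, (1 + |g|) ^ (r - 2) ∂(gaussianReal 0 1)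
  have hG : 0 ≤ G := integral_nonneg fun g => by positivity
  have hr0 : 0 < r := by linarith
  have Ic : Integrable (fun ω => |c ω| ^ r) ν := integrable_comp_simple c fun v => |v| ^ r
  have Iy : Integrable (fun ω => (r - 2) * |y ω| ^ r) ν :=
    integrable_comp_simple y fun v => (r - 2) * |v| ^ r
  have hi := integrable_abs_sub_rpow_simple hr0 hfm hf c
  have K1 : Integrable (fun ω => 1 + (r - 2) * |y ω| ^ r) ν := (integrable_const 1).add Iy
  have K2 : Integrable (fun ω => 1 + (r - 2) * |y ω| ^ r + |f ω| ^ r) ν := K1.add hf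
  have K3 : Integrable (fun ω => 1 + (r - 2) * |y ω| ^ r + |f ω| ^ r + |c ω| ^ r) ν := K2.add Ic
  have K4 : Integrable (fun ω => θ * (1 + (r - 2) * |y ω| ^ r + |f ω| ^ r + |c ω| ^ r)
    + Cθ * |f ω - c ω| ^ r) ν := (K3.const_mul _).add (hi.const_mul _)
  calc _ ≤ ∫ ω, |(f ω ^ 2 - c ω ^ 2) * gP ψ2 (y ω) (s * c ω)| ∂ν := abs_integral_le_integral_abs
    _ ≤ ∫ ω, C * G * (θ * (1 + (r - 2) * |y ω| ^ r + |f ω| ^ r + |c ω| ^ r)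
        + Cθ * |f ω - c ω| ^ r) ∂ν := by
        refine integral_mono_of_nonneg (Filter.Eventually.of_forall fun ω => abs_nonneg _)
          (K4.const_mul _) (Filter.Eventually.of_forall fun ω => ?_)
        have h1 := hy (y ω) (f ω) (c ω)
        have h2 := gP_growth' hψ hC (by linarith : 0 ≤ r - 2) hb (y ω) (s * c ω)
        have h3 : (1 + |y ω| + |s * c ω|) ^ (r - 2) ≤ (1 + |y ω| + |c ω|) ^ (r - 2) := by
          refine Real.rpow_le_rpow (by positivity) ?_ (by linarith)
          rw [abs_mul]
          linarith [mul_le_of_le_one_left (abs_nonneg (c ω)) hs]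
        simp only [abs_mul]
        calc |f ω ^ 2 - c ω ^ 2| * |gP ψ2 (y ω) (s * c ω)|
            ≤ |f ω ^ 2 - c ω ^ 2| * (C * G * (1 + |y ω| + |c ω|) ^ (r - 2)) :=
              mul_le_mul_of_nonneg_left (h2.trans (mul_le_mul_of_nonneg_left h3 (by positivity)))
                (abs_nonneg _)
          _ = C * G * ((1 + |y ω| + |c ω|) ^ (r - 2) * |f ω ^ 2 - c ω ^ 2|) := by ring
          _ ≤ _ := mul_le_mul_of_nonneg_left h1 (by positivity)
    _ = _ := by
        rw [integral_const_mul, integral_add (K3.const_mul _) (hi.const_mul _),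
          integral_const_mul, integral_const_mul, integral_add K2 Ic, integral_add K1 hf,
          integral_add (integrable_const 1) Iy, integral_const_mul]
        simp

end lindeberg

section lindeberg
variable {Ω : Type*} [MeasurableSpace Ω] {ν : Measure Ω} [IsFiniteMeasure ν]

/-- The partial sums `∑ l < i, b l * Y l` as simple functions. -/
noncomputable def simpleSum (Y : ℕ → SimpleFunc Ω ℝ) (b : ℕ → ℝ) (i : ℕ) : SimpleFunc Ω ℝ :=
  (simpleTuple fun l : Fin i => Y l).map fun v => ∑ l : Fin i, b l * v l

lemma simpleSum_apply (Y : ℕ → SimpleFunc Ω ℝ) (b : ℕ → ℝ) (i : ℕ) (ω : Ω) :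
    simpleSum Y b i ω = ∑ l ∈ Finset.range i, b l * Y l ω := by
  rw [Finset.sum_range]; rfl

lemma gP_zero_right (ψ : ℝ → ℝ) (y : ℝ) : gP ψ y 0 = ψ y := by simp [gP]

lemma lindeberg_induction {r : ℝ} {ψ ψ1 ψ2 : ℝ → ℝ} {η C κ M β Cx Bs K0 Cco ρ δ : ℝ}
    (hη : 0 ≤ η) (hC : 0 ≤ C) (hCco : 0 ≤ Cco)
    (hstep : ∀ b s c x y : ℝ, |b| ≤ β → |s| ≤ 1 → |c| ≤ M →
      |gP ψ (y + b * x) (s * c) - gP ψ y (√(s ^ 2 + b ^ 2) * c) - b * x * gP ψ1 y (s * c)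
        - 1 / 2 * b ^ 2 * (x ^ 2 - c ^ 2) * gP ψ2 y (s * c)| ≤
        η * b ^ 2 * (1 + |x| ^ r + (r - 2) * |y| ^ r)
        + C * (if κ < |b * x| then |b * x| ^ r else 0))
    (hcoer : ∀ t, (r - 2) * |t| ^ r ≤ Cco * (1 + ψ t))
    {c : SimpleFunc Ω ℝ} (hcM : ∀ ω, |c ω| ≤ M) {f : Ω → ℝ}
    (hf2 : Integrable (fun ω => f ω ^ 2) ν) (Y : ℕ → SimpleFunc Ω ℝ)
    (hY : ∀ n, ∫ ω, |Y n ω| ^ r ∂ν ≤ Cx)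
    (hK0 : ∀ s, |s| ≤ 1 → |∫ ω, gP ψ 0 (s * c ω) ∂ν| ≤ K0)
    (hBs : Bs = Cco * (ν.real Set.univ + (K0 + δ)))
    (hE : ∀ (y : SimpleFunc Ω ℝ) (s : ℝ), |s| ≤ 1 → (r - 2) * ∫ ω, |y ω| ^ r ∂ν ≤ Bs →
      |∫ ω, (f ω ^ 2 - c ω ^ 2) * gP ψ2 (y ω) (s * c ω) ∂ν| ≤ δ / 4)
    (hηδ : η * (ν.real Set.univ + Cx + Bs) ≤ δ / 8) (hρδ : C * ρ ≤ δ / 8)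
    (h1 : ∀ i (b : ℕ → ℝ) (s : ℝ), (∀ l < i, |b l| ≤ 1) → |s| ≤ 1 →
      |∫ ω, Y i ω * gP ψ1 (∑ l ∈ Finset.range i, b l * Y l ω) (s * c ω) ∂ν| ≤ δ / 8 * (1 / 2) ^ i)
    (h2 : ∀ i (b : ℕ → ℝ) (s : ℝ), (∀ l < i, |b l| ≤ 1) → |s| ≤ 1 →
      |∫ ω, (Y i ω ^ 2 - f ω ^ 2) * gP ψ2 (∑ l ∈ Finset.range i, b l * Y l ω) (s * c ω) ∂ν| ≤ δ / 4)
    (h3 : ∀ i (b : ℝ), |b| ≤ β →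
      ∫ ω, (if κ < |b * Y i ω| then |b * Y i ω| ^ r else 0) ∂ν ≤ ρ * b ^ 2)
    (hδ : 0 < δ) (I : ℕ) (b : ℕ → ℝ) (hb : ∑ i ∈ Finset.range I, b i ^ 2 ≤ 1)
    (hbβ : ∀ i < I, |b i| ≤ β) :
    |∫ ω, ψ (∑ i ∈ Finset.range I, b i * Y i ω) ∂ν
      - ∫ ω, gP ψ 0 (√(∑ i ∈ Finset.range I, b i ^ 2) * c ω) ∂ν| ≤ δ := by
  induction I using Nat.strong_induction_on with
  | _ I ih =>
  have hb1 : ∀ l < I, |b l| ≤ 1 := fun l hl => by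
    have : b l ^ 2 ≤ 1 := (Finset.single_le_sum (f := fun i => b i ^ 2)
      (fun i _ => sq_nonneg _) (Finset.mem_range.2 hl)).trans hb
    exact abs_le_one_iff_mul_self_le_one.2 (by nlinarith)
  have hsub : ∀ i ≤ I, ∑ l ∈ Finset.range i, b l ^ 2 ≤ 1 := fun i hi =>
    (Finset.sum_le_sum_of_subset_of_nonneg (Finset.range_subset_range.2 hi)
      fun _ _ _ => sq_nonneg _).trans hb
  have hsqrt : ∀ x : ℝ, 0 ≤ x → x ≤ 1 → |√x| ≤ 1 := fun x _ h => by
    rw [abs_of_nonneg (Real.sqrt_nonneg _)]; exact Real.sqrt_le_one.2 h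
  -- the moment bound for the partial sums
  have hmom : ∀ i < I, (r - 2) * ∫ ω, |simpleSum Y b i ω| ^ r ∂ν ≤ Bs := by
    intro i hi
    have e1 := ih i hi (hsub i hi.le) fun l hl => hbβ l (hl.trans hi)
    have e2 := hK0 _ (hsqrt (∑ l ∈ Finset.range i, b l ^ 2)
      (Finset.sum_nonneg fun _ _ => sq_nonneg _) (hsub i hi.le))
    have I0 : Integrable (fun ω => ψ (simpleSum Y b i ω)) ν := integrable_comp_simple _ _
    have e3 : (r - 2) * ∫ ω, |simpleSum Y b i ω| ^ r ∂ν ≤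
        Cco * (ν.real Set.univ + ∫ ω, ψ (simpleSum Y b i ω) ∂ν) := by
      have : ∫ ω, Cco * (1 + ψ (simpleSum Y b i ω)) ∂ν =
          Cco * (ν.real Set.univ + ∫ ω, ψ (simpleSum Y b i ω) ∂ν) := by
        rw [integral_const_mul, integral_add (integrable_const 1) I0]; simp
      rw [← this, ← integral_const_mul]
      exact integral_mono (integrable_comp_simple (simpleSum Y b i) fun v => (r - 2) * |v| ^ r)
        (((integrable_const 1).add I0).const_mul _) fun ω => hcoer _
    refine e3.trans ?_
    rw [hBs]
    refine mul_le_mul_of_nonneg_left ?_ hCco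
    simp only [simpleSum_apply]
    linarith [(abs_le.1 e1).2, (abs_le.1 e2).2]
  set σ : ℕ → ℝ := fun i => √(∑ l ∈ Finset.Ico i I, b l ^ 2) with hσ
  set Φ : ℕ → ℝ := fun i => ∫ ω, gP ψ (simpleSum Y b i ω) (σ i * c ω) ∂ν with hΦ
  have hσ1 : ∀ i, |σ i| ≤ 1 := fun i => hsqrt _ (Finset.sum_nonneg fun _ _ => sq_nonneg _) <| by
    refine (Finset.sum_le_sum_of_subset_of_nonneg (fun x hx => ?_) fun _ _ _ => sq_nonneg _).trans
      hb
    exact Finset.mem_range.2 (Finset.mem_Ico.1 hx).2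
  have hσs : ∀ i < I, √(σ (i + 1) ^ 2 + b i ^ 2) = σ i := fun i hi => by
    simp only [hσ]
    rw [Real.sq_sqrt (Finset.sum_nonneg fun _ _ => sq_nonneg _),
      Finset.sum_eq_sum_Ico_succ_bot hi, add_comm]
  have hd : ∀ i < I, |Φ (i + 1) - Φ i| ≤ b i ^ 2 * (δ / 2) + δ / 8 * (1 / 2) ^ i := by
    intro i hi
    have hb2 : 0 ≤ b i ^ 2 := sq_nonneg _
    have key := lindeberg_step (X := Y i) (y := simpleSum Y b i) (c := c) hf2
      (fun ω => hstep (b i) (σ (i + 1)) (c ω) (Y i ω) (simpleSum Y b i ω) (hbβ i hi)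
        (hσ1 _) (hcM ω))
    have es : ∀ ω, simpleSum Y b i ω + b i * Y i ω = simpleSum Y b (i + 1) ω := fun ω => by
      rw [simpleSum_apply, simpleSum_apply, Finset.sum_range_succ]
    simp only [es, hσs i hi] at key
    have k1 := h1 i b (σ (i + 1)) (fun l hl => hb1 l (hl.trans hi)) (hσ1 _)
    have k2 := h2 i b (σ (i + 1)) (fun l hl => hb1 l (hl.trans hi)) (hσ1 _)
    simp only [← simpleSum_apply] at k1 k2
    have k3 := h3 i (b i) (hbβ i hi)
    have k4 := hE (simpleSum Y b i) (σ (i + 1)) (hσ1 _) (hmom i hi)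
    refine key.trans ?_
    have m1 : η * b i ^ 2 * (ν.real Set.univ + ∫ ω, |Y i ω| ^ r ∂ν +
        (r - 2) * ∫ ω, |simpleSum Y b i ω| ^ r ∂ν) ≤ b i ^ 2 * (δ / 8) := by
      calc _ ≤ η * b i ^ 2 * (ν.real Set.univ + Cx + Bs) :=
            mul_le_mul_of_nonneg_left (by linarith [hY i, hmom i hi]) (by positivity)
        _ = b i ^ 2 * (η * (ν.real Set.univ + Cx + Bs)) := by ring
        _ ≤ _ := mul_le_mul_of_nonneg_left hηδ hb2
    have m2 : C * ∫ ω, (if κ < |b i * Y i ω| then |b i * Y i ω| ^ r else 0) ∂ν ≤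
        b i ^ 2 * (δ / 8) := by
      calc _ ≤ C * (ρ * b i ^ 2) := mul_le_mul_of_nonneg_left k3 hC
        _ = b i ^ 2 * (C * ρ) := by ring
        _ ≤ _ := mul_le_mul_of_nonneg_left hρδ hb2
    have m3 := mul_le_mul (hb1 i hi) k1 (abs_nonneg _) zero_le_one
    have m4 := mul_le_mul_of_nonneg_left k2 (by positivity : 0 ≤ 1 / 2 * b i ^ 2)
    have m5 := mul_le_mul_of_nonneg_left k4 (by positivity : 0 ≤ 1 / 2 * b i ^ 2)
    linarith
  have hΦ0 : Φ 0 = ∫ ω, gP ψ 0 (√(∑ i ∈ Finset.range I, b i ^ 2) * c ω) ∂ν := by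
    rw [Finset.range_eq_Ico]; simp [hΦ, hσ, simpleSum_apply]
  have hΦI : Φ I = ∫ ω, ψ (∑ i ∈ Finset.range I, b i * Y i ω) ∂ν := by
    simp [hΦ, hσ, simpleSum_apply, gP_zero_right]
  rw [← hΦ0, ← hΦI, ← Finset.sum_range_sub]
  calc |∑ i ∈ Finset.range I, (Φ (i + 1) - Φ i)| ≤ ∑ i ∈ Finset.range I, |Φ (i + 1) - Φ i| :=
        Finset.abs_sum_le_sum_abs _ _
    _ ≤ ∑ i ∈ Finset.range I, (b i ^ 2 * (δ / 2) + δ / 8 * (1 / 2) ^ i) :=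
        Finset.sum_le_sum fun i hi => hd i (Finset.mem_range.1 hi)
    _ = (∑ i ∈ Finset.range I, b i ^ 2) * (δ / 2) + δ / 8 * ∑ i ∈ Finset.range I, (1 / 2) ^ i := by
        rw [Finset.sum_add_distrib, Finset.sum_mul, Finset.mul_sum]
    _ ≤ 1 * (δ / 2) + δ / 8 * 2 := by
        have h4 := sum_geometric_two_le I
        have h5 := mul_le_mul_of_nonneg_right hb (by positivity : 0 ≤ δ / 2)
        have h6 := mul_le_mul_of_nonneg_left h4 (by positivity : 0 ≤ δ / 8)
        exact add_le_add h5 h6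
    _ ≤ δ := by linarith

set_option maxHeartbeats 1000000 in
/-- Lindeberg's replacement along an ultrafilter. -/
theorem lindeberg {r : ℝ} (hr : 2 ≤ r) {ψ ψ1 ψ2 : ℝ → ℝ} (hψ : TaylorBound r ψ ψ1 ψ2)
    (hcoer : ∃ C : ℝ, 0 ≤ C ∧ ∀ t, (r - 2) * |t| ^ r ≤ C * (1 + ψ t))
    (X : ℕ → SimpleFunc Ω ℝ) {f : Ω → ℝ} (hfm : Measurable f)
    (hf : Integrable (fun ω => |f ω| ^ r) ν) {Cx : ℝ} (hX : ∀ n, ∫ ω, |X n ω| ^ r ∂ν ≤ Cx)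
    (hX1 : ∀ B, MeasurableSet B →
      Filter.Tendsto (fun n => ∫ ω in B, X n ω ∂ν) hypU (nhds 0))
    (hX2 : ∀ B, MeasurableSet B →
      Filter.Tendsto (fun n => ∫ ω in B, X n ω ^ 2 ∂ν) hypU (nhds (∫ ω in B, f ω ^ 2 ∂ν)))
    (hX3 : ∀ κ > 0, ∀ ρ > 0, ∃ β > 0, ∀ᶠ n in hypU, ∀ b : ℝ, |b| ≤ β →
      ∫ ω, (if κ < |b * X n ω| then |b * X n ω| ^ r else 0) ∂ν ≤ ρ * b ^ 2)
    {δ : ℝ} (hδ : 0 < δ) :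
    ∃ c : SimpleFunc Ω ℝ, ∫ ω, |f ω - c ω| ^ r ∂ν ≤ δ ∧ ∃ β > 0, Gen fun n =>
      ∀ (I : ℕ) (b : ℕ → ℝ), ∑ i ∈ Finset.range I, b i ^ 2 ≤ 1 → (∀ i < I, |b i| ≤ β) →
        |∫ ω, ψ (∑ i ∈ Finset.range I, b i * X (n i) ω) ∂ν
          - ∫ ω, gP ψ 0 (√(∑ i ∈ Finset.range I, b i ^ 2) * c ω) ∂ν| ≤ δ := by
  wlog hδ1 : δ ≤ 1 generalizing δ
  · obtain ⟨c, hc, β, hβ, hg⟩ := this one_pos le_rfl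
    exact ⟨c, hc.trans (not_le.1 hδ1).le, β, hβ, hg.mono fun n hn I b hb hb' =>
      (hn I b hb hb').trans (not_le.1 hδ1).le⟩
  have hr0 : 0 < r := by linarith
  obtain ⟨Cco, hCco, hcoer⟩ := hcoer
  obtain ⟨C0, hC0, hgr⟩ := hψ.growth
  have hν : 0 ≤ ν.real Set.univ := measureReal_nonneg (μ := ν) (s := Set.univ)
  have hF : 0 ≤ ∫ ω, |f ω| ^ r ∂ν := integral_nonneg fun ω => by positivity
  have hCx : 0 ≤ Cx := (integral_nonneg fun ω => by positivity).trans (hX 0)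
  set F := ∫ ω, |f ω| ^ r ∂ν
  set Ft := 2 ^ r * (F + 1) with hFt
  set G := ∫ g, (1 + |g|) ^ r ∂(gaussianReal 0 1)
  have hG : 0 ≤ G := integral_nonneg fun g => by positivity
  set G2 := ∫ g, (1 + |g|) ^ (r - 2) ∂(gaussianReal 0 1)
  have hG2 : 0 ≤ G2 := integral_nonneg fun g => by positivity
  have hFt0 : 0 ≤ Ft := by positivity
  set K0 := C0 * G * (2 ^ r * (ν.real Set.univ + Ft)) with hK0
  have hK00 : 0 ≤ K0 := by positivity
  set Bs := Cco * (ν.real Set.univ + (K0 + δ)) with hBs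
  have hBs0 : 0 ≤ Bs := by positivity
  have small : ∀ {K : ℝ}, 0 ≤ K → ∀ {t : ℝ}, 0 < t → ∃ x > 0, x * K ≤ t := fun {K} hK {t} ht => by
    refine ⟨t / (K + 1), by positivity, ?_⟩
    rw [div_mul_eq_mul_div, div_le_iff₀ (by positivity)]
    nlinarith [div_mul_cancel₀ t (by positivity : K + 1 ≠ 0)]
  obtain ⟨η, hη, hηδ⟩ := small (K := ν.real Set.univ + Cx + Bs) (by positivity)
    (by positivity : 0 < δ / 8)
  obtain ⟨θ, hθ, hθδ⟩ := small (K := C0 * G2 * (ν.real Set.univ + Bs + F + Ft)) (by positivity)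
    (by positivity : 0 < δ / 8)
  obtain ⟨Cθ, hCθ, hyoung⟩ := young_sq_sub hr hθ
  obtain ⟨ε, hε, hεδ⟩ := small (K := C0 * G2 * Cθ) (by positivity) (by positivity : 0 < δ / 8)
  obtain ⟨c, hc⟩ := exists_simple_approx hr0 hfm.aestronglyMeasurable hf
    (lt_min hε hδ)
  have hcδ := hc.trans (min_le_right _ _)
  have hcε := hc.trans (min_le_left _ _)
  have hcF := integral_abs_simple_le hr0 hfm.aestronglyMeasurable hf c (hcδ.trans hδ1)
  obtain ⟨M, hM0, hM⟩ := exists_bound_range c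
  obtain ⟨β0, hβ0, C, hC, κ, hκ, hstep⟩ := heat_step hr hψ hη hM0
  obtain ⟨ρ, hρ, hρδ⟩ := small hC (by positivity : 0 < δ / 8)
  obtain ⟨β1, hβ1, hX3⟩ := hX3 κ hκ ρ hρ
  have hfL2 : Integrable (fun ω => f ω ^ 2) ν := by
    have := (memLp_of_integrable_abs_rpow hr0 hfm.aestronglyMeasurable hf).mono_exponent
      (p := 2) (by simpa using ENNReal.ofReal_le_ofReal hr)
    exact this.integrable_sq
  have hXi : ∀ m, Integrable (fun ω => X m ω) ν := fun m => (X m).integrable_of_isFiniteMeasure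
  have hX2i : ∀ m, Integrable (fun ω => X m ω ^ 2) ν := fun m =>
    integrable_comp_simple (X m) fun v => v ^ 2
  have hZ2 : ∀ B, MeasurableSet B → Filter.Tendsto
      (fun m => ∫ ω in B, (X m ω ^ 2 - f ω ^ 2) ∂ν) hypU (nhds 0) := fun B hB => by
    have := (hX2 B hB).sub_const (∫ ω in B, f ω ^ 2 ∂ν)
    rw [sub_self] at this
    refine this.congr fun m => ?_
    rw [integral_sub (hX2i m).integrableOn hfL2.integrableOn]
  refine ⟨c, hcδ, min β0 β1, lt_min hβ0 hβ1, ?_⟩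
  have g1 : ∀ i (n : ℕ → ℕ), ∀ᶠ m in hypU, ∀ (b : ℕ → ℝ) (s : ℝ), (∀ l < i, |b l| ≤ 1) →
      |s| ≤ 1 → |∫ ω, X m ω * gP ψ1 (∑ l ∈ Finset.range i, b l * X (n l) ω) (s * c ω) ∂ν|
      ≤ δ / 8 * (1 / 2) ^ i := fun i n =>
    eventually_test_sums hψ.cont1 hC0.le hr0.le (fun t => (hgr t).2.1) X c hXi hX1
      (by positivity) i n
  have g2 : ∀ i (n : ℕ → ℕ), ∀ᶠ m in hypU, ∀ (b : ℕ → ℝ) (s : ℝ), (∀ l < i, |b l| ≤ 1) →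
      |s| ≤ 1 → |∫ ω, (X m ω ^ 2 - f ω ^ 2) *
        gP ψ2 (∑ l ∈ Finset.range i, b l * X (n l) ω) (s * c ω) ∂ν| ≤ δ / 4 := fun i n =>
    eventually_test_sums hψ.cont2 hC0.le (by linarith : 0 ≤ r - 2) (fun t => (hgr t).2.2) X c
      (fun m => (hX2i m).sub hfL2) hZ2 (by positivity) i n
  have gg := Gen.of_step (fun i n => (g1 i n).and ((g2 i n).and hX3)) fun i n n' m h hq => by
    have e : ∀ (b : ℕ → ℝ) ω, ∑ l ∈ Finset.range i, b l * X (n l) ω =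
        ∑ l ∈ Finset.range i, b l * X (n' l) ω := fun b ω =>
      Finset.sum_congr rfl fun l hl => by rw [h l (Finset.mem_range.1 hl)]
    simpa only [e] using hq
  refine gg.mono fun n hn I b hb hbβ => ?_
  refine lindeberg_induction hη.le hC hCco
    (fun b s c x y hb hs hc => hstep b s c x y (hb.trans (min_le_left _ _)) hs hc) hcoer hM hfL2
    (fun i => X (n i)) (fun i => hX _) (K0 := K0) ?_ hBs ?_ hηδ ((mul_comm C ρ).trans_le hρδ)
    (fun i => (hn i).1)
    (fun i => (hn i).2.1) (fun i b hb => (hn i).2.2 b (hb.trans (min_le_right _ _))) hδ I b hb hbβ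
  · intro s hs
    refine (abs_integral_gP_zero_le hψ.cont hC0.le hr0.le (fun t => (hgr t).1) c hs).trans ?_
    exact mul_le_mul_of_nonneg_left (mul_le_mul_of_nonneg_left (by linarith) (by positivity))
      (by positivity)
  · intro y s hs hy
    refine (second_order_error hr hψ.cont2 hC0.le (fun t => (hgr t).2.2)
      hfm.aestronglyMeasurable hf hyoung y c hs).trans ?_
    have e1 : θ * (ν.real Set.univ + (r - 2) * ∫ ω, |y ω| ^ r ∂ν + F + ∫ ω, |c ω| ^ r ∂ν) ≤
        θ * (ν.real Set.univ + Bs + F + Ft) := mul_le_mul_of_nonneg_left (by linarith) hθ.le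
    have e2 : Cθ * ∫ ω, |f ω - c ω| ^ r ∂ν ≤ Cθ * ε := mul_le_mul_of_nonneg_left hcε hCθ
    calc _ ≤ C0 * G2 * (θ * (ν.real Set.univ + Bs + F + Ft) + Cθ * ε) :=
          mul_le_mul_of_nonneg_left (add_le_add e1 e2) (by positivity)
      _ = θ * (C0 * G2 * (ν.real Set.univ + Bs + F + Ft)) + ε * (C0 * G2 * Cθ) := by ring
      _ ≤ _ := by linarith

end lindeberg

section lpn
variable {Ω : Type*} [MeasurableSpace Ω] {ν : Measure Ω}

/-- The real-valued `L_p` norm. -/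
noncomputable def lpn (p : ℝ) (ν : Measure Ω) (F : Ω → ℝ) : ℝ :=
  (eLpNorm F (ENNReal.ofReal p) ν).toReal

lemma lpn_nonneg {p : ℝ} {F : Ω → ℝ} : 0 ≤ lpn p ν F := ENNReal.toReal_nonneg

lemma lpn_eq {p : ℝ} (hp : 0 < p) {F : Ω → ℝ} (hF : MemLp F (ENNReal.ofReal p) ν) :
    lpn p ν F = (∫ ω, |F ω| ^ p ∂ν) ^ (1 / p) := by
  rw [lpn, integral_abs_sub_rpow_eq hp hF, ENNReal.toReal_ofReal (by positivity)]

lemma lpn_rpow {p : ℝ} (hp : 0 < p) {F : Ω → ℝ} (hF : MemLp F (ENNReal.ofReal p) ν) :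
    lpn p ν F ^ p = ∫ ω, |F ω| ^ p ∂ν := by
  rw [lpn_eq hp hF, ← Real.rpow_mul (by positivity)]
  simp [hp.ne']

lemma one_le_ofReal {p : ℝ} (hp : 1 ≤ p) : 1 ≤ ENNReal.ofReal p := by
  simpa using ENNReal.ofReal_le_ofReal hp

lemma lpn_add_le {p : ℝ} (hp : 1 ≤ p) {F H : Ω → ℝ} (hF : MemLp F (ENNReal.ofReal p) ν)
    (hH : MemLp H (ENNReal.ofReal p) ν) :
    lpn p ν (fun ω => F ω + H ω) ≤ lpn p ν F + lpn p ν H := by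
  rw [lpn, lpn, lpn, ← ENNReal.toReal_add hF.2.ne hH.2.ne]
  exact ENNReal.toReal_mono (ENNReal.add_ne_top.2 ⟨hF.2.ne, hH.2.ne⟩)
    (eLpNorm_add_le hF.1 hH.1 (one_le_ofReal hp))

lemma lpn_sub_comm {p : ℝ} (F H : Ω → ℝ) :
    lpn p ν (fun ω => F ω - H ω) = lpn p ν (fun ω => H ω - F ω) := by
  rw [lpn, lpn]
  congr 1
  exact eLpNorm_sub_comm F H _ _

lemma abs_lpn_sub_le {p : ℝ} (hp : 1 ≤ p) {F H : Ω → ℝ} (hF : MemLp F (ENNReal.ofReal p) ν)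
    (hH : MemLp H (ENNReal.ofReal p) ν) :
    |lpn p ν F - lpn p ν H| ≤ lpn p ν (fun ω => F ω - H ω) := by
  have h1 := lpn_add_le hp (hF.sub hH) hH
  have h2 := lpn_add_le hp (hH.sub hF) hF
  have e : lpn p ν (H - F) = lpn p ν (F - H) := lpn_sub_comm H F
  simp only [Pi.sub_apply, sub_add_cancel] at h1 h2
  change _ ≤ lpn p ν (F - H)
  rw [abs_le]
  change lpn p ν F ≤ _ at h1
  change lpn p ν H ≤ _ at h2
  constructor <;> linarith

lemma lpn_mono {p : ℝ} {F H : Ω → ℝ} (hH : MemLp H (ENNReal.ofReal p) ν)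
    (h : ∀ᵐ ω ∂ν, |F ω| ≤ |H ω|) : lpn p ν F ≤ lpn p ν H :=
  ENNReal.toReal_mono hH.2.ne (eLpNorm_mono_ae h)

lemma lpn_congr {p : ℝ} {F H : Ω → ℝ} (h : F =ᵐ[ν] H) : lpn p ν F = lpn p ν H := by
  rw [lpn, lpn, eLpNorm_congr_ae h]

lemma lpn_const_mul {p : ℝ} (a : ℝ) (F : Ω → ℝ) :
    lpn p ν (fun ω => a * F ω) = |a| * lpn p ν F := by
  have : (fun ω => a * F ω) = a • F := rfl
  rw [lpn, this, eLpNorm_const_smul, ENNReal.toReal_mul]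
  simp [lpn]

lemma lpn_abs {p : ℝ} (F : Ω → ℝ) : lpn p ν (fun ω => |F ω|) = lpn p ν F := by
  rw [lpn, lpn, ← eLpNorm_norm F]; rfl

lemma lpn_const [IsFiniteMeasure ν] {p : ℝ} (hp : 0 < p) {a : ℝ} (ha : 0 ≤ a) :
    lpn p ν (fun _ => a) = a * ν.real Set.univ ^ (1 / p) := by
  rw [lpn_eq hp (memLp_const a)]
  simp only [integral_const, smul_eq_mul, abs_of_nonneg ha]
  rw [Real.mul_rpow (by positivity) (by positivity), ← Real.rpow_mul ha, mul_one_div_cancel hp.ne']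
  simp [mul_comm]

lemma lpn_le_of_integral_le {p : ℝ} (hp : 0 < p) {F : Ω → ℝ} (hF : MemLp F (ENNReal.ofReal p) ν)
    {c : ℝ} (hc : 0 ≤ c) (h : ∫ ω, |F ω| ^ p ∂ν ≤ c ^ p) : lpn p ν F ≤ c := by
  rw [← lpn_rpow hp hF] at h
  exact (Real.rpow_le_rpow_iff lpn_nonneg hc hp).1 h

lemma abs_rpow_inv_sub_le {p : ℝ} (hp : 1 ≤ p) {u v : ℝ} (hu : 0 ≤ u) (hv : 0 ≤ v) :
    |u ^ (1 / p) - v ^ (1 / p)| ≤ |u - v| ^ (1 / p) := by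
  have key : ∀ {x y : ℝ}, 0 ≤ y → y ≤ x → x ^ (1 / p) - y ^ (1 / p) ≤ |x - y| ^ (1 / p) := by
    intro x y hy hxy
    have := Real.rpow_add_le_add_rpow (sub_nonneg.2 hxy) hy (by positivity : 0 ≤ 1 / p)
      ((div_le_one (by linarith)).2 hp)
    rw [abs_of_nonneg (sub_nonneg.2 hxy)]
    simp only [sub_add_cancel] at this
    linarith
  rcases le_total v u with h | h
  · rw [abs_of_nonneg (sub_nonneg.2 (Real.rpow_le_rpow hv h (by positivity)))]
    exact key hv h
  · rw [abs_sub_comm, abs_of_nonneg (sub_nonneg.2 (Real.rpow_le_rpow hu h (by positivity))),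
      abs_sub_comm]
    exact key hu h

lemma gaussNorm_eq_lpn {p : ℝ} (hp : 0 < p) : gaussNorm p = lpn p (gaussianReal 0 1)
    (fun x => x) := by
  rw [lpn_eq hp (memLp_of_integrable_abs_rpow (f := fun x : ℝ => x) hp aestronglyMeasurable_id
    (integrable_abs_rpow_gaussian hp.le)), gaussNorm]

lemma gaussNorm_nonneg (p : ℝ) : 0 ≤ gaussNorm p := by unfold gaussNorm; positivity

end lpn

section lind
variable {Ω : Type*} [MeasurableSpace Ω] {ν : Measure Ω} [IsFiniteMeasure ν]

/-- The mean of `smoothPow` is comparable with the `L_p` norm. -/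
lemma smoothPow_lpn {p δ : ℝ} (hp : 1 ≤ p) (hδ : 0 ≤ δ) {F : Ω → ℝ}
    (hF : MemLp F (ENNReal.ofReal p) ν) :
    |(∫ ω, smoothPow p δ (F ω) ∂ν) ^ (1 / p) - lpn p ν F| ≤ δ * ν.real Set.univ ^ (1 / p) := by
  have hp0 : 0 < p := by linarith
  have hFa : MemLp (fun ω => |F ω|) (ENNReal.ofReal p) ν := hF.norm
  have hFi : Integrable (fun ω => |F ω| ^ p) ν := by
    have := hF.integrable_norm_rpow (by simpa using hp0) (by simp)
    simpa [ENNReal.toReal_ofReal hp0.le] using this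
  have hGm : MemLp (fun ω => δ + |F ω|) (ENNReal.ofReal p) ν := (memLp_const δ).add hFa
  have hGi : Integrable (fun ω => (δ + |F ω|) ^ p) ν := by
    have := hGm.integrable_norm_rpow (by simpa using hp0) (by simp)
    refine this.congr (Filter.Eventually.of_forall fun ω => ?_)
    simp only [ENNReal.toReal_ofReal hp0.le, Real.norm_eq_abs]
    rw [abs_of_nonneg (by positivity)]
  have hnn : ∀ t, 0 ≤ smoothPow p δ t := fun t => (by positivity : 0 ≤ |t| ^ p).trans
    (abs_rpow_le_smoothPow hp0.le t)
  have hcs : Continuous (smoothPow p δ) := by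
    unfold smoothPow
    exact Continuous.rpow_const (by fun_prop) fun _ => Or.inr (by positivity)
  have hSi : Integrable (fun ω => smoothPow p δ (F ω)) ν :=
    hGi.mono' (hcs.comp_aestronglyMeasurable hF.1) (Filter.Eventually.of_forall fun ω => by
      rw [Real.norm_eq_abs, abs_of_nonneg (hnn _)]
      exact smoothPow_le hp0.le hδ _)
  have l1 : lpn p ν F ≤ (∫ ω, smoothPow p δ (F ω) ∂ν) ^ (1 / p) := by
    rw [lpn_eq hp0 hF]
    refine Real.rpow_le_rpow (by positivity) ?_ (by positivity)
    exact integral_mono hFi hSi fun ω => abs_rpow_le_smoothPow hp0.le _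
  have l2 : (∫ ω, smoothPow p δ (F ω) ∂ν) ^ (1 / p) ≤
      δ * ν.real Set.univ ^ (1 / p) + lpn p ν F := by
    calc _ ≤ (∫ ω, |(δ + |F ω|)| ^ p ∂ν) ^ (1 / p) := by
          refine Real.rpow_le_rpow (integral_nonneg fun ω => hnn _) ?_ (by positivity)
          have e : ∀ ω, |(δ + |F ω|)| = δ + |F ω| := fun ω => abs_of_nonneg (by positivity)
          simp only [e]
          exact integral_mono hSi hGi fun ω => smoothPow_le hp0.le hδ _
      _ = lpn p ν (fun ω => δ + |F ω|) := (lpn_eq hp0 hGm).symm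
      _ ≤ lpn p ν (fun _ => δ) + lpn p ν (fun ω => |F ω|) := lpn_add_le hp (memLp_const δ) hFa
      _ = _ := by rw [lpn_const hp0 hδ, lpn_abs]
  rw [abs_of_nonneg (by linarith)]
  linarith

lemma gP_smoothPow {p δ : ℝ} (hp : 1 ≤ p) (hδ : 0 ≤ δ) (c : ℝ) :
    (gaussNorm p * |c|) ^ p ≤ gP (smoothPow p δ) 0 c ∧
      gP (smoothPow p δ) 0 c ≤ (δ + gaussNorm p * |c|) ^ p := by
  have hp0 : 0 < p := by linarith
  have hid : MemLp (fun x : ℝ => x) (ENNReal.ofReal p) (gaussianReal 0 1) :=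
    memLp_of_integrable_abs_rpow hp0 aestronglyMeasurable_id (integrable_abs_rpow_gaussian hp0.le)
  have hm : MemLp (fun x : ℝ => c * x) (ENNReal.ofReal p) (gaussianReal 0 1) := hid.const_mul c
  have hnn : ∀ t, 0 ≤ smoothPow p δ t := fun t => (by positivity : 0 ≤ |t| ^ p).trans
    (abs_rpow_le_smoothPow hp0.le t)
  have e : gP (smoothPow p δ) 0 c = ∫ g, smoothPow p δ (c * g) ∂(gaussianReal 0 1) := by simp [gP]
  have hI : 0 ≤ ∫ g, smoothPow p δ (c * g) ∂(gaussianReal 0 1) := integral_nonneg fun g => hnn _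
  have el : lpn p (gaussianReal 0 1) (fun x => c * x) = gaussNorm p * |c| := by
    rw [lpn_const_mul, gaussNorm_eq_lpn hp0, mul_comm]
  have h := smoothPow_lpn (ν := gaussianReal 0 1) hp hδ hm
  rw [el] at h
  have e2 : gP (smoothPow p δ) 0 c =
      ((∫ g, smoothPow p δ (c * g) ∂(gaussianReal 0 1)) ^ (1 / p)) ^ p := by
    rw [e, ← Real.rpow_mul hI]; simp [hp0.ne']
  rw [e2]
  have hγ := gaussNorm_nonneg p
  constructor
  · refine Real.rpow_le_rpow (by positivity) ?_ hp0.le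
    rw [← el, lpn_eq hp0 hm]
    refine Real.rpow_le_rpow (by positivity) ?_ (by positivity)
    refine integral_mono_of_nonneg (Filter.Eventually.of_forall fun _ => by positivity) ?_
      (Filter.Eventually.of_forall fun g => abs_rpow_le_smoothPow hp0.le _)
    have hcs : Continuous (smoothPow p δ) := by
      unfold smoothPow
      exact Continuous.rpow_const (by fun_prop) fun _ => Or.inr (by positivity)
    have hG : MemLp (fun g => δ + |c * g|) (ENNReal.ofReal p) (gaussianReal 0 1) :=
      (memLp_const δ).add hm.norm
    refine (hG.integrable_norm_rpow (by simpa using hp0) (by simp)).mono'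
      (hcs.comp (continuous_const.mul continuous_id)).aestronglyMeasurable
      (Filter.Eventually.of_forall fun g => ?_)
    simp only [ENNReal.toReal_ofReal hp0.le, Real.norm_eq_abs, abs_of_nonneg (hnn _)]
    rw [abs_of_nonneg (by positivity)]
    exact smoothPow_le hp0.le hδ _
  · refine Real.rpow_le_rpow (by positivity) ?_ hp0.le
    have := (abs_le.1 h).2
    simp only [probReal_univ, Real.one_rpow, mul_one] at this
    linarith

lemma integral_gP_smoothPow {p δ : ℝ} (hp : 1 ≤ p) (hδ : 0 ≤ δ) (c : SimpleFunc Ω ℝ) {σ : ℝ}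
    (hσ : 0 ≤ σ) :
    0 ≤ ∫ ω, gP (smoothPow p δ) 0 (σ * c ω) ∂ν ∧
    |(∫ ω, gP (smoothPow p δ) 0 (σ * c ω) ∂ν) ^ (1 / p) - gaussNorm p * σ * lpn p ν c| ≤
      δ * ν.real Set.univ ^ (1 / p) := by
  have hp0 : 0 < p := by linarith
  have hγ := gaussNorm_nonneg p
  have hb := fun ω => gP_smoothPow hp hδ (σ * c ω)
  have hnn : 0 ≤ ∫ ω, gP (smoothPow p δ) 0 (σ * c ω) ∂ν :=
    integral_nonneg fun ω => (by positivity : 0 ≤ (gaussNorm p * |σ * c ω|) ^ p).trans (hb ω).1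
  refine ⟨hnn, ?_⟩
  have Ig : Integrable (fun ω => gP (smoothPow p δ) 0 (σ * c ω)) ν :=
    integrable_comp_simple c fun v => gP (smoothPow p δ) 0 (σ * v)
  have hm : MemLp (fun ω => gaussNorm p * σ * c ω) (ENNReal.ofReal p) ν :=
    (c.map fun v => gaussNorm p * σ * v).memLp_of_isFiniteMeasure _ _
  have hma : MemLp (fun ω => |gaussNorm p * σ * c ω|) (ENNReal.ofReal p) ν := hm.norm
  have hm2 : MemLp (fun ω => δ + |gaussNorm p * σ * c ω|) (ENNReal.ofReal p) ν :=
    (memLp_const δ).add hma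
  have ea : ∀ ω, |gaussNorm p * σ * c ω| = gaussNorm p * |σ * c ω| := fun ω => by
    rw [mul_assoc, abs_mul, abs_of_nonneg hγ]
  have el : lpn p ν (fun ω => gaussNorm p * σ * c ω) = gaussNorm p * σ * lpn p ν c := by
    rw [lpn_const_mul, abs_of_nonneg (by positivity)]
  have l1 : gaussNorm p * σ * lpn p ν c ≤
      (∫ ω, gP (smoothPow p δ) 0 (σ * c ω) ∂ν) ^ (1 / p) := by
    rw [← el, lpn_eq hp0 hm]
    refine Real.rpow_le_rpow (by positivity) ?_ (by positivity)
    refine integral_mono (integrable_comp_simple c fun v => |gaussNorm p * σ *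
      v| ^ p) Ig fun ω => ?_
    have := (hb ω).1
    simp only [ea]
    exact this
  have l2 : (∫ ω, gP (smoothPow p δ) 0 (σ * c ω) ∂ν) ^ (1 / p) ≤
      δ * ν.real Set.univ ^ (1 / p) + gaussNorm p * σ * lpn p ν c := by
    calc _ ≤ (∫ ω, |(δ + |gaussNorm p * σ * c ω|)| ^ p ∂ν) ^ (1 / p) := by
          refine Real.rpow_le_rpow hnn ?_ (by positivity)
          refine integral_mono Ig
            (integrable_comp_simple c fun v => |(δ + |gaussNorm p * σ * v|)| ^ p) fun ω => ?_
          have := (hb ω).2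
          simp only [ea]
          rwa [abs_of_nonneg (by positivity)]
      _ = lpn p ν (fun ω => δ + |gaussNorm p * σ * c ω|) := (lpn_eq hp0 hm2).symm
      _ ≤ lpn p ν (fun _ => δ) + lpn p ν (fun ω => |gaussNorm p * σ * c ω|) :=
          lpn_add_le hp (memLp_const δ) hma
      _ = _ := by rw [lpn_const hp0 hδ, lpn_abs, el]
  rw [abs_of_nonneg (by linarith)]
  linarith

lemma exists_lpn_le_lpn (ν : Measure Ω) [IsFiniteMeasure ν] {p r : ℝ} (hp : 0 < p) (hpr : p ≤ r) :
    ∃ K : ℝ, 0 ≤ K ∧ ∀ F : Ω → ℝ, MemLp F (ENNReal.ofReal r) ν → lpn p ν F ≤ K * lpn r ν F := by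
  refine ⟨(ν Set.univ ^ (1 / (ENNReal.ofReal p).toReal - 1 / (ENNReal.ofReal r).toReal)).toReal,
    ENNReal.toReal_nonneg, fun F hF => ?_⟩
  rw [lpn, lpn, ← ENNReal.toReal_mul, mul_comm]
  refine ENNReal.toReal_mono (ENNReal.mul_ne_top hF.2.ne (ENNReal.rpow_ne_top_of_nonneg ?_
    (measure_ne_top _ _)))
    (eLpNorm_le_eLpNorm_mul_rpow_measure_univ (ENNReal.ofReal_le_ofReal hpr) hF.1)
  rw [ENNReal.toReal_ofReal hp.le, ENNReal.toReal_ofReal (hp.le.trans hpr)]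
  exact sub_nonneg.2 (one_div_le_one_div_of_le hp hpr)

/-- The condition on large values needed in `lindeberg`. -/
lemma trunc_of_equi {r : ℝ} (hr : 2 ≤ r) {X : ℕ → SimpleFunc Ω ℝ} {Cx : ℝ}
    (hX : ∀ n, ∫ ω, |X n ω| ^ r ∂ν ≤ Cx)
    (hE : ∀ ρ > 0, ∃ L : ℝ, ∀ᶠ n in hypU, ∫ ω, (if L < |X n ω| then X n ω ^ 2 else 0) ∂ν ≤ ρ) :
    ∀ κ > 0, ∀ ρ > 0, ∃ β > 0, ∀ᶠ n in hypU, ∀ b : ℝ, |b| ≤ β →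
      ∫ ω, (if κ < |b * X n ω| then |b * X n ω| ^ r else 0) ∂ν ≤ ρ * b ^ 2 := by
  intro κ hκ ρ hρ
  have hCx : 0 ≤ Cx := (integral_nonneg fun ω => by positivity).trans (hX 0)
  rcases hr.eq_or_lt with rfl | hr2
  · obtain ⟨L, hL⟩ := hE ρ hρ
    refine ⟨κ / (|L| + 1), by positivity, hL.mono fun n hn b hb => ?_⟩
    rw [mul_comm ρ]
    refine le_trans ?_ (mul_le_mul_of_nonneg_left hn (sq_nonneg b))
    rw [← integral_const_mul]
    refine integral_mono (integrable_comp_simple (X n) fun v =>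
      if κ < |b * v| then |b * v| ^ (2 : ℝ) else 0) (integrable_comp_simple (X n) fun v =>
      b ^ 2 * (if L < |v| then v ^ 2 else 0)) fun ω => ?_
    by_cases h : κ < |b * X n ω|
    · have h2 : L < |X n ω| := by
        rw [abs_mul] at h
        have h3 := mul_le_mul_of_nonneg_right hb (abs_nonneg (X n ω))
        have h4 : κ < κ / (|L| + 1) * |X n ω| := h.trans_le h3
        rw [div_mul_eq_mul_div, lt_div_iff₀ (by positivity)] at h4
        have := lt_of_mul_lt_mul_left h4 hκ.le
        linarith [le_abs_self L]
      simp only [h, h2, if_true, Real.rpow_two, sq_abs]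
      rw [mul_pow]
    · simp only [h, if_false]
      split_ifs <;> positivity
  · refine ⟨(ρ / (Cx + 1)) ^ (1 / (r - 2)), by positivity, Filter.Eventually.of_forall
      fun n b hb => ?_⟩
    have h1 : ∫ ω, (if κ < |b * X n ω| then |b * X n ω| ^ r else 0) ∂ν ≤
        |b| ^ r * ∫ ω, |X n ω| ^ r ∂ν := by
      rw [← integral_const_mul]
      refine integral_mono (integrable_comp_simple (X n) fun v =>
        if κ < |b * v| then |b * v| ^ r else 0) (integrable_comp_simple (X n) fun v =>
        |b| ^ r * |v| ^ r) fun ω => ?_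
      simp only [← Real.mul_rpow (abs_nonneg b) (abs_nonneg (X n ω)), ← abs_mul]
      split_ifs
      · exact le_rfl
      · positivity
    have h2 : |b| ^ r = |b| ^ (r - 2) * b ^ 2 := by
      rw [← sq_abs, ← Real.rpow_two, ← Real.rpow_add_of_nonneg (abs_nonneg _) (by linarith)
        (by norm_num)]
      congr 1; ring
    have h3 : |b| ^ (r - 2) ≤ ρ / (Cx + 1) := by
      calc _ ≤ ((ρ / (Cx + 1)) ^ (1 / (r - 2))) ^ (r - 2) :=
            Real.rpow_le_rpow (abs_nonneg _) hb (by linarith)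
        _ = _ := by
          rw [← Real.rpow_mul (by positivity), one_div_mul_cancel (by linarith), Real.rpow_one]
    calc _ ≤ |b| ^ r * Cx := h1.trans (mul_le_mul_of_nonneg_left (hX n) (by positivity))
      _ = |b| ^ (r - 2) * Cx * b ^ 2 := by rw [h2]; ring
      _ ≤ ρ * b ^ 2 := by
        refine mul_le_mul_of_nonneg_right ?_ (sq_nonneg _)
        refine (mul_le_mul_of_nonneg_right h3 hCx).trans ?_
        rw [div_mul_eq_mul_div, div_le_iff₀ (by positivity)]
        nlinarith

lemma coercive_smoothPow {p δ : ℝ} (hp : 1 ≤ p) :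
    ∃ C : ℝ, 0 ≤ C ∧ ∀ t, (max p 2 - 2) * |t| ^ max p 2 ≤ C * (1 + smoothPow p δ t) := by
  refine ⟨max p 2 - 2, by simp, fun t => ?_⟩
  have h0 := abs_rpow_le_smoothPow (δ := δ) (by linarith : 0 ≤ p) t
  have h1 : (0 : ℝ) ≤ |t| ^ p := by positivity
  rcases le_total p 2 with h | h
  · simp [h]
  · rw [max_eq_left h]
    exact mul_le_mul_of_nonneg_left (by linarith) (by linarith)

/-- Lindeberg's theorem for `L_p` norms: combinations with small coefficients of a sequence that
is chosen inductively behave like a Gaussian multiple of `f`. -/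
theorem lindeberg_lpn {p : ℝ} (hp : 1 ≤ p) (X : ℕ → SimpleFunc Ω ℝ) {f : Ω → ℝ}
    (hfm : Measurable f) (hf : Integrable (fun ω => |f ω| ^ max p 2) ν) {Cx : ℝ}
    (hX : ∀ n, ∫ ω, |X n ω| ^ max p 2 ∂ν ≤ Cx)
    (hX1 : ∀ B, MeasurableSet B →
      Filter.Tendsto (fun n => ∫ ω in B, X n ω ∂ν) hypU (nhds 0))
    (hX2 : ∀ B, MeasurableSet B →
      Filter.Tendsto (fun n => ∫ ω in B, X n ω ^ 2 ∂ν) hypU (nhds (∫ ω in B, f ω ^ 2 ∂ν)))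
    (hE : ∀ ρ > 0, ∃ L : ℝ, ∀ᶠ n in hypU, ∫ ω, (if L < |X n ω| then X n ω ^ 2 else 0) ∂ν ≤ ρ)
    {δ : ℝ} (hδ : 0 < δ) :
    ∃ β > 0, Gen fun n =>
      ∀ (I : ℕ) (b : ℕ → ℝ), ∑ i ∈ Finset.range I, b i ^ 2 ≤ 1 → (∀ i < I, |b i| ≤ β) →
        |lpn p ν (fun ω => ∑ i ∈ Finset.range I, b i * X (n i) ω) -
          gaussNorm p * √(∑ i ∈ Finset.range I, b i ^ 2) * lpn p ν f| ≤ δ := by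
  have hp0 : 0 < p := by linarith
  set r := max p 2 with hr
  have hr2 : 2 ≤ r := le_max_right _ _
  have hr0 : 0 < r := by linarith
  have hpr : p ≤ r := le_max_left _ _
  have hγ := gaussNorm_nonneg p
  set V := ν.real Set.univ ^ (1 / p) with hV
  have hV0 : 0 ≤ V := by positivity
  obtain ⟨K, hK, hKl⟩ := exists_lpn_le_lpn ν hp0 hpr
  set δ0 := min 1 (δ / 4 / (V + 1)) with hδ0
  have hδ00 : 0 < δ0 := by positivity
  have hδ0V : δ0 * V ≤ δ / 4 := by
    refine (mul_le_mul_of_nonneg_right (min_le_right _ _) hV0).trans ?_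
    rw [div_mul_eq_mul_div, div_le_iff₀ (by positivity)]
    nlinarith
  set δ1 := δ / 4 / (gaussNorm p * K + 1) with hδ1
  have hδ10 : 0 < δ1 := by positivity
  have hδ1K : gaussNorm p * K * δ1 ≤ δ / 4 := by
    rw [hδ1, mul_div_assoc', div_le_iff₀ (by positivity)]
    nlinarith [mul_nonneg hγ hK]
  obtain ⟨ψ1, ψ2, hψ⟩ := taylorBound_smoothPow hpr hr2 hδ00 (min_le_left _ _)
  obtain ⟨c, hc, β, hβ, hg⟩ := lindeberg hr2 hψ (coercive_smoothPow hp) X hfm hf hX hX1 hX2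
    (trunc_of_equi hr2 hX hE) (δ := min ((δ / 4) ^ p) (δ1 ^ r)) (by positivity)
  refine ⟨β, hβ, hg.mono fun n hn I b hb hbβ => ?_⟩
  have h1 := (hn I b hb hbβ).trans (min_le_left _ _)
  set σ := √(∑ i ∈ Finset.range I, b i ^ 2) with hσ
  have hσ0 : 0 ≤ σ := Real.sqrt_nonneg _
  have hσ1 : σ ≤ 1 := Real.sqrt_le_one.2 hb
  have hfr := memLp_of_integrable_abs_rpow hr0 hfm.aestronglyMeasurable hf
  have hcr : MemLp c (ENNReal.ofReal r) ν := c.memLp_of_isFiniteMeasure _ _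
  have h2 : |lpn p ν f - lpn p ν c| ≤ K * δ1 := by
    refine (abs_lpn_sub_le hp (hfr.mono_exponent (ENNReal.ofReal_le_ofReal hpr))
      (c.memLp_of_isFiniteMeasure _ _)).trans ((hKl _ (hfr.sub hcr)).trans ?_)
    exact mul_le_mul_of_nonneg_left (lpn_le_of_integral_le hr0 (hfr.sub hcr) hδ10.le
      (hc.trans (min_le_right _ _))) hK
  have hSm : MemLp (fun ω => ∑ i ∈ Finset.range I, b i * X (n i) ω) (ENNReal.ofReal p) ν := by
    have := (simpleSum (fun i => X (n i)) b I).memLp_of_isFiniteMeasure (ENNReal.ofReal p) ν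
    refine this.congr_norm (Finset.aestronglyMeasurable_fun_sum _ fun i _ =>
      ((X (n i)).measurable.const_mul _).aestronglyMeasurable)
      (Filter.Eventually.of_forall fun ω => by rw [simpleSum_apply])
  have h3 := smoothPow_lpn hp hδ00.le hSm
  obtain ⟨h40, h4⟩ := integral_gP_smoothPow (ν := ν) hp hδ00.le c hσ0
  have hu : 0 ≤ ∫ ω, smoothPow p δ0 (∑ i ∈ Finset.range I, b i * X (n i) ω) ∂ν :=
    integral_nonneg fun ω =>
      (Real.rpow_nonneg (abs_nonneg _) p).trans (abs_rpow_le_smoothPow hp0.le _)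
  have h5 := (abs_rpow_inv_sub_le hp hu h40).trans
    (Real.rpow_le_rpow (abs_nonneg _) h1 (by positivity : 0 ≤ 1 / p))
  rw [← Real.rpow_mul (by positivity), mul_one_div_cancel hp0.ne', Real.rpow_one] at h5
  have h6 : |gaussNorm p * σ * lpn p ν c - gaussNorm p * σ * lpn p ν f| ≤ δ / 4 := by
    rw [← mul_sub, abs_mul, abs_of_nonneg (by positivity), abs_sub_comm]
    calc _ ≤ gaussNorm p * 1 * (K * δ1) := by
          refine mul_le_mul ?_ h2 (abs_nonneg _) (by positivity)
          exact mul_le_mul_of_nonneg_left hσ1 hγ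
      _ ≤ δ / 4 := by linarith
  rw [abs_le] at *
  constructor <;> linarith [h3.1, h3.2, h4.1, h4.2, h5.1, h5.2, h6.1, h6.2]

end lind

section weaklim
variable {Ω : Type*} [MeasurableSpace Ω] {ν : Measure Ω} [IsFiniteMeasure ν]

lemma exists_tendsto_hypU {E : Type*} [TopologicalSpace E] [CompactSpace E] (u : ℕ → E) :
    ∃ l, Filter.Tendsto u hypU (nhds l) := by
  obtain ⟨l, -, hl⟩ := isCompact_univ.ultrafilter_le_nhds ((Filter.hyperfilter ℕ).map u) (by simp)
  exact ⟨l, hl⟩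

lemma exists_tendsto_hypU_of_bdd {u : ℕ → ℝ} {C : ℝ} (h : ∀ᶠ n in hypU, |u n| ≤ C) :
    ∃ l, Filter.Tendsto u hypU (nhds l) := by
  obtain ⟨l, -, hl⟩ := (isCompact_Icc (a := -C) (b := C)).ultrafilter_le_nhds
    ((Filter.hyperfilter ℕ).map u) (by
      rw [Filter.le_principal_iff]
      exact h.mono fun n hn => abs_le.1 hn)
  exact ⟨l, hl⟩

lemma setLIntegral_le_of_trunc (Z : Ω → ℝ≥0∞) (hZ : Measurable Z) (L : ℝ≥0∞) (B : Set Ω) :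
    ∫⁻ ω in B, Z ω ∂ν ≤ L * ν B + ∫⁻ ω, (if L < Z ω then Z ω else 0) ∂ν := by
  calc ∫⁻ ω in B, Z ω ∂ν ≤ ∫⁻ ω in B, (L + if L < Z ω then Z ω else 0) ∂ν := by
        refine lintegral_mono fun ω => ?_
        dsimp only
        split_ifs with h
        · exact le_add_self
        · exact (not_lt.1 h).trans le_self_add
    _ = L * ν B + ∫⁻ ω in B, (if L < Z ω then Z ω else 0) ∂ν := by
        rw [lintegral_add_left measurable_const]; simp
    _ ≤ _ := by gcongr; exact Measure.restrict_le_self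

/-- Equi-integrable densities converge setwise along an ultrafilter. -/
lemma exists_setwise_limit (Z : ℕ → Ω → ℝ≥0∞) (hZ : ∀ n, Measurable (Z n))
    (hE : ∀ ρ : ℝ≥0∞, ρ ≠ 0 → ∃ L : ℝ≥0∞, L ≠ ∞ ∧
      ∀ᶠ n in hypU, ∫⁻ ω, (if L < Z n ω then Z n ω else 0) ∂ν ≤ ρ) :
    ∃ g : Ω → ℝ≥0∞, Measurable g ∧ ∫⁻ ω, g ω ∂ν ≠ ∞ ∧ ∀ B, MeasurableSet B →
      Filter.Tendsto (fun n => ∫⁻ ω in B, Z n ω ∂ν) hypU (nhds (∫⁻ ω in B, g ω ∂ν)) := by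
  choose m hm using fun B : Set Ω => exists_tendsto_hypU fun n => ∫⁻ ω in B, Z n ω ∂ν
  have hm0 : m ∅ = 0 := tendsto_nhds_unique (hm ∅) (by simp)
  have hmle : ∀ ρ : ℝ≥0∞, ρ ≠ 0 → ∃ L : ℝ≥0∞, L ≠ ∞ ∧ ∀ B, m B ≤ L * ν B + ρ := fun ρ hρ => by
    obtain ⟨L, hL, h⟩ := hE ρ hρ
    exact ⟨L, hL, fun B => le_of_tendsto (hm B) (h.mono fun n hn =>
      (setLIntegral_le_of_trunc (Z n) (hZ n) L B).trans (by gcongr))⟩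
  have hadd : ∀ A B, MeasurableSet B → Disjoint A B → m (A ∪ B) = m A + m B := fun A B hB h =>
    tendsto_nhds_unique (hm _) (((hm A).add (hm B)).congr fun n => (lintegral_union hB h).symm)
  have hmono : ∀ A B, A ⊆ B → m A ≤ m B := fun A B h =>
    le_of_tendsto_of_tendsto' (hm A) (hm B) fun n => lintegral_mono_set h
  have hsum : ∀ (A : ℕ → Set Ω), (∀ i, MeasurableSet (A i)) → Pairwise (Function.onFun Disjoint A) →
      ∀ k, m (⋃ i < k, A i) = ∑ i ∈ Finset.range k, m (A i) := by
    intro A hA hd k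
    induction k with
    | zero => simp [hm0]
    | succ k ih =>
      rw [Finset.sum_range_succ, ← ih, Set.biUnion_lt_succ, hadd _ _ (hA k)]
      rw [Set.disjoint_iUnion₂_left]
      exact fun i hi => hd hi.ne
  have hσ : ∀ (A : ℕ → Set Ω), (∀ i, MeasurableSet (A i)) → Pairwise (Function.onFun Disjoint A) →
      m (⋃ i, A i) = ∑' i, m (A i) := by
    intro A hA hd
    refine le_antisymm ?_ ?_
    · refine ENNReal.le_of_forall_pos_le_add fun ρ hρ _ => ?_
      obtain ⟨L, hL, hmL⟩ := hmle ρ (by simpa using hρ.ne')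
      have ht : Filter.Tendsto (fun k => ν ((⋃ i, A i) \ ⋃ i < k, A i)) Filter.atTop (nhds 0) := by
        have h0 : (⋂ k, (⋃ i, A i) \ ⋃ i < k, A i) = ∅ := by
          ext x
          simp only [Set.mem_iInter, Set.mem_sdiff, Set.mem_iUnion, Set.mem_empty_iff_false,
            iff_false, not_forall]
          by_cases h : ∃ i, x ∈ A i
          · obtain ⟨i, hi⟩ := h
            exact ⟨i + 1, fun hx => hx.2 ⟨i, Nat.lt_succ_self i, hi⟩⟩
          · exact ⟨0, fun hx => h hx.1⟩
        rw [← measure_empty (μ := ν), ← h0]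
        refine tendsto_measure_iInter_atTop (fun k => ?_) (fun i j hij => ?_)
          ⟨0, measure_ne_top _ _⟩
        · exact ((MeasurableSet.iUnion hA).diff
            (MeasurableSet.iUnion fun i => MeasurableSet.iUnion fun _ => hA i)).nullMeasurableSet
        · refine Set.sdiff_subset_sdiff_right ?_
          exact Set.biUnion_mono (fun x hx => lt_of_lt_of_le hx hij) fun _ _ => le_rfl
      have ht2 := (ENNReal.Tendsto.const_mul ht (Or.inr hL)).const_add (∑' i, m (A i) + ρ)
      rw [mul_zero, add_zero] at ht2
      refine ge_of_tendsto' ht2 fun k => ?_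
      have hk : (⋃ i, A i) = (⋃ i < k, A i) ∪ ((⋃ i, A i) \ ⋃ i < k, A i) := by
        rw [Set.union_sdiff_cancel]
        exact Set.iUnion₂_subset fun i _ => Set.subset_iUnion A i
      calc m (⋃ i, A i) = m (⋃ i < k, A i) + m ((⋃ i, A i) \ ⋃ i < k, A i) := by
            conv_lhs => rw [hk]
            exact hadd _ _ ((MeasurableSet.iUnion hA).diff
              (MeasurableSet.iUnion fun i => MeasurableSet.iUnion fun _ => hA i))
              Set.disjoint_sdiff_right
        _ ≤ ∑' i, m (A i) + (L * ν ((⋃ i, A i) \ ⋃ i < k, A i) + ρ) := by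
            gcongr
            · rw [hsum A hA hd]; exact ENNReal.sum_le_tsum _
            · exact hmL _
        _ = _ := by ring
    · rw [ENNReal.tsum_eq_iSup_nat]
      refine iSup_le fun k => ?_
      rw [← hsum A hA hd]
      exact hmono _ _ (Set.iUnion₂_subset fun i _ => Set.subset_iUnion A i)
  set M : Measure Ω := Measure.ofMeasurable (fun B _ => m B) hm0 (fun A hA hd => hσ A hA hd) with hM
  have hMB : ∀ B, MeasurableSet B → M B = m B := fun B hB => Measure.ofMeasurable_apply B hB
  have hac : M ≪ ν := by
    refine Measure.AbsolutelyContinuous.mk fun B hB hν => ?_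
    rw [hMB B hB]
    refine le_antisymm (ENNReal.le_of_forall_pos_le_add fun ρ hρ _ => ?_) zero_le
    obtain ⟨L, hL, hmL⟩ := hmle ρ (by simpa using hρ.ne')
    simpa [hν] using hmL B
  have hfin : IsFiniteMeasure M := by
    refine ⟨?_⟩
    obtain ⟨L, hL, hmL⟩ := hmle 1 one_ne_zero
    rw [hMB _ MeasurableSet.univ]
    exact (hmL _).trans_lt (ENNReal.add_lt_top.2
      ⟨ENNReal.mul_lt_top hL.lt_top (measure_lt_top _ _), ENNReal.one_lt_top⟩)
  have hwd : ν.withDensity (M.rnDeriv ν) = M := Measure.withDensity_rnDeriv_eq _ _ hac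
  have hB : ∀ B, MeasurableSet B → ∫⁻ ω in B, M.rnDeriv ν ω ∂ν = m B := fun B hB => by
    rw [← withDensity_apply _ hB, hwd, hMB B hB]
  refine ⟨M.rnDeriv ν, Measure.measurable_rnDeriv _ _,
    (Measure.lintegral_rnDeriv_lt_top _ _).ne, fun B hBm => ?_⟩
  rw [hB B hBm]
  exact hm B

end weaklim

section lsc
variable {Ω : Type*} [MeasurableSpace Ω] {ν : Measure Ω} [IsFiniteMeasure ν]

lemma rpow_tangent_le {s x t : ℝ} (hs : 1 ≤ s) (hx : 0 ≤ x) (ht : 0 ≤ t) :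
    t ^ s + s * (x * t ^ (s - 1) - t ^ s) ≤ x ^ s := by
  rcases ht.eq_or_lt with rfl | ht
  · rcases hs.eq_or_lt with rfl | hs'
    · simp
    · rw [Real.zero_rpow (by linarith), Real.zero_rpow (by linarith)]
      simpa using Real.rpow_nonneg hx s
  · have h := one_add_mul_self_le_rpow_one_add (s := x / t - 1) (p := s)
      (by have : 0 ≤ x / t := by positivity
          linarith) hs
    rw [add_sub_cancel, Real.div_rpow hx ht.le, le_div_iff₀ (by positivity)] at h
    refine le_trans (le_of_eq ?_) h
    rw [Real.rpow_sub_one ht.ne']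
    field_simp

lemma lpn_le_of_setIntegral_le {s : ℝ} (hs : 1 ≤ s) {F : Ω → ℝ} (hFm : Measurable F)
    (hF0 : ∀ ω, 0 ≤ F ω) (hFi : Integrable F ν) {G : ℕ → Ω → ℝ} (hG0 : ∀ n ω, 0 ≤ G n ω)
    (hGm : ∀ n, MemLp (G n) (ENNReal.ofReal s) ν) {K : ℝ} (hK : ∀ᶠ n in hypU, lpn s ν (G n) ≤ K)
    (h : ∀ B, MeasurableSet B → ∀ ε > 0, ∀ᶠ n in hypU, ∫ ω in B, F ω ∂ν ≤ ∫ ω in B, G n ω ∂ν + ε) :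
    MemLp F (ENNReal.ofReal s) ν ∧ lpn s ν F ≤ K := by
  have hs0 : 0 < s := by linarith
  have hK0 : 0 ≤ K := by
    obtain ⟨n, hn⟩ := hK.exists
    exact lpn_nonneg.trans hn
  have hGi : ∀ n, Integrable (G n) ν := fun n => (hGm n).integrable (one_le_ofReal hs)
  have key : ∀ c : SimpleFunc Ω ℝ, (∀ ω, 0 ≤ c ω) → (∀ ω, c ω ≤ F ω) →
      ∫ ω, c ω ^ s ∂ν ≤ K ^ s := by
    intro c hc0 hcF
    have hi1 : Integrable (fun ω => c ω ^ s) ν := integrable_comp_simple c (fun x => x ^ s)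
    have hlim : ∀ ε > 0, ∀ᶠ n in hypU,
        ∫ ω, F ω * c ω ^ (s - 1) ∂ν ≤ ∫ ω, G n ω * c ω ^ (s - 1) ∂ν + ε := by
      intro ε hε
      have hpos : ∀ x ∈ c.range, 0 ≤ x ^ (s - 1) := by
        intro x hx
        obtain ⟨ω, rfl⟩ := SimpleFunc.mem_range.1 hx
        exact Real.rpow_nonneg (hc0 ω) _
      set M := ∑ x ∈ c.range, x ^ (s - 1) with hM
      have hM0 : 0 ≤ M := Finset.sum_nonneg hpos
      have := (Finset.eventually_all c.range).2 fun x _ =>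
        h (c ⁻¹' {x}) (c.measurableSet_preimage _) (ε / (M + 1)) (by positivity)
      filter_upwards [this] with n hn
      rw [integral_mul_comp_simple c hFi (fun x => x ^ (s - 1)),
        integral_mul_comp_simple c (hGi n) (fun x => x ^ (s - 1))]
      calc _ ≤ ∑ x ∈ c.range, x ^ (s - 1) * (∫ ω in c ⁻¹' {x}, G n ω ∂ν + ε / (M + 1)) :=
            Finset.sum_le_sum fun x hx => mul_le_mul_of_nonneg_left (hn x hx) (hpos x hx)
        _ = ∑ x ∈ c.range, x ^ (s - 1) * ∫ ω in c ⁻¹' {x}, G n ω ∂ν + M * (ε / (M + 1)) := by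
            rw [hM, Finset.sum_mul, ← Finset.sum_add_distrib]
            exact Finset.sum_congr rfl fun x _ => mul_add _ _ _
        _ ≤ _ := by
            have : M * (ε / (M + 1)) ≤ ε := by
              rw [mul_div_assoc', div_le_iff₀ (by positivity)]
              nlinarith
            linarith
    refine le_of_forall_pos_le_add fun ε hε => ?_
    obtain ⟨n, hn, hnK⟩ := ((hlim (ε / s) (by positivity)).and hK).exists
    have hi2 : ∀ Z : Ω → ℝ, Integrable Z ν → Integrable (fun ω => Z ω * c ω ^ (s - 1)) ν :=
      fun Z hZ => integrable_mul_comp_simple c (fun x => x ^ (s - 1)) hZ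
    have hi3 : Integrable (fun ω => |G n ω| ^ s) ν := by
      simpa [ENNReal.toReal_ofReal hs0.le] using (hGm n).integrable_norm_rpow (by simpa using hs0)
        (by simp)
    have h1 : ∫ ω, (c ω ^ s + s * (G n ω * c ω ^ (s - 1) - c ω ^ s)) ∂ν ≤ ∫ ω, |G n ω| ^ s ∂ν := by
      refine integral_mono (hi1.add (((hi2 _ (hGi n)).sub hi1).const_mul s)) hi3 fun ω => ?_
      dsimp only
      rw [abs_of_nonneg (hG0 n ω)]
      exact rpow_tangent_le hs (hG0 n ω) (hc0 ω)
    have hi4 : Integrable (fun ω => s * (G n ω * c ω ^ (s - 1) - c ω ^ s)) ν :=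
      ((hi2 _ (hGi n)).sub hi1).const_mul s
    rw [integral_add hi1 hi4, integral_const_mul,
      integral_sub (hi2 _ (hGi n)) hi1, ← lpn_rpow hs0 (hGm n)] at h1
    have h2 : ∫ ω, c ω ^ s ∂ν ≤ ∫ ω, F ω * c ω ^ (s - 1) ∂ν := by
      refine integral_mono hi1 (hi2 _ hFi) fun ω => ?_
      dsimp only
      rcases (hc0 ω).eq_or_lt with h0 | h0
      · rw [← h0, Real.zero_rpow hs0.ne']
        exact mul_nonneg (hF0 ω) (Real.rpow_nonneg le_rfl _)
      · calc c ω ^ s = c ω * c ω ^ (s - 1) := by rw [Real.rpow_sub_one h0.ne']; field_simp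
          _ ≤ _ := mul_le_mul_of_nonneg_right (hcF ω) (Real.rpow_nonneg h0.le _)
    have h3 : lpn s ν (G n) ^ s ≤ K ^ s := Real.rpow_le_rpow lpn_nonneg hnK hs0.le
    have h4 : s * (∫ ω, F ω * c ω ^ (s - 1) ∂ν) ≤
        s * (∫ ω, G n ω * c ω ^ (s - 1) ∂ν) + ε := by
      have := mul_le_mul_of_nonneg_left hn hs0.le
      rw [mul_add, mul_div_cancel₀ _ hs0.ne'] at this
      exact this
    nlinarith [mul_le_mul_of_nonneg_left h2 hs0.le]
  have hli : ∫⁻ ω, ENNReal.ofReal (F ω ^ s) ∂ν ≤ ENNReal.ofReal (K ^ s) := by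
    rw [lintegral_eq_nnreal]
    refine iSup₂_le fun φ hφ => ?_
    set c : SimpleFunc Ω ℝ := φ.map (fun x : NNReal => (x : ℝ) ^ (1 / s)) with hc
    have hcs : ∀ ω, c ω ^ s = φ ω := fun ω => by
      simp only [hc, SimpleFunc.map_apply]
      rw [← Real.rpow_mul (by positivity), one_div_mul_cancel hs0.ne', Real.rpow_one]
    have hc0 : ∀ ω, 0 ≤ c ω := fun ω => by
      simp only [hc, SimpleFunc.map_apply]; positivity
    have hφF : ∀ ω, (φ ω : ℝ) ≤ F ω ^ s := fun ω => by
      have := hφ ω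
      rw [← ENNReal.ofReal_coe_nnreal] at this
      exact (ENNReal.ofReal_le_ofReal_iff (Real.rpow_nonneg (hF0 ω) _)).1 this
    have := key c hc0 fun ω => by
      rw [← Real.rpow_le_rpow_iff (hc0 ω) (hF0 ω) hs0, hcs]
      exact hφF ω
    refine le_trans (le_of_eq ?_) (ENNReal.ofReal_le_ofReal this)
    rw [ofReal_integral_eq_lintegral_ofReal (integrable_comp_simple c (fun x => x ^ s))
      (Filter.Eventually.of_forall fun ω => Real.rpow_nonneg (hc0 ω) _),
      ← SimpleFunc.lintegral_eq_lintegral]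
    refine lintegral_congr fun ω => ?_
    rw [hcs]; simp
  have hφg : Integrable (fun ω => |F ω| ^ s) ν := by
    refine ⟨((hFm.norm).pow_const s).aestronglyMeasurable, ?_⟩
    rw [hasFiniteIntegral_iff_ofReal (Filter.Eventually.of_forall fun ω => Real.rpow_nonneg
      (abs_nonneg _) _)]
    simp only [abs_of_nonneg (hF0 _)]
    exact hli.trans_lt ENNReal.ofReal_lt_top
  have hm := memLp_of_integrable_abs_rpow hs0 hFm.aestronglyMeasurable hφg
  refine ⟨hm, lpn_le_of_integral_le hs0 hm hK0 ?_⟩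
  rw [← ENNReal.ofReal_le_ofReal_iff (by positivity), ofReal_integral_eq_lintegral_ofReal hφg
    (Filter.Eventually.of_forall fun ω => Real.rpow_nonneg (abs_nonneg _) _)]
  simpa only [abs_of_nonneg (hF0 _)] using hli

end lsc

section wlim
variable {Ω : Type*} [MeasurableSpace Ω] {ν : Measure Ω} [IsFiniteMeasure ν]

lemma integrable_abs_rpow_of_memLp {s : ℝ} (hs0 : 0 < s) {F : Ω → ℝ}
    (hF : MemLp F (ENNReal.ofReal s) ν) : Integrable (fun ω => |F ω| ^ s) ν := by
  simpa [ENNReal.toReal_ofReal hs0.le] using hF.integrable_norm_rpow (by simpa using hs0) (by simp)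

lemma memLp_ofReal_mono {p r : ℝ} (hpr : p ≤ r) {F : Ω → ℝ} (hF : MemLp F (ENNReal.ofReal r) ν) :
    MemLp F (ENNReal.ofReal p) ν := hF.mono_exponent (ENNReal.ofReal_le_ofReal hpr)

lemma integrable_sq_of_memLp {r : ℝ} (hr : 2 ≤ r) {F : Ω → ℝ}
    (hF : MemLp F (ENNReal.ofReal r) ν) : Integrable (fun ω => F ω ^ 2) ν := by
  have := integrable_abs_rpow_of_memLp two_pos (memLp_ofReal_mono hr hF)
  simpa using this

lemma lpn_two {F : Ω → ℝ} (hF : MemLp F (ENNReal.ofReal 2) ν) :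
    lpn 2 ν F = √(∫ ω, F ω ^ 2 ∂ν) := by
  rw [lpn_eq two_pos hF, Real.sqrt_eq_rpow]
  simp

lemma lpn_restrict_le {r : ℝ} {F : Ω → ℝ} (hF : MemLp F (ENNReal.ofReal r) ν) (A : Set Ω) :
    lpn r (ν.restrict A) F ≤ lpn r ν F :=
  ENNReal.toReal_mono hF.2.ne (eLpNorm_restrict_le _ _ _ _)

lemma memLp_sum_mul {ι : Type*} (t : Finset ι) {p : ℝ} {F : ι → Ω → ℝ}
    (hF : ∀ i ∈ t, MemLp (F i) (ENNReal.ofReal p) ν) (b : ι → ℝ) :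
    MemLp (fun ω => ∑ i ∈ t, b i * F i ω) (ENNReal.ofReal p) ν :=
  memLp_finsetSum t fun i hi => (hF i hi).const_mul (b i)

lemma lpn_sum_mul_le {ι : Type*} (t : Finset ι) {p : ℝ} (hp : 1 ≤ p) {F : ι → Ω → ℝ}
    (hF : ∀ i ∈ t, MemLp (F i) (ENNReal.ofReal p) ν) (b : ι → ℝ) :
    lpn p ν (fun ω => ∑ i ∈ t, b i * F i ω) ≤ ∑ i ∈ t, |b i| * lpn p ν (F i) := by
  classical
  induction t using Finset.induction_on with
  | empty => simp [lpn]
  | insert i t hi ih =>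
    simp only [Finset.sum_insert hi]
    refine (lpn_add_le hp ((hF i (by simp)).const_mul (b i))
      (memLp_sum_mul t (fun j hj => hF j (by simp [hj])) b)).trans ?_
    rw [lpn_const_mul]
    exact add_le_add_right (ih fun j hj => hF j (by simp [hj])) _

/-- `X n` is bounded in `L_r`, `r ≥ 2`, tends to zero weakly, and `X n ^ 2` tends weakly to
`f ^ 2` without loss of mass. -/
structure WLim (r : ℝ) (ν : Measure Ω) (X : ℕ → Ω → ℝ) (f : Ω → ℝ) : Prop where
  two_le : 2 ≤ r
  meas : ∀ n, Measurable (X n)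
  memLp : ∀ n, MemLp (X n) (ENNReal.ofReal r) ν
  bdd : ∃ C, ∀ n, lpn r ν (X n) ≤ C
  null : ∀ B, MeasurableSet B → Filter.Tendsto (fun n => ∫ ω in B, X n ω ∂ν) hypU (nhds 0)
  fmeas : Measurable f
  fnonneg : ∀ ω, 0 ≤ f ω
  fmemLp : MemLp f (ENNReal.ofReal r) ν
  sq : ∀ B, MeasurableSet B →
    Filter.Tendsto (fun n => ∫ ω in B, X n ω ^ 2 ∂ν) hypU (nhds (∫ ω in B, f ω ^ 2 ∂ν))
  equi : ∀ ρ > 0, ∃ L : ℝ, ∀ᶠ n in hypU, ∫ ω, (if L < |X n ω| then X n ω ^ 2 else 0) ∂ν ≤ ρ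

lemma integrable_trunc_sq {X : Ω → ℝ} (hXm : Measurable X) (hX : Integrable (fun ω => X ω ^ 2) ν)
    (L : ℝ) : Integrable (fun ω => if L < |X ω| then X ω ^ 2 else 0) ν := by
  refine hX.mono ?_ (Filter.Eventually.of_forall fun ω => ?_)
  · exact (Measurable.ite (measurableSet_lt measurable_const (by fun_prop)) (by fun_prop)
      measurable_const).aestronglyMeasurable
  · split_ifs
    · rfl
    · simpa using sq_nonneg (X ω)

lemma WLim.restrict {r : ℝ} {X : ℕ → Ω → ℝ} {f : Ω → ℝ} (h : WLim r ν X f) {A : Set Ω}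
    (hA : MeasurableSet A) : WLim r (ν.restrict A) X f where
  two_le := h.two_le
  meas := h.meas
  memLp n := (h.memLp n).restrict A
  bdd := by
    obtain ⟨C, hC⟩ := h.bdd
    exact ⟨C, fun n => (lpn_restrict_le (h.memLp n) A).trans (hC n)⟩
  null B hB := by
    simp only [Measure.restrict_restrict hB]; exact h.null _ (hB.inter hA)
  fmeas := h.fmeas
  fnonneg := h.fnonneg
  fmemLp := h.fmemLp.restrict A
  sq B hB := by
    simp only [Measure.restrict_restrict hB]; exact h.sq _ (hB.inter hA)
  equi ρ hρ := by
    obtain ⟨L, hL⟩ := h.equi ρ hρ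
    refine ⟨L, hL.mono fun n hn => le_trans ?_ hn⟩
    refine setIntegral_le_integral (integrable_trunc_sq (h.meas n)
      (integrable_sq_of_memLp h.two_le (h.memLp n)) L) (Filter.Eventually.of_forall fun ω => ?_)
    dsimp only [Pi.zero_apply]
    split_ifs <;> positivity

lemma exists_simple_approx_le {r : ℝ} {F : Ω → ℝ} (hFm : Measurable F)
    (hF : MemLp F (ENNReal.ofReal r) ν) {ε : ℝ} (hε : 0 < ε) :
    ∃ c : SimpleFunc Ω ℝ, (∀ ω, |c ω| ≤ 2 * |F ω|) ∧ lpn r ν (fun ω => c ω - F ω) ≤ ε := by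
  have h := SimpleFunc.tendsto_approxOn_Lp_eLpNorm (μ := ν) (p := ENNReal.ofReal r) (s := Set.univ)
    hFm (Set.mem_univ (0 : ℝ)) (by simp) (by simp) (by simpa using hF.2)
  have h2 := (h.eventually (gt_mem_nhds (ENNReal.ofReal_pos.2 hε))).exists
  obtain ⟨n, hn⟩ := h2
  refine ⟨SimpleFunc.approxOn F hFm Set.univ 0 (Set.mem_univ _) n, fun ω => ?_, ?_⟩
  · have := SimpleFunc.norm_approxOn_zero_le hFm (Set.mem_univ (0 : ℝ)) ω n
    simp only [Real.norm_eq_abs] at this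
    linarith
  · refine (ENNReal.toReal_mono (by simp) hn.le).trans ?_
    rw [ENNReal.toReal_ofReal hε.le]

end wlim

section wlim
variable {Ω : Type*} [MeasurableSpace Ω] {ν : Measure Ω} [IsFiniteMeasure ν]

lemma abs_sq_rpow_half (r x : ℝ) : |x ^ 2| ^ (r / 2) = |x| ^ r := by
  rw [abs_pow, ← Real.rpow_natCast, ← Real.rpow_mul (abs_nonneg x)]
  congr 1; push_cast; ring

lemma memLp_sq_half {r : ℝ} (hr : 0 < r) {F : Ω → ℝ} (hF : MemLp F (ENNReal.ofReal r) ν) :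
    MemLp (fun ω => F ω ^ 2) (ENNReal.ofReal (r / 2)) ν :=
  memLp_of_integrable_abs_rpow (by positivity) (hF.1.pow 2)
    (by simpa only [abs_sq_rpow_half] using integrable_abs_rpow_of_memLp hr hF)

lemma memLp_of_sq_half {r : ℝ} (hr : 0 < r) {F : Ω → ℝ} (hFm : Measurable F)
    (hF : MemLp (fun ω => F ω ^ 2) (ENNReal.ofReal (r / 2)) ν) : MemLp F (ENNReal.ofReal r) ν :=
  memLp_of_integrable_abs_rpow hr hFm.aestronglyMeasurable
    (by simpa only [abs_sq_rpow_half] using integrable_abs_rpow_of_memLp (by positivity) hF)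

lemma lpn_sq_half {r : ℝ} (hr : 0 < r) {F : Ω → ℝ} (hF : MemLp F (ENNReal.ofReal r) ν) :
    lpn (r / 2) ν (fun ω => F ω ^ 2) = lpn r ν F ^ 2 := by
  have h1 := lpn_rpow (by positivity) (memLp_sq_half hr hF)
  simp only [abs_sq_rpow_half] at h1
  rw [← lpn_rpow hr hF] at h1
  have h2 : (lpn r ν F ^ 2) ^ (r / 2) = lpn r ν F ^ r := by
    have := abs_sq_rpow_half r (lpn r ν F)
    rwa [abs_of_nonneg (by positivity), abs_of_nonneg lpn_nonneg] at this
  rw [← h2] at h1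
  exact (Real.rpow_left_inj lpn_nonneg (sq_nonneg _) (by positivity)).1 h1

lemma exists_sq_limit {r : ℝ} (hr : 2 ≤ r) {X : ℕ → Ω → ℝ} (hXm : ∀ n, Measurable (X n))
    (hX : ∀ n, MemLp (X n) (ENNReal.ofReal r) ν) {C : ℝ} (hC : ∀ n, lpn r ν (X n) ≤ C)
    (hE : ∀ ρ > 0, ∃ L : ℝ, ∀ᶠ n in hypU,
      ∫ ω, (if L < |X n ω| then X n ω ^ 2 else 0) ∂ν ≤ ρ) :
    ∃ f : Ω → ℝ, Measurable f ∧ (∀ ω, 0 ≤ f ω) ∧ MemLp f (ENNReal.ofReal r) ν ∧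
      ∀ B, MeasurableSet B →
        Filter.Tendsto (fun n => ∫ ω in B, X n ω ^ 2 ∂ν) hypU (nhds (∫ ω in B, f ω ^ 2 ∂ν)) := by
  have hr0 : 0 < r := by linarith
  have hXi : ∀ n, Integrable (fun ω => X n ω ^ 2) ν := fun n => integrable_sq_of_memLp hr (hX n)
  obtain ⟨g, hg, hgi, hgl⟩ := exists_setwise_limit (ν := ν) (fun n ω => ENNReal.ofReal (X n ω ^ 2))
    (fun n => by have := hXm n; fun_prop) (by
      intro ρ hρ
      obtain ⟨L, hL⟩ := hE (min ρ 1).toReal (ENNReal.toReal_pos (by simp [hρ]) (by simp))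
      refine ⟨ENNReal.ofReal ((max L 0) ^ 2), by simp, hL.mono fun n hn => ?_⟩
      calc _ ≤ ∫⁻ ω, ENNReal.ofReal (if L < |X n ω| then X n ω ^ 2 else 0) ∂ν := by
            refine lintegral_mono fun ω => ?_
            dsimp only
            split_ifs with h1 h2 h2
            · exact le_rfl
            · exfalso
              have := (ENNReal.ofReal_lt_ofReal_iff_of_nonneg (sq_nonneg _)).1 h1
              rw [← sq_abs (X n ω)] at this
              exact h2 ((le_max_left _ _).trans_lt (lt_of_pow_lt_pow_left₀ 2 (abs_nonneg _) this))
            · exact zero_le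
            · exact zero_le
        _ = ENNReal.ofReal (∫ ω, (if L < |X n ω| then X n ω ^ 2 else 0) ∂ν) := by
            rw [ofReal_integral_eq_lintegral_ofReal (integrable_trunc_sq (hXm n) (hXi n) L)]
            exact Filter.Eventually.of_forall fun ω => by
              dsimp only [Pi.zero_apply]; split_ifs <;> positivity
        _ ≤ ENNReal.ofReal (min ρ 1).toReal := ENNReal.ofReal_le_ofReal hn
        _ = min ρ 1 := ENNReal.ofReal_toReal (by simp)
        _ ≤ ρ := min_le_left _ _)
  have hfin : ∀ᵐ ω ∂ν, g ω < ∞ := ae_lt_top hg hgi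
  set f : Ω → ℝ := fun ω => √(g ω).toReal with hf
  have hfm : Measurable f := by fun_prop
  have hf2 : ∀ ω, f ω ^ 2 = (g ω).toReal := fun ω => Real.sq_sqrt ENNReal.toReal_nonneg
  have hf2i : Integrable (fun ω => f ω ^ 2) ν := by
    simp only [hf2]
    exact integrable_toReal_of_lintegral_ne_top hg.aemeasurable hgi
  have hsq : ∀ B, MeasurableSet B →
      Filter.Tendsto (fun n => ∫ ω in B, X n ω ^ 2 ∂ν) hypU (nhds (∫ ω in B, f ω ^ 2 ∂ν)) := by
    intro B hB
    have h1 : ∀ n, ∫ ω in B, X n ω ^ 2 ∂ν = (∫⁻ ω in B, ENNReal.ofReal (X n ω ^ 2) ∂ν).toReal :=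
      fun n => integral_eq_lintegral_of_nonneg_ae
        (Filter.Eventually.of_forall fun ω => sq_nonneg _) (by have := hXm n; fun_prop)
    have h2 : ∫ ω in B, f ω ^ 2 ∂ν = (∫⁻ ω in B, g ω ∂ν).toReal := by
      simp only [hf2]
      exact integral_toReal hg.aemeasurable (ae_restrict_of_ae hfin)
    simp only [h1, h2]
    exact (ENNReal.tendsto_toReal ((setLIntegral_le_lintegral _ _).trans_lt hgi.lt_top).ne).comp
      (hgl B hB)
  have hl := lpn_le_of_setIntegral_le (ν := ν) (s := r / 2) (by linarith) (F := fun ω => f ω ^ 2)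
    (by fun_prop) (fun ω => sq_nonneg _) hf2i (G := fun n ω => X n ω ^ 2) (fun n ω => sq_nonneg _)
    (fun n => memLp_sq_half hr0 (hX n)) (K := C ^ 2) (Filter.Eventually.of_forall fun n => by
      rw [lpn_sq_half hr0 (hX n)]
      exact pow_le_pow_left₀ lpn_nonneg (hC n) 2)
    (fun B hB ε hε => by
      filter_upwards [(hsq B hB).eventually (lt_mem_nhds (sub_lt_self _ hε))] with n hn
      linarith)
  exact ⟨f, hfm, fun ω => Real.sqrt_nonneg _, memLp_of_sq_half hr0 hfm hl.1, hsq⟩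

lemma exists_wLim {r : ℝ} (hr : 2 ≤ r) {X : ℕ → Ω → ℝ} (hXm : ∀ n, Measurable (X n))
    (hX : ∀ n, MemLp (X n) (ENNReal.ofReal r) ν) {C : ℝ} (hC : ∀ n, lpn r ν (X n) ≤ C)
    (h0 : ∀ B, MeasurableSet B → Filter.Tendsto (fun n => ∫ ω in B, X n ω ∂ν) hypU (nhds 0))
    (hE : ∀ ρ > 0, ∃ L : ℝ, ∀ᶠ n in hypU,
      ∫ ω, (if L < |X n ω| then X n ω ^ 2 else 0) ∂ν ≤ ρ) :
    ∃ f, WLim r ν X f := by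
  obtain ⟨f, hfm, hf0, hf, hsq⟩ := exists_sq_limit hr hXm hX hC hE
  exact ⟨f, hr, hXm, hX, ⟨C, hC⟩, h0, hfm, hf0, hf, hsq, hE⟩

lemma equi_of_moment {r : ℝ} (hr : 2 < r) {X : ℕ → Ω → ℝ} (hXm : ∀ n, Measurable (X n))
    (hX : ∀ n, MemLp (X n) (ENNReal.ofReal r) ν) {C : ℝ} (hC : ∀ n, lpn r ν (X n) ≤ C) :
    ∀ ρ > 0, ∃ L : ℝ, ∀ᶠ n in hypU, ∫ ω, (if L < |X n ω| then X n ω ^ 2 else 0) ∂ν ≤ ρ := by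
  intro ρ hρ
  have hC0 : 0 ≤ C := lpn_nonneg.trans (hC 0)
  have hr0 : 0 < r := by linarith
  set L := ((C ^ r + 1) / ρ) ^ (1 / (r - 2)) with hL
  have hL0 : 0 < L := by positivity
  have hLr : L ^ (r - 2) = (C ^ r + 1) / ρ := by
    rw [hL, ← Real.rpow_mul (by positivity), one_div_mul_cancel (by linarith), Real.rpow_one]
  refine ⟨L, Filter.Eventually.of_forall fun n => ?_⟩
  calc _ ≤ ∫ ω, |X n ω| ^ r * (ρ / (C ^ r + 1)) ∂ν := by
        refine integral_mono (integrable_trunc_sq (hXm n) (integrable_sq_of_memLp hr.le (hX n)) L)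
          ((integrable_abs_rpow_of_memLp hr0 (hX n)).mul_const _) fun ω => ?_
        dsimp only
        split_ifs with h
        · have h1 : L ^ (r - 2) ≤ |X n ω| ^ (r - 2) :=
            Real.rpow_le_rpow hL0.le h.le (by linarith)
          have h2 : |X n ω| ^ r = |X n ω| ^ (r - 2) * X n ω ^ 2 := by
            rw [← sq_abs (X n ω), ← Real.rpow_natCast |X n ω|, ← Real.rpow_add (hL0.trans h)]
            congr 1; push_cast; ring
          rw [h2, hLr] at *
          have h3 : 0 < ρ / (C ^ r + 1) := by positivity
          calc X n ω ^ 2 = (C ^ r + 1) / ρ * (ρ / (C ^ r + 1)) * X n ω ^ 2 := by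
                field_simp
            _ ≤ |X n ω| ^ (r - 2) * (ρ / (C ^ r + 1)) * X n ω ^ 2 := by gcongr
            _ = _ := by ring
        · positivity
    _ = lpn r ν (X n) ^ r * (ρ / (C ^ r + 1)) := by rw [integral_mul_const, lpn_rpow hr0 (hX n)]
    _ ≤ C ^ r * (ρ / (C ^ r + 1)) := by
        gcongr
        · exact lpn_nonneg
        · exact hC n
    _ ≤ ρ := by
        rw [mul_div_assoc', div_le_iff₀ (by positivity)]
        nlinarith [Real.rpow_nonneg hC0 r]

end wlim

section wlim
variable {Ω : Type*} [MeasurableSpace Ω] {ν : Measure Ω} [IsFiniteMeasure ν]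

lemma abs_setIntegral_le_lpn {r K : ℝ} (hK : ∀ F : Ω → ℝ,
    MemLp F (ENNReal.ofReal r) ν → lpn 1 ν F ≤ K * lpn r ν F)
    (hr : 1 ≤ r) {F : Ω → ℝ} (hF : MemLp F (ENNReal.ofReal r) ν) (B : Set Ω) :
    |∫ ω in B, F ω ∂ν| ≤ K * lpn r ν F := by
  have hi : Integrable F ν := hF.integrable (one_le_ofReal hr)
  refine le_trans ?_ (hK F hF)
  have h1 : MemLp F (ENNReal.ofReal 1) ν := memLp_ofReal_mono hr hF
  rw [lpn_eq one_pos h1]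
  simp only [Real.rpow_one, div_one]
  exact (abs_integral_le_integral_abs).trans
    (setIntegral_le_integral hi.abs (Filter.Eventually.of_forall fun ω => abs_nonneg _))

/-- Approximation by simple functions preserves `WLim`. -/
lemma WLim.approx {r : ℝ} {X : ℕ → Ω → ℝ} {f : Ω → ℝ} (h : WLim r ν X f)
    {Y : ℕ → SimpleFunc Ω ℝ} (hY : ∀ n ω, |Y n ω| ≤ 2 * |X n ω|)
    (hYX : ∀ n, lpn r ν (fun ω => Y n ω - X n ω) ≤ (1 / 2) ^ n) :
    WLim r ν (fun n => Y n) f := by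
  have hr := h.two_le
  have hr1 : 1 ≤ r := by linarith
  have hYm : ∀ n, MemLp (Y n) (ENNReal.ofReal r) ν := fun n => SimpleFunc.memLp_of_isFiniteMeasure
      _ _ _
  have hd : ∀ n, MemLp (fun ω => Y n ω - X n ω) (ENNReal.ofReal r) ν :=
      fun n => (hYm n).sub (h.memLp n)
  have hhalf : Filter.Tendsto (fun n : ℕ => (1 / 2 : ℝ) ^ n) hypU (nhds 0) :=
    (tendsto_pow_atTop_nhds_zero_of_lt_one (by norm_num) (by norm_num)).mono_left
      (by rw [← Nat.cofinite_eq_atTop]; exact Filter.hyperfilter_le_cofinite)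
  refine ⟨hr, fun n => (Y n).measurable, hYm, ?_, ?_, h.fmeas, h.fnonneg, h.fmemLp, ?_, ?_⟩
  · obtain ⟨C, hC⟩ := h.bdd
    refine ⟨2 * C, fun n => ?_⟩
    have := lpn_mono (F := Y n) ((h.memLp n).const_mul 2) (Filter.Eventually.of_forall fun ω => by
      rw [abs_mul, abs_two]; exact hY n ω)
    rw [lpn_const_mul, abs_two] at this
    linarith [hC n]
  · intro B hB
    obtain ⟨K, hK0, hK⟩ := exists_lpn_le_lpn ν one_pos hr1
    have h1 : Filter.Tendsto (fun n => ∫ ω in B, (Y n ω - X n ω) ∂ν) hypU (nhds 0) := by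
      refine squeeze_zero_norm (fun n => ?_) (by simpa using hhalf.const_mul K)
      exact (abs_setIntegral_le_lpn hK hr1 (hd n) B).trans
        (by simpa using mul_le_mul_of_nonneg_left (hYX n) hK0)
    have := h1.add (h.null B hB)
    rw [add_zero] at this
    refine this.congr fun n => ?_
    rw [integral_sub ((hYm n).integrable (one_le_ofReal hr1)).integrableOn
      ((h.memLp n).integrable (one_le_ofReal hr1)).integrableOn]
    ring
  · intro B hB
    obtain ⟨K, hK0, hK⟩ := exists_lpn_le_lpn ν two_pos hr
    have e : ∀ F : Ω → ℝ, MemLp F (ENNReal.ofReal r) ν →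
        ∫ ω in B, F ω ^ 2 ∂ν = lpn 2 (ν.restrict B) F ^ 2 := fun F hF => by
      rw [lpn_two ((memLp_ofReal_mono hr hF).restrict B),
        Real.sq_sqrt (integral_nonneg fun ω => sq_nonneg _)]
    have e' : ∀ F : Ω → ℝ, MemLp F (ENNReal.ofReal r) ν →
        √(∫ ω in B, F ω ^ 2 ∂ν) = lpn 2 (ν.restrict B) F := fun F hF => by
      rw [lpn_two ((memLp_ofReal_mono hr hF).restrict B)]
    have h1 := (Real.continuous_sqrt.tendsto _).comp (h.sq B hB)
    have h2 : Filter.Tendsto (fun n => lpn 2 (ν.restrict B) (Y n) - lpn 2 (ν.restrict B) (X n)) hypU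
        (nhds 0) := by
      refine squeeze_zero_norm (fun n => ?_) (by simpa using hhalf.const_mul K)
      refine (abs_lpn_sub_le one_le_two ((memLp_ofReal_mono hr (hYm n)).restrict B)
        ((memLp_ofReal_mono hr (h.memLp n)).restrict B)).trans ?_
      refine (lpn_restrict_le (memLp_ofReal_mono hr (hd n)) B).trans ((hK _ (hd n)).trans ?_)
      simpa using mul_le_mul_of_nonneg_left (hYX n) hK0
    have h3 := (h2.add h1).pow 2
    rw [zero_add, Real.sq_sqrt (integral_nonneg fun ω => sq_nonneg _)] at h3
    refine h3.congr fun n => ?_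
    simp only [Function.comp_apply]
    rw [e' _ (h.memLp n), e _ (hYm n)]
    ring
  · intro ρ hρ
    obtain ⟨L, hL⟩ := h.equi (ρ / 4) (by positivity)
    refine ⟨2 * L, hL.mono fun n hn => ?_⟩
    have hi := integrable_trunc_sq (h.meas n) (integrable_sq_of_memLp hr (h.memLp n)) L
    calc _ ≤ ∫ ω, 4 * (if L < |X n ω| then X n ω ^ 2 else 0) ∂ν := by
          refine integral_mono (integrable_trunc_sq (Y n).measurable
            (integrable_sq_of_memLp hr (hYm n)) _) (hi.const_mul 4) fun ω => ?_
          dsimp only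
          have h1 := hY n ω
          split_ifs with h2 h3 h3
          · calc Y n ω ^ 2 = |Y n ω| ^ 2 := (sq_abs _).symm
              _ ≤ (2 * |X n ω|) ^ 2 := by gcongr
              _ = _ := by rw [mul_pow, sq_abs]; norm_num
          · linarith
          · positivity
          · positivity
      _ = 4 * ∫ ω, (if L < |X n ω| then X n ω ^ 2 else 0) ∂ν := integral_const_mul _ _
      _ ≤ ρ := by linarith

/-- Small linear combinations of a generic subsequence behave like Gaussian variables
conditionally on `f`. -/
theorem WLim.lindeberg {p : ℝ} (hp : 1 ≤ p) {X : ℕ → Ω → ℝ} {f : Ω → ℝ}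
    (h : WLim (max p 2) ν X f) {A : Set Ω} (hA : MeasurableSet A) {δ : ℝ} (hδ : 0 < δ) :
    ∃ β > 0, Gen fun n =>
      ∀ (I : ℕ) (b : ℕ → ℝ), ∑ i ∈ Finset.range I, b i ^ 2 ≤ 1 → (∀ i < I, |b i| ≤ β) →
        |lpn p (ν.restrict A) (fun ω => ∑ i ∈ Finset.range I, b i * X (n i) ω) -
          gaussNorm p * √(∑ i ∈ Finset.range I, b i ^ 2) * lpn p (ν.restrict A) f| ≤ δ := by
  have hr := h.two_le
  have hr1 : 1 ≤ max p 2 := by linarith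
  choose Y hY hYX using fun n => exists_simple_approx_le (h.meas n) (h.memLp n)
    (show (0 : ℝ) < (1 / 2) ^ n by positivity)
  have hYm : ∀ n, MemLp (Y n) (ENNReal.ofReal (max p 2)) ν :=
    fun n => SimpleFunc.memLp_of_isFiniteMeasure _ _ _
  have hd : ∀ n, MemLp (fun ω => Y n ω - X n ω) (ENNReal.ofReal (max p 2)) ν :=
    fun n => (hYm n).sub (h.memLp n)
  have h' := (h.approx hY hYX).restrict hA
  obtain ⟨C, hC⟩ := h'.bdd
  have hr0 : 0 < max p 2 := by linarith
  obtain ⟨β, hβ, hg⟩ := lindeberg_lpn (ν := ν.restrict A) hp Y h'.fmeas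
    (integrable_abs_rpow_of_memLp hr0 h'.fmemLp) (Cx := C ^ max p 2)
    (fun n => by
      rw [← lpn_rpow hr0 (h'.memLp n)]
      exact Real.rpow_le_rpow lpn_nonneg (hC n) hr0.le)
    h'.null h'.sq h'.equi (half_pos hδ)
  obtain ⟨K, hK0, hK⟩ := exists_lpn_le_lpn ν (by linarith : 0 < p) (le_max_left p 2)
  refine ⟨min β (δ / (4 * (K + 1))), by positivity, (hg.and gen_strictMono).mono ?_⟩
  rintro n ⟨hn, hmono⟩ I b hb hbβ
  have h1 := hn I b hb fun i hi => (hbβ i hi).trans (min_le_left _ _)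
  have hpY : ∀ n, MemLp (Y n) (ENNReal.ofReal p) (ν.restrict A) := fun n =>
    (memLp_ofReal_mono (le_max_left p 2) (hYm n)).restrict A
  have hpX : ∀ n, MemLp (X n) (ENNReal.ofReal p) (ν.restrict A) := fun n =>
    (memLp_ofReal_mono (le_max_left p 2) (h.memLp n)).restrict A
  have h2 := abs_lpn_sub_le hp
    (memLp_sum_mul (Finset.range I) (F := fun i => Y (n i)) (fun i _ => hpY (n i)) b)
    (memLp_sum_mul (Finset.range I) (F := fun i => X (n i)) (fun i _ => hpX (n i)) b)
  have h3 : lpn p (ν.restrict A) (fun ω => ∑ i ∈ Finset.range I, b i * Y (n i) ω -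
      ∑ i ∈ Finset.range I, b i * X (n i) ω) ≤ δ / 2 := by
    have e : (fun ω => ∑ i ∈ Finset.range I, b i * Y (n i) ω -
      ∑ i ∈ Finset.range I, b i * X (n i) ω) =
      fun ω => ∑ i ∈ Finset.range I, b i * (fun ω => Y (n i) ω - X (n i) ω) ω := by
      funext ω
      rw [← Finset.sum_sub_distrib]
      exact Finset.sum_congr rfl fun i _ => by ring
    rw [e]
    refine (lpn_sum_mul_le _ hp (F := fun i ω => Y (n i) ω - X (n i) ω)
      (fun i _ => (hpY _).sub (hpX _)) b).trans ?_
    calc _ ≤ ∑ i ∈ Finset.range I, δ / (4 * (K + 1)) * (K * (1 / 2) ^ i) := by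
          refine Finset.sum_le_sum fun i hi => ?_
          refine mul_le_mul ((hbβ i (Finset.mem_range.1 hi)).trans (min_le_right _ _)) ?_
            lpn_nonneg (by positivity)
          refine (lpn_restrict_le (memLp_ofReal_mono (le_max_left p 2) (hd (n i))) A).trans
            ((hK _ (hd _)).trans ?_)
          refine mul_le_mul_of_nonneg_left ((hYX _).trans ?_) hK0
          exact pow_le_pow_of_le_one (by norm_num) (by norm_num) (hmono.le_apply)
      _ = δ / (4 * (K + 1)) * K * ∑ i ∈ Finset.range I, (1 / 2 : ℝ) ^ i := by
          rw [Finset.mul_sum]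
          exact Finset.sum_congr rfl fun i _ => by ring
      _ ≤ δ / (4 * (K + 1)) * K * 2 := by
          gcongr
          exact sum_geometric_two_le I
      _ ≤ δ / 2 := by
          rw [div_mul_eq_mul_div, div_mul_eq_mul_div, div_le_div_iff₀ (by positivity)
            (by positivity)]
          nlinarith
  have h4 := abs_le.1 h1
  have h5 := abs_le.1 (h2.trans h3)
  rw [abs_le]
  constructor <;> linarith [h4.1, h4.2, h5.1, h5.2]

end wlim

/-- The Hilbert space `ℓ_2`. -/
abbrev SeqL2 := lp (fun _ : ℕ => ℝ) 2

/-- The unit vector basis of `ℓ_2`. -/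
noncomputable def l2e (n : ℕ) : SeqL2 := lp.single 2 n (1 : ℝ)

section l2
variable {E : Type*} [NormedAddCommGroup E] [NormedSpace ℝ E]

lemma l2e_apply (n k : ℕ) : l2e n k = if k = n then 1 else 0 := by
  rw [l2e, lp.coeFn_single, Pi.single_apply]

lemma norm_l2e (n : ℕ) : ‖l2e n‖ = 1 := by
  rw [l2e, lp.norm_single (by norm_num)]; simp

lemma inner_l2e (a : SeqL2) (n : ℕ) : inner ℝ a (l2e n) = a n := by
  rw [l2e, lp.inner_single_right]
  simp

lemma orthonormal_l2e : Orthonormal ℝ l2e := by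
  rw [orthonormal_iff_ite]
  intro i j
  rw [inner_l2e, l2e_apply]
  simp [eq_comm]

lemma single_eq_smul_l2e (n : ℕ) (x : ℝ) : (lp.single 2 n x : SeqL2) = x • l2e n := by
  rw [l2e, ← lp.single_smul, smul_eq_mul, mul_one]

lemma hasSum_l2e (a : SeqL2) : HasSum (fun n => a n • l2e n) a := by
  have := lp.hasSum_single (p := 2) (by norm_num) a
  simpa only [single_eq_smul_l2e] using this

lemma abs_apply_le_norm (a : SeqL2) (n : ℕ) : |a n| ≤ ‖a‖ := lp.norm_apply_le_norm (by norm_num) a n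

lemma sum_sq_le_norm_sq (a : SeqL2) (s : Finset ℕ) : ∑ i ∈ s, a i ^ 2 ≤ ‖a‖ ^ 2 := by
  have := lp.sum_rpow_le_norm_rpow (p := 2) (by norm_num) a s
  simpa using this

lemma summable_sq (a : SeqL2) : Summable fun n => a n ^ 2 :=
  summable_of_sum_le (fun _ => sq_nonneg _) (sum_sq_le_norm_sq a)

lemma tendsto_apply_hypU (a : SeqL2) : Filter.Tendsto (fun n => a n) hypU (nhds 0) := by
  have h := (summable_sq a).tendsto_atTop_zero
  have h2 := (Real.continuous_sqrt.tendsto _).comp h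
  simp only [Function.comp_def, Real.sqrt_sq_eq_abs, Real.sqrt_zero] at h2
  exact ((tendsto_zero_iff_abs_tendsto_zero _).2 h2).mono_left
    (by rw [← Nat.cofinite_eq_atTop]; exact Filter.hyperfilter_le_cofinite)

lemma tendsto_functional_l2e (φ : SeqL2 →L[ℝ] ℝ) :
    Filter.Tendsto (fun n => φ (l2e n)) hypU (nhds 0) := by
  have := tendsto_apply_hypU ((InnerProductSpace.toDual ℝ SeqL2).symm φ)
  refine this.congr fun n => ?_
  rw [← inner_l2e, InnerProductSpace.toDual_symm_apply]

lemma norm_sum_smul_l2e (s : Finset ℕ) (b : ℕ → ℝ) :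
    ‖∑ i ∈ s, b i • l2e i‖ = √(∑ i ∈ s, b i ^ 2) := by
  rw [eq_comm, Real.sqrt_eq_iff_eq_sq (Finset.sum_nonneg fun _ _ => sq_nonneg _) (norm_nonneg _),
    ← real_inner_self_eq_norm_sq, orthonormal_l2e.inner_sum]
  simp [sq]

lemma norm_le_of_apply_le {a : SeqL2} {c : ℝ} (h : ∀ k, |a k| ≤ c * (1 / 2) ^ k / 2) :
    ‖a‖ ≤ c := by
  have hs := hasSum_geometric_two.mul_left (c / 2)
  have h1 := tsum_of_norm_bounded hs (f := fun n => a n • l2e n) fun k => by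
    rw [norm_smul, norm_l2e, mul_one]
    exact (h k).trans (le_of_eq (by ring))
  rw [(hasSum_l2e a).tsum_eq] at h1
  linarith

lemma ContinuousLinearMap.norm_le_of_l2e (R : SeqL2 →L[ℝ] E) {c : ℝ}
    (h : ∀ l, ‖R (l2e l)‖ ≤ c * (1 / 2) ^ l / 2) (a : SeqL2) : ‖R a‖ ≤ c * ‖a‖ := by
  have hs := hasSum_geometric_two.mul_left (c / 2 * ‖a‖)
  have hR : HasSum (fun n => a n • R (l2e n)) (R a) := by
    simpa using R.hasSum (hasSum_l2e a)
  have h1 := tsum_of_norm_bounded hs (f := fun n => a n • R (l2e n)) fun k => by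
    rw [norm_smul]
    calc _ ≤ ‖a‖ * (c * (1 / 2) ^ k / 2) :=
          mul_le_mul (abs_apply_le_norm a k) (h k) (norm_nonneg _) (norm_nonneg _)
      _ = _ := by ring
  rw [hR.tsum_eq] at h1
  linarith

/-- A closed homogeneous inequality on `ℓ_2` may be checked on finitely supported vectors. -/
lemma l2_induction {N : SeqL2 → ℝ} (hN : Continuous N)
    (h : ∀ (K : ℕ) (a : ℕ → ℝ), 0 ≤ N (∑ i ∈ Finset.range K, a i • l2e i)) (a : SeqL2) : 0 ≤
      N a := by
  have h1 := (hN.tendsto a).comp (hasSum_l2e a).tendsto_sum_nat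
  exact ge_of_tendsto' h1 fun K => h K _

/-- The isometry of `ℓ_2` onto the closed span of an orthonormal sequence. -/
lemma exists_isometry_of_orthonormal {H : Type*} [NormedAddCommGroup H] [InnerProductSpace ℝ H]
    [CompleteSpace H] {v : ℕ → H} (hv : Orthonormal ℝ v) :
    ∃ ι : SeqL2 →ₗᵢ[ℝ] H, ∀ k, ι (l2e k) = v k := by
  refine ⟨hv.orthogonalFamily.linearIsometry, fun k => ?_⟩
  rw [l2e, OrthogonalFamily.linearIsometry_apply_single]
  simp

/-- Coordinate functionals with an upper `2`-estimate form an operator into `ℓ_2`. -/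
lemma exists_operator_of_functionals (φ : ℕ → E →L[ℝ] ℝ) {C : ℝ} (hC : 0 ≤ C)
    (h : ∀ (K : ℕ) (a : ℕ → ℝ) (x : E),
      ∑ k ∈ Finset.range K, a k * φ k x ≤ C * √(∑ k ∈ Finset.range K, a k ^ 2) * ‖x‖) :
    ∃ V : E →L[ℝ] SeqL2, ‖V‖ ≤ C ∧ ∀ x k, V x k = φ k x := by
  have hb : ∀ x K, ∑ k ∈ Finset.range K, φ k x ^ 2 ≤ (C * ‖x‖) ^ 2 := by
    intro x K
    have h1 := h K (fun k => φ k x) x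
    set S := ∑ k ∈ Finset.range K, φ k x ^ 2 with hS
    have hS0 : 0 ≤ S := Finset.sum_nonneg fun _ _ => sq_nonneg _
    have h2 : ∑ k ∈ Finset.range K, φ k x * φ k x = √S * √S := by
      rw [Real.mul_self_sqrt hS0, hS]; exact Finset.sum_congr rfl fun _ _ => by ring
    rw [h2] at h1
    have h3 : √S ≤ C * ‖x‖ := by
      rcases (Real.sqrt_nonneg S).eq_or_lt with h0 | h0
      · rw [← h0]; positivity
      · refine le_of_mul_le_mul_right (h1.trans (le_of_eq ?_)) h0
        ring
    calc S = √S ^ 2 := (Real.sq_sqrt hS0).symm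
      _ ≤ _ := by gcongr
  have hm : ∀ x, Memℓp (fun k => φ k x) 2 := fun x => by
    refine memℓp_gen' (C := (C * ‖x‖) ^ 2) fun s => ?_
    obtain ⟨K, hK⟩ := s.exists_nat_subset_range
    refine le_trans ?_ (hb x K)
    simp only [ENNReal.toReal_ofNat, Real.rpow_ofNat, Real.norm_eq_abs, sq_abs]
    exact Finset.sum_le_sum_of_subset_of_nonneg hK fun _ _ _ => sq_nonneg _
  let L : E →ₗ[ℝ] SeqL2 :=
    { toFun := fun x => ⟨fun k => φ k x, hm x⟩
      map_add' := fun x y => by ext k; simp; rfl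
      map_smul' := fun c x => by ext k; simp }
  have hL : ∀ x, ‖L x‖ ≤ C * ‖x‖ := fun x => by
    refine lp.norm_le_of_forall_sum_le (p := 2) (by norm_num) (by positivity) fun s => ?_
    obtain ⟨K, hK⟩ := s.exists_nat_subset_range
    refine le_trans ?_ (le_trans (hb x K) (le_of_eq (by simp)))
    simp only [ENNReal.toReal_ofNat, Real.rpow_ofNat, Real.norm_eq_abs, sq_abs]
    exact Finset.sum_le_sum_of_subset_of_nonneg hK fun _ _ _ => sq_nonneg _
  exact ⟨L.mkContinuous C hL, L.mkContinuous_norm_le hC hL, fun x k => rfl⟩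

/-- Normalised sums over consecutive blocks of length `m` of a subsequence `n`. -/
noncomputable def l2block (n : ℕ → ℕ) (m k : ℕ) : SeqL2 :=
  ∑ i ∈ Finset.range m, (√m)⁻¹ • l2e (n (m * k + i))

lemma sum_block {M : Type*} [AddCommMonoid M] (g : ℕ → M) (m K : ℕ) :
    ∑ k ∈ Finset.range K, ∑ i ∈ Finset.range m, g (m * k + i) = ∑ i ∈ Finset.range (m * K),
      g i := by
  induction K with
  | zero => simp
  | succ K ih => rw [Finset.sum_range_succ, ih, mul_add, mul_one, Finset.sum_range_add]

lemma sum_smul_l2block {n : ℕ → ℕ} {m : ℕ} (hm : 0 < m) (K : ℕ) (a : ℕ → ℝ) :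
    ∑ k ∈ Finset.range K, a k • l2block n m k =
      ∑ i ∈ Finset.range (m * K), (a (i / m) * (√m)⁻¹) • l2e (n i) := by
  rw [← sum_block]
  refine Finset.sum_congr rfl fun k _ => ?_
  rw [l2block, Finset.smul_sum]
  refine Finset.sum_congr rfl fun i hi => ?_
  rw [smul_smul, Nat.mul_add_div hm, Nat.div_eq_of_lt (Finset.mem_range.1 hi), add_zero]

lemma sum_sq_block {m : ℕ} (hm : 0 < m) (K : ℕ) (a : ℕ → ℝ) :
    ∑ i ∈ Finset.range (m * K), (a (i / m) * (√m)⁻¹) ^ 2 = ∑ k ∈ Finset.range K, a k ^ 2 := by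
  rw [← sum_block]
  refine Finset.sum_congr rfl fun k _ => ?_
  have hm' : (0 : ℝ) < m := by exact_mod_cast hm
  rw [Finset.sum_congr rfl fun i hi => by
    rw [Nat.mul_add_div hm, Nat.div_eq_of_lt (Finset.mem_range.1 hi), add_zero]]
  simp only [Finset.sum_const, Finset.card_range, nsmul_eq_mul, mul_pow, inv_pow,
    Real.sq_sqrt hm'.le]
  field_simp

lemma orthonormal_l2block {n : ℕ → ℕ} (hn : Function.Injective n) {m : ℕ} (hm : 0 < m) :
    Orthonormal ℝ (l2block n m) := by
  have hm' : (0 : ℝ) < m := by exact_mod_cast hm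
  rw [orthonormal_iff_ite]
  intro k l
  simp only [l2block, sum_inner, inner_sum, inner_smul_left, inner_smul_right, inner_l2e, l2e_apply]
  simp only [conj_trivial]
  have h : ∀ i ∈ Finset.range m, ∀ j ∈ Finset.range m,
      (√m)⁻¹ * ((√m)⁻¹ * (if n (m * l + j) = n (m * k + i) then 1 else 0)) =
      if k = l then (if j = i then (m : ℝ)⁻¹ else 0) else 0 := by
    intro i hi j hj
    rw [Finset.mem_range] at hi hj
    have e : n (m * l + j) = n (m * k + i) ↔ k = l ∧ j = i := by
      rw [hn.eq_iff]
      constructor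
      · intro h
        have h1 := congrArg (· / m) h
        have h2 := congrArg (· % m) h
        simp only [Nat.mul_add_div hm, Nat.div_eq_of_lt hi, Nat.div_eq_of_lt hj, add_zero,
          Nat.mul_add_mod, Nat.mod_eq_of_lt hi, Nat.mod_eq_of_lt hj] at h1 h2
        exact ⟨h1.symm, h2⟩
      · rintro ⟨rfl, rfl⟩; rfl
    rw [if_congr e rfl rfl]
    by_cases h1 : k = l <;> by_cases h2 : j = i <;> simp [h1, h2, ← mul_inv]
  simp only [Finset.mul_sum]
  rw [Finset.sum_congr rfl fun j hj => Finset.sum_congr rfl fun i hi => h i hi j hj]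
  by_cases hkl : k = l
  · simp only [hkl, if_true, Finset.sum_ite_eq, Finset.mem_range]
    rw [Finset.sum_congr rfl fun j hj => if_pos (Finset.mem_range.1 hj)]
    simp [hm'.ne']
  · simp [hkl]

end l2

section collim
variable {Ω : Type*} [MeasurableSpace Ω] {μ : Measure Ω} {p : ℝ}

/-- Small linear combinations of generic subsequences of `X` look, in every `L_p(A)`, like Gaussian
multiples of `f`, and the squares of `X n` dominate `f ^ 2` asymptotically. -/
structure ColLim (p : ℝ) (μ : Measure Ω) (X : ℕ → Ω → ℝ) (f : Ω → ℝ) : Prop where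
  fmeas : Measurable f
  fnonneg : ∀ ω, 0 ≤ f ω
  fmemLp : MemLp f (ENNReal.ofReal p) μ
  lind : ∀ A, MeasurableSet A → ∀ δ > 0, ∃ β > 0, Gen fun n =>
      ∀ (I : ℕ) (b : ℕ → ℝ), ∑ i ∈ Finset.range I, b i ^ 2 ≤ 1 → (∀ i < I, |b i| ≤ β) →
        |lpn p (μ.restrict A) (fun ω => ∑ i ∈ Finset.range I, b i * X (n i) ω) -
          gaussNorm p * √(∑ i ∈ Finset.range I, b i ^ 2) * lpn p (μ.restrict A) f| ≤ δ
  lsc : ∀ u : Ω → ℝ≥0∞, Measurable u → ∀ C, C < ∫⁻ ω, u ω * ENNReal.ofReal (f ω ^ 2) ∂μ →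
    ∀ᶠ n in hypU, C < ∫⁻ ω, u ω * ENNReal.ofReal (X n ω ^ 2) ∂μ

variable [IsFiniteMeasure μ] [Fact (1 ≤ ENNReal.ofReal p)]

lemma lpn_coeFn (F : Lp ℝ (ENNReal.ofReal p) μ) : lpn p μ F = ‖F‖ := rfl

lemma one_le_of_fact : 1 ≤ p := by
  have h : 1 ≤ ENNReal.ofReal p := Fact.out
  simpa using h

lemma continuous_lpn_restrict (A : Set Ω) :
    Continuous fun F : Lp ℝ (ENNReal.ofReal p) μ => lpn p (μ.restrict A) F := by
  refine (LipschitzWith.of_dist_le_mul (K := 1) fun F H => ?_).continuous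
  rw [Real.dist_eq, dist_eq_norm, NNReal.coe_one, one_mul, ← lpn_coeFn]
  refine (abs_lpn_sub_le one_le_of_fact ((Lp.memLp F).restrict A)
    ((Lp.memLp H).restrict A)).trans ?_
  refine (lpn_restrict_le ((Lp.memLp F).sub (Lp.memLp H)) A).trans (le_of_eq ?_)
  exact lpn_congr (Lp.coeFn_sub F H).symm

lemma coeFn_sum_smul {ι : Type*} (t : Finset ι) (b : ι → ℝ) (F : ι → Lp ℝ (ENNReal.ofReal p) μ) :
    ⇑(∑ i ∈ t, b i • F i) =ᵐ[μ] fun ω => ∑ i ∈ t, b i * F i ω := by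
  classical
  induction t using Finset.induction_on with
  | empty =>
    filter_upwards [Lp.coeFn_zero ℝ (ENNReal.ofReal p) μ] with ω h
    simpa using h
  | insert i t hi ih =>
    rw [Finset.sum_insert hi]
    filter_upwards [Lp.coeFn_add (b i • F i) (∑ i ∈ t, b i • F i), ih, Lp.coeFn_smul (b i) (F i)]
      with ω h1 h2 h3
    rw [h1, Pi.add_apply, h2, h3, Finset.sum_insert hi, Pi.smul_apply, smul_eq_mul]

/-- On the range of suitable isometries, `S` acts as a Gaussian multiple of `f`. -/
def IsGauss (S : SeqL2 →L[ℝ] Lp ℝ (ENNReal.ofReal p) μ) (f : Ω → ℝ) : Prop :=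
  ∀ A, MeasurableSet A → ∀ δ > 0, ∃ ι : SeqL2 →ₗᵢ[ℝ] SeqL2, ∀ a,
    |lpn p (μ.restrict A) (S (ι a)) - gaussNorm p * ‖a‖ * lpn p (μ.restrict A) f| ≤ δ * ‖a‖ ∧
    |lpn p (μ.restrict Aᶜ) (S (ι a)) - gaussNorm p * ‖a‖ * lpn p (μ.restrict Aᶜ) f| ≤ δ * ‖a‖

lemma block_gauss (S : SeqL2 →L[ℝ] Lp ℝ (ENNReal.ofReal p) μ) {f : Ω → ℝ} {δ β : ℝ}
    {n : ℕ → ℕ} {m : ℕ} (hm : 0 < m) (hmβ : (√m)⁻¹ ≤ β) {A : Set Ω}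
    (h : ∀ (I : ℕ) (b : ℕ → ℝ), ∑ i ∈ Finset.range I, b i ^ 2 ≤ 1 → (∀ i < I, |b i| ≤ β) →
        |lpn p (μ.restrict A) (fun ω => ∑ i ∈ Finset.range I, b i * S (l2e (n i)) ω) -
          gaussNorm p * √(∑ i ∈ Finset.range I, b i ^ 2) * lpn p (μ.restrict A) f| ≤ δ)
    {ι : SeqL2 →ₗᵢ[ℝ] SeqL2} (hι : ∀ k, ι (l2e k) = l2block n m k) (a : SeqL2) :
    |lpn p (μ.restrict A) (S (ι a)) - gaussNorm p * ‖a‖ * lpn p (μ.restrict A) f| ≤ δ * ‖a‖ := by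
  have hc : Continuous fun a : SeqL2 => lpn p (μ.restrict A) (S (ι a)) :=
    (continuous_lpn_restrict A).comp (S.continuous.comp ι.continuous)
  rw [← sub_nonneg]
  refine l2_induction (N := fun a => δ * ‖a‖ -
    |lpn p (μ.restrict A) (S (ι a)) - gaussNorm p * ‖a‖ * lpn p (μ.restrict A) f|)
    (by fun_prop) (fun K a => ?_) a
  rw [sub_nonneg, norm_sum_smul_l2e]
  set s := √(∑ k ∈ Finset.range K, a k ^ 2) with hs
  have hs0 : 0 ≤ s := Real.sqrt_nonneg _
  have hss : s ^ 2 = ∑ k ∈ Finset.range K, a k ^ 2 :=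
    Real.sq_sqrt (Finset.sum_nonneg fun _ _ => sq_nonneg _)
  rcases hs0.eq_or_lt with h0 | h0
  · have ha : ∑ k ∈ Finset.range K, a k • l2e k = 0 := by
      rw [← norm_eq_zero, norm_sum_smul_l2e, ← hs, h0]
    rw [ha, ← h0, map_zero, map_zero]
    have : lpn p (μ.restrict A) (⇑(0 : Lp ℝ (ENNReal.ofReal p) μ)) = 0 := by
      rw [lpn_congr (ae_restrict_of_ae (Lp.coeFn_zero ℝ (ENNReal.ofReal p) μ))]
      simp [lpn]
    rw [this]; simp
  · set b : ℕ → ℝ := fun i => s⁻¹ * (a (i / m) * (√m)⁻¹) with hb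
    have hbs : ∑ i ∈ Finset.range (m * K), b i ^ 2 = 1 := by
      simp only [hb, mul_pow s⁻¹]
      rw [← Finset.mul_sum, sum_sq_block hm, ← hss]
      field_simp
    have h1 := h (m * K) b hbs.le fun i hi => by
      have h2 : |a (i / m)| ≤ s := by
        refine Real.abs_le_sqrt (Finset.single_le_sum (f := fun k => a k ^ 2)
          (fun _ _ => sq_nonneg _) ?_)
        exact Finset.mem_range.2 (Nat.div_lt_of_lt_mul hi)
      rw [hb, abs_mul, abs_mul, abs_of_pos (inv_pos.2 h0), abs_of_nonneg (by positivity : 0 ≤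
        (√m)⁻¹),
        ← mul_assoc]
      refine le_trans ?_ hmβ
      have : s⁻¹ * |a (i / m)| ≤ 1 := by
        rw [inv_mul_le_iff₀ h0]; linarith
      exact mul_le_of_le_one_left (by positivity) this
    rw [hbs, Real.sqrt_one, mul_one] at h1
    have e1 : ι (∑ k ∈ Finset.range K, a k • l2e k) =
        s • ∑ i ∈ Finset.range (m * K), b i • l2e (n i) := by
      rw [map_sum, Finset.smul_sum]
      simp only [map_smul, hι]
      rw [sum_smul_l2block hm]
      refine Finset.sum_congr rfl fun i _ => ?_
      rw [smul_smul, hb, mul_inv_cancel_left₀ h0.ne']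
    have e2 : lpn p (μ.restrict A) (S (ι (∑ k ∈ Finset.range K, a k • l2e k))) =
        s * lpn p (μ.restrict A) (fun ω => ∑ i ∈ Finset.range (m * K), b i * S (l2e (n i)) ω) := by
      rw [← abs_of_pos h0, ← lpn_const_mul, e1, map_smul, map_sum]
      simp only [map_smul]
      refine lpn_congr (ae_restrict_of_ae ?_)
      filter_upwards [coeFn_sum_smul (Finset.range (m * K)) b (fun i => S (l2e (n i))),
        Lp.coeFn_smul s (∑ i ∈ Finset.range (m * K), b i • S (l2e (n i)))] with ω h3 h4
      rw [h4, Pi.smul_apply, h3, smul_eq_mul]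
    rw [e2]
    calc _ = s * |lpn p (μ.restrict A) (fun ω => ∑ i ∈ Finset.range (m * K),
        b i * S (l2e (n i)) ω) -
          gaussNorm p * lpn p (μ.restrict A) f| := by
          rw [← abs_of_pos h0, ← abs_mul, abs_of_pos h0]
          congr 1; ring
      _ ≤ s * δ := by gcongr
      _ = _ := mul_comm _ _

lemma exists_inv_sqrt_le {β : ℝ} (hβ : 0 < β) : ∃ m : ℕ, 0 < m ∧ (√m)⁻¹ ≤ β := by
  obtain ⟨m, hm⟩ := exists_nat_gt (β⁻¹ ^ 2)
  have h0 : (0 : ℝ) < m := lt_of_le_of_lt (by positivity) hm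
  refine ⟨m, by exact_mod_cast h0, ?_⟩
  rw [inv_le_comm₀ (by positivity) hβ]
  exact Real.le_sqrt_of_sq_le hm.le

lemma ColLim.isGauss {S : SeqL2 →L[ℝ] Lp ℝ (ENNReal.ofReal p) μ} {f : Ω → ℝ}
    (h : ColLim p μ (fun n => S (l2e n)) f) : IsGauss S f := by
  intro A hA δ hδ
  obtain ⟨β₁, hβ₁, hg₁⟩ := h.lind A hA δ hδ
  obtain ⟨β₂, hβ₂, hg₂⟩ := h.lind Aᶜ hA.compl δ hδ
  obtain ⟨n, ⟨hn₁, hn₂⟩, hn⟩ := ((hg₁.and hg₂).and gen_strictMono).exists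
  obtain ⟨m, hm, hmβ⟩ := exists_inv_sqrt_le (lt_min hβ₁ hβ₂)
  obtain ⟨ι, hι⟩ := exists_isometry_of_orthonormal (orthonormal_l2block hn.injective hm)
  exact ⟨ι, fun a => ⟨block_gauss S hm (hmβ.trans (min_le_left _ _)) hn₁ hι a,
    block_gauss S hm (hmβ.trans (min_le_right _ _)) hn₂ hι a⟩⟩

end collim

section collim
variable {Ω : Type*} [MeasurableSpace Ω] {μ : Measure Ω} {p : ℝ}

lemma eventually_lt_lintegral_of_setwise {κ : Measure Ω} {κn : ℕ → Measure Ω}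
    (h : ∀ B, MeasurableSet B → Filter.Tendsto (fun n => κn n B) hypU (nhds (κ B)))
    {u : Ω → ℝ≥0∞} {C : ℝ≥0∞} (hC : C < ∫⁻ ω, u ω ∂κ) : ∀ᶠ n in hypU, C < ∫⁻ ω, u ω ∂(κn n) := by
  rw [lintegral_eq_nnreal] at hC
  obtain ⟨s, hs⟩ := lt_iSup_iff.1 hC
  obtain ⟨hsu, hs⟩ := lt_iSup_iff.1 hs
  set t : SimpleFunc Ω ℝ≥0∞ := s.map (fun x : NNReal => (x : ℝ≥0∞)) with ht
  have hl : Filter.Tendsto (fun n => t.lintegral (κn n)) hypU (nhds (t.lintegral κ)) := by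
    simp only [SimpleFunc.lintegral]
    refine tendsto_finsetSum _ fun x hx => ?_
    refine ENNReal.Tendsto.const_mul (h _ (t.measurableSet_preimage _)) (Or.inr ?_)
    obtain ⟨ω, rfl⟩ := SimpleFunc.mem_range.1 hx
    simp [ht]
  filter_upwards [hl.eventually (lt_mem_nhds hs)] with n hn
  refine hn.trans_le ?_
  rw [← SimpleFunc.lintegral_eq_lintegral]
  exact lintegral_mono hsu

lemma WLim.lsc [IsFiniteMeasure μ] {r : ℝ} {X : ℕ → Ω → ℝ} {f : Ω → ℝ} (h : WLim r μ X f)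
    {u : Ω → ℝ≥0∞} (hu : Measurable u) {C : ℝ≥0∞}
    (hC : C < ∫⁻ ω, u ω * ENNReal.ofReal (f ω ^ 2) ∂μ) :
    ∀ᶠ n in hypU, C < ∫⁻ ω, u ω * ENNReal.ofReal (X n ω ^ 2) ∂μ := by
  have hXm := h.meas
  have hfm := h.fmeas
  have e : ∀ F : Ω → ℝ, Measurable F → ∫⁻ ω, u ω * ENNReal.ofReal (F ω ^ 2) ∂μ =
      ∫⁻ ω, u ω ∂(μ.withDensity fun ω => ENNReal.ofReal (F ω ^ 2)) := fun F hF => by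
    rw [lintegral_withDensity_eq_lintegral_mul _ (by fun_prop) hu]
    exact lintegral_congr fun ω => mul_comm _ _
  rw [e f h.fmeas] at hC
  have e2 : ∀ F : Ω → ℝ, MemLp F (ENNReal.ofReal r) μ → ∀ B, MeasurableSet B →
      (μ.withDensity fun ω => ENNReal.ofReal (F ω ^ 2)) B = ENNReal.ofReal (∫ ω in B,
        F ω ^ 2 ∂μ) := by
    intro F hF B hB
    rw [withDensity_apply _ hB, ofReal_integral_eq_lintegral_ofReal
      (integrable_sq_of_memLp h.two_le hF).integrableOn
      (Filter.Eventually.of_forall fun ω => sq_nonneg _)]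
  simp only [e _ (hXm _)]
  refine eventually_lt_lintegral_of_setwise (fun B hB => ?_) hC
  simp only [e2 _ h.fmemLp B hB, e2 _ (h.memLp _) B hB]
  exact ENNReal.tendsto_ofReal (h.sq B hB)

lemma WLim.colLim [IsFiniteMeasure μ] (hp : 2 ≤ p) {X : ℕ → Ω → ℝ} {f : Ω → ℝ} (h : WLim p μ X f) :
    ColLim p μ X f where
  fmeas := h.fmeas
  fnonneg := h.fnonneg
  fmemLp := h.fmemLp
  lind A hA δ hδ := by
    have h' : WLim (max p 2) μ X f := by rwa [max_eq_left hp]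
    exact h'.lindeberg (by linarith) hA hδ
  lsc u hu C hC := h.lsc hu hC

section weighted
variable {φ : Ω → ℝ}

/-- The measure `φ ^ p μ`. -/
noncomputable def powDensity (μ : Measure Ω) (φ : Ω → ℝ) (p : ℝ) : Measure Ω :=
  μ.withDensity fun ω => ENNReal.ofReal (φ ω ^ p)

lemma lintegral_powDensity (hφ : Measurable φ) (F : Ω → ℝ≥0∞) :
    ∫⁻ ω, F ω ∂(powDensity μ φ p) = ∫⁻ ω, ENNReal.ofReal (φ ω ^ p) * F ω ∂μ :=
  lintegral_withDensity_eq_lintegral_mul_non_measurable _ (by fun_prop)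
    (Filter.Eventually.of_forall fun _ => ENNReal.ofReal_lt_top) _

lemma eLpNorm_powDensity (hp : 0 < p) (hφ : Measurable φ) (hφ1 : ∀ ω, 0 < φ ω) (F : Ω → ℝ) :
    eLpNorm F (ENNReal.ofReal p) (powDensity μ φ p) =
      eLpNorm (fun ω => φ ω * F ω) (ENNReal.ofReal p) μ := by
  rw [eLpNorm_eq_lintegral_rpow_enorm_toReal (by simpa) (by simp),
    eLpNorm_eq_lintegral_rpow_enorm_toReal (by simpa) (by simp), lintegral_powDensity hφ,
    ENNReal.toReal_ofReal hp.le]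
  congr 1
  refine lintegral_congr fun ω => ?_
  rw [enorm_mul, ENNReal.mul_rpow_of_nonneg _ _ hp.le, Real.enorm_of_nonneg (hφ1 ω).le,
    ENNReal.ofReal_rpow_of_pos (hφ1 ω)]

lemma powDensity_restrict {A : Set Ω} (hA : MeasurableSet A) :
    (powDensity μ φ p).restrict A = powDensity (μ.restrict A) φ p :=
  restrict_withDensity hA _

lemma lpn_powDensity (hp : 0 < p) (hφ : Measurable φ) (hφ1 : ∀ ω, 0 < φ ω) (F : Ω → ℝ) :
    lpn p (powDensity μ φ p) F = lpn p μ (fun ω => φ ω * F ω) := by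
  rw [lpn, lpn, eLpNorm_powDensity hp hφ hφ1]

lemma memLp_powDensity (hp : 0 < p) (hφ : Measurable φ) (hφ1 : ∀ ω, 0 < φ ω) {F : Ω → ℝ}
    (hF : Measurable F) : MemLp F (ENNReal.ofReal p) (powDensity μ φ p) ↔
      MemLp (fun ω => φ ω * F ω) (ENNReal.ofReal p) μ := by
  rw [MemLp, MemLp, eLpNorm_powDensity hp hφ hφ1]
  exact and_congr_left fun _ => ⟨fun _ => (hφ.mul hF).aestronglyMeasurable,
    fun _ => hF.aestronglyMeasurable⟩

lemma WLim.colLim_of_density [IsFiniteMeasure μ] (hp : 1 ≤ p) (hp2 : p ≤ 2) (hφ : Measurable φ)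
    (hφ1 : ∀ ω, 0 < φ ω)
    [IsFiniteMeasure (powDensity μ φ p)] {X Y : ℕ → Ω → ℝ} {f : Ω → ℝ}
    (hXm : ∀ n, MemLp (X n) (ENNReal.ofReal p) μ)
    (h : WLim 2 (powDensity μ φ p) Y f) (hYX : ∀ n ω, |φ ω * Y n ω| ≤ |X n ω|)
    (hd : ∀ ε > 0, ∀ᶠ n in hypU, lpn p μ (fun ω => X n ω - φ ω * Y n ω) ≤ ε) :
    ColLim p μ X (fun ω => φ ω * f ω) where
  fmeas := hφ.mul h.fmeas
  fnonneg ω := mul_nonneg (hφ1 ω).le (h.fnonneg ω)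
  fmemLp := (memLp_powDensity (by linarith) hφ hφ1 h.fmeas).1 (memLp_ofReal_mono hp2 h.fmemLp)
  lind A hA δ hδ := by
    have hp0 : 0 < p := by linarith
    have h' : WLim (max p 2) (powDensity μ φ p) Y f := by rwa [max_eq_right hp2]
    obtain ⟨β, hβ, hg⟩ := h'.lindeberg hp hA (half_pos hδ)
    have hYm : ∀ n, MemLp (fun ω => φ ω * Y n ω) (ENNReal.ofReal p) μ := fun n =>
      (memLp_powDensity hp0 hφ hφ1 (h.meas n)).1 (memLp_ofReal_mono hp2 (h.memLp n))
    have hsmall := Gen.of_eventually fun i : ℕ => hd (δ / 4 * (1 / 2) ^ i) (by positivity)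
    refine ⟨min β 1, by positivity, (hg.and hsmall).mono ?_⟩
    rintro n ⟨hn, hs⟩ I b hb hbβ
    have h1 := hn I b hb fun i hi => (hbβ i hi).trans (min_le_left _ _)
    rw [powDensity_restrict hA, lpn_powDensity hp0 hφ hφ1, lpn_powDensity hp0 hφ hφ1] at h1
    have e : (fun ω => φ ω * ∑ i ∈ Finset.range I, b i * Y (n i) ω) =
        fun ω => ∑ i ∈ Finset.range I, b i * (fun ω => φ ω * Y (n i) ω) ω := by
      funext ω
      rw [Finset.mul_sum]
      exact Finset.sum_congr rfl fun i _ => by ring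
    rw [e] at h1
    have h2 := abs_lpn_sub_le hp
      (memLp_sum_mul (Finset.range I) (fun i _ => (hXm (n i)).restrict A) b)
      (memLp_sum_mul (Finset.range I) (fun i _ => (hYm (n i)).restrict A) b)
    have e2 : (fun ω => ∑ i ∈ Finset.range I, b i * X (n i) ω -
        ∑ i ∈ Finset.range I, b i * (fun ω => φ ω * Y (n i) ω) ω) =
        fun ω => ∑ i ∈ Finset.range I, b i * (fun ω => X (n i) ω - φ ω * Y (n i) ω) ω := by
      funext ω
      rw [← Finset.sum_sub_distrib]
      exact Finset.sum_congr rfl fun i _ => by ring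
    have h3 : lpn p (μ.restrict A) (fun ω => ∑ i ∈ Finset.range I, b i * X (n i) ω -
        ∑ i ∈ Finset.range I, b i * (fun ω => φ ω * Y (n i) ω) ω) ≤ δ / 2 := by
      rw [e2]
      refine (lpn_sum_mul_le _ hp (F := fun i ω => X (n i) ω - φ ω * Y (n i) ω)
        (fun i _ => ((hXm _).sub (hYm _)).restrict A) b).trans ?_
      calc _ ≤ ∑ i ∈ Finset.range I, 1 * (δ / 4 * (1 / 2) ^ i) := by
            refine Finset.sum_le_sum fun i hi => ?_
            refine mul_le_mul ((hbβ i (Finset.mem_range.1 hi)).trans (min_le_right _ _)) ?_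
              lpn_nonneg zero_le_one
            exact (lpn_restrict_le ((hXm _).sub (hYm _)) A).trans (hs i)
        _ = δ / 4 * ∑ i ∈ Finset.range I, (1 / 2 : ℝ) ^ i := by
            rw [Finset.mul_sum]
            exact Finset.sum_congr rfl fun i _ => by ring
        _ ≤ δ / 4 * 2 := by
            gcongr
            exact sum_geometric_two_le I
        _ = δ / 2 := by ring
    have h4 := abs_le.1 h1
    have h5 := abs_le.1 (h2.trans h3)
    rw [abs_le]
    constructor <;> linarith [h4.1, h4.2, h5.1, h5.2]
  lsc u hu C hC := by
    have hfm := h.fmeas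
    have e : ∀ F : Ω → ℝ, ∫⁻ ω, u ω * ENNReal.ofReal ((φ ω * F ω) ^ 2) ∂μ =
        ∫⁻ ω, (u ω * ENNReal.ofReal (φ ω ^ (2 - p))) * ENNReal.ofReal (F ω ^ 2)
          ∂(powDensity μ φ p) := fun F => by
      rw [lintegral_powDensity hφ]
      refine lintegral_congr fun ω => ?_
      have : (φ ω * F ω) ^ 2 = φ ω ^ p * (φ ω ^ (2 - p) * F ω ^ 2) := by
        rw [← mul_assoc, ← Real.rpow_add (hφ1 ω), add_sub_cancel, mul_pow]
        norm_num
      rw [this, ENNReal.ofReal_mul (Real.rpow_nonneg (hφ1 ω).le _),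
        ENNReal.ofReal_mul (Real.rpow_nonneg (hφ1 ω).le _)]
      ring
    rw [e] at hC
    refine (h.lsc (by fun_prop) hC).mono fun n hn => hn.trans_le ?_
    rw [← e]
    refine lintegral_mono fun ω => ?_
    dsimp only
    have := sq_le_sq.2 (hYX n ω)
    gcongr

end weighted
end collim

section lpfun
variable {Ω : Type*} [MeasurableSpace Ω] {μ : Measure Ω} {p q : ℝ}

lemma integrable_mul_of_holder (hpq : p.HolderConjugate q) {g h : Ω → ℝ}
    (hg : MemLp g (ENNReal.ofReal q) μ) (hh : MemLp h (ENNReal.ofReal p) μ) :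
    Integrable (fun ω => g ω * h ω) μ := by
  have := hpq.symm.ennrealOfReal
  exact hg.integrable_mul hh

lemma integral_abs_mul_le_lpn (hpq : p.HolderConjugate q) {g h : Ω → ℝ}
    (hg : MemLp g (ENNReal.ofReal q) μ) (hh : MemLp h (ENNReal.ofReal p) μ) :
    ∫ ω, |g ω| * |h ω| ∂μ ≤ lpn q μ g * lpn p μ h := by
  rw [lpn_eq hpq.symm.pos hg, lpn_eq hpq.pos hh]
  exact integral_mul_norm_le_Lp_mul_Lq hpq.symm hg hh

lemma abs_integral_mul_le_lpn (hpq : p.HolderConjugate q) {g h : Ω → ℝ}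
    (hg : MemLp g (ENNReal.ofReal q) μ) (hh : MemLp h (ENNReal.ofReal p) μ) :
    |∫ ω, g ω * h ω ∂μ| ≤ lpn q μ g * lpn p μ h := by
  refine (abs_integral_le_integral_abs).trans ?_
  simp only [abs_mul]
  exact integral_abs_mul_le_lpn hpq hg hh

/-- Integration against a function in `L_q`, as a functional on `L_p`. -/
noncomputable def lpFunctional [Fact (1 ≤ ENNReal.ofReal p)] (hpq : p.HolderConjugate q) {g : Ω → ℝ}
    (hg : MemLp g (ENNReal.ofReal q) μ) : Lp ℝ (ENNReal.ofReal p) μ →L[ℝ] ℝ :=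
  LinearMap.mkContinuous
    { toFun := fun h => ∫ ω, g ω * h ω ∂μ
      map_add' := fun h k => by
        rw [← integral_add (integrable_mul_of_holder hpq hg (Lp.memLp h))
          (integrable_mul_of_holder hpq hg (Lp.memLp k))]
        refine integral_congr_ae ?_
        filter_upwards [Lp.coeFn_add h k] with ω hω
        rw [hω, Pi.add_apply, mul_add]
      map_smul' := fun c h => by
        rw [RingHom.id_apply, smul_eq_mul, ← integral_const_mul]
        refine integral_congr_ae ?_
        filter_upwards [Lp.coeFn_smul c h] with ω hω
        rw [hω, Pi.smul_apply, smul_eq_mul]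
        ring } (lpn q μ g) fun h => abs_integral_mul_le_lpn hpq hg (Lp.memLp h)

variable [Fact (1 ≤ ENNReal.ofReal p)]

lemma lpFunctional_apply (hpq : p.HolderConjugate q) {g : Ω → ℝ}
    (hg : MemLp g (ENNReal.ofReal q) μ) (h : Lp ℝ (ENNReal.ofReal p) μ) :
    lpFunctional hpq hg h = ∫ ω, g ω * h ω ∂μ := rfl

lemma tendsto_integral_mul_l2e (hpq : p.HolderConjugate q) {g : Ω → ℝ}
    (hg : MemLp g (ENNReal.ofReal q) μ) (S : SeqL2 →L[ℝ] Lp ℝ (ENNReal.ofReal p) μ) :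
    Filter.Tendsto (fun n => ∫ ω, g ω * S (l2e n) ω ∂μ) hypU (nhds 0) :=
  tendsto_functional_l2e ((lpFunctional hpq hg).comp S)

lemma tendsto_setIntegral_l2e [IsFiniteMeasure μ] (hp : 1 < p)
    (S : SeqL2 →L[ℝ] Lp ℝ (ENNReal.ofReal p) μ) {B : Set Ω} (hB : MeasurableSet B) :
    Filter.Tendsto (fun n => ∫ ω in B, S (l2e n) ω ∂μ) hypU (nhds 0) := by
  have hg : MemLp (B.indicator fun _ => (1 : ℝ)) (ENNReal.ofReal p.conjExponent) μ :=
    (memLp_const 1).indicator hB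
  have h := tendsto_integral_mul_l2e (Real.HolderConjugate.conjExponent hp) hg S
  refine h.congr fun n => ?_
  rw [← integral_indicator hB]
  congr 1
  funext ω
  by_cases hω : ω ∈ B <;> simp [hω]

lemma measurable_coeFn (F : Lp ℝ (ENNReal.ofReal p) μ) : Measurable F :=
  (Lp.stronglyMeasurable F).measurable

lemma norm_apply_l2e_le [IsFiniteMeasure μ] (S : SeqL2 →L[ℝ] Lp ℝ (ENNReal.ofReal p) μ) (n : ℕ) :
    lpn p μ (S (l2e n)) ≤ ‖S‖ := by
  rw [lpn_coeFn]
  simpa [norm_l2e] using S.le_opNorm (l2e n)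

lemma exists_wLim_of_two_lt [IsFiniteMeasure μ] (hp : 2 < p)
    (S : SeqL2 →L[ℝ] Lp ℝ (ENNReal.ofReal p) μ) : ∃ f, WLim p μ (fun n => S (l2e n)) f :=
  exists_wLim hp.le (fun n => measurable_coeFn _) (fun n => Lp.memLp _) (norm_apply_l2e_le S)
    (fun _ hB => tendsto_setIntegral_l2e (by linarith) S hB)
    (equi_of_moment hp (fun n => measurable_coeFn _) (fun n => Lp.memLp _) (norm_apply_l2e_le S))

end lpfun

section proj
variable {Ω : Type*} [MeasurableSpace Ω] {μ : Measure Ω} [IsFiniteMeasure μ] {p q : ℝ}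

/-- Homogeneous form of a Lindeberg estimate along blocks of length `m`. -/
lemma lpn_block_le {Y : ℕ → Ω → ℝ} {δ β C : ℝ} {m : ℕ} (hm : 0 < m) (hmβ : (√m)⁻¹ ≤ β)
    (h : ∀ (I : ℕ) (b : ℕ → ℝ), ∑ i ∈ Finset.range I, b i ^ 2 ≤ 1 → (∀ i < I, |b i| ≤ β) →
        |lpn p μ (fun ω => ∑ i ∈ Finset.range I, b i * Y i ω) -
          √(∑ i ∈ Finset.range I, b i ^ 2) * C| ≤ δ) (K : ℕ) (a : ℕ → ℝ) :
    lpn p μ (fun ω => ∑ i ∈ Finset.range (m * K), (a (i / m) * (√m)⁻¹) * Y i ω) ≤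
      (C + δ) * √(∑ k ∈ Finset.range K, a k ^ 2) := by
  set s := √(∑ k ∈ Finset.range K, a k ^ 2) with hs
  have hs0 : 0 ≤ s := Real.sqrt_nonneg _
  have hss : s ^ 2 = ∑ k ∈ Finset.range K, a k ^ 2 :=
    Real.sq_sqrt (Finset.sum_nonneg fun _ _ => sq_nonneg _)
  have h2 : ∀ i ∈ Finset.range (m * K), |a (i / m)| ≤ s := fun i hi =>
    Real.abs_le_sqrt (Finset.single_le_sum (f := fun k => a k ^ 2) (fun _ _ => sq_nonneg _)
      (Finset.mem_range.2 (Nat.div_lt_of_lt_mul (Finset.mem_range.1 hi))))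
  rcases hs0.eq_or_lt with h0 | h0
  · have : (fun ω => ∑ i ∈ Finset.range (m * K), (a (i / m) * (√m)⁻¹) * Y i ω) = fun _ => 0 := by
      funext ω
      refine Finset.sum_eq_zero fun i hi => ?_
      have := h2 i hi
      rw [← h0] at this
      rw [abs_nonpos_iff.1 this]; ring
    rw [this, ← h0]
    simp [lpn]
  · set b : ℕ → ℝ := fun i => s⁻¹ * (a (i / m) * (√m)⁻¹) with hb
    have hbs : ∑ i ∈ Finset.range (m * K), b i ^ 2 = 1 := by
      simp only [hb, mul_pow s⁻¹]
      rw [← Finset.mul_sum, sum_sq_block hm, ← hss]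
      field_simp
    have h1 := h (m * K) b hbs.le fun i hi => by
      rw [hb, abs_mul, abs_mul, abs_of_pos (inv_pos.2 h0), abs_of_nonneg (by positivity : 0 ≤
        (√m)⁻¹),
        ← mul_assoc]
      refine le_trans ?_ hmβ
      have : s⁻¹ * |a (i / m)| ≤ 1 := by
        rw [inv_mul_le_iff₀ h0]; linarith [h2 i (Finset.mem_range.2 hi)]
      exact mul_le_of_le_one_left (by positivity) this
    rw [hbs, Real.sqrt_one, one_mul] at h1
    have e : (fun ω => ∑ i ∈ Finset.range (m * K), (a (i / m) * (√m)⁻¹) * Y i ω) =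
        fun ω => s * ∑ i ∈ Finset.range (m * K), b i * Y i ω := by
      funext ω
      rw [Finset.mul_sum]
      refine Finset.sum_congr rfl fun i _ => ?_
      rw [hb]; field_simp
    rw [e, lpn_const_mul, abs_of_pos h0, mul_comm]
    exact mul_le_mul_of_nonneg_right (by linarith [(abs_le.1 h1).2]) hs0

lemma abs_block_entry_le {g : ℕ → ℕ → ℝ} {n : ℕ → ℕ} {η : ℝ} (hη : 0 ≤ η) {m : ℕ} (hm : 0 < m)
    (h : ∀ i j, |g (n i) (n j) - if i = j then 1 else 0| ≤ η * ((1 / 2) ^ i * (1 / 2) ^ j))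
    (k l : ℕ) :
    |∑ i ∈ Finset.range m, (√m)⁻¹ * ∑ j ∈ Finset.range m, (√m)⁻¹ * g (n (m * k + i))
      (n (m * l + j)) -
      if k = l then 1 else 0| ≤ η * m * ((1 / 2) ^ k * (1 / 2) ^ l) := by
  have hm' : (0 : ℝ) < m := by exact_mod_cast hm
  have hsq : (√m)⁻¹ * (√m)⁻¹ = (m : ℝ)⁻¹ := by
    rw [← mul_inv, Real.mul_self_sqrt hm'.le]
  have hδ : ∀ i ∈ Finset.range m, ∑ j ∈ Finset.range m,
      (if m * k + i = m * l + j then (1 : ℝ) else 0) = if k = l then 1 else 0 := by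
    intro i hi
    have hd : ∀ j ∈ Finset.range m, (if m * k + i = m * l + j then (1 : ℝ) else 0) =
        if j = i then (if k = l then 1 else 0) else 0 := by
      intro j hj
      rw [Finset.mem_range] at hi hj
      have : m * k + i = m * l + j ↔ j = i ∧ k = l := by
        constructor
        · intro e
          have e1 := congrArg (· / m) e
          have e2 := congrArg (· % m) e
          simp only [Nat.mul_add_div hm, Nat.div_eq_of_lt hi, Nat.div_eq_of_lt hj, add_zero] at e1
          simp only [Nat.mul_add_mod, Nat.mod_eq_of_lt hi, Nat.mod_eq_of_lt hj] at e2
          exact ⟨e2.symm, e1⟩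
        · rintro ⟨rfl, rfl⟩; rfl
      simp only [this]
      split_ifs <;> simp_all
    rw [Finset.sum_congr rfl hd, Finset.sum_ite_eq' _ _ _, if_pos hi]
  have e : ∑ i ∈ Finset.range m, (√m)⁻¹ * ∑ j ∈ Finset.range m, (√m)⁻¹ * g (n (m * k + i))
      (n (m * l + j)) -
      (if k = l then (1 : ℝ) else 0) = (m : ℝ)⁻¹ * ∑ i ∈ Finset.range m, ∑ j ∈ Finset.range m,
        (g (n (m * k + i)) (n (m * l + j)) - if m * k + i = m * l + j then 1 else 0) := by
    simp only [Finset.sum_sub_distrib]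
    rw [Finset.sum_congr rfl hδ, mul_sub, Finset.sum_const, Finset.card_range, nsmul_eq_mul,
      inv_mul_cancel_left₀ hm'.ne']
    congr 1
    simp only [← Finset.mul_sum]
    rw [← mul_assoc, hsq]
  rw [e, abs_mul, abs_of_pos (inv_pos.2 hm')]
  have hb : ∀ i ∈ Finset.range m, ∀ j ∈ Finset.range m,
      |g (n (m * k + i)) (n (m * l + j)) - if m * k + i = m * l + j then 1 else 0| ≤
        η * ((1 / 2) ^ k * (1 / 2) ^ l) := by
    intro i _ j _
    refine (h _ _).trans (mul_le_mul_of_nonneg_left (mul_le_mul ?_ ?_ (by positivity)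
      (by positivity)) hη)
    · exact pow_le_pow_of_le_one (by norm_num) (by norm_num) (by nlinarith)
    · exact pow_le_pow_of_le_one (by norm_num) (by norm_num) (by nlinarith)
  rw [inv_mul_le_iff₀ hm']
  calc _ ≤ ∑ i ∈ Finset.range m, ∑ j ∈ Finset.range m,
        |g (n (m * k + i)) (n (m * l + j)) - if m * k + i = m * l + j then 1 else 0| :=
        (Finset.abs_sum_le_sum_abs _ _).trans
          (Finset.sum_le_sum fun i _ => Finset.abs_sum_le_sum_abs _ _)
    _ ≤ ∑ i ∈ Finset.range m, ∑ j ∈ Finset.range m, η * ((1 / 2) ^ k * (1 / 2) ^ l) :=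
        Finset.sum_le_sum fun i hi => Finset.sum_le_sum fun j hj => hb i hi j hj
    _ = _ := by simp only [Finset.sum_const, Finset.card_range, nsmul_eq_mul]; ring

lemma gen_biorthogonal {g : ℕ → ℕ → ℝ} (h1 : Filter.Tendsto (fun n => g n n) hypU (nhds 1))
    (h0 : ∀ m, Filter.Tendsto (fun n => g n m) hypU (nhds 0))
    (h0' : ∀ m, Filter.Tendsto (fun n => g m n) hypU (nhds 0)) {η : ℝ} (hη : 0 < η) :
    Gen fun n => ∀ i j, |g (n i) (n j) - if i = j then 1 else 0| ≤
      η * ((1 / 2) ^ i * (1 / 2) ^ j) := by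
  have key : ∀ {u : ℕ → ℝ} {l : ℝ}, Filter.Tendsto u hypU (nhds l) → ∀ {c : ℝ}, 0 < c →
      ∀ᶠ k in hypU, |u k - l| ≤ c := fun hu c hc => by
    filter_upwards [hu.eventually (Metric.closedBall_mem_nhds _ hc)] with k hk
    rwa [← Real.dist_eq]
  refine (Gen.of_step (Q := fun i n k => (∀ j ∈ Finset.range i,
      |g k (n j) - 0| ≤ η * (1 / 4) ^ i ∧ |g (n j) k - 0| ≤ η * (1 / 4) ^ i) ∧
      |g k k - 1| ≤ η * (1 / 4) ^ i) (fun i n => ?_) ?_).mono ?_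
  · refine Filter.Eventually.and ?_ (key h1 (by positivity))
    rw [Filter.eventually_all_finset]
    exact fun j _ => (key (h0 _) (by positivity)).and (key (h0' _) (by positivity))
  · rintro i n n' k hn ⟨ha, hb⟩
    refine ⟨fun j hj => ?_, hb⟩
    rw [← hn j (Finset.mem_range.1 hj)]
    exact ha j hj
  · intro n hn i j
    have e : ∀ i j : ℕ, i ≤ j → η * (1 / 4 : ℝ) ^ j ≤ η * ((1 / 2) ^ i * (1 / 2) ^ j) := by
      intro i j hij
      refine mul_le_mul_of_nonneg_left ?_ hη.le
      have : (1 / 4 : ℝ) ^ j = (1 / 2) ^ j * (1 / 2) ^ j := by rw [← mul_pow]; norm_num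
      rw [this]
      exact mul_le_mul_of_nonneg_right (pow_le_pow_of_le_one (by norm_num) (by norm_num) hij)
        (by positivity)
    rcases lt_trichotomy i j with h | h | h
    · rw [if_neg h.ne]
      exact ((hn j).1 i (Finset.mem_range.2 h)).2.trans (e i j h.le)
    · subst h
      rw [if_pos rfl]
      exact (hn i).2.trans (e i i le_rfl)
    · rw [if_neg h.ne']
      refine ((hn i).1 j (Finset.mem_range.2 h)).1.trans ((e j i h.le).trans (le_of_eq (by ring)))

variable [Fact (1 ≤ ENNReal.ofReal p)]

set_option maxHeartbeats 1000000 in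
/-- A weakly null sequence in `L_q` which is asymptotically biorthogonal to the images of the unit
vectors yields an almost left inverse of `X` on a block subspace. -/
theorem exists_left_inverse_of_dual (hpq : p.HolderConjugate q)
    (X : SeqL2 →L[ℝ] Lp ℝ (ENNReal.ofReal p) μ) {D : ℕ → Ω → ℝ} {f : Ω → ℝ}
    (hD : WLim (max q 2) μ D f)
    (h1 : Filter.Tendsto (fun n => ∫ ω, D n ω * X (l2e n) ω ∂μ) hypU (nhds 1))
    (h0 : ∀ m, Filter.Tendsto (fun n => ∫ ω, D n ω * X (l2e m) ω ∂μ) hypU (nhds 0))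
    {κ : ℝ} (hκ : 0 < κ) :
    ∃ (ι : SeqL2 →ₗᵢ[ℝ] SeqL2) (V : Lp ℝ (ENNReal.ofReal p) μ →L[ℝ] SeqL2),
      ‖V‖ ≤ gaussNorm q * lpn q μ f + κ ∧ ∀ a, ‖V (X (ι a)) - a‖ ≤ κ * ‖a‖ := by
  have hq : 1 ≤ q := hpq.symm.lt.le
  have hDq : ∀ n, MemLp (D n) (ENNReal.ofReal q) μ := fun n =>
    memLp_ofReal_mono (le_max_left _ _) (hD.memLp n)
  obtain ⟨β, hβ, hg⟩ := hD.lindeberg hq MeasurableSet.univ hκ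
  obtain ⟨m, hm, hmβ⟩ := exists_inv_sqrt_le hβ
  have hm' : (0 : ℝ) < m := by exact_mod_cast hm
  set g : ℕ → ℕ → ℝ := fun i j => ∫ ω, D i ω * X (l2e j) ω ∂μ with hgdef
  have hη : 0 < κ / (4 * m) := by positivity
  obtain ⟨n, ⟨hn, hbi⟩, hmono⟩ := ((hg.and (gen_biorthogonal (g := g) h1 h0
    (fun i => tendsto_integral_mul_l2e hpq (hDq i) X) hη)).and gen_strictMono).exists
  simp only [Measure.restrict_univ] at hn
  have hblk := lpn_block_le (Y := fun i => D (n i)) (p := q) (δ := κ) (β := β)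
    (C := gaussNorm q * lpn q μ f) hm hmβ (fun I b hb hbβ => by
      have := hn I b hb hbβ
      rwa [show √(∑ i ∈ Finset.range I, b i ^ 2) * (gaussNorm q * lpn q μ f) =
        gaussNorm q * √(∑ i ∈ Finset.range I, b i ^ 2) * lpn q μ f by ring])
  set φ : ℕ → Lp ℝ (ENNReal.ofReal p) μ →L[ℝ] ℝ := fun k =>
    ∑ i ∈ Finset.range m, (√m)⁻¹ • lpFunctional hpq (hDq (n (m * k + i))) with hφ
  have hφa : ∀ k x, φ k x = ∑ i ∈ Finset.range m, (√m)⁻¹ * ∫ ω, D (n (m * k + i)) ω * x ω ∂μ := by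
    intro k x
    simp [hφ, lpFunctional_apply]
  obtain ⟨V, hV, hVφ⟩ := exists_operator_of_functionals φ
    (C := gaussNorm q * lpn q μ f + κ)
    (add_nonneg (mul_nonneg (gaussNorm_nonneg _) lpn_nonneg) hκ.le) (fun K a x => by
      have e : ∑ k ∈ Finset.range K, a k * φ k x =
          ∫ ω, (∑ i ∈ Finset.range (m * K), (a (i / m) * (√m)⁻¹) * D (n i) ω) * x ω ∂μ := by
        simp only [Finset.sum_mul]
        rw [integral_finsetSum _ (fun i _ => by
          simp only [mul_assoc]
          exact ((integrable_mul_of_holder hpq (hDq (n i)) (Lp.memLp x)).const_mul _).const_mul _)]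
        rw [← sum_block]
        refine Finset.sum_congr rfl fun k _ => ?_
        rw [hφa, Finset.mul_sum]
        refine Finset.sum_congr rfl fun i hi => ?_
        rw [Nat.mul_add_div hm, Nat.div_eq_of_lt (Finset.mem_range.1 hi), add_zero]
        simp only [mul_assoc]
        rw [integral_const_mul, integral_const_mul]
      rw [e]
      refine (le_abs_self _).trans ((abs_integral_mul_le_lpn hpq
        (memLp_sum_mul _ (fun i _ => hDq (n i)) _) (Lp.memLp x)).trans ?_)
      rw [lpn_coeFn]
      exact mul_le_mul_of_nonneg_right (hblk K a) (norm_nonneg _))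
  obtain ⟨ι, hι⟩ := exists_isometry_of_orthonormal (orthonormal_l2block hmono.injective hm)
  refine ⟨ι, V, hV, fun a => ?_⟩
  set R : SeqL2 →L[ℝ] SeqL2 := (V.comp X).comp ι.toContinuousLinearMap -
    ContinuousLinearMap.id ℝ SeqL2 with hR
  change ‖R a‖ ≤ κ * ‖a‖
  refine R.norm_le_of_l2e (fun l => norm_le_of_apply_le fun k => ?_) a
  have e : R (l2e l) k = ∑ i ∈ Finset.range m, (√m)⁻¹ * ∑ j ∈ Finset.range m,
      (√m)⁻¹ * g (n (m * k + i)) (n (m * l + j)) - if k = l then 1 else 0 := by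
    have e1 : R (l2e l) k = φ k (X (l2block n m l)) - l2e l k := by
      rw [← hVφ, ← hι]; rfl
    rw [e1, l2e_apply]
    congr 1
    · rw [hφa]
      refine Finset.sum_congr rfl fun i _ => ?_
      congr 1
      rw [← lpFunctional_apply hpq (hDq _), l2block, map_sum, map_sum]
      refine Finset.sum_congr rfl fun j _ => ?_
      rw [map_smul, map_smul, lpFunctional_apply, smul_eq_mul]
  rw [e]
  refine (abs_block_entry_le hη.le hm hbi k l).trans (le_of_eq ?_)
  field_simp
  ring

end proj

section projtwo
variable {Ω : Type*} [MeasurableSpace Ω] {μ : Measure Ω} [IsFiniteMeasure μ] {p q r : ℝ}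

lemma tendsto_integral_mul_simple (w : SimpleFunc Ω ℝ) {Z : ℕ → Ω → ℝ} {z : Ω → ℝ}
    (hZ : ∀ n, Integrable (Z n) μ) (hz : Integrable z μ)
    (h : ∀ B, MeasurableSet B →
      Filter.Tendsto (fun n => ∫ ω in B, Z n ω ∂μ) hypU (nhds (∫ ω in B, z ω ∂μ))) :
    Filter.Tendsto (fun n => ∫ ω, Z n ω * w ω ∂μ) hypU (nhds (∫ ω, z ω * w ω ∂μ)) := by
  rw [integral_mul_comp_simple w hz (fun x => x)]
  simp only [fun n => integral_mul_comp_simple w (hZ n) (fun x => x)]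
  exact tendsto_finsetSum _ fun x _ => (h _ (w.measurableSet_fiber x)).const_mul _

lemma tendsto_setIntegral_mul_simple (w : SimpleFunc Ω ℝ) {Z : ℕ → Ω → ℝ} {z : Ω → ℝ}
    (hZ : ∀ n, Integrable (Z n) μ) (hz : Integrable z μ)
    (h : ∀ B, MeasurableSet B →
      Filter.Tendsto (fun n => ∫ ω in B, Z n ω ∂μ) hypU (nhds (∫ ω in B, z ω ∂μ)))
    {A : Set Ω} (hA : MeasurableSet A) :
    Filter.Tendsto (fun n => ∫ ω in A, Z n ω * w ω ∂μ) hypU (nhds (∫ ω in A, z ω * w ω ∂μ)) := by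
  refine tendsto_integral_mul_simple w (fun n => (hZ n).restrict) hz.restrict fun B hB => ?_
  simp only [Measure.restrict_restrict hB]
  exact h _ (hB.inter hA)

lemma WLim.mono {s : ℝ} (hs : 2 ≤ s) (hsr : s ≤ r) {X : ℕ → Ω → ℝ} {f : Ω → ℝ}
    (h : WLim r μ X f) : WLim s μ X f where
  two_le := hs
  meas := h.meas
  memLp n := memLp_ofReal_mono hsr (h.memLp n)
  bdd := by
    obtain ⟨C, hC⟩ := h.bdd
    obtain ⟨K, hK0, hK⟩ := exists_lpn_le_lpn μ (by linarith : 0 < s) hsr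
    exact ⟨K * C, fun n => (hK _ (h.memLp n)).trans (mul_le_mul_of_nonneg_left (hC n) hK0)⟩
  null := h.null
  fmeas := h.fmeas
  fnonneg := h.fnonneg
  fmemLp := memLp_ofReal_mono hsr h.fmemLp
  sq := h.sq
  equi := h.equi

lemma lpn_mul_bdd_le {w F : Ω → ℝ} {R : ℝ} (hR : ∀ ω, |w ω| ≤ R)
    (hF : MemLp F (ENNReal.ofReal r) μ) :
    lpn r μ (fun ω => w ω * F ω) ≤ R * lpn r μ F := by
  by_cases hΩ : IsEmpty Ω
  · have : ∀ G : Ω → ℝ, lpn r μ G = 0 := fun G => by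
      rw [lpn_congr (H := fun _ => 0) (Filter.Eventually.of_forall fun ω => (hΩ.false ω).elim)]
      simp [lpn]
    rw [this, this, mul_zero]
  · have hR0 : 0 ≤ R := by
      obtain ⟨ω⟩ := not_isEmpty_iff.1 hΩ
      exact (abs_nonneg _).trans (hR ω)
    calc _ ≤ lpn r μ (fun ω => R * F ω) := by
          refine lpn_mono (hF.const_mul R) (Filter.Eventually.of_forall fun ω => ?_)
          rw [abs_mul, abs_mul, abs_of_nonneg hR0]
          exact mul_le_mul_of_nonneg_right (hR ω) (abs_nonneg _)
      _ = _ := by rw [lpn_const_mul, abs_of_nonneg hR0]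

lemma memLp_mul_simple (w : SimpleFunc Ω ℝ) {F : Ω → ℝ} (hF : MemLp F (ENNReal.ofReal r) μ) :
    MemLp (fun ω => w ω * F ω) (ENNReal.ofReal r) μ := by
  obtain ⟨R, hR0, hR⟩ := exists_bound_range w
  refine (hF.const_mul R).mono (w.measurable.aestronglyMeasurable.mul hF.1)
    (Filter.Eventually.of_forall fun ω => ?_)
  rw [norm_mul, norm_mul, Real.norm_eq_abs, Real.norm_eq_abs R, abs_of_nonneg hR0]
  exact mul_le_mul_of_nonneg_right (hR ω) (norm_nonneg _)

lemma WLim.mul_simple {X : ℕ → Ω → ℝ} {f : Ω → ℝ} (h : WLim r μ X f) (w : SimpleFunc Ω ℝ)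
    (hw : ∀ ω, 0 ≤ w ω) : WLim r μ (fun n ω => w ω * X n ω) (fun ω => w ω * f ω) where
  two_le := h.two_le
  meas n := w.measurable.mul (h.meas n)
  memLp n := memLp_mul_simple w (h.memLp n)
  bdd := by
    obtain ⟨C, hC⟩ := h.bdd
    obtain ⟨R, hR0, hR⟩ := exists_bound_range w
    exact ⟨R * C, fun n => (lpn_mul_bdd_le hR (h.memLp n)).trans
      (mul_le_mul_of_nonneg_left (hC n) hR0)⟩
  null B hB := by
    have hi : ∀ n, Integrable (X n) μ := fun n =>
      (h.memLp n).integrable (one_le_ofReal (by linarith [h.two_le]))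
    have := tendsto_setIntegral_mul_simple w hi (integrable_zero Ω ℝ μ)
      (fun B hB => by simpa using h.null B hB) hB
    simpa [mul_comm] using this
  fmeas := w.measurable.mul h.fmeas
  fnonneg ω := mul_nonneg (hw ω) (h.fnonneg ω)
  fmemLp := memLp_mul_simple w h.fmemLp
  sq B hB := by
    have := tendsto_setIntegral_mul_simple (w.map fun x => x ^ 2)
      (fun n => integrable_sq_of_memLp h.two_le (h.memLp n))
      (integrable_sq_of_memLp h.two_le h.fmemLp) h.sq hB
    simpa [mul_pow, mul_comm] using this
  equi ρ hρ := by
    obtain ⟨R', hR'0, hR'⟩ := exists_bound_range w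
    set R := R' + 1 with hRdef
    have hR0 : 0 < R := by linarith
    have hR : ∀ ω, |w ω| ≤ R := fun ω => (hR' ω).trans (by linarith)
    obtain ⟨L, hL⟩ := h.equi (ρ / R ^ 2) (by positivity)
    refine ⟨R * L, hL.mono fun n hn => ?_⟩
    have hi := integrable_trunc_sq (h.meas n) (integrable_sq_of_memLp h.two_le (h.memLp n)) L
    calc _ ≤ ∫ ω, R ^ 2 * (if L < |X n ω| then X n ω ^ 2 else 0) ∂μ := by
          refine integral_mono_of_nonneg (Filter.Eventually.of_forall fun ω => ?_)
            (hi.const_mul _) (Filter.Eventually.of_forall fun ω => ?_)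
          · dsimp only [Pi.zero_apply]; split_ifs <;> positivity
          · dsimp only
            by_cases h1 : R * L < |w ω * X n ω|
            · have h2 : L < |X n ω| := by
                by_contra! h2
                rw [abs_mul] at h1
                exact absurd h1 (not_lt.2 ((mul_le_mul_of_nonneg_right (hR ω) (abs_nonneg _)).trans
                  (mul_le_mul_of_nonneg_left h2 hR0.le)))
              rw [if_pos h1, if_pos h2, mul_pow]
              exact mul_le_mul_of_nonneg_right (sq_le_sq' (by linarith [(abs_le.1 (hR ω)).1])
                (abs_le.1 (hR ω)).2) (sq_nonneg _)
            · rw [if_neg h1]; split_ifs <;> positivity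
      _ ≤ ρ := by
          rw [integral_const_mul]
          calc _ ≤ R ^ 2 * (ρ / R ^ 2) := mul_le_mul_of_nonneg_left hn (by positivity)
            _ = ρ := by field_simp

/-- Truncated simple weights below `f ^ (p - 2)` almost recover the `p`-th moment of `f`. -/
lemma exists_simple_weight (hp : 2 < p) {f : Ω → ℝ} (hfm : Measurable f) (hf0 : ∀ ω, 0 ≤ f ω)
    (hf : MemLp f (ENNReal.ofReal p) μ) {C : ℝ} (hC0 : 0 ≤ C) (hC : C < ∫ ω, f ω ^ p ∂μ) :
    ∃ w : SimpleFunc Ω ℝ, (∀ ω, 0 ≤ w ω ∧ w ω ≤ f ω ^ (p - 2)) ∧ C < ∫ ω, w ω * f ω ^ 2 ∂μ := by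
  have hfp : Integrable (fun ω => f ω ^ p) μ := by
    have := integrable_abs_rpow_of_memLp (by linarith) hf
    simpa only [abs_of_nonneg (hf0 _)] using this
  have hf2 : Integrable (fun ω => f ω ^ 2) μ := integrable_sq_of_memLp hp.le hf
  have e : ∀ ω, ENNReal.ofReal (f ω ^ 2) * ENNReal.ofReal (f ω ^ (p - 2)) =
      ENNReal.ofReal (f ω ^ p) := fun ω => by
    rw [← ENNReal.ofReal_mul (sq_nonneg _), ← Real.rpow_natCast,
      ← Real.rpow_add' (hf0 ω) (by push_cast; linarith)]
    congr 2; push_cast; ring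
  have h1 : ENNReal.ofReal C < ∫⁻ ω, ENNReal.ofReal (f ω ^ (p - 2))
      ∂(μ.withDensity fun ω => ENNReal.ofReal (f ω ^ 2)) := by
    rw [lintegral_withDensity_eq_lintegral_mul _ (by fun_prop) (by fun_prop)]
    simp only [Pi.mul_apply, e]
    rw [← ofReal_integral_eq_lintegral_ofReal hfp
      (Filter.Eventually.of_forall fun ω => Real.rpow_nonneg (hf0 ω) _)]
    exact (ENNReal.ofReal_lt_ofReal_iff (by linarith)).2 hC
  rw [lintegral_eq_nnreal] at h1
  obtain ⟨s, hs⟩ := lt_iSup_iff.1 h1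
  obtain ⟨hsu, hs⟩ := lt_iSup_iff.1 hs
  refine ⟨s.map (fun x : NNReal => (x : ℝ)), fun ω => ⟨by simp, ?_⟩, ?_⟩
  · have := hsu ω
    rw [← ENNReal.ofReal_coe_nnreal] at this
    simpa using (ENNReal.ofReal_le_ofReal_iff (Real.rpow_nonneg (hf0 ω) _)).1 this
  · rw [← SimpleFunc.lintegral_eq_lintegral, lintegral_withDensity_eq_lintegral_mul _ (by fun_prop)
      (SimpleFunc.measurable _)] at hs
    have hi : Integrable (fun ω => (s.map (fun x : NNReal => (x : ℝ))) ω * f ω ^ 2) μ := by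
      have := integrable_mul_comp_simple (s.map (fun x : NNReal => (x : ℝ))) (fun x => x) hf2
      simpa only [mul_comm] using this
    rw [← ENNReal.ofReal_lt_ofReal_iff_of_nonneg hC0, ofReal_integral_eq_lintegral_ofReal hi
      (Filter.Eventually.of_forall fun ω => by simp; positivity)]
    refine hs.trans_le (le_of_eq (lintegral_congr fun ω => ?_))
    rw [Pi.mul_apply, SimpleFunc.map_apply, SimpleFunc.map_apply, mul_comm,
      ENNReal.ofReal_mul NNReal.zero_le_coe, ENNReal.ofReal_coe_nnreal]

lemma gaussNorm_le_one (hq : 1 ≤ q) (hq2 : q ≤ 2) : gaussNorm q ≤ 1 := by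
  have h2 : MemLp (fun x : ℝ => x) (ENNReal.ofReal 2) (gaussianReal 0 1) := by
    have := memLp_id_gaussianReal (μ := 0) (v := 1) 2
    rw [show ENNReal.ofReal 2 = ((2 : NNReal) : ℝ≥0∞) by simp]
    exact this
  have h : lpn 2 (gaussianReal 0 1) (fun x => x) = 1 := by
    rw [lpn_two h2]
    rw [integral_gaussian_sq, Real.sqrt_one]
  rw [gaussNorm_eq_lpn (by linarith), ← h]
  refine ENNReal.toReal_mono h2.2.ne ?_
  exact eLpNorm_le_eLpNorm_of_exponent_le (ENNReal.ofReal_le_ofReal hq2) h2.1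

lemma le_gaussNorm_mul_of_isGauss [Fact (1 ≤ ENNReal.ofReal p)]
    {X : SeqL2 →L[ℝ] Lp ℝ (ENNReal.ofReal p) μ} {f : Ω → ℝ} (h : IsGauss X f) {c : ℝ}
    (hX : ∀ a, c * ‖a‖ ≤ ‖X a‖) : c ≤ gaussNorm p * lpn p μ f := by
  refine le_of_forall_pos_le_add fun δ hδ => ?_
  obtain ⟨ι, hι⟩ := h Set.univ MeasurableSet.univ δ hδ
  have h1 := (hι (l2e 0)).1
  have h2 := hX (ι (l2e 0))
  rw [ι.norm_map] at h2
  rw [Measure.restrict_univ, norm_l2e, lpn_coeFn] at h1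
  rw [norm_l2e] at h2
  linarith [(abs_le.1 h1).2]

set_option maxHeartbeats 1000000 in
theorem exists_left_inverse_of_two_lt [Fact (1 ≤ ENNReal.ofReal p)] (hp : 2 < p)
    (X : SeqL2 →L[ℝ] Lp ℝ (ENNReal.ofReal p) μ) {c : ℝ} (hc : 0 < c) (hX : ∀ a, c * ‖a‖ ≤ ‖X a‖)
    {κ : ℝ} (hκ : 0 < κ) :
    ∃ (ι : SeqL2 →ₗᵢ[ℝ] SeqL2) (V : Lp ℝ (ENNReal.ofReal p) μ →L[ℝ] SeqL2),
      ‖V‖ ≤ gaussNorm p / c + κ ∧ ∀ a, ‖V (X (ι a)) - a‖ ≤ κ * ‖a‖ := by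
  have hp0 : 0 < p := by linarith
  have hpq : p.HolderConjugate p.conjExponent := Real.HolderConjugate.conjExponent (by linarith)
  set q := p.conjExponent with hq
  have hq1 : 1 ≤ q := hpq.symm.lt.le
  have hq2 : q ≤ 2 := by
    rw [hq, Real.conjExponent, div_le_iff₀ (by linarith)]; linarith
  have hqp : q ≤ p := by linarith
  obtain ⟨f, hf⟩ := exists_wLim_of_two_lt hp X
  have hcN := le_gaussNorm_mul_of_isGauss (hf.colLim hp.le).isGauss hX
  set N := lpn p μ f with hN
  set G := gaussNorm p with hG
  have hG0 : 0 ≤ G := gaussNorm_nonneg p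
  have hN0 : 0 < N := by
    rcases (lpn_nonneg : 0 ≤ lpn p μ f).eq_or_lt with h | h
    · rw [hN, ← h, mul_zero] at hcN; linarith
    · exact h
  have hNp : N ^ p = ∫ ω, f ω ^ p ∂μ := by
    rw [hN, lpn_rpow hp0 hf.fmemLp]
    simp only [abs_of_nonneg (hf.fnonneg _)]
  set t := min (1 / 2) (κ / (2 * (G / c) + 1)) with ht
  have hGc : 0 ≤ G / c := by positivity
  have ht0 : 0 < t := by positivity
  have ht1 : t ≤ 1 / 2 := min_le_left _ _
  have ht2 : t * (2 * (G / c) + 1) ≤ κ := by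
    rw [← le_div_iff₀ (by positivity)]; exact min_le_right _ _
  have hNpp : 0 < N ^ p := Real.rpow_pos_of_pos hN0 p
  obtain ⟨w, hw, hws⟩ := exists_simple_weight hp hf.fmeas hf.fnonneg hf.fmemLp
    (C := (1 - t) * N ^ p) (by nlinarith) (by rw [← hNp]; nlinarith)
  set s := ∫ ω, w ω * f ω ^ 2 ∂μ with hs
  have hs0 : 0 < s := by nlinarith
  have hw' := (hf.mono (s := max q 2) (le_max_right _ _) (by
    rw [max_eq_right hq2]; exact hp.le)).mul_simple (w.map fun x => s⁻¹ * x)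
      (fun ω => by simpa using mul_nonneg (inv_nonneg.2 hs0.le) (hw ω).1)
  obtain ⟨ι, V, hV, hι⟩ := exists_left_inverse_of_dual hpq X hw' (by
      have := tendsto_integral_mul_simple (w.map fun x => s⁻¹ * x)
        (fun n => integrable_sq_of_memLp hp.le (hf.memLp n))
        (integrable_sq_of_memLp hp.le hf.fmemLp) hf.sq
      have e : ∫ ω, f ω ^ 2 * (w.map fun x => s⁻¹ * x) ω ∂μ = 1 := by
        rw [← inv_mul_cancel₀ hs0.ne', hs, ← integral_const_mul]
        refine integral_congr_ae (Filter.Eventually.of_forall fun ω => ?_)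
        simp only [SimpleFunc.map_apply]; ring
      rw [e] at this
      refine this.congr fun n => integral_congr_ae (Filter.Eventually.of_forall fun ω => ?_)
      dsimp only; ring) (fun m => by
      have := tendsto_integral_mul_l2e hpq (memLp_mul_simple (w.map fun x => s⁻¹ * x)
        (memLp_ofReal_mono hqp (hf.memLp m))) X
      refine this.congr fun n => integral_congr_ae (Filter.Eventually.of_forall fun ω => ?_)
      dsimp only; ring) ht0
  have hfq : lpn q μ (fun ω => f ω ^ (p - 1)) = N ^ (p - 1) ∧
      MemLp (fun ω => f ω ^ (p - 1)) (ENNReal.ofReal q) μ := by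
    have e : ∀ ω, |f ω ^ (p - 1)| ^ q = f ω ^ p := fun ω => by
      rw [abs_of_nonneg (Real.rpow_nonneg (hf.fnonneg ω) _), ← Real.rpow_mul (hf.fnonneg ω)]
      congr 1
      rw [hq, Real.conjExponent]
      field_simp [(by linarith : p - 1 ≠ 0)]
    have hm : MemLp (fun ω => f ω ^ (p - 1)) (ENNReal.ofReal q) μ := by
      refine memLp_of_integrable_abs_rpow (by linarith) ?_ ?_
      · exact (hf.fmeas.pow_const _).aestronglyMeasurable
      · simp only [e]
        have := integrable_abs_rpow_of_memLp hp0 hf.fmemLp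
        simpa only [abs_of_nonneg (hf.fnonneg _)] using this
    refine ⟨?_, hm⟩
    rw [lpn_eq (by linarith) hm]
    simp only [e]
    rw [← hNp, ← Real.rpow_mul hN0.le]
    congr 1
    rw [hq, Real.conjExponent]; field_simp
  have hfD : lpn q μ (fun ω => (w.map fun x => s⁻¹ * x) ω * f ω) ≤ s⁻¹ * N ^ (p - 1) := by
    rw [← hfq.1, ← abs_of_pos (inv_pos.2 hs0), ← lpn_const_mul]
    refine lpn_mono (hfq.2.const_mul _) (Filter.Eventually.of_forall fun ω => ?_)
    simp only [SimpleFunc.map_apply]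
    rw [abs_of_pos (inv_pos.2 hs0), mul_assoc, abs_mul, abs_mul (s⁻¹) (f ω ^ (p - 1))]
    refine mul_le_mul_of_nonneg_left ?_ (abs_nonneg _)
    rw [abs_of_nonneg (mul_nonneg (hw ω).1 (hf.fnonneg ω)),
      abs_of_nonneg (Real.rpow_nonneg (hf.fnonneg ω) _)]
    calc _ ≤ f ω ^ (p - 2) * f ω := mul_le_mul_of_nonneg_right (hw ω).2 (hf.fnonneg ω)
      _ = _ := by
        nth_rw 2 [← Real.rpow_one (f ω)]
        rw [← Real.rpow_add' (hf.fnonneg ω) (by linarith)]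
        congr 1; ring
  have hfin : s⁻¹ * N ^ (p - 1) ≤ (1 + 2 * t) * (G / c) := by
    have e : N ^ (p - 1) = N ^ p / N := by rw [Real.rpow_sub_one hN0.ne']
    rw [e, inv_mul_le_iff₀ hs0, div_le_iff₀ hN0]
    have h1 : 1 ≤ G / c * N := by
      rw [div_mul_eq_mul_div, le_div_iff₀ hc]; linarith
    have h2 : 1 ≤ (1 + 2 * t) * (1 - t) := by nlinarith
    have h3 : N ^ p ≤ (1 + 2 * t) * s := by nlinarith
    calc N ^ p ≤ (1 + 2 * t) * s * 1 := by linarith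
      _ ≤ (1 + 2 * t) * s * (G / c * N) := mul_le_mul_of_nonneg_left h1 (by positivity)
      _ = _ := by ring
  refine ⟨ι, V, hV.trans ?_, fun a => (hι a).trans ?_⟩
  · have h1 : gaussNorm q * lpn q μ (fun ω => (w.map fun x => s⁻¹ * x) ω * f ω) ≤
        1 * (s⁻¹ * N ^ (p - 1)) :=
      mul_le_mul (gaussNorm_le_one hq1 hq2) hfD lpn_nonneg zero_le_one
    nlinarith
  · refine mul_le_mul_of_nonneg_right ?_ (norm_nonneg _)
    nlinarith

end projtwo

section projlt
variable {Ω : Type*} [MeasurableSpace Ω] {μ : Measure Ω} [IsFiniteMeasure μ] {p q r : ℝ}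

lemma exists_weak_limit_nonneg (hq : 1 < q) {Z : ℕ → Ω → ℝ} (hZm : ∀ n, Measurable (Z n))
    (hZ0 : ∀ n ω, 0 ≤ Z n ω) (hZ : ∀ n, MemLp (Z n) (ENNReal.ofReal q) μ) {C : ℝ}
    (hC : ∀ n, lpn q μ (Z n) ≤ C) :
    ∃ v : Ω → ℝ, Measurable v ∧ MemLp v (ENNReal.ofReal q) μ ∧ ∀ B, MeasurableSet B →
      Filter.Tendsto (fun n => ∫ ω in B, Z n ω ∂μ) hypU (nhds (∫ ω in B, v ω ∂μ)) := by
  have hq2 : 2 < 2 * q := by linarith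
  have hh : 2 * q / 2 = q := by ring
  have e : ∀ n ω, √(Z n ω) ^ 2 = Z n ω := fun n ω => Real.sq_sqrt (hZ0 n ω)
  have hXm : ∀ n, Measurable fun ω => √(Z n ω) := fun n => (hZm n).sqrt
  have hX : ∀ n, MemLp (fun ω => √(Z n ω)) (ENNReal.ofReal (2 * q)) μ := fun n =>
    memLp_of_sq_half (by linarith) (hXm n) (by simpa only [hh, e] using hZ n)
  have hC' : ∀ n, lpn (2 * q) μ (fun ω => √(Z n ω)) ≤ √C := fun n => by
    refine Real.le_sqrt_of_sq_le ?_
    rw [← lpn_sq_half (by linarith) (hX n)]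
    simpa only [hh, e] using hC n
  obtain ⟨f, hfm, _, hf, hsq⟩ := exists_sq_limit hq2.le hXm hX hC' (equi_of_moment hq2 hXm hX hC')
  refine ⟨fun ω => f ω ^ 2, by fun_prop, ?_, fun B hB => ?_⟩
  · simpa only [hh] using memLp_sq_half (by linarith) hf
  · simpa only [e] using hsq B hB

lemma exists_weak_limit (hq : 1 < q) {V : ℕ → Ω → ℝ} (hVm : ∀ n, Measurable (V n))
    (hV : ∀ n, MemLp (V n) (ENNReal.ofReal q) μ) {C : ℝ} (hC : ∀ n, lpn q μ (V n) ≤ C) :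
    ∃ v : Ω → ℝ, Measurable v ∧ MemLp v (ENNReal.ofReal q) μ ∧ ∀ B, MeasurableSet B →
      Filter.Tendsto (fun n => ∫ ω in B, V n ω ∂μ) hypU (nhds (∫ ω in B, v ω ∂μ)) := by
  have key : ∀ W : ℕ → Ω → ℝ, (∀ n, Measurable (W n)) → (∀ n ω, |W n ω| = |V n ω|) →
      (∀ n, MemLp (fun ω => max (W n ω) 0) (ENNReal.ofReal q) μ) ∧
      ∃ v : Ω → ℝ, Measurable v ∧ MemLp v (ENNReal.ofReal q) μ ∧ ∀ B, MeasurableSet B →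
      Filter.Tendsto (fun n => ∫ ω in B, max (W n ω) 0 ∂μ) hypU (nhds (∫ ω in B, v ω ∂μ)) := by
    intro W hWm hW
    have hle : ∀ n ω, |max (W n ω) 0| ≤ |V n ω| := fun n ω => by
      rw [← hW, abs_of_nonneg (le_max_right _ _)]
      exact max_le (le_abs_self _) (abs_nonneg _)
    have hm : ∀ n, MemLp (fun ω => max (W n ω) 0) (ENNReal.ofReal q) μ := fun n =>
      (hV n).mono ((hWm n).max measurable_const).aestronglyMeasurable
        (Filter.Eventually.of_forall (hle n))
    exact ⟨hm, exists_weak_limit_nonneg hq (fun n => (hWm n).max measurable_const)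
      (fun n ω => le_max_right _ _) hm (C := C) fun n =>
      (lpn_mono (hV n) (Filter.Eventually.of_forall (hle n))).trans (hC n)⟩
  obtain ⟨hm1, v1, hv1m, hv1, h1⟩ := key V hVm fun _ _ => rfl
  obtain ⟨hm2, v2, hv2m, hv2, h2⟩ := key (fun n ω => -V n ω) (fun n => (hVm n).neg)
    fun _ _ => abs_neg _
  have h1q : 1 ≤ ENNReal.ofReal q := one_le_ofReal hq.le
  refine ⟨fun ω => v1 ω - v2 ω, hv1m.sub hv2m, hv1.sub hv2, fun B hB => ?_⟩
  rw [integral_sub (hv1.integrable h1q).restrict (hv2.integrable h1q).restrict]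
  refine ((h1 B hB).sub (h2 B hB)).congr fun n => ?_
  rw [← integral_sub ((hm1 n).integrable h1q).restrict ((hm2 n).integrable h1q).restrict]
  congr 1
  funext ω
  rcases le_total 0 (V n ω) with h | h
  · rw [max_eq_left h, max_eq_right (by linarith), sub_zero]
  · rw [max_eq_right h, max_eq_left (by linarith)]; ring

lemma tendsto_integral_mul_of_null (hpq : p.HolderConjugate q) {D : ℕ → Ω → ℝ}
    (hD : ∀ n, MemLp (D n) (ENNReal.ofReal q) μ) {C : ℝ} (hC : ∀ n, lpn q μ (D n) ≤ C)
    (h0 : ∀ B, MeasurableSet B → Filter.Tendsto (fun n => ∫ ω in B, D n ω ∂μ) hypU (nhds 0))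
    {g : Ω → ℝ} (hgm : Measurable g) (hg : MemLp g (ENNReal.ofReal p) μ) :
    Filter.Tendsto (fun n => ∫ ω, D n ω * g ω ∂μ) hypU (nhds 0) := by
  have hC0 : 0 ≤ C := lpn_nonneg.trans (hC 0)
  rw [Metric.tendsto_nhds]
  intro ε hε
  obtain ⟨w, -, hw⟩ := exists_simple_approx_le hgm hg (ε := ε / (2 * (C + 1))) (by positivity)
  have hwp : MemLp w (ENNReal.ofReal p) μ := SimpleFunc.memLp_of_isFiniteMeasure _ _ _
  have hDi : ∀ n, Integrable (D n) μ := fun n => (hD n).integrable (one_le_ofReal hpq.symm.lt.le)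
  have h1 := tendsto_integral_mul_simple w hDi (integrable_zero Ω ℝ μ)
    (fun B hB => by simpa using h0 B hB)
  simp only [Pi.zero_apply, zero_mul, integral_zero] at h1
  filter_upwards [(Metric.tendsto_nhds.1 h1) (ε / 2) (by positivity)] with n hn
  rw [Real.dist_eq, sub_zero] at hn ⊢
  have e : ∫ ω, D n ω * g ω ∂μ = ∫ ω, D n ω * w ω ∂μ - ∫ ω, D n ω * (w ω - g ω) ∂μ := by
    have i2 : Integrable (fun ω => D n ω * (w ω - g ω)) μ :=
      integrable_mul_of_holder hpq (hD n) (hwp.sub hg)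
    rw [← integral_sub (integrable_mul_of_holder hpq (hD n) hwp) i2]
    congr 1; funext ω; ring
  have h2 := abs_integral_mul_le_lpn hpq (hD n) (hwp.sub hg)
  have h3 : lpn q μ (D n) * lpn p μ (⇑w - g) ≤ C * (ε / (2 * (C + 1))) :=
    mul_le_mul (hC n) hw lpn_nonneg hC0
  have h4 : C * (ε / (2 * (C + 1))) < ε / 2 := by
    rw [mul_div_assoc', div_lt_iff₀ (by positivity)]
    nlinarith
  rw [e]
  refine (abs_sub _ _).trans_lt ?_
  have h5 : |∫ ω, D n ω * (w ω - g ω) ∂μ| ≤ lpn q μ (D n) * lpn p μ (⇑w - g) := h2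
  linarith

/-- Subtracting its weak limit from a bounded sequence does not increase the limiting norm. -/
lemma exists_wLim_sub_weak_limit (hq : 2 < q) {V : ℕ → Ω → ℝ} (hVm : ∀ n, Measurable (V n))
    (hV : ∀ n, MemLp (V n) (ENNReal.ofReal q) μ) {C : ℝ} (hC : ∀ n, lpn q μ (V n) ≤ C) :
    ∃ v f : Ω → ℝ, MemLp v (ENNReal.ofReal q) μ ∧ WLim q μ (fun n ω => V n ω - v ω) f ∧
      lpn q μ f ≤ C := by
  have hC0 : 0 ≤ C := lpn_nonneg.trans (hC 0)
  have hq1 : 1 ≤ ENNReal.ofReal q := one_le_ofReal (by linarith)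
  obtain ⟨v, hvm, hv, hvl⟩ := exists_weak_limit (by linarith) hVm hV hC
  have hDm : ∀ n, Measurable fun ω => V n ω - v ω := fun n => (hVm n).sub hvm
  have hD : ∀ n, MemLp (fun ω => V n ω - v ω) (ENNReal.ofReal q) μ := fun n => (hV n).sub hv
  have hDC : ∀ n, lpn q μ (fun ω => V n ω - v ω) ≤ C + lpn q μ v := fun n => by
    have := abs_lpn_sub_le (by linarith) (hD n) (hV n)
    have e : lpn q μ (fun ω => (V n ω - v ω) - V n ω) = lpn q μ v := by
      rw [← lpn_sub_comm]
      congr 1; funext ω; ring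
    rw [e] at this
    linarith [(abs_le.1 this).2, hC n]
  have hnull : ∀ B, MeasurableSet B →
      Filter.Tendsto (fun n => ∫ ω in B, (V n ω - v ω) ∂μ) hypU (nhds 0) := by
    intro B hB
    have := (hvl B hB).sub_const (∫ ω in B, v ω ∂μ)
    rw [sub_self] at this
    refine this.congr fun n => ?_
    rw [integral_sub ((hV n).integrable hq1).restrict (hv.integrable hq1).restrict]
  obtain ⟨f, hf⟩ := exists_wLim hq.le hDm hD hDC hnull (equi_of_moment hq hDm hD hDC)
  refine ⟨v, f, hv, hf, ?_⟩
  have hq0 : 0 < q := by linarith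
  have hl := lpn_le_of_setIntegral_le (ν := μ) (s := q / 2) (by linarith)
    (F := fun ω => f ω ^ 2) (by have := hf.fmeas; fun_prop) (fun ω => sq_nonneg _)
    (integrable_sq_of_memLp hq.le hf.fmemLp)
    (G := fun n ω => V n ω ^ 2) (fun n ω => sq_nonneg _)
    (fun n => memLp_sq_half hq0 (hV n)) (K := C ^ 2) (Filter.Eventually.of_forall fun n => by
      rw [lpn_sq_half hq0 (hV n)]
      exact pow_le_pow_left₀ lpn_nonneg (hC n) 2)
    (fun B hB ε hε => by
      have hpq := (Real.HolderConjugate.conjExponent (by linarith : 1 < q)).symm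
      have hle : q.conjExponent ≤ q := by
        have : q.conjExponent ≤ 2 := by
          rw [Real.conjExponent, div_le_iff₀ (by linarith)]; linarith
        linarith
      have h2 := tendsto_integral_mul_of_null hpq hD hDC hnull (hvm.indicator hB)
        ((memLp_ofReal_mono hle hv).indicator hB)
      filter_upwards [(hf.sq B hB).eventually (lt_mem_nhds (sub_lt_self _ (half_pos hε))),
        h2.eventually (lt_mem_nhds (by linarith : -(ε / 4) < 0))] with n hn h3
      have i1 : Integrable (fun ω => (V n ω - v ω) ^ 2) (μ.restrict B) :=
        (integrable_sq_of_memLp hq.le (hD n)).restrict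
      have i2 : Integrable (fun ω => (V n ω - v ω) * v ω) (μ.restrict B) :=
        (integrable_mul_of_holder hpq (hD n) (memLp_ofReal_mono hle hv)).restrict
      have i3 : Integrable (fun ω => v ω ^ 2) (μ.restrict B) :=
        (integrable_sq_of_memLp hq.le hv).restrict
      have e : ∫ ω in B, V n ω ^ 2 ∂μ = ∫ ω in B, (V n ω - v ω) ^ 2 ∂μ +
          2 * ∫ ω in B, (V n ω - v ω) * v ω ∂μ + ∫ ω in B, v ω ^ 2 ∂μ := by
        have i12 : Integrable (fun ω => (V n ω - v ω) ^ 2 + 2 * ((V n ω - v ω) * v ω))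
            (μ.restrict B) := i1.add (i2.const_mul 2)
        rw [← integral_const_mul, ← integral_add i1 (i2.const_mul 2), ← integral_add i12 i3]
        congr 1; funext ω; ring
      have e2 : ∫ ω, (V n ω - v ω) * B.indicator v ω ∂μ = ∫ ω in B, (V n ω - v ω) * v ω ∂μ := by
        rw [← integral_indicator hB]
        congr 1; funext ω
        by_cases hω : ω ∈ B <;> simp [hω]
      rw [e2] at h3
      have h4 : 0 ≤ ∫ ω in B, v ω ^ 2 ∂μ := integral_nonneg fun ω => sq_nonneg _
      rw [e]
      linarith)
  have := hl.2
  rw [lpn_sq_half hq0 hf.fmemLp] at this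
  exact le_of_sq_le_sq this hC0

/-- The derivative of `|x| ^ p / p`. -/
noncomputable def signPow (p x : ℝ) : ℝ := |x| ^ (p - 2) * x

lemma signPow_mul_self (hp : 0 < p) (x : ℝ) : signPow p x * x = |x| ^ p := by
  rcases eq_or_ne x 0 with rfl | h
  · simp [Real.zero_rpow hp.ne']
  · rw [signPow, mul_assoc, ← sq, ← sq_abs, ← Real.rpow_natCast, ← Real.rpow_add (abs_pos.2 h)]
    congr 1; push_cast; ring

lemma abs_signPow (hp : 1 < p) (x : ℝ) : |signPow p x| = |x| ^ (p - 1) := by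
  rcases eq_or_ne x 0 with rfl | h
  · simp [signPow, Real.zero_rpow (by linarith : p - 1 ≠ 0)]
  · rw [signPow, abs_mul, abs_of_nonneg (Real.rpow_nonneg (abs_nonneg _) _)]
    nth_rw 2 [← Real.rpow_one |x|]
    rw [← Real.rpow_add (abs_pos.2 h)]
    congr 1; ring

lemma memLp_signPow (hp : 1 < p) {F : Ω → ℝ} (hFm : Measurable F)
    (hF : MemLp F (ENNReal.ofReal p) μ) :
    MemLp (fun ω => signPow p (F ω)) (ENNReal.ofReal p.conjExponent) μ ∧
      lpn p.conjExponent μ (fun ω => signPow p (F ω)) = lpn p μ F ^ (p - 1) := by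
  have hq := (Real.HolderConjugate.conjExponent hp).symm.pos
  have hp0 : 0 < p := by linarith
  have hp1 : p - 1 ≠ 0 := by linarith
  have e : ∀ ω, |signPow p (F ω)| ^ p.conjExponent = |F ω| ^ p := fun ω => by
    rw [abs_signPow hp, ← Real.rpow_mul (abs_nonneg _), Real.conjExponent]
    congr 1; field_simp
  have hm : MemLp (fun ω => signPow p (F ω)) (ENNReal.ofReal p.conjExponent) μ := by
    refine memLp_of_integrable_abs_rpow hq ?_ ?_
    · exact Measurable.aestronglyMeasurable (by unfold signPow; fun_prop)
    · simp only [e]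
      exact integrable_abs_rpow_of_memLp hp0 hF
  refine ⟨hm, ?_⟩
  rw [lpn_eq hq hm]
  simp only [e]
  rw [← lpn_rpow hp0 hF, ← Real.rpow_mul lpn_nonneg, Real.conjExponent]
  congr 1; field_simp

set_option maxHeartbeats 1000000 in
theorem exists_left_inverse_of_lt_two [Fact (1 ≤ ENNReal.ofReal p)] (hp : 1 < p) (hp2 : p < 2)
    (X : SeqL2 →L[ℝ] Lp ℝ (ENNReal.ofReal p) μ) {c : ℝ} (hc : 0 < c) (hX : ∀ a, c * ‖a‖ ≤ ‖X a‖)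
    {κ : ℝ} (hκ : 0 < κ) :
    ∃ (ι : SeqL2 →ₗᵢ[ℝ] SeqL2) (V : Lp ℝ (ENNReal.ofReal p) μ →L[ℝ] SeqL2),
      ‖V‖ ≤ gaussNorm (p / (p - 1)) / c + κ ∧ ∀ a, ‖V (X (ι a)) - a‖ ≤ κ * ‖a‖ := by
  have hp0 : 0 < p := by linarith
  have hpq : p.HolderConjugate p.conjExponent := Real.HolderConjugate.conjExponent hp
  have hq2 : 2 < p.conjExponent := by
    rw [Real.conjExponent, lt_div_iff₀ (by linarith)]; linarith
  set N : ℕ → ℝ := fun n => lpn p μ (X (l2e n)) with hN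
  have hNc : ∀ n, c ≤ N n := fun n => by
    have := hX (l2e n)
    rwa [norm_l2e, mul_one] at this
  have hN0 : ∀ n, 0 < N n := fun n => hc.trans_le (hNc n)
  have hVm : ∀ n, Measurable fun ω => (N n ^ p)⁻¹ * signPow p (X (l2e n) ω) := fun n => by
    have := measurable_coeFn (X (l2e n))
    unfold signPow; fun_prop
  have hV : ∀ n, MemLp (fun ω => (N n ^ p)⁻¹ * signPow p (X (l2e n) ω))
      (ENNReal.ofReal p.conjExponent) μ := fun n =>
    (memLp_signPow hp (measurable_coeFn _) (Lp.memLp _)).1.const_mul _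
  have hVC : ∀ n, lpn p.conjExponent μ (fun ω => (N n ^ p)⁻¹ * signPow p (X (l2e n) ω)) ≤
      1 / c := by
    intro n
    rw [lpn_const_mul, (memLp_signPow hp (measurable_coeFn _) (Lp.memLp _)).2, abs_inv,
      abs_of_pos (Real.rpow_pos_of_pos (hN0 n) p)]
    change (N n ^ p)⁻¹ * N n ^ (p - 1) ≤ 1 / c
    rw [Real.rpow_sub_one (hN0 n).ne', mul_div_assoc',
      inv_mul_cancel₀ (Real.rpow_pos_of_pos (hN0 n) p).ne']
    exact one_div_le_one_div_of_le hc (hNc n)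
  obtain ⟨v, f, hv, hf, hfc⟩ := exists_wLim_sub_weak_limit hq2 hVm hV hVC
  obtain ⟨C, hC⟩ := hf.bdd
  obtain ⟨ι, V, hV', hι⟩ := exists_left_inverse_of_dual hpq X
    (D := fun n ω => (N n ^ p)⁻¹ * signPow p (X (l2e n) ω) - v ω) (f := f)
    (by rwa [max_eq_left hq2.le]) (by
      have h := (tendsto_integral_mul_l2e hpq hv X).const_sub 1
      rw [sub_zero] at h
      refine h.congr fun n => ?_
      simp only [sub_mul]
      rw [integral_sub (integrable_mul_of_holder hpq (hV n) (Lp.memLp _))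
        (integrable_mul_of_holder hpq hv (Lp.memLp _))]
      congr 1
      simp only [mul_assoc, signPow_mul_self hp0]
      rw [integral_const_mul, ← lpn_rpow hp0 (Lp.memLp _),
        inv_mul_cancel₀ (Real.rpow_pos_of_pos (hN0 n) p).ne'])
    (fun m => tendsto_integral_mul_of_null hpq hf.memLp hC hf.null (measurable_coeFn _)
      (Lp.memLp _)) hκ
  refine ⟨ι, V, hV'.trans ?_, hι⟩
  have h1 : gaussNorm p.conjExponent * lpn p.conjExponent μ f ≤ gaussNorm (p / (p - 1)) * (1 / c) :=
    mul_le_mul_of_nonneg_left hfc (gaussNorm_nonneg _)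
  rw [mul_one_div] at h1
  linarith

/-- `γ_p` for `p > 2` and `γ_{p / (p - 1)}` for `p < 2`. -/
noncomputable def gaussConst (p : ℝ) : ℝ :=
  if 2 < p then gaussNorm p else gaussNorm (p / (p - 1))

theorem exists_left_inverse [Fact (1 ≤ ENNReal.ofReal p)] (hp : 1 < p) (hp2 : p ≠ 2)
    (X : SeqL2 →L[ℝ] Lp ℝ (ENNReal.ofReal p) μ) {c : ℝ} (hc : 0 < c) (hX : ∀ a, c * ‖a‖ ≤ ‖X a‖)
    {κ : ℝ} (hκ : 0 < κ) :
    ∃ (ι : SeqL2 →ₗᵢ[ℝ] SeqL2) (V : Lp ℝ (ENNReal.ofReal p) μ →L[ℝ] SeqL2),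
      ‖V‖ ≤ gaussConst p / c + κ ∧ ∀ a, ‖V (X (ι a)) - a‖ ≤ κ * ‖a‖ := by
  rw [gaussConst]
  split_ifs with h
  · exact exists_left_inverse_of_two_lt h X hc hX hκ
  · exact exists_left_inverse_of_lt_two hp (lt_of_le_of_ne (not_lt.1 h) hp2) X hc hX hκ

end projlt

lemma rpow_neg_tangent_le {s x t : ℝ} (hs0 : 0 ≤ s) (hs : s ≤ 1) (hx : 0 < x) (ht : 0 < t) :
    t ^ (-s) - s * t ^ (-s - 1) * (x - t) ≤ x ^ (-s) := by
  have h := rpow_one_add_le_one_add_mul_self (s := x / t - 1)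
    (by have : 0 ≤ x / t := by positivity
        linarith) hs0 hs
  rw [add_sub_cancel] at h
  have hy : 0 < (x / t) ^ s := by positivity
  have h1 : 1 - s * (x / t - 1) ≤ ((x / t) ^ s)⁻¹ := by
    rw [← one_div, le_div_iff₀ hy]
    nlinarith [sq_nonneg ((x / t) ^ s - 1)]
  have h2 : x ^ (-s) = t ^ (-s) * ((x / t) ^ s)⁻¹ := by
    rw [Real.div_rpow hx.le ht.le, Real.rpow_neg hx.le, Real.rpow_neg ht.le]
    field_simp
  rw [h2]
  refine le_trans (le_of_eq ?_) (mul_le_mul_of_nonneg_left h1 (by positivity))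
  rw [Real.rpow_sub_one ht.ne']
  field_simp

/-- The variational inequality satisfied by a near maximiser of `∫ a ^ θ`. -/
lemma rpow_variation_le {θ a b t : ℝ} (hθ0 : 0 < θ) (hθ : θ < 1) (ha : 1 ≤ a) (hb : 1 ≤ b)
    (ht0 : 0 < t) (ht : t ≤ 1 / 2) :
    θ * t * ((if t * b ≤ 1 then a ^ (θ - 1) * b else 0) / 2 - 2 * a ^ θ) ≤
      ((1 - t) * a + t * b) ^ θ - a ^ θ := by
  have ha0 : 0 < a := by linarith
  set x := (1 - t) * a + t * b with hx
  have hx0 : 0 < x := by nlinarith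
  have h := rpow_one_add_le_one_add_mul_self (s := a / x - 1)
    (by have : 0 ≤ a / x := by positivity
        linarith) hθ0.le hθ.le
  rw [add_sub_cancel, Real.div_rpow ha0.le hx0.le, div_le_iff₀ (by positivity)] at h
  have h1 : θ * x ^ (θ - 1) * (t * (b - a)) ≤ x ^ θ - a ^ θ := by
    have e : (1 + θ * (a / x - 1)) * x ^ θ = x ^ θ - θ * x ^ (θ - 1) * (t * (b - a)) := by
      rw [Real.rpow_sub_one hx0.ne']
      field_simp
      rw [hx]; ring
    linarith
  have h2 : x ^ (θ - 1) * a ≤ 2 * a ^ θ := by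
    have h3 : x ^ (θ - 1) ≤ (a / 2) ^ (θ - 1) :=
      Real.rpow_le_rpow_of_nonpos (by positivity) (by rw [hx]; nlinarith) (by linarith)
    have h4 : (a / 2) ^ (θ - 1) ≤ 2 * a ^ (θ - 1) := by
      rw [Real.div_rpow ha0.le two_pos.le, div_eq_mul_inv, mul_comm, ← Real.rpow_neg two_pos.le]
      refine mul_le_mul_of_nonneg_right ?_ (by positivity)
      calc (2 : ℝ) ^ (-(θ - 1)) ≤ 2 ^ (1 : ℝ) :=
            Real.rpow_le_rpow_of_exponent_le one_le_two (by linarith)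
        _ = 2 := Real.rpow_one 2
    calc x ^ (θ - 1) * a ≤ 2 * a ^ (θ - 1) * a :=
          mul_le_mul_of_nonneg_right (h3.trans h4) ha0.le
      _ = 2 * a ^ θ := by rw [Real.rpow_sub_one ha0.ne']; field_simp
  have h5 : (if t * b ≤ 1 then a ^ (θ - 1) * b else 0) / 2 ≤ x ^ (θ - 1) * b := by
    split_ifs with hc
    · have h6 : (2 * a) ^ (θ - 1) ≤ x ^ (θ - 1) :=
        Real.rpow_le_rpow_of_nonpos hx0 (by rw [hx]; nlinarith) (by linarith)
      have h7 : a ^ (θ - 1) / 2 ≤ (2 * a) ^ (θ - 1) := by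
        rw [Real.mul_rpow two_pos.le ha0.le, div_eq_inv_mul, ← Real.rpow_neg_one 2]
        exact mul_le_mul_of_nonneg_right
          (Real.rpow_le_rpow_of_exponent_le one_le_two (by linarith)) (by positivity)
      have := mul_le_mul_of_nonneg_right (h7.trans h6) (by linarith : 0 ≤ b)
      linarith
    · rw [zero_div]
      exact mul_nonneg (by positivity) (by linarith)
  have h8 : θ * t * ((if t * b ≤ 1 then a ^ (θ - 1) * b else 0) / 2 - 2 * a ^ θ) ≤
      θ * t * (x ^ (θ - 1) * b - x ^ (θ - 1) * a) :=
    mul_le_mul_of_nonneg_left (by linarith) (by positivity)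
  refine h8.trans (le_trans (le_of_eq ?_) h1)
  ring

section maurey
variable {Ω : Type*} [MeasurableSpace Ω] {μ : Measure Ω} [IsFiniteMeasure μ] {p : ℝ}

/-- Near maximisers of `∫ (1 + F) ^ (p / 2)` over a convex family. -/
lemma exists_near_maximizers (hp : 0 < p) (hp2 : p < 2) {K : Set (Ω → ℝ)} (hne : K.Nonempty)
    (hconv : ∀ F ∈ K, ∀ G ∈ K, ∀ t : ℝ, 0 ≤ t → t ≤ 1 → (fun ω => (1 - t) * F ω + t * G ω) ∈ K)
    (hm : ∀ F ∈ K, Measurable F) (h0 : ∀ F ∈ K, ∀ ω, 0 ≤ F ω) {C : ℝ}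
    (hi : ∀ F ∈ K, Integrable (fun ω => (1 + F ω) ^ (p / 2)) μ)
    (hC : ∀ F ∈ K, ∫ ω, (1 + F ω) ^ (p / 2) ∂μ ≤ C) :
    ∃ A : ℕ → Ω → ℝ, (∀ n, (fun ω => A n ω - 1) ∈ K) ∧ ∀ F ∈ K, ∀ M : ℝ, 2 ≤ M → ∀ ε > 0,
      ∀ᶠ n in hypU, ∫ ω, (if F ω + 1 ≤ M then A n ω ^ (p / 2 - 1) * F ω else 0) ∂μ ≤ 4 * C + ε := by
  set J : (Ω → ℝ) → ℝ := fun F => ∫ ω, (1 + F ω) ^ (p / 2) ∂μ with hJ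
  have hbdd : BddAbove (J '' K) := ⟨C, by rintro _ ⟨F, hF, rfl⟩; exact hC F hF⟩
  have hex : ∀ n : ℕ, ∃ F ∈ K, sSup (J '' K) - 1 / (n + 1) < J F := fun n => by
    obtain ⟨_, ⟨F, hF, rfl⟩, h⟩ := exists_lt_of_lt_csSup (hne.image J)
      (sub_lt_self (sSup (J '' K)) (by positivity : (0 : ℝ) < 1 / (n + 1)))
    exact ⟨F, hF, h⟩
  choose G hG hGJ using hex
  refine ⟨fun n ω => 1 + G n ω, fun n => by simpa using hG n, fun F hF M hM ε hε => ?_⟩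
  obtain ⟨k, hk⟩ := exists_nat_gt (4 * M / (p * ε))
  filter_upwards [eventually_hypU_gt k] with n hn
  have hM0 : 0 < M := by linarith
  set t := 1 / M with ht
  have ht0 : 0 < t := by positivity
  have ht2 : t ≤ 1 / 2 := one_div_le_one_div_of_le two_pos hM
  have hmem := hconv _ (hG n) _ hF t ht0.le (by linarith)
  have h1 : J (fun ω => (1 - t) * G n ω + t * F ω) - J (G n) ≤ 1 / (n + 1) := by
    have := le_csSup hbdd ⟨_, hmem, rfl⟩
    linarith [hGJ n]
  rw [hJ] at h1
  dsimp only at h1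
  rw [← integral_sub (hi _ hmem) (hi _ (hG n))] at h1
  set W : Ω → ℝ := fun ω => if F ω + 1 ≤ M then (1 + G n ω) ^ (p / 2 - 1) * (1 + F ω) else 0 with hW
  have hW0 : ∀ ω, 0 ≤ W ω := fun ω => by
    simp only [hW]; split_ifs
    · exact mul_nonneg (Real.rpow_nonneg (by linarith [h0 _ (hG n) ω]) _) (by linarith [h0 _ hF ω])
    · exact le_rfl
  have hpow1 : ∀ ω, (1 + G n ω) ^ (p / 2 - 1) ≤ 1 := fun ω =>
    Real.rpow_le_one_of_one_le_of_nonpos (by linarith [h0 _ (hG n) ω]) (by linarith)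
  have hpow0 : ∀ ω, 0 ≤ (1 + G n ω) ^ (p / 2 - 1) := fun ω =>
    Real.rpow_nonneg (by linarith [h0 _ (hG n) ω]) _
  have hFm := hm F hF
  have hGm := hm _ (hG n)
  have hbd : ∀ a b : ℝ, 0 ≤ a → a ≤ 1 → 0 ≤ b → b ≤ M → |a * b| ≤ M := fun a b ha ha1 hb hbM => by
    rw [abs_of_nonneg (mul_nonneg ha hb)]; nlinarith
  have hWi : Integrable W μ := by
    refine Integrable.of_bound (C := M) ?_ (Filter.Eventually.of_forall fun ω => ?_)
    · exact (Measurable.ite (measurableSet_le (by fun_prop) (by fun_prop)) (by fun_prop)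
        (by fun_prop)).aestronglyMeasurable
    · simp only [hW, Real.norm_eq_abs]; split_ifs with h
      · exact hbd _ _ (hpow0 ω) (hpow1 ω) (by linarith [h0 _ hF ω]) (by linarith)
      · simpa using hM0.le
  have h2 : ∫ ω, p / 2 * t * (W ω / 2 - 2 * (1 + G n ω) ^ (p / 2)) ∂μ ≤ 1 / (n + 1) := by
    refine le_trans (integral_mono ?_ ((hi _ hmem).sub (hi _ (hG n))) fun ω => ?_) h1
    · exact ((hWi.div_const 2).sub ((hi _ (hG n)).const_mul 2)).const_mul _
    · have := rpow_variation_le (θ := p / 2) (a := 1 + G n ω) (b := 1 + F ω) (t := t)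
        (by linarith) (by linarith) (by linarith [h0 _ (hG n) ω]) (by linarith [h0 _ hF ω]) ht0 ht2
      have e : (t * (1 + F ω) ≤ 1) ↔ F ω + 1 ≤ M := by
        rw [ht, one_div, inv_mul_le_iff₀ hM0, mul_one, add_comm]
      simp only [e] at this
      simp only [hW, Pi.sub_apply]
      rw [show 1 + ((1 - t) * G n ω + t * F ω) = (1 - t) * (1 + G n ω) + t * (1 + F ω) by ring]
      exact this
  rw [integral_const_mul, integral_sub (hWi.div_const 2) ((hi _ (hG n)).const_mul 2),
    integral_div, integral_const_mul] at h2
  have h3 : ∫ ω, W ω ∂μ ≤ 4 * C + ε := by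
    have hn' : 4 * M / (p * ε) < n + 1 := hk.trans (by exact_mod_cast Nat.lt_succ_of_lt hn)
    rw [div_lt_iff₀ (by positivity)] at hn'
    have h4 := hC _ (hG n)
    have h5 : p / 2 * (1 / M) * (ε / 2) ≥ 1 / (n + 1) := by
      rw [ge_iff_le, div_le_iff₀ (by positivity)]
      rw [show p / 2 * (1 / M) * (ε / 2) * ((n : ℝ) + 1) = ((n + 1) * (p * ε)) / (4 * M) by
        field_simp; ring, le_div_iff₀ (by positivity)]
      linarith
    have h6 : p / 2 * t * ((∫ ω, W ω ∂μ) / 2 - 2 * ∫ ω, (1 + G n ω) ^ (p / 2) ∂μ) ≤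
        p / 2 * t * (ε / 2) := h2.trans h5
    have h7 := le_of_mul_le_mul_left h6 (by positivity)
    linarith
  refine le_trans (integral_mono_of_nonneg (Filter.Eventually.of_forall fun ω => ?_) hWi
    (Filter.Eventually.of_forall fun ω => ?_)) h3
  · dsimp only [Pi.zero_apply]; split_ifs
    · exact mul_nonneg (hpow0 ω) (h0 _ hF ω)
    · exact le_rfl
  · simp only [hW]; split_ifs
    · exact mul_le_mul_of_nonneg_left (by linarith) (hpow0 ω)
    · exact le_rfl

end maurey

section maurey
variable {Ω : Type*} [MeasurableSpace Ω] {μ : Measure Ω} [IsFiniteMeasure μ] {p : ℝ}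

/-- Maurey's change of density for a convex family bounded in `L_{p/2}`. -/
theorem exists_density (hp : 1 < p) (hp2 : p < 2) {K : Set (Ω → ℝ)} (hne : K.Nonempty)
    (hconv : ∀ F ∈ K, ∀ G ∈ K, ∀ t : ℝ, 0 ≤ t → t ≤ 1 → (fun ω => (1 - t) * F ω + t * G ω) ∈ K)
    (hm : ∀ F ∈ K, Measurable F) (h0 : ∀ F ∈ K, ∀ ω, 0 ≤ F ω) {C : ℝ}
    (hi : ∀ F ∈ K, Integrable (fun ω => (1 + F ω) ^ (p / 2)) μ)
    (hC : ∀ F ∈ K, ∫ ω, (1 + F ω) ^ (p / 2) ∂μ ≤ C) :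
    ∃ φ : Ω → ℝ, Measurable φ ∧ (∀ ω, 1 ≤ φ ω) ∧ MemLp φ (ENNReal.ofReal p) μ ∧
      ∫ ω, φ ω ^ p ∂μ ≤ C ∧
      ∀ F ∈ K, ∫⁻ ω, ENNReal.ofReal (φ ω ^ (p - 2) * F ω) ∂μ ≤ ENNReal.ofReal (4 * C) := by
  have hp0 : 0 < p := by linarith
  obtain ⟨A, hAK, hA⟩ := exists_near_maximizers hp0 hp2 hne hconv hm h0 hi hC
  have hA1 : ∀ n ω, 1 ≤ A n ω := fun n ω => by linarith [h0 _ (hAK n) ω]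
  have hA0 : ∀ n ω, 0 ≤ A n ω := fun n ω => by linarith [hA1 n ω]
  have hAm : ∀ n, Measurable (A n) := fun n => by
    simpa using (hm _ (hAK n)).add_const 1
  have hC0 : 0 ≤ C := by
    obtain ⟨F, hF⟩ := hne
    exact (integral_nonneg fun ω => Real.rpow_nonneg (by linarith [h0 F hF ω]) _).trans (hC F hF)
  set Z : ℕ → Ω → ℝ := fun n ω => √(A n ω) with hZ
  have hZ1 : ∀ n ω, 1 ≤ Z n ω := fun n ω => Real.one_le_sqrt.2 (hA1 n ω)
  have hZm : ∀ n, Measurable (Z n) := fun n => (hAm n).sqrt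
  have hZpow : ∀ n ω (s : ℝ), Z n ω ^ s = A n ω ^ (s / 2) := fun n ω s => by
    simp only [hZ]
    rw [Real.sqrt_eq_rpow, ← Real.rpow_mul (hA0 n ω)]
    congr 1; ring
  have hZabs : ∀ n ω, |Z n ω| ^ p = (1 + (A n ω - 1)) ^ (p / 2) := fun n ω => by
    rw [abs_of_pos (by linarith [hZ1 n ω]), hZpow, add_sub_cancel]
  have hZp : ∀ n, MemLp (Z n) (ENNReal.ofReal p) μ := fun n =>
    memLp_of_integrable_abs_rpow hp0 (hZm n).aestronglyMeasurable
      (by simpa only [hZabs] using hi _ (hAK n))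
  have hCp : 0 ≤ C ^ (1 / p) := Real.rpow_nonneg hC0 _
  have hCpp : (C ^ (1 / p)) ^ p = C := by
    rw [← Real.rpow_mul hC0, one_div_mul_cancel hp0.ne', Real.rpow_one]
  have hZl : ∀ n, lpn p μ (Z n) ≤ C ^ (1 / p) := fun n =>
    lpn_le_of_integral_le hp0 (hZp n) hCp (by
      rw [hCpp]; simpa only [hZabs] using hC _ (hAK n))
  obtain ⟨v, hvm, hv, hvl⟩ := exists_weak_limit hp hZm hZp hZl
  have h1p := one_le_ofReal hp.le
  set φ : Ω → ℝ := fun ω => max (v ω) 1 with hφ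
  have hφm : Measurable φ := hvm.max measurable_const
  have hφ1 : ∀ ω, 1 ≤ φ ω := fun ω => le_max_right _ _
  have hφi : Integrable φ μ := (hv.integrable h1p).sup (integrable_const 1)
  have hφL : MemLp φ (ENNReal.ofReal p) μ ∧ lpn p μ φ ≤ C ^ (1 / p) := by
    refine lpn_le_of_setIntegral_le hp.le hφm (fun ω => by linarith [hφ1 ω]) hφi
      (fun n ω => by linarith [hZ1 n ω]) hZp (Filter.Eventually.of_forall hZl) fun B hB ε hε => ?_
    have hD : MeasurableSet {ω | 1 ≤ v ω} := measurableSet_le measurable_const hvm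
    filter_upwards [(hvl _ (hB.inter hD)).eventually (lt_mem_nhds (sub_lt_self _ hε))] with n hn
    rw [← integral_inter_add_sdiff hD hφi.integrableOn,
      ← integral_inter_add_sdiff hD ((hZp n).integrable h1p).integrableOn]
    have e1 : ∫ ω in B ∩ {ω | 1 ≤ v ω}, φ ω ∂μ = ∫ ω in B ∩ {ω | 1 ≤ v ω}, v ω ∂μ :=
      setIntegral_congr_fun (hB.inter hD) fun ω hω => max_eq_left hω.2
    have e2 : ∫ ω in B \ {ω | 1 ≤ v ω}, φ ω ∂μ ≤ ∫ ω in B \ {ω | 1 ≤ v ω}, Z n ω ∂μ := by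
      refine setIntegral_mono_on hφi.integrableOn ((hZp n).integrable h1p).integrableOn
        (hB.diff hD) fun ω hω => ?_
      have : v ω < 1 := not_le.1 hω.2
      rw [hφ]; dsimp only
      rw [max_eq_right this.le]
      exact hZ1 n ω
    linarith
  refine ⟨φ, hφm, hφ1, hφL.1, ?_, fun F hF => ?_⟩
  · have h := Real.rpow_le_rpow lpn_nonneg hφL.2 hp0.le
    rw [hCpp, lpn_rpow hp0 hφL.1] at h
    refine le_trans (le_of_eq ?_) h
    congr 1; funext ω
    rw [abs_of_pos (by linarith [hφ1 ω])]
  have hφ0 : ∀ ω, 0 < φ ω := fun ω => by linarith [hφ1 ω]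
  have hFm := hm F hF
  have hF0 := h0 F hF
  have hset : ∀ M : ℝ, MeasurableSet {ω | F ω + 1 ≤ M} := fun M =>
    measurableSet_le (by fun_prop) (by fun_prop)
  have hbdd : ∀ M : ℝ, 2 ≤ M → ∀ s : ℝ, s ≤ 0 → ∀ ψ : Ω → ℝ, Measurable ψ → (∀ ω, 1 ≤ ψ ω) →
      Measurable (fun ω => if F ω + 1 ≤ M then ψ ω ^ s * F ω else 0) ∧
      ∀ ω, ‖(if F ω + 1 ≤ M then ψ ω ^ s * F ω else 0)‖ ≤ M := by
    intro M hM s hs ψ hψm hψ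
    refine ⟨Measurable.ite (hset M) (by fun_prop) (by fun_prop), fun ω => ?_⟩
    split_ifs with h
    · have h1 : 0 ≤ ψ ω ^ s := Real.rpow_nonneg (by linarith [hψ ω]) _
      have h2 : ψ ω ^ s ≤ 1 := Real.rpow_le_one_of_one_le_of_nonpos (hψ ω) hs
      rw [Real.norm_eq_abs, abs_of_nonneg (mul_nonneg h1 (hF0 ω))]
      nlinarith [hF0 ω]
    · rw [norm_zero]; linarith
  have key : ∀ M : ℝ, 2 ≤ M →
      ∫ ω, (if F ω + 1 ≤ M then φ ω ^ (p - 2) * F ω else 0) ∂μ ≤ 4 * C := by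
    intro M hM
    refine le_of_forall_pos_le_add fun ε hε => ?_
    set g : Ω → ℝ := fun ω => if F ω + 1 ≤ M then φ ω ^ (p - 3) * F ω else 0 with hg
    obtain ⟨hgm, hgb⟩ := hbdd M hM (p - 3) (by linarith) φ hφm hφ1
    obtain ⟨hfm, hfb⟩ := hbdd M hM (p - 2) (by linarith) φ hφm hφ1
    have hpq := Real.HolderConjugate.conjExponent hp
    have hgq : MemLp g (ENNReal.ofReal p.conjExponent) μ :=
      MemLp.of_bound hgm.aestronglyMeasurable M (Filter.Eventually.of_forall hgb)
    have hD : ∀ n, MemLp (fun ω => Z n ω - v ω) (ENNReal.ofReal p) μ := fun n => (hZp n).sub hv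
    have ht := tendsto_integral_mul_of_null hpq.symm hD (C := C ^ (1 / p) + lpn p μ v)
      (fun n => by
        have := abs_lpn_sub_le (ν := μ) hp.le (hD n) (hZp n)
        have h2 : (fun ω => Z n ω - v ω - Z n ω) = fun ω => (-1) * v ω := by funext ω; ring
        rw [h2, lpn_const_mul] at this
        have h3 := (abs_le.1 this).2
        norm_num at h3
        linarith [hZl n])
      (fun B hB => by
        have h := (hvl B hB).sub_const (∫ ω in B, v ω ∂μ)
        rw [sub_self] at h
        refine h.congr fun n => ?_
        rw [integral_sub ((hZp n).integrable h1p).restrict (hv.integrable h1p).restrict])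
      hgm hgq
    obtain ⟨n, h1, h2⟩ := ((hA F hF M hM (ε / 2) (by positivity)).and
      (ht.eventually (gt_mem_nhds (by positivity : (0 : ℝ) < ε / 2)))).exists
    obtain ⟨hzm, hzb⟩ := hbdd M hM (p - 2) (by linarith) (Z n) (hZm n) (hZ1 n)
    have hzi : Integrable (fun ω => if F ω + 1 ≤ M then Z n ω ^ (p - 2) * F ω else 0) μ :=
      Integrable.of_bound hzm.aestronglyMeasurable M (Filter.Eventually.of_forall hzb)
    have hDg : Integrable (fun ω => (2 - p) * ((Z n ω - v ω) * g ω)) μ :=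
      (integrable_mul_of_holder hpq.symm (hD n) hgq).const_mul _
    have h3 : ∫ ω, (if F ω + 1 ≤ M then φ ω ^ (p - 2) * F ω else 0) ∂μ ≤
        ∫ ω, (if F ω + 1 ≤ M then Z n ω ^ (p - 2) * F ω else 0) ∂μ +
        (2 - p) * ∫ ω, (Z n ω - v ω) * g ω ∂μ := by
      rw [← integral_const_mul, ← integral_add hzi hDg]
      refine integral_mono
        (Integrable.of_bound hfm.aestronglyMeasurable M (Filter.Eventually.of_forall hfb))
        (hzi.add hDg) fun ω => ?_
      simp only [hg]
      split_ifs
      · have h4 := rpow_neg_tangent_le (s := 2 - p) (x := Z n ω) (t := φ ω) (by linarith)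
          (by linarith) (by linarith [hZ1 n ω]) (hφ0 ω)
        rw [show -(2 - p) = p - 2 by ring, show p - 2 - 1 = p - 3 by ring] at h4
        have h5 : v ω ≤ φ ω := le_max_left _ _
        have h6 : (2 - p) * φ ω ^ (p - 3) * (Z n ω - φ ω) ≤
            (2 - p) * φ ω ^ (p - 3) * (Z n ω - v ω) :=
          mul_le_mul_of_nonneg_left (by linarith)
            (mul_nonneg (by linarith) (Real.rpow_nonneg (hφ0 ω).le _))
        have := mul_le_mul_of_nonneg_right
          (by linarith : φ ω ^ (p - 2) ≤ Z n ω ^ (p - 2) + (2 - p) * φ ω ^ (p - 3) * (Z n ω - v ω))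
          (hF0 ω)
        linarith
      · simp
    have h4 : ∫ ω, (if F ω + 1 ≤ M then Z n ω ^ (p - 2) * F ω else 0) ∂μ ≤ 4 * C + ε / 2 := by
      simpa only [hZpow, sub_div, div_self (two_ne_zero : (2 : ℝ) ≠ 0)] using h1
    nlinarith
  have hU : (⋃ n : ℕ, {ω | F ω + 1 ≤ (n : ℝ) + 2}) = Set.univ :=
    Set.eq_univ_of_forall fun ω => by
      obtain ⟨n, hn⟩ := exists_nat_gt (F ω)
      exact Set.mem_iUnion.2 ⟨n, by simp only [Set.mem_ofPred_eq]; linarith⟩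
  rw [← setLIntegral_univ, ← hU, setLIntegral_iUnion_of_directed]
  · refine iSup_le fun n => ?_
    rw [← lintegral_indicator (hset _)]
    obtain ⟨hfm, hfb⟩ := hbdd ((n : ℝ) + 2) (by linarith [n.cast_nonneg (α := ℝ)]) (p - 2)
      (by linarith) φ hφm hφ1
    have hfi := Integrable.of_bound (μ := μ) hfm.aestronglyMeasurable _
      (Filter.Eventually.of_forall hfb)
    refine le_trans (le_of_eq ?_) (ENNReal.ofReal_le_ofReal
      (key ((n : ℝ) + 2) (by linarith [n.cast_nonneg (α := ℝ)])))
    rw [ofReal_integral_eq_lintegral_ofReal hfi (Filter.Eventually.of_forall fun ω => ?_)]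
    · refine lintegral_congr fun ω => ?_
      by_cases h : F ω + 1 ≤ (n : ℝ) + 2
      · rw [Set.indicator_of_mem (by exact h), if_pos h]
      · rw [Set.indicator_of_notMem (by exact h), if_neg h, ENNReal.ofReal_zero]
    · dsimp only [Pi.zero_apply]; split_ifs
      · exact mul_nonneg (Real.rpow_nonneg (hφ0 ω).le _) (hF0 ω)
      · exact le_rfl
  · refine Monotone.directed_le fun m n hmn ω hω => ?_
    have : (m : ℝ) ≤ n := by exact_mod_cast hmn
    simp only [Set.mem_ofPred_eq] at hω ⊢
    linarith

end maurey

lemma gaussNorm_pos {p : ℝ} (hp : 0 < p) : 0 < gaussNorm p := by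
  have h0 : ∀ x : ℝ, 0 ≤ |x| ^ p := fun x => Real.rpow_nonneg (abs_nonneg _) p
  have h : 0 < ∫ x, |x| ^ p ∂(gaussianReal 0 1) := by
    refine lt_of_le_of_ne (integral_nonneg h0) fun h => ?_
    have h1 := (integral_eq_zero_iff_of_nonneg h0 (integrable_abs_rpow_gaussian hp.le)).1 h.symm
    have h2 : ∫ x : ℝ, x ^ 2 ∂(gaussianReal 0 1) = 0 := by
      refine integral_eq_zero_of_ae ?_
      filter_upwards [h1] with x hx
      have : |x| = 0 := ((Real.rpow_eq_zero_iff_of_nonneg (abs_nonneg x)).1 hx).1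
      simp [abs_eq_zero.1 this]
    rw [integral_gaussian_sq] at h2
    exact one_ne_zero h2
  exact Real.rpow_pos_of_pos h _

lemma gaussNorm_rpow {p : ℝ} (hp : 0 < p) :
    gaussNorm p ^ p = ∫ x, |x| ^ p ∂(gaussianReal 0 1) := by
  unfold gaussNorm
  rw [← Real.rpow_mul (integral_nonneg fun x => Real.rpow_nonneg (abs_nonneg _) p),
    one_div_mul_cancel hp.ne', Real.rpow_one]

section gauss
variable {E : Type*} [NormedAddCommGroup E] [InnerProductSpace ℝ E] [FiniteDimensional ℝ E]
  [MeasurableSpace E] [BorelSpace E]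

lemma map_inner_stdGaussian (v : E) :
    (stdGaussian E).map (fun x => inner ℝ v x) = (gaussianReal 0 1).map (fun g => ‖v‖ * g) := by
  have h := IsGaussian.map_eq_gaussianReal (μ := stdGaussian E) (innerSL ℝ v)
  rw [integral_strongDual_stdGaussian, variance_dual_stdGaussian, innerSL_apply_norm] at h
  rw [gaussianReal_map_const_mul]
  refine Eq.trans h ?_
  congr 1
  · simp
  · ext; simp

lemma lintegral_inner_stdGaussian (v : E) {h : ℝ → ℝ≥0∞} (hh : Measurable h) :
    ∫⁻ x, h (inner ℝ v x) ∂(stdGaussian E) = ∫⁻ g, h (‖v‖ * g) ∂(gaussianReal 0 1) := by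
  rw [← lintegral_map hh (by fun_prop : Measurable fun g : ℝ => ‖v‖ * g), ← map_inner_stdGaussian,
    lintegral_map hh (by fun_prop)]

lemma lintegral_abs_inner_rpow_stdGaussian {p : ℝ} (hp : 0 < p) (v : E) :
    ∫⁻ x, ENNReal.ofReal (|inner ℝ v x| ^ p) ∂(stdGaussian E) =
      ENNReal.ofReal (gaussNorm p ^ p * ‖v‖ ^ p) := by
  rw [lintegral_inner_stdGaussian v (h := fun t => ENNReal.ofReal (|t| ^ p)) (by fun_prop),
    gaussNorm_rpow hp, mul_comm, ← integral_const_mul, ofReal_integral_eq_lintegral_ofReal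
      ((integrable_abs_rpow_gaussian hp.le).const_mul _)
      (Filter.Eventually.of_forall fun x => by positivity)]
  refine lintegral_congr fun g => ?_
  rw [abs_mul, abs_of_nonneg (norm_nonneg v), Real.mul_rpow (norm_nonneg v) (abs_nonneg g)]

lemma lintegral_sq_inner_stdGaussian (v : E) :
    ∫⁻ x, ENNReal.ofReal ((inner ℝ v x) ^ 2) ∂(stdGaussian E) = ENNReal.ofReal (‖v‖ ^ 2) := by
  rw [lintegral_inner_stdGaussian v (h := fun t => ENNReal.ofReal (t ^ 2)) (by fun_prop)]
  have e : ‖v‖ ^ 2 = ∫ g, ‖v‖ ^ 2 * g ^ 2 ∂(gaussianReal 0 1) := by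
    rw [integral_const_mul, integral_gaussian_sq, mul_one]
  rw [e, ofReal_integral_eq_lintegral_ofReal
      ((Integrable.of_integral_ne_zero (by rw [integral_gaussian_sq]; exact one_ne_zero)).const_mul
        _)
      (Filter.Eventually.of_forall fun x => by positivity)]
  refine lintegral_congr fun g => ?_
  rw [mul_pow]

end gauss

section sqfun
variable {Ω : Type*} [MeasurableSpace Ω] {μ : Measure Ω} [IsFiniteMeasure μ] {p : ℝ}
  [Fact (1 ≤ ENNReal.ofReal p)]

lemma lintegral_abs_rpow_eq (hp : 0 < p) {F : Ω → ℝ} (hF : MemLp F (ENNReal.ofReal p) μ) :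
    ∫⁻ ω, ENNReal.ofReal (|F ω| ^ p) ∂μ = ENNReal.ofReal (lpn p μ F ^ p) := by
  rw [lpn_rpow hp hF, ofReal_integral_eq_lintegral_ofReal (integrable_abs_rpow_of_memLp hp hF)
    (Filter.Eventually.of_forall fun x => Real.rpow_nonneg (abs_nonneg _) p)]

/-- The square function estimate, obtained by averaging over Gaussian coefficients. -/
lemma lintegral_square_function_le (hp2 : p ≤ 2) (S : SeqL2 →L[ℝ] Lp ℝ (ENNReal.ofReal p) μ)
    (s : Finset ℕ) {w : ℕ → ℝ} (hw0 : ∀ i, 0 ≤ w i) (hw : ∑ i ∈ s, w i ≤ 1) :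
    ∫⁻ ω, ENNReal.ofReal ((∑ i ∈ s, w i * S (l2e i) ω ^ 2) ^ (p / 2)) ∂μ ≤
      ENNReal.ofReal (2 * ‖S‖ ^ p / gaussNorm p ^ p) := by
  have hp : 0 < p := by linarith [one_le_of_fact (p := p)]
  set v : Ω → EuclideanSpace ℝ s := fun ω => WithLp.toLp 2 fun i : s => √(w i) * S (l2e i) ω with hv
  have hvm : Measurable v := by
    refine (WithLp.measurable_toLp 2 _).comp (measurable_pi_lambda _ fun i => ?_)
    exact (measurable_coeFn _).const_mul _
  have hvn : ∀ ω, ‖v ω‖ ^ p = (∑ i ∈ s, w i * S (l2e i) ω ^ 2) ^ (p / 2) := fun ω => by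
    rw [EuclideanSpace.norm_eq, Real.sqrt_eq_rpow, ← Real.rpow_mul (by positivity)]
    congr 1
    · rw [← Finset.sum_coe_sort s fun i => w i * S (l2e i) ω ^ 2]
      refine Finset.sum_congr rfl fun i _ => ?_
      simp only [hv, Real.norm_eq_abs, sq_abs, mul_pow, Real.sq_sqrt (hw0 _)]
    · ring
  have hx : ∀ x : EuclideanSpace ℝ s, ∫⁻ ω, ENNReal.ofReal (|inner ℝ (v ω) x| ^ p) ∂μ ≤
      ENNReal.ofReal (‖S‖ ^ p) * (1 + ∑ i : s, ENNReal.ofReal (w i) *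
        ENNReal.ofReal (x i ^ 2)) := by
    intro x
    set y : SeqL2 := ∑ i : s, (√(w i) * x i) • l2e i with hy
    have e1 : ⇑(S y) =ᵐ[μ] fun ω => inner ℝ (v ω) x := by
      rw [hy, map_sum]
      simp only [map_smul]
      refine (coeFn_sum_smul _ _ _).trans (Filter.Eventually.of_forall fun ω => ?_)
      simp only [hv, PiLp.inner_apply, RCLike.inner_apply, conj_trivial]
      exact Finset.sum_congr rfl fun i _ => by ring
    have e2 : ‖y‖ ^ 2 = ∑ i : s, w i * x i ^ 2 := by
      have := (orthonormal_l2e.comp (fun i : s => (i : ℕ)) Subtype.val_injective).inner_sum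
        (fun i : s => √(w i) * x i) (fun i : s => √(w i) * x i) Finset.univ
      rw [← real_inner_self_eq_norm_sq]
      refine Eq.trans this (Finset.sum_congr rfl fun i _ => ?_)
      simp only [conj_trivial]
      have := Real.sq_sqrt (hw0 i)
      linear_combination (x i) ^ 2 * this
    have e3 : ∫⁻ ω, ENNReal.ofReal (|inner ℝ (v ω) x| ^ p) ∂μ = ENNReal.ofReal (‖S y‖ ^ p) := by
      rw [← lpn_coeFn, ← lintegral_abs_rpow_eq hp (Lp.memLp _)]
      refine lintegral_congr_ae ?_
      filter_upwards [e1] with ω h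
      rw [h]
    rw [e3]
    have h1 : ‖S y‖ ^ p ≤ ‖S‖ ^ p * (1 + ∑ i : s, w i * x i ^ 2) := by
      calc ‖S y‖ ^ p ≤ (‖S‖ * ‖y‖) ^ p :=
            Real.rpow_le_rpow (norm_nonneg _) (S.le_opNorm y) hp.le
        _ = ‖S‖ ^ p * ‖y‖ ^ p := Real.mul_rpow (norm_nonneg _) (norm_nonneg _)
        _ ≤ ‖S‖ ^ p * (1 + ∑ i : s, w i * x i ^ 2) := by
            refine mul_le_mul_of_nonneg_left ?_ (by positivity)
            rw [← e2]
            rcases le_total ‖y‖ 1 with h | h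
            · have := Real.rpow_le_one (norm_nonneg y) h hp.le
              nlinarith [sq_nonneg ‖y‖]
            · have := Real.rpow_le_rpow_of_exponent_le h hp2
              rw [Real.rpow_two] at this
              linarith
    have h2 : ∀ i : s, 0 ≤ w i * x i ^ 2 := fun i => mul_nonneg (hw0 _) (sq_nonneg _)
    refine (ENNReal.ofReal_le_ofReal h1).trans (le_of_eq ?_)
    rw [ENNReal.ofReal_mul (by positivity), ENNReal.ofReal_add zero_le_one
      (Finset.sum_nonneg fun i _ => h2 i), ENNReal.ofReal_sum_of_nonneg fun i _ => h2 i,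
      ENNReal.ofReal_one]
    congr 2
    exact Finset.sum_congr rfl fun i _ => ENNReal.ofReal_mul (hw0 _)
  have hsum : ∫⁻ x : EuclideanSpace ℝ s, (1 + ∑ i : s, ENNReal.ofReal (w i) *
      ENNReal.ofReal (x i ^ 2))
      ∂(stdGaussian (EuclideanSpace ℝ s)) ≤ 2 := by
    have hmi : ∀ i : s, Measurable fun x : EuclideanSpace ℝ s => ENNReal.ofReal (x i ^ 2) :=
        fun i => by fun_prop
    rw [lintegral_add_left measurable_const, lintegral_const, measure_univ, mul_one,
      lintegral_finsetSum _ fun i _ => (hmi i).const_mul _]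
    refine le_trans ?_ one_add_one_eq_two.le
    refine add_le_add le_rfl ?_
    have : ∀ i : s, ∫⁻ x : EuclideanSpace ℝ s, ENNReal.ofReal (w i) * ENNReal.ofReal (x i ^ 2)
        ∂(stdGaussian (EuclideanSpace ℝ s)) =
        ENNReal.ofReal (w i) := fun i => by
      rw [lintegral_const_mul _ (hmi i)]
      have h := lintegral_sq_inner_stdGaussian (EuclideanSpace.single i (1 : ℝ))
      simp only [EuclideanSpace.inner_single_left, map_one, one_mul, PiLp.norm_single,
        norm_one, one_pow, ENNReal.ofReal_one] at h
      rw [h, mul_one]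
    simp only [this]
    rw [← ENNReal.ofReal_sum_of_nonneg fun i _ => hw0 _, Finset.sum_coe_sort s w]
    exact ENNReal.ofReal_le_one.2 hw
  have hg : 0 < gaussNorm p ^ p := Real.rpow_pos_of_pos (gaussNorm_pos hp) _
  have main : ENNReal.ofReal (gaussNorm p ^ p) *
      ∫⁻ ω, ENNReal.ofReal ((∑ i ∈ s, w i * S (l2e i) ω ^ 2) ^ (p / 2)) ∂μ ≤
      ENNReal.ofReal (‖S‖ ^ p) * 2 := by
    have hjm : Measurable fun z : Ω × EuclideanSpace ℝ s => ENNReal.ofReal (|inner ℝ (v z.1) z.2| ^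
        p) := by
      fun_prop
    calc _ = ∫⁻ ω, ∫⁻ x, ENNReal.ofReal (|inner ℝ (v ω) x| ^ p)
        ∂(stdGaussian (EuclideanSpace ℝ s)) ∂μ := by
          simp only [lintegral_abs_inner_rpow_stdGaussian hp, hvn]
          simp only [ENNReal.ofReal_mul hg.le]
          rw [lintegral_const_mul' _ _ ENNReal.ofReal_ne_top]
      _ = ∫⁻ x, ∫⁻ ω, ENNReal.ofReal (|inner ℝ (v ω) x| ^ p) ∂μ
          ∂(stdGaussian (EuclideanSpace ℝ s)) :=
          lintegral_lintegral_swap hjm.aemeasurable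
      _ ≤ ∫⁻ x : EuclideanSpace ℝ s, ENNReal.ofReal (‖S‖ ^ p) *
          (1 + ∑ i : s, ENNReal.ofReal (w i) * ENNReal.ofReal (x i ^ 2))
            ∂(stdGaussian (EuclideanSpace ℝ s)) :=
          lintegral_mono hx
      _ ≤ _ := by
          rw [lintegral_const_mul' _ _ ENNReal.ofReal_ne_top]
          exact mul_le_mul_right hsum _
  rw [ENNReal.ofReal_div_of_pos hg, ENNReal.le_div_iff_mul_le (Or.inl (by simpa using hg))
    (Or.inl ENNReal.ofReal_ne_top), mul_comm]
  refine main.trans (le_of_eq ?_)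
  rw [mul_comm 2, ENNReal.ofReal_mul (by positivity)]
  simp

end sqfun

section maurey
variable {Ω : Type*} [MeasurableSpace Ω] {μ : Measure Ω} {p : ℝ}
  [IsFiniteMeasure μ] [Fact (1 ≤ ENNReal.ofReal p)]

/-- Maurey's factorization: the columns of an operator into `L_p`, `p < 2`, become bounded in
`L_2` after a change of density, with constants depending on the norm of the operator only. -/
theorem exists_maurey_density (hp : 1 < p) (hp2 : p < 2) (M : ℝ) :
    ∃ C : ℝ, 0 ≤ C ∧ ∀ S : SeqL2 →L[ℝ] Lp ℝ (ENNReal.ofReal p) μ, ‖S‖ ≤ M →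
      ∃ φ : Ω → ℝ, Measurable φ ∧ (∀ ω, 1 ≤ φ ω) ∧ MemLp φ (ENNReal.ofReal p) μ ∧
        ∫ ω, φ ω ^ p ∂μ ≤ C ∧
        ∀ n, ∫⁻ ω, ENNReal.ofReal (φ ω ^ (p - 2) * S (l2e n) ω ^ 2) ∂μ ≤ ENNReal.ofReal C := by
  have hp0 : 0 < p := by linarith
  have hg : 0 < gaussNorm p ^ p := Real.rpow_pos_of_pos (gaussNorm_pos hp0) _
  rcases lt_or_ge M 0 with hM | hM
  · exact ⟨0, le_rfl, fun S hS => absurd (norm_nonneg S) (by linarith)⟩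
  set D : ℝ := 2 * M ^ p / gaussNorm p ^ p with hD
  have hD0 : 0 ≤ D := by positivity
  set C : ℝ := 2 * (μ.real Set.univ + D) with hCdef
  have hC0 : 0 ≤ C := by positivity
  refine ⟨4 * C, by positivity, fun S hS => ?_⟩
  have hXm : ∀ n, Measurable (S (l2e n) : Ω → ℝ) := fun n => measurable_coeFn _
  set K : Set (Ω → ℝ) := {F | ∃ w : ℕ →₀ ℝ, (∀ i, 0 ≤ w i) ∧
    Finsupp.linearCombination ℝ (fun _ => (1 : ℝ)) w ≤ 1 ∧
    F = fun ω => Finsupp.linearCombination ℝ (fun i => S (l2e i) ω ^ 2) w} with hK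
  have hm : ∀ F ∈ K, Measurable F := by
    rintro F ⟨w, -, -, rfl⟩
    simp only [Finsupp.linearCombination_apply, Finsupp.sum, smul_eq_mul]
    exact Finset.measurable_fun_sum _ fun i _ => ((hXm i).pow_const 2).const_mul _
  have h0 : ∀ F ∈ K, ∀ ω, 0 ≤ F ω := by
    rintro F ⟨w, hw, -, rfl⟩ ω
    simp only [Finsupp.linearCombination_apply, Finsupp.sum, smul_eq_mul]
    exact Finset.sum_nonneg fun i _ => mul_nonneg (hw i) (sq_nonneg _)
  have hlint : ∀ F ∈ K, ∫⁻ ω, ENNReal.ofReal ((1 + F ω) ^ (p / 2)) ∂μ ≤ ENNReal.ofReal C := by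
    intro F hF
    have hF0 := h0 F hF
    obtain ⟨w, hw0, hw1, hFw⟩ := id hF
    have h1 : ∫⁻ ω, ENNReal.ofReal (F ω ^ (p / 2)) ∂μ ≤ ENNReal.ofReal D := by
      simp only [Finsupp.linearCombination_apply, Finsupp.sum, smul_eq_mul, mul_one] at hw1 hFw
      rw [hFw]
      refine (lintegral_square_function_le hp2.le S w.support hw0 hw1).trans
        (ENNReal.ofReal_le_ofReal ?_)
      rw [hD]
      have := Real.rpow_le_rpow (norm_nonneg S) hS hp0.le
      exact div_le_div_of_nonneg_right (by linarith) hg.le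
    have h2 : ∀ ω, ENNReal.ofReal ((1 + F ω) ^ (p / 2)) ≤
        ENNReal.ofReal 2 * (1 + ENNReal.ofReal (F ω ^ (p / 2))) := fun ω => by
      have a1 : 0 ≤ F ω ^ (p / 2) := Real.rpow_nonneg (hF0 ω) _
      rw [← ENNReal.ofReal_one, ← ENNReal.ofReal_add zero_le_one a1,
        ← ENNReal.ofReal_mul two_pos.le]
      refine ENNReal.ofReal_le_ofReal ?_
      have a2 := add_rpow_le_two_rpow zero_le_one (hF0 ω) (s := p / 2) (by linarith)
      rw [Real.one_rpow] at a2
      refine a2.trans (mul_le_mul_of_nonneg_right ?_ (by linarith))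
      simpa using Real.rpow_le_rpow_of_exponent_le one_le_two (show p / 2 ≤ 1 by linarith)
    refine (lintegral_mono h2).trans ?_
    rw [lintegral_const_mul' _ _ ENNReal.ofReal_ne_top, lintegral_add_left measurable_const,
      lintegral_const, one_mul, hCdef, ENNReal.ofReal_mul two_pos.le,
      ENNReal.ofReal_add (by positivity) hD0, ofReal_measureReal]
    exact mul_le_mul_right (add_le_add_right h1 _) _
  have hpos : ∀ F ∈ K, ∀ ω, 0 ≤ (1 + F ω) ^ (p / 2) := fun F hF ω =>
    Real.rpow_nonneg (by linarith [h0 F hF ω]) _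
  have hpm : ∀ F ∈ K, Measurable fun ω => (1 + F ω) ^ (p / 2) := fun F hF =>
    ((hm F hF).const_add 1).pow_const _
  have hi : ∀ F ∈ K, Integrable (fun ω => (1 + F ω) ^ (p / 2)) μ := fun F hF =>
    ⟨(hpm F hF).aestronglyMeasurable, by
      rw [hasFiniteIntegral_iff_ofReal (Filter.Eventually.of_forall (hpos F hF))]
      exact (hlint F hF).trans_lt ENNReal.ofReal_lt_top⟩
  have hCK : ∀ F ∈ K, ∫ ω, (1 + F ω) ^ (p / 2) ∂μ ≤ C := fun F hF => by
    rw [integral_eq_lintegral_of_nonneg_ae (Filter.Eventually.of_forall (hpos F hF))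
      (hpm F hF).aestronglyMeasurable]
    exact ENNReal.toReal_le_of_le_ofReal hC0 (hlint F hF)
  obtain ⟨φ, hφm, hφ1, hφp, hφC, hφK⟩ := exists_density hp hp2 (K := K)
    ⟨_, 0, by simp, by simp, rfl⟩ (by
      rintro F ⟨w, hw0, hw1, rfl⟩ G ⟨u, hu0, hu1, rfl⟩ t ht0 ht1
      refine ⟨(1 - t) • w + t • u, fun i => ?_, ?_, ?_⟩
      · simp only [Finsupp.coe_add, Finsupp.coe_smul, Pi.add_apply, Pi.smul_apply, smul_eq_mul]
        have := hw0 i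
        have := hu0 i
        have : 0 ≤ 1 - t := by linarith
        positivity
      · rw [map_add, map_smul, map_smul, smul_eq_mul, smul_eq_mul]
        nlinarith
      · simp only [map_add, map_smul, smul_eq_mul]) hm h0 hi hCK
  refine ⟨φ, hφm, hφ1, hφp, by linarith, fun n => ?_⟩
  refine hφK _ ⟨Finsupp.single n 1, fun i => ?_, by simp, by simp⟩
  rw [Finsupp.single_apply]
  split_ifs <;> norm_num

end maurey

section split
variable {Ω : Type*} [MeasurableSpace Ω] {ν : Measure Ω} [IsFiniteMeasure ν]

lemma indicator_sq_integral_bounds {Z : Ω → ℝ} (hZm : Measurable Z)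
    (hZ : Integrable (fun ω => Z ω ^ 2) ν) (M : ℝ) :
    Integrable (fun ω => if |Z ω| ≤ M then Z ω ^ 2 else 0) ν := by
  refine hZ.mono ?_ (Filter.Eventually.of_forall fun ω => ?_)
  · exact (Measurable.ite (measurableSet_le (by fun_prop) measurable_const) (by fun_prop)
      measurable_const).aestronglyMeasurable
  · split_ifs
    · rfl
    · simpa using sq_nonneg (Z ω)

/-- A subsequence-free splitting: an `L_2`-bounded sequence can be truncated, with truncation
levels tending to infinity along `hypU`, so that the truncations have equi-integrable squares. -/
theorem exists_truncation {Z : ℕ → Ω → ℝ} (hZm : ∀ n, Measurable (Z n))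
    (hZ : ∀ n, Integrable (fun ω => Z n ω ^ 2) ν) {C : ℝ} (hC : ∀ n, ∫ ω, Z n ω ^ 2 ∂ν ≤ C) :
    ∃ M : ℕ → ℕ, (∀ k, ∀ᶠ n in hypU, k ≤ M n) ∧
      ∀ ρ > 0, ∃ L : ℝ, ∀ᶠ n in hypU,
        ∫ ω, (if L < |if |Z n ω| ≤ M n then Z n ω else 0| then
          (if |Z n ω| ≤ M n then Z n ω else 0) ^ 2 else 0) ∂ν ≤ ρ := by
  set t : ℕ → ℕ → ℝ := fun n K => ∫ ω, (if |Z n ω| ≤ K then Z n ω ^ 2 else 0) ∂ν with ht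
  have hti : ∀ n (K : ℕ), Integrable (fun ω => if |Z n ω| ≤ K then Z n ω ^ 2 else 0) ν :=
    fun n K => indicator_sq_integral_bounds (hZm n) (hZ n) K
  have ht0 : ∀ n K, 0 ≤ t n K := fun n K => integral_nonneg fun ω => by
    dsimp only
    split_ifs
    · exact sq_nonneg _
    · exact le_rfl
  have htC : ∀ n K, t n K ≤ C := fun n K => (integral_mono (hti n K) (hZ n) fun ω => by
    dsimp only
    split_ifs
    · exact le_rfl
    · exact sq_nonneg _).trans (hC n)
  have hlim : ∀ K, ∃ l, Filter.Tendsto (fun n => t n K) hypU (nhds l) := fun K =>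
    exists_tendsto_hypU_of_bdd (C := C) (Filter.Eventually.of_forall fun n => by
      rw [abs_of_nonneg (ht0 n K)]
      exact htC n K)
  choose τ hτ using hlim
  have hτC : ∀ K, τ K ≤ C := fun K => le_of_tendsto (hτ K)
    (Filter.Eventually.of_forall fun n => htC n K)
  have hbdd : BddAbove (Set.range τ) := ⟨C, by rintro _ ⟨K, rfl⟩; exact hτC K⟩
  set T : ℝ := ⨆ K, τ K with hT
  have hτT : ∀ K, τ K ≤ T := fun K => le_ciSup hbdd K
  set M : ℕ → ℕ := fun n => Nat.findGreatest (fun K => t n K ≤ T + 1 / ((K : ℝ) + 1)) n with hM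
  have hM1 : ∀ k, ∀ᶠ n in hypU, k ≤ M n := fun k => by
    have h1 : ∀ᶠ n in hypU, t n k < T + 1 / ((k : ℝ) + 1) :=
      (hτ k).eventually_lt_const (by
        have : 0 < 1 / ((k : ℝ) + 1) := by positivity
        linarith [hτT k])
    filter_upwards [h1, eventually_hypU_gt k] with n h2 h3
    exact Nat.le_findGreatest h3.le h2.le
  refine ⟨M, hM1, fun ρ hρ => ?_⟩
  obtain ⟨L, hL⟩ := exists_lt_of_lt_ciSup (show T - ρ / 2 < ⨆ K, τ K by linarith)
  obtain ⟨k, hk⟩ := exists_nat_one_div_lt (half_pos hρ)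
  refine ⟨L, ?_⟩
  filter_upwards [(hτ L).eventually_const_lt hL, hM1 L, hM1 k, hM1 1] with n h1 h2 h3 h4
  have h5 : t n (M n) ≤ T + ρ / 2 := by
    have := Nat.findGreatest_of_ne_zero (P := fun K => t n K ≤ T + 1 / ((K : ℝ) + 1))
      (rfl : M n = M n) (by omega)
    have h6 : 1 / ((M n : ℝ) + 1) ≤ 1 / ((k : ℝ) + 1) :=
      one_div_le_one_div_of_le (by positivity) (by exact_mod_cast Nat.succ_le_succ h3)
    linarith
  have h7 : ∫ ω, (if (L : ℝ) < |if |Z n ω| ≤ M n then Z n ω else 0| then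
          (if |Z n ω| ≤ M n then Z n ω else 0) ^ 2 else 0) ∂ν = t n (M n) - t n L := by
    rw [ht]
    dsimp only
    rw [← integral_sub (hti n _) (hti n _)]
    refine integral_congr_ae (Filter.Eventually.of_forall fun ω => ?_)
    have h8 : (L : ℝ) ≤ M n := by exact_mod_cast h2
    dsimp only
    by_cases h9 : |Z n ω| ≤ M n
    · simp only [h9, if_true]
      by_cases h10 : |Z n ω| ≤ L
      · simp [h10]
      · simp [h10, lt_of_not_ge h10]
    · have h10 : ¬ |Z n ω| ≤ L := fun h => h9 (h.trans h8)
      simp [h9, h10]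
  rw [h7]
  linarith

lemma lpn_tail_le {s : ℝ} (hs : 0 < s) (hs2 : s < 2) {Z : Ω → ℝ} (hZm : Measurable Z)
    (hZ : Integrable (fun ω => Z ω ^ 2) ν) {C : ℝ} (hC : ∫ ω, Z ω ^ 2 ∂ν ≤ C) {K : ℝ}
    (hK : 0 < K) {M : ℝ} (hM : K ≤ M) {c : ℝ} (hc : 0 ≤ c) (hKc : K ^ (s - 2) * C ≤ c ^ s) :
    lpn s ν (fun ω => Z ω - if |Z ω| ≤ M then Z ω else 0) ≤ c := by
  have hm : Measurable fun ω => Z ω - if |Z ω| ≤ M then Z ω else 0 :=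
    hZm.sub (Measurable.ite (measurableSet_le (by fun_prop) measurable_const) hZm measurable_const)
  have hZ2 : MemLp Z (ENNReal.ofReal 2) ν := by
    refine memLp_of_integrable_abs_rpow two_pos hZm.aestronglyMeasurable ?_
    simpa using hZ
  have hmem : MemLp (fun ω => Z ω - if |Z ω| ≤ M then Z ω else 0) (ENNReal.ofReal s) ν := by
    refine (memLp_ofReal_mono hs2.le hZ2).mono hm.aestronglyMeasurable
      (Filter.Eventually.of_forall fun ω => ?_)
    split_ifs <;> simp
  refine lpn_le_of_integral_le hs hmem hc ?_
  have hpt : ∀ ω, |Z ω - if |Z ω| ≤ M then Z ω else 0| ^ s ≤ K ^ (s - 2) * Z ω ^ 2 := fun ω => by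
    split_ifs with h
    · rw [sub_self, abs_zero, Real.zero_rpow hs.ne']
      positivity
    · have h1 : K ≤ |Z ω| := by linarith [not_le.1 h]
      have h2 : 0 < |Z ω| := hK.trans_le h1
      have h3 : |Z ω| ^ s = |Z ω| ^ (s - 2) * Z ω ^ 2 := by
        rw [← sq_abs, ← Real.rpow_natCast, ← Real.rpow_add h2]
        norm_num
      rw [sub_zero, h3]
      exact mul_le_mul_of_nonneg_right
        (Real.rpow_le_rpow_of_nonpos hK h1 (by linarith)) (sq_nonneg _)
  calc _ ≤ ∫ ω, K ^ (s - 2) * Z ω ^ 2 ∂ν :=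
        integral_mono (integrable_abs_rpow_of_memLp hs hmem) (hZ.const_mul _) hpt
    _ = K ^ (s - 2) * ∫ ω, Z ω ^ 2 ∂ν := integral_const_mul _ _
    _ ≤ K ^ (s - 2) * C := mul_le_mul_of_nonneg_left hC (by positivity)
    _ ≤ c ^ s := hKc

end split

section colLim
variable {Ω : Type*} [MeasurableSpace Ω] {μ : Measure Ω} {p : ℝ}
  [IsFiniteMeasure μ] [Fact (1 ≤ ENNReal.ofReal p)]

lemma lintegral_div_sq_powDensity {φ : Ω → ℝ} (hφ : Measurable φ) (hφ1 : ∀ ω, 1 ≤ φ ω)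
    (X : Ω → ℝ) : ∫⁻ ω, ENNReal.ofReal ((X ω / φ ω) ^ 2) ∂(powDensity μ φ p) =
      ∫⁻ ω, ENNReal.ofReal (φ ω ^ (p - 2) * X ω ^ 2) ∂μ := by
  rw [lintegral_powDensity hφ]
  refine lintegral_congr fun ω => ?_
  have h : 0 < φ ω := by linarith [hφ1 ω]
  rw [← ENNReal.ofReal_mul (by positivity)]
  congr 1
  rw [Real.rpow_sub h, Real.rpow_two, div_pow]
  ring

/-- Every operator from `ℓ_2` into `L_p`, `1 < p < 2`, has a limiting column density. -/
theorem exists_colLim_of_lt_two (hp : 1 < p) (hp2 : p < 2)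
    (S : SeqL2 →L[ℝ] Lp ℝ (ENNReal.ofReal p) μ) :
    ∃ f, ColLim p μ (fun n => S (l2e n)) f := by
  have hp0 : 0 < p := by linarith
  obtain ⟨C, hC0, hC⟩ := exists_maurey_density (μ := μ) hp hp2 ‖S‖
  obtain ⟨φ, hφm, hφ1, hφp, -, hφX⟩ := hC S le_rfl
  have hφ0 : ∀ ω, 0 < φ ω := fun ω => by linarith [hφ1 ω]
  have hfin : IsFiniteMeasure (powDensity μ φ p) := by
    refine ⟨?_⟩
    have := lintegral_powDensity (μ := μ) (p := p) hφm fun _ => 1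
    rw [lintegral_one] at this
    rw [this]
    simp only [mul_one]
    have h1 := lintegral_abs_rpow_eq hp0 hφp
    simp only [abs_of_pos (hφ0 _)] at h1
    rw [h1]
    exact ENNReal.ofReal_lt_top
  have hXm : ∀ n, Measurable (S (l2e n) : Ω → ℝ) := fun n => measurable_coeFn _
  set Z : ℕ → Ω → ℝ := fun n ω => S (l2e n) ω / φ ω with hZdef
  have hZm : ∀ n, Measurable (Z n) := fun n => (hXm n).div hφm
  have hφZ : ∀ n ω, φ ω * Z n ω = S (l2e n) ω := fun n ω => by
    rw [hZdef]
    exact mul_div_cancel₀ _ (hφ0 ω).ne'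
  have hZl : ∀ n, ∫⁻ ω, ENNReal.ofReal (Z n ω ^ 2) ∂(powDensity μ φ p) ≤ ENNReal.ofReal C :=
    fun n => by
      rw [hZdef]
      exact (lintegral_div_sq_powDensity hφm hφ1 _).le.trans (hφX n)
  have hZi : ∀ n, Integrable (fun ω => Z n ω ^ 2) (powDensity μ φ p) := fun n =>
    ⟨((hZm n).pow_const 2).aestronglyMeasurable, by
      rw [hasFiniteIntegral_iff_ofReal (Filter.Eventually.of_forall fun ω => sq_nonneg _)]
      exact (hZl n).trans_lt ENNReal.ofReal_lt_top⟩
  have hZC : ∀ n, ∫ ω, Z n ω ^ 2 ∂(powDensity μ φ p) ≤ C := fun n => by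
    rw [integral_eq_lintegral_of_nonneg_ae (Filter.Eventually.of_forall fun ω => sq_nonneg _)
      ((hZm n).pow_const 2).aestronglyMeasurable]
    exact ENNReal.toReal_le_of_le_ofReal hC0 (hZl n)
  obtain ⟨M, hM, hequi⟩ := exists_truncation hZm hZi hZC
  set Y : ℕ → Ω → ℝ := fun n ω => if |Z n ω| ≤ M n then Z n ω else 0 with hY
  have hYm : ∀ n, Measurable (Y n) := fun n =>
    Measurable.ite (measurableSet_le (hZm n).abs measurable_const) (hZm n) measurable_const
  have hYZ : ∀ n ω, |Y n ω| ≤ |Z n ω| := fun n ω => by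
    simp only [hY]
    split_ifs
    · exact le_rfl
    · simp
  have hZ2 : ∀ n, MemLp (Z n) (ENNReal.ofReal 2) (powDensity μ φ p) := fun n => by
    refine memLp_of_integrable_abs_rpow two_pos (hZm n).aestronglyMeasurable ?_
    simpa using hZi n
  have hY2 : ∀ n, MemLp (Y n) (ENNReal.ofReal 2) (powDensity μ φ p) := fun n =>
    (hZ2 n).mono (hYm n).aestronglyMeasurable (Filter.Eventually.of_forall fun ω => hYZ n ω)
  have hdist : ∀ c > 0, ∀ᶠ n in hypU, lpn p (powDensity μ φ p) (fun ω => Z n ω - Y n ω) ≤ c := by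
    intro c hc
    have h1 : Filter.Tendsto (fun k : ℕ => (k : ℝ) ^ (p - 2) * C) Filter.atTop (nhds (0 * C)) := by
      refine Filter.Tendsto.mul_const _ ?_
      have := (tendsto_rpow_neg_atTop (show 0 < 2 - p by linarith)).comp
        tendsto_natCast_atTop_atTop
      refine this.congr fun k => ?_
      simp
    rw [zero_mul] at h1
    obtain ⟨k, h2, h3⟩ := ((h1.eventually_lt_const (Real.rpow_pos_of_pos hc p)).and
      (Filter.eventually_gt_atTop 0)).exists
    filter_upwards [hM k] with n hn
    exact lpn_tail_le hp0 hp2 (hZm n) (hZi n) (hZC n) (K := k) (by exact_mod_cast h3)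
      (by exact_mod_cast hn) hc.le h2.le
  have hZnull : ∀ B, MeasurableSet B →
      Filter.Tendsto (fun n => ∫ ω in B, Z n ω ∂(powDensity μ φ p)) hypU (nhds 0) := by
    intro B hB
    have hpq := Real.HolderConjugate.conjExponent hp
    have hq0 : 0 < p.conjExponent := hpq.symm.pos
    have hg : MemLp (B.indicator fun ω => φ ω ^ (p - 1)) (ENNReal.ofReal p.conjExponent) μ := by
      refine MemLp.indicator hB ?_
      refine memLp_of_integrable_abs_rpow hq0 (hφm.pow_const _).aestronglyMeasurable ?_
      refine (integrable_abs_rpow_of_memLp hp0 hφp).congr (Filter.Eventually.of_forall fun ω => ?_)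
      dsimp only
      rw [abs_of_pos (hφ0 ω), abs_of_pos (Real.rpow_pos_of_pos (hφ0 ω) _),
        ← Real.rpow_mul (hφ0 ω).le, hpq.sub_one_mul_conj]
    refine (tendsto_integral_mul_l2e hpq hg S).congr fun n => ?_
    rw [powDensity, restrict_withDensity hB,
      integral_withDensity_eq_integral_toReal_smul (by fun_prop)
        (Filter.Eventually.of_forall fun _ => ENNReal.ofReal_lt_top), ← integral_indicator hB]
    refine integral_congr_ae (Filter.Eventually.of_forall fun ω => ?_)
    by_cases h : ω ∈ B
    · simp only [Set.indicator_of_mem h]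
      rw [ENNReal.toReal_ofReal (by have := hφ0 ω; positivity), smul_eq_mul, ← hφZ n,
        ← mul_assoc, Real.rpow_sub_one (hφ0 ω).ne', div_mul_cancel₀ _ (hφ0 ω).ne']
    · simp only [Set.indicator_of_notMem h, zero_mul]
  have hYnull : ∀ B, MeasurableSet B →
      Filter.Tendsto (fun n => ∫ ω in B, Y n ω ∂(powDensity μ φ p)) hypU (nhds 0) := by
    intro B hB
    have hZp : ∀ n, MemLp (Z n) (ENNReal.ofReal p) (powDensity μ φ p) := fun n =>
      memLp_ofReal_mono hp2.le (hZ2 n)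
    have hYp : ∀ n, MemLp (Y n) (ENNReal.ofReal p) (powDensity μ φ p) := fun n =>
      memLp_ofReal_mono hp2.le (hY2 n)
    have h1e : (1 : ℝ≥0∞) = ENNReal.ofReal 1 := by simp
    obtain ⟨R, hR0, hR⟩ := exists_lpn_le_lpn (powDensity μ φ p) one_pos hp.le
    have hD : Filter.Tendsto (fun n => ∫ ω in B, (Z n ω - Y n ω) ∂(powDensity μ φ p)) hypU
        (nhds 0) := by
      rw [Metric.tendsto_nhds]
      intro e he
      have hpos : 0 < e / (2 * (R + 1)) := by positivity
      filter_upwards [hdist _ hpos] with n hn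
      rw [Real.dist_eq, sub_zero]
      have hmem := (hZp n).sub (hYp n)
      have hmem' : MemLp (fun ω => Z n ω - Y n ω) (ENNReal.ofReal p) (powDensity μ φ p) := hmem
      have h1 := hR _ hmem'
      have h2 : ∫ ω, |Z n ω - Y n ω| ∂(powDensity μ φ p) =
          lpn 1 (powDensity μ φ p) (fun ω => Z n ω - Y n ω) := by
        rw [lpn_eq one_pos (memLp_ofReal_mono hp.le hmem')]
        simp
      have h3 : Integrable (fun ω => Z n ω - Y n ω) (powDensity μ φ p) :=
        hmem'.integrable (by simpa using hp.le)
      calc _ ≤ ∫ ω in B, |Z n ω - Y n ω| ∂(powDensity μ φ p) := abs_integral_le_integral_abs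
        _ ≤ ∫ ω, |Z n ω - Y n ω| ∂(powDensity μ φ p) :=
            setIntegral_le_integral h3.abs (Filter.Eventually.of_forall fun ω => abs_nonneg _)
        _ ≤ R * (e / (2 * (R + 1))) := by
            rw [h2]
            exact h1.trans (mul_le_mul_of_nonneg_left hn hR0)
        _ < e := by
            rw [mul_div_assoc', div_lt_iff₀ (by positivity)]
            nlinarith
    have := (hZnull B hB).sub hD
    rw [sub_zero] at this
    refine this.congr fun n => ?_
    have i1 : Integrable (Z n) ((powDensity μ φ p).restrict B) :=
      ((hZp n).integrable (by simpa using hp.le)).integrableOn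
    have i2 : Integrable (Y n) ((powDensity μ φ p).restrict B) :=
      ((hYp n).integrable (by simpa using hp.le)).integrableOn
    rw [integral_sub i1 i2]
    ring
  obtain ⟨f, hf⟩ := exists_wLim (le_refl (2 : ℝ)) hYm hY2 (C := √C) (fun n => by
    rw [lpn_two (hY2 n)]
    refine Real.sqrt_le_sqrt ((integral_mono ?_ (hZi n) fun ω => ?_).trans (hZC n))
    · exact integrable_sq_of_memLp le_rfl (hY2 n)
    · exact sq_le_sq.2 (hYZ n ω)) hYnull hequi
  refine ⟨_, WLim.colLim_of_density hp.le hp2.le hφm hφ0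
    (fun n => Lp.memLp _) hf (fun n ω => ?_) fun e he => ?_⟩
  · rw [abs_mul, ← hφZ n, abs_mul]
    exact mul_le_mul_of_nonneg_left (hYZ n ω) (abs_nonneg _)
  · filter_upwards [hdist e he] with n hn
    rw [lpn_powDensity hp0 hφm hφ0] at hn
    refine le_trans (le_of_eq ?_) hn
    congr 1
    funext ω
    rw [mul_sub, hφZ]

/-- Every operator from `ℓ_2` into `L_p`, `1 < p ≠ 2`, has a limiting column density. -/
theorem exists_colLim (hp : 1 < p) (hp2 : p ≠ 2) (S : SeqL2 →L[ℝ] Lp ℝ (ENNReal.ofReal p) μ) :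
    ∃ f, ColLim p μ (fun n => S (l2e n)) f := by
  rcases lt_or_gt_of_ne hp2 with h | h
  · exact exists_colLim_of_lt_two hp h S
  · obtain ⟨f, hf⟩ := exists_wLim_of_two_lt h S
    exact ⟨f, hf.colLim h.le⟩

end colLim

section signs
variable {Ω : Type*} [MeasurableSpace Ω] {μ : Measure Ω}

lemma lintegral_parallelogram {u : Ω → ℝ≥0∞} (hu : Measurable u) {F G : Ω → ℝ}
    (hF : Measurable F) (hG : Measurable G) :
    ∫⁻ ω, u ω * ENNReal.ofReal ((1 * G ω + F ω) ^ 2) ∂μ +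
      ∫⁻ ω, u ω * ENNReal.ofReal ((-1 * G ω + F ω) ^ 2) ∂μ =
    (∫⁻ ω, u ω * ENNReal.ofReal (G ω ^ 2) ∂μ + ∫⁻ ω, u ω * ENNReal.ofReal (F ω ^ 2) ∂μ) +
      (∫⁻ ω, u ω * ENNReal.ofReal (G ω ^ 2) ∂μ + ∫⁻ ω, u ω * ENNReal.ofReal (F ω ^ 2) ∂μ) := by
  rw [← lintegral_add_left (by fun_prop), ← lintegral_add_left (by fun_prop),
    ← lintegral_add_left (by fun_prop)]
  refine lintegral_congr fun ω => ?_
  rw [← mul_add, ← mul_add, ← mul_add, ← ENNReal.ofReal_add (by positivity) (by positivity),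
    ← ENNReal.ofReal_add (by positivity) (by positivity),
    ← ENNReal.ofReal_add (by positivity) (by positivity)]
  congr 2
  ring

variable {ι : Type*}

lemma measurable_sum_mul {X : ι → Ω → ℝ} (hX : ∀ i, Measurable (X i)) (b : ι → ℝ)
    (J : Finset ι) : Measurable fun ω => ∑ j ∈ J, b j * X j ω :=
  Finset.measurable_fun_sum _ fun i _ => (hX i).const_mul _

lemma sum_update_sign [DecidableEq ι] {X : ι → Ω → ℝ} (e : ι → ℝ) {J : Finset ι} {j : ι}
    (hj : j ∉ J) (s : ℝ) (ω : Ω) : ∑ i ∈ insert j J, Function.update e j s i * X i ω =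
      s * X j ω + ∑ i ∈ J, e i * X i ω := by
  rw [Finset.sum_insert hj, Function.update_self]
  congr 1
  refine Finset.sum_congr rfl fun i hi => ?_
  rw [Function.update_of_ne (ne_of_mem_of_not_mem hi hj)]

lemma update_sign [DecidableEq ι] {e : ι → ℝ} (he : ∀ i, e i = 1 ∨ e i = -1) (j : ι) {s : ℝ}
    (hs : s = 1 ∨ s = -1) (i : ι) : Function.update e j s i = 1 ∨ Function.update e j s i = -1 := by
  by_cases h : i = j
  · subst h
    rwa [Function.update_self]
  · rw [Function.update_of_ne h]
    exact he i

/-- Signs for which the weighted square norm of a sum is at most the sum of the square norms. -/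
lemma exists_signs_le {u : Ω → ℝ≥0∞} (hu : Measurable u) {X : ι → Ω → ℝ}
    (hX : ∀ i, Measurable (X i)) (J : Finset ι) : ∃ e : ι → ℝ, (∀ i, e i = 1 ∨ e i = -1) ∧
      ∫⁻ ω, u ω * ENNReal.ofReal ((∑ i ∈ J, e i * X i ω) ^ 2) ∂μ ≤
        ∑ i ∈ J, ∫⁻ ω, u ω * ENNReal.ofReal (X i ω ^ 2) ∂μ := by
  classical
  induction J using Finset.induction_on with
  | empty => exact ⟨fun _ => 1, fun _ => Or.inl rfl, by simp⟩
  | insert j J hj ih =>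
    obtain ⟨e, he, h⟩ := ih
    have hpar := lintegral_parallelogram (μ := μ) hu (measurable_sum_mul hX e J) (hX j)
    have : ∃ s : ℝ, (s = 1 ∨ s = -1) ∧
        ∫⁻ ω, u ω * ENNReal.ofReal ((s * X j ω + ∑ i ∈ J, e i * X i ω) ^ 2) ∂μ ≤
        ∫⁻ ω, u ω * ENNReal.ofReal (X j ω ^ 2) ∂μ +
          ∫⁻ ω, u ω * ENNReal.ofReal ((∑ i ∈ J, e i * X i ω) ^ 2) ∂μ := by
      by_contra! hcon
      exact absurd hpar (ENNReal.add_lt_add (hcon 1 (Or.inl rfl)) (hcon (-1) (Or.inr rfl))).ne'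
    obtain ⟨s, hs, h2⟩ := this
    refine ⟨Function.update e j s, update_sign he j hs, ?_⟩
    simp only [sum_update_sign e hj]
    rw [Finset.sum_insert hj]
    exact h2.trans (add_le_add le_rfl h)

/-- Signs for which the weighted square norm of a sum is at least the sum of the square norms. -/
lemma exists_signs_ge {u : Ω → ℝ≥0∞} (hu : Measurable u) {X : ι → Ω → ℝ}
    (hX : ∀ i, Measurable (X i)) (J : Finset ι) : ∃ e : ι → ℝ, (∀ i, e i = 1 ∨ e i = -1) ∧
      ∑ i ∈ J, ∫⁻ ω, u ω * ENNReal.ofReal (X i ω ^ 2) ∂μ ≤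
      ∫⁻ ω, u ω * ENNReal.ofReal ((∑ i ∈ J, e i * X i ω) ^ 2) ∂μ := by
  classical
  induction J using Finset.induction_on with
  | empty => exact ⟨fun _ => 1, fun _ => Or.inl rfl, by simp⟩
  | insert j J hj ih =>
    obtain ⟨e, he, h⟩ := ih
    have hpar := lintegral_parallelogram (μ := μ) hu (measurable_sum_mul hX e J) (hX j)
    have : ∃ s : ℝ, (s = 1 ∨ s = -1) ∧
        ∫⁻ ω, u ω * ENNReal.ofReal (X j ω ^ 2) ∂μ +
          ∫⁻ ω, u ω * ENNReal.ofReal ((∑ i ∈ J, e i * X i ω) ^ 2) ∂μ ≤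
        ∫⁻ ω, u ω * ENNReal.ofReal ((s * X j ω + ∑ i ∈ J, e i * X i ω) ^ 2) ∂μ := by
      by_contra! hcon
      exact absurd hpar (ENNReal.add_lt_add (hcon 1 (Or.inl rfl)) (hcon (-1) (Or.inr rfl))).ne
    obtain ⟨s, hs, h2⟩ := this
    refine ⟨Function.update e j s, update_sign he j hs, ?_⟩
    simp only [sum_update_sign e hj]
    rw [Finset.sum_insert hj]
    exact (add_le_add le_rfl h).trans h2

end signs

section columns
variable {p : ℝ} [Fact (1 ≤ ENNReal.ofReal p)]

/-- The embedding of `ℓ_2` as the `j`-th column of `ℓ_p(ℓ_2)`. -/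
noncomputable def colEmb (p : ℝ) [Fact (1 ≤ ENNReal.ofReal p)] (j : ℕ) : SeqL2 →L[ℝ] lpl2 p :=
  lp.singleContinuousLinearMap ℝ (fun _ : ℕ => SeqL2) (ENNReal.ofReal p) j

lemma colEmb_apply (j : ℕ) (a : SeqL2) :
    colEmb p j a = lp.single (E := fun _ : ℕ => SeqL2) (ENNReal.ofReal p) j a := rfl

lemma norm_colEmb (j : ℕ) (a : SeqL2) : ‖colEmb p j a‖ = ‖a‖ :=
  lp.norm_single (E := fun _ : ℕ => SeqL2) (zero_lt_one.trans_le Fact.out) j a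

lemma colEmb_apply_ne {j i : ℕ} (h : i ≠ j) (a : SeqL2) : colEmb p j a i = 0 :=
  lp.single_apply_ne (E := fun _ : ℕ => SeqL2) _ j a h

lemma norm_sum_colEmb {c : ℕ → ℕ} (hc : Function.Injective c) (J : Finset ℕ) (x : ℕ → SeqL2) :
    ‖∑ j ∈ J, colEmb p (c j) (x j)‖ ^ p = ∑ j ∈ J, ‖x j‖ ^ p := by
  have hp : 0 < p := by linarith [one_le_of_fact (p := p)]
  have h := lp.norm_sum_single (E := fun _ : ℕ => SeqL2) (p := ENNReal.ofReal p)
    (by rwa [ENNReal.toReal_ofReal hp.le]) (fun i => x (Function.invFun c i)) (J.map ⟨c, hc⟩)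
  rw [ENNReal.toReal_ofReal hp.le, Finset.sum_map, Finset.sum_map] at h
  simpa [Function.leftInverse_invFun hc _, colEmb_apply] using h

end columns

section smallDensity
variable {Ω : Type*} [MeasurableSpace Ω] {μ : Measure Ω} {p : ℝ}
  [IsFiniteMeasure μ] [Fact (1 ≤ ENNReal.ofReal p)]

lemma lintegral_sq_eq {F : Ω → ℝ} (hF : MemLp F (ENNReal.ofReal 2) μ) :
    ∫⁻ ω, ENNReal.ofReal (F ω ^ 2) ∂μ = ENNReal.ofReal (lpn 2 μ F ^ 2) := by
  have : Fact (1 ≤ ENNReal.ofReal 2) := ⟨by simp⟩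
  have := lintegral_abs_rpow_eq two_pos hF
  simpa using this

lemma lpn_two_sq {F : Ω → ℝ} (hF : MemLp F (ENNReal.ofReal 2) μ) :
    lpn 2 μ F ^ 2 = ∫ ω, F ω ^ 2 ∂μ := by
  rw [lpn_two hF, Real.sq_sqrt (integral_nonneg fun ω => sq_nonneg _)]

/-- Summed second moments of the columns of an operator on `ℓ_p(ℓ_2)`, `p ≥ 2`. -/
lemma exists_sum_integral_sq_le (hp : 2 ≤ p) (T : lpl2 p →L[ℝ] Lp ℝ (ENNReal.ofReal p) μ) :
    ∃ D : ℝ, ∀ c : ℕ → ℕ, Function.Injective c → ∀ N n : ℕ,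
      ∑ j ∈ Finset.range N, ∫ ω, T (colEmb p (c j) (l2e n)) ω ^ 2 ∂μ ≤ D * (N : ℝ) ^ (2 / p) := by
  have hp0 : 0 < p := by linarith
  obtain ⟨K, hK0, hK⟩ := exists_lpn_le_lpn μ two_pos hp
  refine ⟨(K * ‖T‖) ^ 2, fun c hc N n => ?_⟩
  set X : ℕ → Lp ℝ (ENNReal.ofReal p) μ := fun j => T (colEmb p (c j) (l2e n)) with hX
  have hX2 : ∀ F : Lp ℝ (ENNReal.ofReal p) μ, MemLp F (ENNReal.ofReal 2) μ := fun F =>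
    memLp_ofReal_mono hp (Lp.memLp F)
  obtain ⟨e, he, h⟩ := exists_signs_ge (μ := μ) (u := fun _ => 1) measurable_const
    (fun j => measurable_coeFn (X j)) (Finset.range N)
  simp only [one_mul] at h
  set v : lpl2 p := ∑ j ∈ Finset.range N, colEmb p (c j) (e j • l2e n) with hv
  have hvn : ‖v‖ = (N : ℝ) ^ (1 / p) := by
    have h1 := norm_sum_colEmb (p := p) hc (Finset.range N) (fun j => e j • l2e n)
    have h2 : ∀ j, ‖e j • l2e n‖ = 1 := fun j => by
      rw [norm_smul, norm_l2e, mul_one]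
      rcases he j with h | h <;> simp [h]
    simp only [h2, Real.one_rpow, Finset.sum_const, Finset.card_range, nsmul_eq_mul,
      mul_one] at h1
    rw [← h1, ← Real.rpow_mul (norm_nonneg _), mul_one_div_cancel hp0.ne', Real.rpow_one]
  have hTv : T v = ∑ j ∈ Finset.range N, e j • X j := by
    simp only [hv, map_sum, map_smul, hX]
  have h3 : lpn 2 μ (T v) ≤ K * ‖T‖ * (N : ℝ) ^ (1 / p) := by
    refine (hK _ (Lp.memLp (T v))).trans ?_
    rw [lpn_coeFn, mul_assoc, ← hvn]
    exact mul_le_mul_of_nonneg_left (T.le_opNorm v) hK0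
  have h4 : ∫⁻ ω, ENNReal.ofReal ((∑ i ∈ Finset.range N, e i * X i ω) ^ 2) ∂μ =
      ENNReal.ofReal (lpn 2 μ (T v) ^ 2) := by
    rw [← lintegral_sq_eq (hX2 _), hTv]
    refine lintegral_congr_ae ?_
    filter_upwards [coeFn_sum_smul (Finset.range N) e X] with ω hω
    rw [hω]
  have h5 : ∀ j, ∫⁻ ω, ENNReal.ofReal (X j ω ^ 2) ∂μ = ENNReal.ofReal (∫ ω, X j ω ^ 2 ∂μ) :=
    fun j => by rw [lintegral_sq_eq (hX2 _), lpn_two_sq (hX2 _)]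
  simp only [h4, h5] at h
  rw [← ENNReal.ofReal_sum_of_nonneg fun j _ => integral_nonneg fun ω => sq_nonneg _,
    ENNReal.ofReal_le_ofReal_iff (sq_nonneg _)] at h
  refine h.trans ((pow_le_pow_left₀ lpn_nonneg h3 2).trans (le_of_eq ?_))
  rw [mul_pow, ← Real.rpow_natCast ((N : ℝ) ^ (1 / p)), ← Real.rpow_mul N.cast_nonneg]
  congr 2
  push_cast
  ring

lemma measure_one_lt_le {f : Ω → ℝ} (hf : MemLp f (ENNReal.ofReal 2) μ) {δ : ℝ}
    (hδ : ∫ ω, f ω ^ 2 ∂μ ≤ δ) : μ {ω | 1 < f ω} ≤ ENNReal.ofReal δ := by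
  refine le_trans ?_ (ENNReal.ofReal_le_ofReal hδ)
  rw [← lpn_two_sq hf, ← lintegral_sq_eq hf]
  have hm : AEMeasurable (fun ω => ENNReal.ofReal (f ω ^ 2)) μ :=
    (hf.aestronglyMeasurable.aemeasurable.pow_const 2).ennreal_ofReal
  have := mul_meas_ge_le_lintegral₀ hm 1
  rw [one_mul] at this
  refine (measure_mono fun ω hω => ?_).trans this
  have hω' : 1 < f ω := hω
  refine ENNReal.one_le_ofReal.2 (by nlinarith)

/-- For `p > 2`, among any infinitely many columns there is one whose limiting density is small
off a small set. -/
theorem exists_small_density_of_two_lt (hp : 2 < p)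
    (T : lpl2 p →L[ℝ] Lp ℝ (ENNReal.ofReal p) μ) {c : ℕ → ℕ} (hc : Function.Injective c) {δ : ℝ}
    (hδ : 0 < δ) :
    ∃ (U : SeqL2 →L[ℝ] lpl2 p) (f : Ω → ℝ) (A : Set Ω), (∀ a, ‖U a‖ = ‖a‖) ∧
      (∀ a, ∀ j ∉ Set.range c, U a j = 0) ∧ ColLim p μ (fun n => T (U (l2e n))) f ∧
      MeasurableSet A ∧ μ A ≤ ENNReal.ofReal δ ∧ lpn p (μ.restrict Aᶜ) f ≤ δ := by
  have hp0 : 0 < p := by linarith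
  obtain ⟨D, hD⟩ := exists_sum_integral_sq_le hp.le T
  have hw : ∀ j, ∃ f, WLim p μ (fun n => T (colEmb p (c j) (l2e n))) f := fun j =>
    exists_wLim_of_two_lt hp (T.comp (colEmb p (c j)))
  choose f hf using hw
  set θ : ℝ := min δ (δ ^ p) with hθ
  have hθ0 : 0 < θ := lt_min hδ (Real.rpow_pos_of_pos hδ p)
  have hsum : ∀ N : ℕ, ∑ j ∈ Finset.range N, ∫ ω, f j ω ^ 2 ∂μ ≤ D * (N : ℝ) ^ (2 / p) := by
    intro N
    have h : Filter.Tendsto (fun n => ∑ j ∈ Finset.range N,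
        ∫ ω, T (colEmb p (c j) (l2e n)) ω ^ 2 ∂μ) hypU
        (nhds (∑ j ∈ Finset.range N, ∫ ω, f j ω ^ 2 ∂μ)) :=
      tendsto_finsetSum _ fun j _ => by simpa using (hf j).sq Set.univ MeasurableSet.univ
    exact le_of_tendsto h (Filter.Eventually.of_forall fun n => hD c hc N n)
  have hlim : Filter.Tendsto (fun N : ℕ => D * (N : ℝ) ^ (2 / p - 1)) Filter.atTop
      (nhds (D * 0)) := by
    refine Filter.Tendsto.const_mul _ ?_
    have h1 : 0 < 1 - 2 / p := by
      rw [sub_pos, div_lt_one hp0]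
      exact hp
    have := (tendsto_rpow_neg_atTop h1).comp tendsto_natCast_atTop_atTop
    refine this.congr fun k => ?_
    simp
  rw [mul_zero] at hlim
  obtain ⟨N, hN, hN0⟩ := ((hlim.eventually_lt_const hθ0).and (Filter.eventually_gt_atTop 0)).exists
  have hNr : (0 : ℝ) < N := by exact_mod_cast hN0
  obtain ⟨j, -, hj⟩ : ∃ j ∈ Finset.range N, ∫ ω, f j ω ^ 2 ∂μ ≤ θ := by
    refine Finset.exists_le_of_sum_le ⟨0, Finset.mem_range.2 hN0⟩ ?_
    refine (hsum N).trans ?_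
    rw [Finset.sum_const, Finset.card_range, nsmul_eq_mul]
    rw [Real.rpow_sub_one hNr.ne', mul_div_assoc', div_lt_iff₀ hNr] at hN
    linarith
  have hf2 : MemLp (f j) (ENNReal.ofReal 2) μ := memLp_ofReal_mono hp.le (hf j).fmemLp
  have hAm : MeasurableSet {ω | 1 < f j ω} := measurableSet_lt measurable_const (hf j).fmeas
  refine ⟨colEmb p (c j), f j, {ω | 1 < f j ω}, norm_colEmb _, fun a i hi => ?_,
    (hf j).colLim hp.le,
    hAm, measure_one_lt_le hf2 (hj.trans (min_le_left _ _)), ?_⟩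
  · exact colEmb_apply_ne (fun h => hi ⟨j, h.symm⟩) a
  · refine lpn_le_of_integral_le hp0 ((hf j).fmemLp.mono_measure Measure.restrict_le_self) hδ.le ?_
    have h2i := integrable_sq_of_memLp le_rfl hf2
    refine le_trans ?_ (hj.trans (min_le_right _ _))
    refine le_trans (setIntegral_mono_on ((integrable_abs_rpow_of_memLp hp0 (hf
      j).fmemLp).integrableOn)
      h2i.integrableOn hAm.compl fun ω hω => ?_)
      (setIntegral_le_integral h2i (Filter.Eventually.of_forall fun ω => sq_nonneg _))
    have h1 : f j ω ≤ 1 := not_lt.1 hω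
    have h0 := (hf j).fnonneg ω
    rw [abs_of_nonneg h0, ← Real.rpow_two]
    exact Real.rpow_le_rpow_of_exponent_ge' h0 h1 two_pos.le hp.le

end smallDensity

section level
variable {Ω : Type*} [MeasurableSpace Ω] {μ : Measure Ω} [IsFiniteMeasure μ]

lemma sum_dyadic_levels_le {η : ℝ} (hη : 0 < η) {x : ℝ} (hx : 0 ≤ x) (K : ℕ) :
    ∑ k ∈ Finset.range K, (if η * 2 ^ k < x then (2 : ℝ) ^ k else 0) ≤ 2 * x / η := by
  induction K with
  | zero => simpa using by positivity
  | succ K ih =>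
    by_cases h : η * 2 ^ K < x
    · calc _ ≤ ∑ k ∈ Finset.range (K + 1), (2 : ℝ) ^ k := Finset.sum_le_sum fun k _ => by
            split_ifs
            · exact le_rfl
            · positivity
        _ = 2 ^ (K + 1) - 1 := by rw [geom_sum_eq (by norm_num)]; norm_num
        _ ≤ 2 * x / η := by
            rw [le_div_iff₀ hη, pow_succ]
            nlinarith
    · rw [Finset.sum_range_succ, if_neg h, add_zero]
      exact ih

/-- Among `K` dyadic levels there is one at which the weak type bound improves by a factor `K`. -/
lemma exists_dyadic_level {φ : Ω → ℝ} (hφm : Measurable φ) (hφ0 : ∀ ω, 0 ≤ φ ω)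
    (hφi : Integrable φ μ) {C : ℝ} (hC : ∫ ω, φ ω ∂μ ≤ C) {η : ℝ} (hη : 0 < η) {K : ℕ}
    (hK : 0 < K) : ∃ k < K, 2 ^ k * μ.real {ω | η * 2 ^ k < φ ω} ≤ 2 * C / η / K := by
  have hS : ∀ k : ℕ, MeasurableSet {ω | η * 2 ^ k < φ ω} := fun k =>
    measurableSet_lt measurable_const hφm
  have hi : ∀ k : ℕ, Integrable (fun ω => if η * 2 ^ k < φ ω then (2 : ℝ) ^ k else 0) μ :=
    fun k => (integrable_const ((2 : ℝ) ^ k)).indicator (hS k)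
  have h1 : ∀ k : ℕ, ∫ ω, (if η * 2 ^ k < φ ω then (2 : ℝ) ^ k else 0) ∂μ =
      2 ^ k * μ.real {ω | η * 2 ^ k < φ ω} := fun k => by
    have := integral_indicator_const (μ := μ) ((2 : ℝ) ^ k) (hS k)
    rw [smul_eq_mul, mul_comm (μ.real _)] at this
    exact this
  have h2 : ∑ k ∈ Finset.range K, 2 ^ k * μ.real {ω | η * 2 ^ k < φ ω} ≤ 2 * C / η := by
    simp only [← h1]
    rw [← integral_finsetSum _ fun k _ => hi k]
    calc _ ≤ ∫ ω, 2 * φ ω / η ∂μ := integral_mono (integrable_finsetSum _ fun k _ => hi k)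
          ((hφi.const_mul 2).div_const η) fun ω => sum_dyadic_levels_le hη (hφ0 ω) K
      _ = 2 * (∫ ω, φ ω ∂μ) / η := by rw [integral_div, integral_const_mul]
      _ ≤ 2 * C / η := div_le_div_of_nonneg_right (by linarith) hη.le
  obtain ⟨k, hk, h3⟩ := Finset.exists_le_of_sum_le (s := Finset.range K)
    (g := fun _ => 2 * C / η / K) ⟨0, Finset.mem_range.2 hK⟩ (h2.trans (le_of_eq (by
      rw [Finset.sum_const, Finset.card_range, nsmul_eq_mul]
      have : (K : ℝ) ≠ 0 := by exact_mod_cast hK.ne'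
      rw [mul_div_cancel₀ _ this])))
  exact ⟨k, Finset.mem_range.1 hk, h3⟩

end level

lemma orthonormal_sign_smul {e : ℕ → ℝ} (he : ∀ n, e n = 1 ∨ e n = -1) :
    Orthonormal ℝ fun n => e n • l2e n := by
  have h := orthonormal_iff_ite.1 orthonormal_l2e
  rw [orthonormal_iff_ite]
  intro i j
  rw [real_inner_smul_left, real_inner_smul_right, h]
  split_ifs with hij
  · subst hij
    rcases he i with h | h <;> simp [h]
  · simp

section averages
variable {p : ℝ} [Fact (1 ≤ ENNReal.ofReal p)]

/-- Normalized signed sums of columns embed `ℓ_2` isometrically into `ℓ_p(ℓ_2)`. -/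
lemma exists_signed_average {c : ℕ → ℕ} (hc : Function.Injective c) {J : Finset ℕ}
    (hJ : J.Nonempty) {e : ℕ → ℕ → ℝ} (he : ∀ n j, e n j = 1 ∨ e n j = -1) :
    ∃ U : SeqL2 →L[ℝ] lpl2 p, (∀ a, ‖U a‖ = ‖a‖) ∧ (∀ a, ∀ j ∉ Set.range c, U a j = 0) ∧
      ∀ n, U (l2e n) = ((J.card : ℝ) ^ (1 / p))⁻¹ • ∑ j ∈ J, e n j • colEmb p (c j) (l2e n) := by
  have hp : 0 < p := by linarith [one_le_of_fact (p := p)]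
  have hN : (0 : ℝ) < J.card := by exact_mod_cast hJ.card_pos
  choose D hD using fun j => exists_isometry_of_orthonormal
    (orthonormal_sign_smul (e := fun n => e n j) fun n => he n j)
  refine ⟨((J.card : ℝ) ^ (1 / p))⁻¹ •
    ∑ j ∈ J, (colEmb p (c j)).comp (D j).toContinuousLinearMap, fun a => ?_, fun a i hi => ?_,
    fun n => ?_⟩
  · have h1 := norm_sum_colEmb (p := p) hc J fun j => D j a
    simp only [LinearIsometry.norm_map, Finset.sum_const, nsmul_eq_mul] at h1
    have h2 : ‖∑ j ∈ J, colEmb p (c j) (D j a)‖ = (J.card : ℝ) ^ (1 / p) * ‖a‖ := by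
      refine (Real.rpow_left_inj (norm_nonneg _) (by positivity) hp.ne').1 ?_
      rw [h1, Real.mul_rpow (by positivity) (norm_nonneg _), ← Real.rpow_mul hN.le,
        one_div_mul_cancel hp.ne', Real.rpow_one]
    simp only [smul_apply, sum_apply,
      ContinuousLinearMap.comp_apply, LinearIsometry.coe_toContinuousLinearMap]
    rw [norm_smul, h2, norm_inv, Real.norm_of_nonneg (by positivity),
      inv_mul_cancel_left₀ (by positivity)]
  · simp only [smul_apply, sum_apply,
      ContinuousLinearMap.comp_apply, LinearIsometry.coe_toContinuousLinearMap]
    rw [lp.coeFn_smul, Pi.smul_apply, lp.coeFn_sum, Finset.sum_apply,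
      Finset.sum_eq_zero fun j _ => colEmb_apply_ne (fun h => hi ⟨j, h.symm⟩) _, smul_zero]
  · simp only [smul_apply, sum_apply,
      ContinuousLinearMap.comp_apply, LinearIsometry.coe_toContinuousLinearMap, hD, map_smul]

end averages

section smallDensity
variable {Ω : Type*} [MeasurableSpace Ω] {μ : Measure Ω} {p : ℝ}
  [IsFiniteMeasure μ] [Fact (1 ≤ ENNReal.ofReal p)]

lemma lpn_restrict_le_of_lintegral_sq {K : ℝ} (hK0 : 0 ≤ K)
    (hK : ∀ F : Ω → ℝ, MemLp F (ENNReal.ofReal 2) μ → lpn p μ F ≤ K * lpn 2 μ F) {f : Ω → ℝ}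
    (hfm : Measurable f) {B : Set Ω} (hB : MeasurableSet B) {G : ℝ} (hG : 0 ≤ G)
    (h : ∫⁻ ω, B.indicator 1 ω * ENNReal.ofReal (f ω ^ 2) ∂μ ≤ ENNReal.ofReal G) :
    lpn p (μ.restrict B) f ≤ K * √G := by
  have hm : Measurable (B.indicator f) := hfm.indicator hB
  have h1 : ∫⁻ ω, ENNReal.ofReal (B.indicator f ω ^ 2) ∂μ ≤ ENNReal.ofReal G := by
    refine le_trans (le_of_eq (lintegral_congr fun ω => ?_)) h
    by_cases hω : ω ∈ B <;> simp [hω]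
  have hmem : MemLp (B.indicator f) (ENNReal.ofReal 2) μ := by
    refine memLp_of_integrable_abs_rpow two_pos hm.aestronglyMeasurable ?_
    simp only [Real.rpow_two, sq_abs]
    exact ⟨(hm.pow_const 2).aestronglyMeasurable, by
      rw [hasFiniteIntegral_iff_ofReal (Filter.Eventually.of_forall fun ω => sq_nonneg _)]
      exact h1.trans_lt ENNReal.ofReal_lt_top⟩
  have h2 : lpn p (μ.restrict B) f = lpn p μ (B.indicator f) := by
    rw [lpn, lpn, eLpNorm_indicator_eq_eLpNorm_restrict hB]
  rw [h2]
  refine (hK _ hmem).trans (mul_le_mul_of_nonneg_left (Real.le_sqrt_of_sq_le ?_) hK0)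
  rw [lintegral_sq_eq hmem, ENNReal.ofReal_le_ofReal_iff hG] at h1
  exact h1

set_option maxHeartbeats 1000000 in
/-- For `p < 2`, infinitely many columns have a normalized signed sum whose limiting density is
small off a small set. -/
theorem exists_small_density_of_lt_two (hp : 1 < p) (hp2 : p < 2)
    (T : lpl2 p →L[ℝ] Lp ℝ (ENNReal.ofReal p) μ) {c : ℕ → ℕ} (hc : Function.Injective c) {δ : ℝ}
    (hδ : 0 < δ) :
    ∃ (U : SeqL2 →L[ℝ] lpl2 p) (f : Ω → ℝ) (A : Set Ω), (∀ a, ‖U a‖ = ‖a‖) ∧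
      (∀ a, ∀ j ∉ Set.range c, U a j = 0) ∧ ColLim p μ (fun n => T (U (l2e n))) f ∧
      MeasurableSet A ∧ μ A ≤ ENNReal.ofReal δ ∧ lpn p (μ.restrict Aᶜ) f ≤ δ := by
  have hp0 : 0 < p := by linarith
  obtain ⟨C, hC0, hC⟩ := exists_maurey_density (μ := μ) hp hp2 ‖T‖
  have hS : ∀ j, ‖T.comp (colEmb p (c j))‖ ≤ ‖T‖ := fun j =>
    ContinuousLinearMap.opNorm_le_bound _ (norm_nonneg _) fun a => by
      simpa [norm_colEmb] using T.le_opNorm (colEmb p (c j) a)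
  choose φ hφm hφ1 hφp hφC hφX using fun j => hC _ (hS j)
  simp only [ContinuousLinearMap.comp_apply] at hφX
  obtain ⟨R₀, hR0, hR⟩ := exists_lpn_le_lpn μ hp0 hp2.le
  have hα : 0 < (2 - p) / p := div_pos (by linarith) hp0
  obtain ⟨η, hη, hηδ⟩ : ∃ η : ℝ, 0 < η ∧ R₀ * √(C * η ^ ((2 - p) / p)) ≤ δ := by
    have h1 : Filter.Tendsto (fun η : ℝ => R₀ * √(C * η ^ ((2 - p) / p))) (nhdsWithin 0 (Set.Ioi 0))
        (nhds 0) := by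
      have h2 : ContinuousAt (fun η : ℝ => R₀ * √(C * η ^ ((2 - p) / p))) 0 := by
        refine continuousAt_const.mul (Real.continuous_sqrt.continuousAt.comp
          (continuousAt_const.mul ?_))
        exact Real.continuousAt_rpow_const _ _ (Or.inr hα.le)
      have h3 := h2.tendsto
      rw [Real.zero_rpow hα.ne', mul_zero, Real.sqrt_zero, mul_zero] at h3
      exact h3.mono_left nhdsWithin_le_nhds
    obtain ⟨η, h4, h5⟩ := ((h1.eventually_lt_const hδ).and self_mem_nhdsWithin).exists
    exact ⟨η, h5, h4.le⟩
  obtain ⟨K, hK⟩ := exists_nat_gt (2 * C / η / δ)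
  have hK0 : (0 : ℝ) < K := lt_of_le_of_lt (by positivity) hK
  have hKδ : 2 * C / η / K ≤ δ := by
    rw [div_le_iff₀ hK0, mul_comm δ]
    exact ((div_lt_iff₀ hδ).1 hK).le
  have hlev : ∀ j, ∃ k : Fin K, 2 ^ (k : ℕ) * μ.real {ω | η * 2 ^ (k : ℕ) < φ j ω ^ p} ≤ δ := by
    intro j
    have hi : Integrable (fun ω => φ j ω ^ p) μ :=
      (integrable_abs_rpow_of_memLp hp0 (hφp j)).congr (Filter.Eventually.of_forall fun ω => by
        dsimp only
        rw [abs_of_pos (by linarith [hφ1 j ω])])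
    obtain ⟨k, hk, h⟩ := exists_dyadic_level ((hφm j).pow_const p)
      (fun ω => Real.rpow_nonneg (by linarith [hφ1 j ω]) p) hi (hφC j) hη
      (by exact_mod_cast hK0 : 0 < K)
    exact ⟨⟨k, hk⟩, h.trans hKδ⟩
  choose k hk using hlev
  obtain ⟨κ, hκ⟩ := Finite.exists_infinite_fiber k
  obtain ⟨J, hJk, hJc⟩ := (Set.infinite_coe_iff.1 hκ).exists_subset_card_eq (2 ^ (κ : ℕ))
  set N : ℝ := 2 ^ (κ : ℕ) with hN
  have hN0 : 0 < N := by positivity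
  have hJN : (J.card : ℝ) = N := by rw [hJc]; push_cast; rfl
  have hJne : J.Nonempty := Finset.card_pos.1 (by rw [hJc]; positivity)
  have hJμ : ∀ j ∈ J, N * μ.real {ω | η * N < φ j ω ^ p} ≤ δ := fun j hj => by
    have h1 : k j = κ := hJk hj
    have h2 := hk j
    rwa [h1] at h2
  set A : Set Ω := ⋃ j ∈ J, {ω | η * N < φ j ω ^ p} with hA
  have hAm : MeasurableSet A := Finset.measurableSet_biUnion _ fun j _ =>
    measurableSet_lt measurable_const ((hφm j).pow_const p)
  have hAμ : μ A ≤ ENNReal.ofReal δ := by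
    refine (measure_biUnion_finset_le J _).trans ?_
    have h1 : ∀ j ∈ J, μ {ω | η * N < φ j ω ^ p} ≤ ENNReal.ofReal (δ / N) := fun j hj => by
      rw [← ofReal_measureReal]
      refine ENNReal.ofReal_le_ofReal ?_
      rw [le_div_iff₀ hN0, mul_comm]
      exact hJμ j hj
    refine (Finset.sum_le_sum h1).trans (le_of_eq ?_)
    rw [← ENNReal.ofReal_sum_of_nonneg fun j _ => by positivity, Finset.sum_const, nsmul_eq_mul,
      hJN, mul_div_cancel₀ _ hN0.ne']
  set X : ℕ → ℕ → Ω → ℝ := fun n j => T (colEmb p (c j) (l2e n)) with hX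
  have hXm : ∀ n j, Measurable (X n j) := fun n j => measurable_coeFn _
  have hum : Measurable (Aᶜ.indicator (1 : Ω → ℝ≥0∞)) := measurable_one.indicator hAm.compl
  choose e he hle using fun n => exists_signs_le (μ := μ) hum (hXm n) J
  obtain ⟨U, hU, hUc, hUe⟩ := exists_signed_average (p := p) hc hJne he
  obtain ⟨f, hf⟩ := exists_colLim hp hp2.ne (T.comp U)
  refine ⟨U, f, A, hU, hUc, hf, hAm, hAμ, le_trans ?_ hηδ⟩
  refine lpn_restrict_le_of_lintegral_sq hR0 hR hf.fmeas hAm.compl (by positivity) ?_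
  by_contra! hcon
  obtain ⟨n, hn⟩ := (hf.lsc _ hum _ hcon).exists
  refine absurd hn (not_lt.2 ?_)
  have hcol : ∀ j ∈ J, ∫⁻ ω, Aᶜ.indicator 1 ω * ENNReal.ofReal (X n j ω ^ 2) ∂μ ≤
      ENNReal.ofReal ((η * N) ^ ((2 - p) / p) * C) := fun j hj => by
    have h1 : ∀ ω, Aᶜ.indicator 1 ω * ENNReal.ofReal (X n j ω ^ 2) ≤
        ENNReal.ofReal ((η * N) ^ ((2 - p) / p)) * ENNReal.ofReal (φ j ω ^ (p - 2) * X n j ω ^ 2) :=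
      fun ω => by
        by_cases hω : ω ∈ A
        · simp [hω]
        · have hφ0 : 0 < φ j ω := by linarith [hφ1 j ω]
          have h2 : φ j ω ^ p ≤ η * N := by
            by_contra! hc
            exact hω (Set.mem_biUnion hj hc)
          rw [Set.indicator_of_mem hω, Pi.one_apply, one_mul,
            ← ENNReal.ofReal_mul (by positivity), ← mul_assoc]
          refine ENNReal.ofReal_le_ofReal (le_mul_of_one_le_left (sq_nonneg _) ?_)
          have h3 := Real.rpow_le_rpow (by positivity) h2 hα.le
          rw [← Real.rpow_mul hφ0.le, mul_div_cancel₀ _ hp0.ne'] at h3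
          calc (1 : ℝ) = φ j ω ^ (2 - p) * φ j ω ^ (p - 2) := by
                rw [← Real.rpow_add hφ0]
                simp
            _ ≤ _ := mul_le_mul_of_nonneg_right h3 (by positivity)
    refine (lintegral_mono h1).trans ?_
    rw [lintegral_const_mul' _ _ ENNReal.ofReal_ne_top, ENNReal.ofReal_mul (by positivity)]
    exact mul_le_mul_right (hφX j n) _
  set s : ℝ := (N ^ (1 / p))⁻¹ with hs
  have hTU : (T.comp U (l2e n) : Ω → ℝ) =ᵐ[μ] fun ω => s * ∑ j ∈ J, e n j * X n j ω := by
    have h1 : T.comp U (l2e n) = s • ∑ j ∈ J, e n j • T (colEmb p (c j) (l2e n)) := by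
      rw [ContinuousLinearMap.comp_apply, hUe, hJN, map_smul, map_sum]
      simp only [map_smul, hs]
    rw [h1]
    filter_upwards [Lp.coeFn_smul s (∑ j ∈ J, e n j • T (colEmb p (c j) (l2e n))),
      coeFn_sum_smul J (e n) fun j => T (colEmb p (c j) (l2e n))] with ω h2 h3
    rw [h2, Pi.smul_apply, h3, smul_eq_mul]
  calc ∫⁻ ω, Aᶜ.indicator 1 ω * ENNReal.ofReal ((T.comp U (l2e n) : Ω → ℝ) ω ^ 2) ∂μ
      = ENNReal.ofReal (s ^ 2) *
        ∫⁻ ω, Aᶜ.indicator 1 ω * ENNReal.ofReal ((∑ j ∈ J, e n j * X n j ω) ^ 2) ∂μ := by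
        rw [← lintegral_const_mul' _ _ ENNReal.ofReal_ne_top]
        refine lintegral_congr_ae ?_
        filter_upwards [hTU] with ω h
        rw [h, mul_pow, ENNReal.ofReal_mul (sq_nonneg _)]
        ring
    _ ≤ ENNReal.ofReal (s ^ 2) * ∑ j ∈ J, ENNReal.ofReal ((η * N) ^ ((2 - p) / p) * C) :=
        mul_le_mul_right ((hle n).trans (Finset.sum_le_sum hcol)) _
    _ = ENNReal.ofReal (C * η ^ ((2 - p) / p)) := by
        rw [← ENNReal.ofReal_sum_of_nonneg fun j _ => by positivity, Finset.sum_const,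
          nsmul_eq_mul, hJN, ← ENNReal.ofReal_mul (sq_nonneg _), Real.mul_rpow hη.le hN0.le]
        congr 1
        have h1 : s ^ 2 * N * N ^ ((2 - p) / p) = 1 := by
          have h2 : (2 - p) / p = 1 / p + 1 / p - 1 := by
            field_simp
            ring
          rw [h2, Real.rpow_sub_one hN0.ne', Real.rpow_add hN0, hs]
          have : N ^ (1 / p) ≠ 0 := (Real.rpow_pos_of_pos hN0 _).ne'
          field_simp
        calc _ = s ^ 2 * N * N ^ ((2 - p) / p) * (C * η ^ ((2 - p) / p)) := by ring
          _ = _ := by rw [h1, one_mul]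

/-- Among any infinitely many columns of `ℓ_p(ℓ_2)` there is a further copy of `ℓ_2` whose
limiting density is small off a small set. -/
theorem exists_small_density (hp : 1 < p) (hp2 : p ≠ 2)
    (T : lpl2 p →L[ℝ] Lp ℝ (ENNReal.ofReal p) μ) {c : ℕ → ℕ} (hc : Function.Injective c) {δ : ℝ}
    (hδ : 0 < δ) :
    ∃ (U : SeqL2 →L[ℝ] lpl2 p) (f : Ω → ℝ) (A : Set Ω), (∀ a, ‖U a‖ = ‖a‖) ∧
      (∀ a, ∀ j ∉ Set.range c, U a j = 0) ∧ ColLim p μ (fun n => T (U (l2e n))) f ∧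
      MeasurableSet A ∧ μ A ≤ ENNReal.ofReal δ ∧ lpn p (μ.restrict Aᶜ) f ≤ δ := by
  rcases lt_or_gt_of_ne hp2 with h | h
  · exact exists_small_density_of_lt_two hp h T hc hδ
  · exact exists_small_density_of_two_lt h T hc hδ

end smallDensity

section restriction
variable {Ω : Type*} [MeasurableSpace Ω] {μ : Measure Ω} {p : ℝ}
  [IsFiniteMeasure μ] [Fact (1 ≤ ENNReal.ofReal p)]

lemma lpn_indicator {A : Set Ω} (hA : MeasurableSet A) (F : Ω → ℝ) :
    lpn p μ (A.indicator F) = lpn p (μ.restrict A) F := by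
  rw [lpn, lpn, eLpNorm_indicator_eq_eLpNorm_restrict hA]

/-- Multiplication by the indicator function of a measurable set, as an operator on `L_p`. -/
noncomputable def resLp (p : ℝ) [Fact (1 ≤ ENNReal.ofReal p)] {A : Set Ω} (hA : MeasurableSet A) :
    Lp ℝ (ENNReal.ofReal p) μ →L[ℝ] Lp ℝ (ENNReal.ofReal p) μ :=
  LinearMap.mkContinuous
    { toFun := fun F => ((Lp.memLp F).indicator hA).toLp
      map_add' := fun F G => by
        rw [← MemLp.toLp_add, MemLp.toLp_eq_toLp_iff]
        filter_upwards [Lp.coeFn_add F G] with ω h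
        rw [Pi.add_apply]
        by_cases hω : ω ∈ A
        · simp only [Set.indicator_of_mem hω, h, Pi.add_apply]
        · simp only [Set.indicator_of_notMem hω, add_zero]
      map_smul' := fun r F => by
        rw [RingHom.id_apply, ← MemLp.toLp_const_smul, MemLp.toLp_eq_toLp_iff]
        filter_upwards [Lp.coeFn_smul r F] with ω h
        by_cases hω : ω ∈ A
        · simp only [Set.indicator_of_mem hω, h, Pi.smul_apply]
        · simp only [Set.indicator_of_notMem hω, Pi.smul_apply, smul_zero] } 1 fun F => by
    rw [one_mul]
    refine Lp.norm_le_norm_of_ae_le ?_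
    filter_upwards [((Lp.memLp F).indicator hA).coeFn_toLp] with ω h
    simp only [LinearMap.coe_mk, AddHom.coe_mk]
    rw [h]
    exact norm_indicator_le_norm_self _ _

variable {A : Set Ω} (hA : MeasurableSet A)

lemma coeFn_resLp (F : Lp ℝ (ENNReal.ofReal p) μ) : resLp p hA F =ᵐ[μ] A.indicator F :=
  ((Lp.memLp F).indicator hA).coeFn_toLp

lemma norm_resLp (F : Lp ℝ (ENNReal.ofReal p) μ) : ‖resLp p hA F‖ = lpn p (μ.restrict A) F := by
  rw [← lpn_indicator hA, ← lpn_coeFn]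
  exact lpn_congr (coeFn_resLp hA F)

lemma norm_sub_resLp (F : Lp ℝ (ENNReal.ofReal p) μ) :
    ‖F - resLp p hA F‖ = lpn p (μ.restrict Aᶜ) F := by
  rw [← lpn_indicator hA.compl, ← lpn_coeFn]
  refine lpn_congr ?_
  filter_upwards [coeFn_resLp hA F, Lp.coeFn_sub F (resLp p hA F)] with ω h1 h2
  rw [h2, Pi.sub_apply, h1]
  by_cases hω : ω ∈ A <;> simp [hω]

lemma resLp_resLp (F : Lp ℝ (ENNReal.ofReal p) μ) :
    resLp p hA (resLp p hA F) = resLp p hA F := by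
  refine Lp.ext ?_
  filter_upwards [coeFn_resLp hA F, coeFn_resLp hA (resLp p hA F)] with ω h1 h2
  rw [h2]
  by_cases hω : ω ∈ A
  · simp [hω]
  · simp [hω, h1]

lemma resLp_resLp_of_disjoint {B : Set Ω} (hB : MeasurableSet B) (h : Disjoint A B)
    (F : Lp ℝ (ENNReal.ofReal p) μ) : resLp p hA (resLp p hB F) = 0 := by
  refine Lp.ext ?_
  filter_upwards [coeFn_resLp hB F, coeFn_resLp hA (resLp p hB F),
    Lp.coeFn_zero ℝ (ENNReal.ofReal p) μ] with ω h1 h2 h3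
  rw [h2, h3]
  by_cases hω : ω ∈ A
  · simp [hω, h1, Set.disjoint_left.1 h hω]
  · simp [hω]

lemma norm_rpow_eq_integral (F : Lp ℝ (ENNReal.ofReal p) μ) : ‖F‖ ^ p = ∫ ω, |F ω| ^ p ∂μ := by
  have hp : 0 < p := by linarith [one_le_of_fact (p := p)]
  rw [← lpn_coeFn, lpn_rpow hp (Lp.memLp F)]

variable {S : ℕ → Set Ω} (hS : ∀ i, MeasurableSet (S i))

lemma norm_sum_resLp_rpow (hd : Pairwise fun i j => Disjoint (S i) (S j)) (t : Finset ℕ)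
    (F : ℕ → Lp ℝ (ENNReal.ofReal p) μ) :
    ‖∑ i ∈ t, resLp p (hS i) (F i)‖ ^ p = ∑ i ∈ t, ‖resLp p (hS i) (F i)‖ ^ p := by
  have hp : 0 < p := by linarith [one_le_of_fact (p := p)]
  simp only [norm_rpow_eq_integral]
  rw [← integral_finsetSum _ fun i _ => integrable_abs_rpow_of_memLp hp (Lp.memLp _)]
  refine integral_congr_ae ?_
  have h1 := coeFn_sum_smul t (fun _ => 1) fun i => resLp p (hS i) (F i)
  simp only [one_smul, one_mul] at h1
  filter_upwards [h1, ae_all_iff.2 fun i => coeFn_resLp (hS i) (F i)] with ω h2 h3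
  rw [h2]
  simp only [h3]
  by_cases h : ∃ k ∈ t, ω ∈ S k
  · obtain ⟨k, hk, hω⟩ := h
    have hz : ∀ i ≠ k, (S i).indicator (F i) ω = 0 := fun i hi =>
      Set.indicator_of_notMem (Set.disjoint_right.1 (hd hi) hω) _
    rw [Finset.sum_eq_single_of_mem k hk fun i _ hi => hz i hi,
      Finset.sum_eq_single_of_mem k hk fun i _ hi => by
        rw [hz i hi, abs_zero, Real.zero_rpow hp.ne']]
  · push Not at h
    have hz : ∀ i ∈ t, (S i).indicator (F i) ω = 0 := fun i hi =>
      Set.indicator_of_notMem (h i hi) _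
    rw [Finset.sum_eq_zero hz, abs_zero, Real.zero_rpow hp.ne', Finset.sum_eq_zero fun i hi => by
      rw [hz i hi, abs_zero, Real.zero_rpow hp.ne']]

lemma sum_norm_resLp_rpow_le (hd : Pairwise fun i j => Disjoint (S i) (S j)) (t : Finset ℕ)
    (F : Lp ℝ (ENNReal.ofReal p) μ) :
    ∑ i ∈ t, ‖resLp p (hS i) F‖ ^ p ≤ ‖F‖ ^ p := by
  have hp : 0 ≤ p := by linarith [one_le_of_fact (p := p)]
  rw [← norm_sum_resLp_rpow hS hd t fun _ => F]
  refine Real.rpow_le_rpow (norm_nonneg _) (Lp.norm_le_norm_of_ae_le ?_) hp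
  have h1 := coeFn_sum_smul t (fun _ => 1) fun i => resLp p (hS i) F
  simp only [one_smul, one_mul] at h1
  filter_upwards [h1, ae_all_iff.2 fun i => coeFn_resLp (hS i) F] with ω h2 h3
  rw [h2]
  simp only [h3]
  by_cases h : ∃ k ∈ t, ω ∈ S k
  · obtain ⟨k, hk, hω⟩ := h
    rw [Finset.sum_eq_single_of_mem k hk fun i _ hi =>
      Set.indicator_of_notMem (Set.disjoint_right.1 (hd hi) hω) _]
    exact norm_indicator_le_norm_self _ _
  · push Not at h
    rw [Finset.sum_eq_zero fun i hi => Set.indicator_of_notMem (h i hi) _]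
    simp

end restriction

section sums
variable {p : ℝ} [Fact (1 ≤ ENNReal.ofReal p)] {E : Type*} [NormedAddCommGroup E] [NormedSpace ℝ E]

lemma hasSum_norm_rpow (h : lpl2 p) : HasSum (fun i => ‖h i‖ ^ p) (‖h‖ ^ p) := by
  have hp : 0 < p := by linarith [one_le_of_fact (p := p)]
  have := lp.hasSum_norm (by rwa [ENNReal.toReal_ofReal hp.le]) h
  rwa [ENNReal.toReal_ofReal hp.le] at this

lemma norm_apply_le (h : lpl2 p) (i : ℕ) : ‖h i‖ ≤ ‖h‖ :=
  lp.norm_apply_le_norm (by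
    have := one_le_of_fact (p := p)
    simp only [ne_eq, ENNReal.ofReal_eq_zero, not_le]
    linarith) h i

/-- Operators on `ℓ_2` satisfying an upper `p`-estimate sum to an operator on `ℓ_p(ℓ_2)`. -/
lemma exists_sum_operator [CompleteSpace E] {U : ℕ → SeqL2 →L[ℝ] E} {C : ℝ} (hC : 0 ≤ C)
    (hU : ∀ (t : Finset ℕ) (a : ℕ → SeqL2),
      ‖∑ i ∈ t, U i (a i)‖ ^ p ≤ C ^ p * ∑ i ∈ t, ‖a i‖ ^ p) :
    ∃ J : lpl2 p →L[ℝ] E, ∀ h, HasSum (fun i => U i (h i)) (J h) := by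
  have hp : 0 < p := by linarith [one_le_of_fact (p := p)]
  have hs : ∀ h : lpl2 p, Summable fun i => U i (h i) := fun h => by
    rw [summable_iff_vanishing_norm]
    intro ε hε
    have h1 := summable_iff_vanishing_norm.1 (hasSum_norm_rpow h).summable
      (ε ^ p / (C ^ p + 1)) (by positivity)
    obtain ⟨s, hs⟩ := h1
    refine ⟨s, fun t ht => ?_⟩
    have h2 := hs t ht
    rw [Real.norm_of_nonneg (Finset.sum_nonneg fun i _ => by positivity),
      lt_div_iff₀ (by positivity)] at h2
    by_contra! hlt
    have h3 := Real.rpow_le_rpow hε.le hlt hp.le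
    have h4 : 0 ≤ ∑ i ∈ t, ‖h i‖ ^ p := Finset.sum_nonneg fun i _ => by positivity
    have h5 := hU t fun i => h i
    nlinarith [Real.rpow_nonneg hC p]
  let J : lpl2 p →ₗ[ℝ] E :=
    { toFun := fun h => ∑' i, U i (h i)
      map_add' := fun h k => by
        rw [← (hs h).tsum_add (hs k)]
        exact tsum_congr fun i => by rw [lp.coeFn_add, Pi.add_apply, map_add]
      map_smul' := fun r h => by
        rw [RingHom.id_apply, ← (hs h).tsum_const_smul r]
        exact tsum_congr fun i => by rw [lp.coeFn_smul, Pi.smul_apply, map_smul] }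
  refine ⟨J.mkContinuous C fun h => ?_, fun h => (hs h).hasSum⟩
  have h1 : Filter.Tendsto (fun t : Finset ℕ => ‖∑ i ∈ t, U i (h i)‖) Filter.atTop
    (nhds ‖J h‖) := ((hs h).hasSum.norm :)
  refine le_of_tendsto h1 (Filter.Eventually.of_forall fun t => ?_)
  refine (Real.rpow_le_rpow_iff (norm_nonneg _) (by positivity) hp).1 ?_
  rw [Real.mul_rpow hC (norm_nonneg _)]
  exact (hU t fun i => h i).trans (mul_le_mul_of_nonneg_left
    (sum_le_hasSum _ (fun i _ => by positivity) (hasSum_norm_rpow h)) (by positivity))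

/-- If the norm is `p`-additive on the terms of a series, it is `p`-additive on its sum. -/
lemma hasSum_norm_rpow_of_sum {g : ℕ → E} {x : E} (hx : HasSum g x)
    (hg : ∀ t : Finset ℕ, ‖∑ i ∈ t, g i‖ ^ p = ∑ i ∈ t, ‖g i‖ ^ p) :
    HasSum (fun i => ‖g i‖ ^ p) (‖x‖ ^ p) := by
  have hp : 0 < p := by linarith [one_le_of_fact (p := p)]
  have h1 : Filter.Tendsto (fun t : Finset ℕ => ‖∑ i ∈ t, g i‖ ^ p) Filter.atTop
    (nhds (‖x‖ ^ p)) := (Filter.Tendsto.norm hx).rpow_const (Or.inr hp.le)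
  exact h1.congr hg

lemma le_mul_of_hasSum_rpow (hp : 0 < p) {g k : ℕ → ℝ} {x y C : ℝ} (hC : 0 ≤ C)
    (hg0 : ∀ i, 0 ≤ g i) (hk0 : ∀ i, 0 ≤ k i) (hx : 0 ≤ x) (hy : 0 ≤ y)
      (hg : HasSum (fun i => g i ^ p) (x ^ p))
    (hk : HasSum (fun i => k i ^ p) (y ^ p)) (h : ∀ i, g i ≤ C * k i) : x ≤ C * y := by
  refine (Real.rpow_le_rpow_iff hx (by positivity) hp).1 ?_
  rw [Real.mul_rpow hC hy]
  refine hasSum_le (fun i => ?_) hg (hk.mul_left (C ^ p))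
  rw [← Real.mul_rpow hC (hk0 i)]
  exact Real.rpow_le_rpow (hg0 i) (h i) hp.le

/-- The norm of `ℓ_p(ℓ_2)` is `p`-additive on matrices with disjoint column supports. -/
lemma norm_add_rpow_of_disjoint {x y : lpl2 p} (h : ∀ j, x j = 0 ∨ y j = 0) :
    ‖x + y‖ ^ p = ‖x‖ ^ p + ‖y‖ ^ p := by
  have hp : p ≠ 0 := by linarith [one_le_of_fact (p := p)]
  refine (hasSum_norm_rpow (x + y)).unique (((hasSum_norm_rpow x).add
    (hasSum_norm_rpow y)).congr_fun fun j => ?_)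
  rw [lp.coeFn_add, Pi.add_apply]
  rcases h j with h | h <;> simp [h, Real.zero_rpow hp]

lemma norm_sum_rpow_of_disjoint {x : ℕ → lpl2 p}
    (h : Pairwise fun i k => ∀ j, x i j = 0 ∨ x k j = 0) (t : Finset ℕ) :
    ‖∑ i ∈ t, x i‖ ^ p = ∑ i ∈ t, ‖x i‖ ^ p := by
  have hp : p ≠ 0 := by linarith [one_le_of_fact (p := p)]
  induction t using Finset.induction_on with
  | empty => simp [Real.zero_rpow hp]
  | insert i t hi ih =>
    rw [Finset.sum_insert hi, Finset.sum_insert hi, ← ih, norm_add_rpow_of_disjoint fun j => ?_]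
    by_cases h0 : x i j = 0
    · exact Or.inl h0
    · refine Or.inr ?_
      rw [lp.coeFn_sum, Finset.sum_apply]
      exact Finset.sum_eq_zero fun k hk =>
        (h (ne_of_mem_of_not_mem hk hi).symm j).resolve_left h0

end sums

section blocks
variable {Ω : Type*} [MeasurableSpace Ω] {μ : Measure Ω} {p : ℝ}
  [IsFiniteMeasure μ] [Fact (1 ≤ ENNReal.ofReal p)] {S : ℕ → Set Ω}

/-- Operators into `ℓ_2`, precomposed with restrictions to disjoint sets, combine to an operator
into `ℓ_p(ℓ_2)`. -/
lemma exists_coordinate_operator (hS : ∀ i, MeasurableSet (S i))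
    (hd : Pairwise fun i j => Disjoint (S i) (S j))
    {V : ℕ → Lp ℝ (ENNReal.ofReal p) μ →L[ℝ] SeqL2} {C : ℝ} (hV : ∀ i, ‖V i‖ ≤ C) :
    ∃ Q : Lp ℝ (ENNReal.ofReal p) μ →L[ℝ] lpl2 p, (∀ g, ‖Q g‖ ≤ C * ‖g‖) ∧
      ∀ g i, Q g i = V i (resLp p (hS i) g) := by
  have hp : 0 < p := by linarith [one_le_of_fact (p := p)]
  have hC : 0 ≤ C := (norm_nonneg _).trans (hV 0)
  have hsum : ∀ (g : Lp ℝ (ENNReal.ofReal p) μ) (t : Finset ℕ),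
      ∑ i ∈ t, ‖V i (resLp p (hS i) g)‖ ^ p ≤ (C * ‖g‖) ^ p := fun g t => by
    rw [Real.mul_rpow hC (norm_nonneg _)]
    refine le_trans ?_ (mul_le_mul_of_nonneg_left (sum_norm_resLp_rpow_le hS hd t g)
      (by positivity))
    rw [Finset.mul_sum]
    refine Finset.sum_le_sum fun i _ => ?_
    rw [← Real.mul_rpow hC (norm_nonneg _)]
    exact Real.rpow_le_rpow (norm_nonneg _) ((V i).le_of_opNorm_le (hV i) _) hp.le
  have hmem : ∀ g : Lp ℝ (ENNReal.ofReal p) μ,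
      Memℓp (fun i => V i (resLp p (hS i) g)) (ENNReal.ofReal p) := fun g =>
    memℓp_gen' (C := (C * ‖g‖) ^ p) fun t => by
      simpa only [ENNReal.toReal_ofReal hp.le] using hsum g t
  let Q : Lp ℝ (ENNReal.ofReal p) μ →ₗ[ℝ] lpl2 p :=
    { toFun := fun g => ⟨fun i => V i (resLp p (hS i) g), hmem g⟩
      map_add' := fun g h => by ext i : 2; simp only [map_add]; rfl
      map_smul' := fun r g => by ext i : 2; simp only [map_smul]; rfl }
  have hQ : ∀ g, ‖Q g‖ ≤ C * ‖g‖ := fun g => by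
    refine lp.norm_le_of_forall_sum_le (by rwa [ENNReal.toReal_ofReal hp.le]) (by positivity)
      fun t => ?_
    rw [ENNReal.toReal_ofReal hp.le]
    exact hsum g t
  exact ⟨Q.mkContinuous C hQ, hQ, fun g i => rfl⟩

/-- An operator close to the identity is invertible. -/
lemma exists_inverse_of_norm_sub_le {E : Type*} [NormedAddCommGroup E] [NormedSpace ℝ E]
    [CompleteSpace E] {R : E →L[ℝ] E} {θ : ℝ} (hθ : θ < 1) (hθ0 : 0 ≤ θ)
    (hR : ∀ x, ‖R x - x‖ ≤ θ * ‖x‖) :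
    ∃ L : E →L[ℝ] E, (∀ x, L (R x) = x) ∧ ∀ x, ‖L x‖ ≤ (1 - θ)⁻¹ * ‖x‖ := by
  have h1 : ‖1 - R‖ < 1 := lt_of_le_of_lt (ContinuousLinearMap.opNorm_le_bound _ hθ0 fun x => by
    rw [sub_apply, one_apply_eq_self, norm_sub_rev]
    exact hR x) hθ
  have h2 : ((Units.oneSub (1 - R) h1 : (E →L[ℝ] E)ˣ) : E →L[ℝ] E) = R := by
    rw [Units.val_oneSub, sub_sub_cancel]
  set u := Units.oneSub (1 - R) h1
  refine ⟨((u⁻¹ : (E →L[ℝ] E)ˣ) : E →L[ℝ] E), fun x => ?_, fun x => ?_⟩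
  · rw [← h2]
    exact DFunLike.congr_fun u.inv_mul x
  · set y := ((u⁻¹ : (E →L[ℝ] E)ˣ) : E →L[ℝ] E) x
    have h3 : R y = x := by
      rw [← h2]
      exact DFunLike.congr_fun u.mul_inv x
    have h4 := hR y
    rw [h3] at h4
    have h5 : ‖y‖ ≤ ‖x - y‖ + ‖x‖ := by
      rw [norm_sub_rev]
      simpa using norm_add_le (y - x) x
    rw [inv_mul_eq_div, le_div_iff₀ (by linarith)]
    linarith

lemma norm_sub_le_of_hasSum {E : Type*} [NormedAddCommGroup E] {g k : ℕ → E} {x y : E} {C : ℝ}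
    (hg : HasSum g x) (hk : HasSum k y) (h : ∀ i, ‖g i - k i‖ ≤ C * (1 / 2) ^ (i + 1)) :
    ‖x - y‖ ≤ C := by
  rw [← (hg.sub hk).tsum_eq]
  refine tsum_of_norm_bounded (hasSum_geometric_two' C) fun i => (h i).trans (le_of_eq ?_)
  rw [pow_succ, one_div_pow]
  ring

set_option maxHeartbeats 1000000 in
/-- Glueing uniformly complemented isomorphic copies of `ℓ_2`, essentially supported on disjoint
sets, to a complemented copy of `ℓ_p(ℓ_2)`. -/
theorem exists_projection_of_blocks (hS : ∀ i, MeasurableSet (S i))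
    (hd : Pairwise fun i j => Disjoint (S i) (S j)) (T : lpl2 p →L[ℝ] Lp ℝ (ENNReal.ofReal p) μ)
    {J : ℕ → SeqL2 →L[ℝ] lpl2 p} (hJ : ∀ i a, ‖J i a‖ = ‖a‖)
    (hJd : Pairwise fun i k => ∀ a b j, J i a j = 0 ∨ J k b j = 0)
    {V : ℕ → Lp ℝ (ENNReal.ofReal p) μ →L[ℝ] SeqL2} {l v η : ℝ} (hl : 0 < l) (hη : 0 ≤ η)
    (hη1 : η ≤ 1) (hv : (1 + v) * η < 1)
    (hlow : ∀ i a, l * (1 - η) * ‖a‖ ≤ ‖resLp p (hS i) (T (J i a))‖)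
    (hup : ∀ i a, ‖resLp p (hS i) (T (J i a))‖ ≤ l * (1 + η) * ‖a‖)
    (hoff : ∀ i a, ‖T (J i a) - resLp p (hS i) (T (J i a))‖ ≤ l * η * ‖a‖ * (1 / 2) ^ (i + 1))
    (hV : ∀ i, ‖V i‖ ≤ v / l)
    (hVJ : ∀ i a, ‖V i (resLp p (hS i) (T (J i a))) - a‖ ≤ η * ‖a‖) :
    ∃ Θ : lpl2 p →L[ℝ] lpl2 p, (∀ h, ‖Θ h‖ = ‖h‖) ∧
      (∀ h, l * (1 - 2 * η) * ‖h‖ ≤ ‖T (Θ h)‖ ∧ ‖T (Θ h)‖ ≤ l * (1 + 2 * η) * ‖h‖) ∧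
      ∃ P : Lp ℝ (ENNReal.ofReal p) μ →L[ℝ] Lp ℝ (ENNReal.ofReal p) μ,
        ‖P‖ ≤ (1 + 2 * η) * v / (1 - (1 + v) * η) ∧ (∀ g, ∃ h, P g = T (Θ h)) ∧
        ∀ h, P (T (Θ h)) = T (Θ h) := by
  have hp : 0 < p := by linarith [one_le_of_fact (p := p)]
  have hv0 : 0 ≤ v := by
    have := (norm_nonneg _).trans (hV 0)
    rwa [le_div_iff₀ hl, zero_mul] at this
  have hJsum : ∀ (t : Finset ℕ) (a : ℕ → SeqL2),
      ‖∑ i ∈ t, J i (a i)‖ ^ p = ∑ i ∈ t, ‖J i (a i)‖ ^ p := fun t a =>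
    norm_sum_rpow_of_disjoint (fun i k hik j => hJd hik (a i) (a k) j) t
  have hTsum : ∀ (t : Finset ℕ) (a : ℕ → SeqL2),
      ‖∑ i ∈ t, resLp p (hS i) (T (J i (a i)))‖ ^ p =
        ∑ i ∈ t, ‖resLp p (hS i) (T (J i (a i)))‖ ^ p := fun t a =>
    norm_sum_resLp_rpow hS hd t fun i => T (J i (a i))
  obtain ⟨Θ, hΘ⟩ := exists_sum_operator (p := p) (U := J) zero_le_one fun t a => by
    rw [hJsum, Real.one_rpow, one_mul]
    simp only [hJ, le_refl]
  obtain ⟨T', hT'⟩ := exists_sum_operator (p := p)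
    (U := fun i => (resLp p (hS i)).comp (T.comp (J i))) (C := l * (1 + η)) (by positivity)
    fun t a => by
      simp only [ContinuousLinearMap.comp_apply]
      rw [hTsum, Finset.mul_sum]
      refine Finset.sum_le_sum fun i _ => ?_
      rw [← Real.mul_rpow (by positivity) (norm_nonneg _)]
      exact Real.rpow_le_rpow (norm_nonneg _) (hup i _) hp.le
  simp only [ContinuousLinearMap.comp_apply] at hT'
  obtain ⟨Q, hQ, hQi⟩ := exists_coordinate_operator hS hd hV
  have hΘn : ∀ h, ‖Θ h‖ = ‖h‖ := fun h => by
    have h1 := hasSum_norm_rpow_of_sum (p := p) (hΘ h) fun t => hJsum t fun i => h i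
    simp only [hJ] at h1
    exact (Real.rpow_left_inj (norm_nonneg _) (norm_nonneg _) hp.ne').1
      (h1.unique (hasSum_norm_rpow h))
  have hT'n : ∀ h : lpl2 p, HasSum (fun i => ‖resLp p (hS i) (T (J i (h i)))‖ ^ p)
      (‖T' h‖ ^ p) := fun h =>
    hasSum_norm_rpow_of_sum (p := p) (hT' h) fun t => hTsum t fun i => h i
  have hT'up : ∀ h, ‖T' h‖ ≤ l * (1 + η) * ‖h‖ := fun h =>
    le_mul_of_hasSum_rpow hp (by positivity) (fun _ => norm_nonneg _) (fun _ => norm_nonneg _)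
      (norm_nonneg _) (norm_nonneg _) (hT'n h) (hasSum_norm_rpow h) fun i => hup i _
  have hT'low : ∀ h, l * (1 - η) * ‖h‖ ≤ ‖T' h‖ := fun h => by
    rcases hη1.eq_or_lt with h1 | h1
    · rw [h1, sub_self, mul_zero, zero_mul]
      exact norm_nonneg _
    have h2 : 0 < l * (1 - η) := mul_pos hl (by linarith)
    rw [← le_div_iff₀' h2, ← inv_mul_eq_div]
    refine le_mul_of_hasSum_rpow hp (by positivity) (fun _ => norm_nonneg _)
      (fun _ => norm_nonneg _)
      (norm_nonneg _) (norm_nonneg _) (hasSum_norm_rpow h) (hT'n h) fun i => ?_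
    rw [inv_mul_eq_div, le_div_iff₀' h2]
    exact hlow i _
  have hclose : ∀ h, ‖T (Θ h) - T' h‖ ≤ l * η * ‖h‖ := fun h => by
    refine norm_sub_le_of_hasSum ((hΘ h).mapL T) (hT' h) fun i => (hoff i _).trans ?_
    exact mul_le_mul_of_nonneg_right (mul_le_mul_of_nonneg_left (norm_apply_le h i)
      (by positivity)) (by positivity)
  have hQT' : ∀ h, ‖Q (T' h) - h‖ ≤ η * ‖h‖ := fun h => by
    refine le_mul_of_hasSum_rpow hp hη (fun _ => norm_nonneg _) (fun _ => norm_nonneg _)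
      (norm_nonneg _) (norm_nonneg _) (hasSum_norm_rpow _) (hasSum_norm_rpow h) fun i => ?_
    have h1 : resLp p (hS i) (T' h) = resLp p (hS i) (T (J i (h i))) := by
      refine ((hT' h).mapL (resLp p (hS i))).unique ?_
      rw [← resLp_resLp (hS i) (T (J i (h i)))]
      exact hasSum_single i fun k hk =>
        resLp_resLp_of_disjoint (hS i) (hS k) (hd hk.symm) _
    rw [lp.coeFn_sub, Pi.sub_apply, hQi, h1]
    exact hVJ i _
  have hR : ∀ h, ‖(Q.comp (T.comp Θ)) h - h‖ ≤ (1 + v) * η * ‖h‖ := fun h => by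
    have h1 : ‖Q (T (Θ h) - T' h)‖ ≤ v / l * (l * η * ‖h‖) :=
      (hQ _).trans (mul_le_mul_of_nonneg_left (hclose h) (by positivity))
    have h2 : v / l * (l * η * ‖h‖) = v * η * ‖h‖ := by field_simp
    have h3 : (Q.comp (T.comp Θ)) h - h = Q (T (Θ h) - T' h) + (Q (T' h) - h) := by
      rw [map_sub]
      simp only [ContinuousLinearMap.comp_apply]
      abel
    rw [h3]
    refine (norm_add_le _ _).trans ?_
    linarith [hQT' h]
  obtain ⟨L, hL, hLn⟩ := exists_inverse_of_norm_sub_le hv (by positivity) hR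
  have hTΘ : ∀ h, ‖T (Θ h)‖ ≤ l * (1 + 2 * η) * ‖h‖ := fun h => by
    have h1 := norm_add_le (T (Θ h) - T' h) (T' h)
    rw [sub_add_cancel] at h1
    linarith [hclose h, hT'up h]
  refine ⟨Θ, hΘn, fun h => ⟨?_, hTΘ h⟩, (T.comp Θ).comp (L.comp Q), ?_, fun g => ⟨L (Q g), rfl⟩,
    fun h => ?_⟩
  · have h1 := norm_sub_le (T (Θ h)) (T (Θ h) - T' h)
    rw [sub_sub_cancel] at h1
    linarith [hclose h, hT'low h]
  · have h0 : 0 < 1 - (1 + v) * η := by linarith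
    refine ContinuousLinearMap.opNorm_le_bound _ (by positivity) fun g => ?_
    have h1 : ‖L (Q g)‖ ≤ (1 - (1 + v) * η)⁻¹ * (v / l * ‖g‖) :=
      (hLn _).trans (mul_le_mul_of_nonneg_left (hQ g) (by positivity))
    refine (hTΘ (L (Q g))).trans ((mul_le_mul_of_nonneg_left h1 (by positivity)).trans
      (le_of_eq ?_))
    field_simp
  · have := hL h
    simp only [ContinuousLinearMap.comp_apply] at this ⊢
    rw [this]

end blocks

section construction
variable {Ω : Type*} [MeasurableSpace Ω] {μ : Measure Ω} {p : ℝ}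
  [IsFiniteMeasure μ] [Fact (1 ≤ ENNReal.ofReal p)]

lemma lpn_restrict_union_le (hp : 1 ≤ p) {A B : Set Ω} (hA : MeasurableSet A)
    (hB : MeasurableSet B) {F : Ω → ℝ} (hF : MemLp F (ENNReal.ofReal p) μ) :
    lpn p (μ.restrict (A ∪ B)) F ≤ lpn p (μ.restrict A) F + lpn p (μ.restrict B) F := by
  have hA' := (hF.indicator hA).norm
  have hB' := (hF.indicator hB).norm
  have h2 : lpn p μ ((A ∪ B).indicator F) ≤
      lpn p μ ((fun ω => ‖A.indicator F ω‖) + fun ω => ‖B.indicator F ω‖) := by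
    refine lpn_mono (hA'.add hB') (Filter.Eventually.of_forall fun ω => ?_)
    rw [Pi.add_apply, abs_of_nonneg (add_nonneg (norm_nonneg _) (norm_nonneg _))]
    by_cases h1 : ω ∈ A <;> by_cases h2 : ω ∈ B <;> simp [h1, h2]
  rw [← lpn_indicator (hA.union hB), ← lpn_indicator hA, ← lpn_indicator hB,
    ← lpn_abs (F := A.indicator F), ← lpn_abs (F := B.indicator F)]
  exact h2.trans (lpn_add_le hp hA' hB')

lemma tendsto_lpn_restrict (hp : 0 < p) {F : Ω → ℝ} (hF : MemLp F (ENNReal.ofReal p) μ)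
    {D : ℕ → Set Ω} (hD : Filter.Tendsto (fun n => μ (D n)) Filter.atTop (nhds 0)) :
    Filter.Tendsto (fun n => lpn p (μ.restrict (D n)) F) Filter.atTop (nhds 0) := by
  have h1 := ((integrable_abs_rpow_of_memLp hp hF).tendsto_setIntegral_nhds_zero hD).rpow_const
    (p := 1 / p) (Or.inr (by positivity))
  rw [Real.zero_rpow (by positivity)] at h1
  exact h1.congr fun n => (lpn_eq hp (hF.restrict _)).symm

/-- Functions concentrated on small sets have a subsequence concentrated on disjoint sets. -/
lemma exists_disjoint_sets (hp : 1 ≤ p) {f : ℕ → Ω → ℝ} {A : ℕ → Set Ω}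
    (hf : ∀ t, MemLp (f t) (ENNReal.ofReal p) μ) (hA : ∀ t, MeasurableSet (A t))
    (hμ : ∀ t, μ (A t) ≤ ENNReal.ofReal ((1 / 2) ^ t))
    (hfA : ∀ t, lpn p (μ.restrict (A t)ᶜ) (f t) ≤ (1 / 2) ^ t) :
    ∃ (φ : ℕ → ℕ) (S : ℕ → Set Ω), StrictMono φ ∧ (∀ i, MeasurableSet (S i)) ∧
      (Pairwise fun i j => Disjoint (S i) (S j)) ∧
      ∀ i, lpn p (μ.restrict (S i)ᶜ) (f (φ i)) ≤ 2 * (1 / 2) ^ i := by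
  have hp0 : 0 < p := by linarith
  set D : ℕ → Set Ω := fun n => ⋃ b, A (n + b) with hDdef
  have hDm : ∀ n, MeasurableSet (D n) := fun n => MeasurableSet.iUnion fun b => hA _
  have hDμ : ∀ n, μ (D n) ≤ ENNReal.ofReal (2 * (1 / 2) ^ n) := fun n => by
    have h1 : HasSum (fun b : ℕ => (1 / 2 : ℝ) ^ n * (1 / 2) ^ b) ((1 / 2) ^ n * 2) :=
      hasSum_geometric_two.mul_left _
    rw [mul_comm, ← h1.tsum_eq, ENNReal.ofReal_tsum_of_nonneg (fun b => by positivity)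
      h1.summable]
    refine (measure_iUnion_le _).trans (ENNReal.tsum_le_tsum fun b => ?_)
    rw [← pow_add]
    exact hμ _
  have hDt : Filter.Tendsto (fun n => μ (D n)) Filter.atTop (nhds 0) := by
    refine tendsto_of_tendsto_of_tendsto_of_le_of_le tendsto_const_nhds ?_ (fun _ => zero_le) hDμ
    have h1 : Filter.Tendsto (fun n : ℕ => (2 : ℝ) * (1 / 2) ^ n) Filter.atTop (nhds (2 * 0)) :=
      (tendsto_pow_atTop_nhds_zero_of_lt_one (by norm_num) (by norm_num)).const_mul 2
    rw [mul_zero] at h1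
    simpa using ENNReal.tendsto_ofReal h1
  have hN : ∀ t, ∃ n, t < n ∧ lpn p (μ.restrict (D n)) (f t) ≤ (1 / 2) ^ t := fun t =>
    ((Filter.eventually_gt_atTop t).and ((tendsto_lpn_restrict hp0 (hf t) hDt).eventually_le_const
      (show (0 : ℝ) < (1 / 2) ^ t by positivity))).exists
  choose N hN1 hN2 using hN
  set φ : ℕ → ℕ := fun i => N^[i] 0 with hφdef
  have hφs : ∀ i, φ (i + 1) = N (φ i) := fun i => Function.iterate_succ_apply' N i 0
  have hφ : StrictMono φ := strictMono_nat_of_lt_succ fun i => by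
    rw [hφs]
    exact hN1 _
  have hpow : ∀ i, (1 / 2 : ℝ) ^ φ i ≤ (1 / 2) ^ i := fun i =>
    pow_le_pow_of_le_one (by norm_num) (by norm_num) (hφ.le_apply)
  refine ⟨φ, fun i => A (φ i) \ D (φ (i + 1)), hφ, fun i => (hA _).diff (hDm _), ?_, fun i => ?_⟩
  · have hlt : ∀ i j, i < j → Disjoint (A (φ i) \ D (φ (i + 1))) (A (φ j) \ D (φ (j + 1))) :=
      fun i j hij => Set.disjoint_left.2 fun ω h1 h2 => h1.2 <| Set.mem_iUnion.2
        ⟨φ j - φ (i + 1), by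
          rw [Nat.add_sub_cancel' (hφ.monotone hij)]
          exact h2.1⟩
    intro i j hij
    rcases hij.lt_or_gt with h | h
    · exact hlt i j h
    · exact (hlt j i h).symm
  · have h1 : (A (φ i) \ D (φ (i + 1)))ᶜ = (A (φ i))ᶜ ∪ D (φ (i + 1)) := by
      rw [Set.sdiff_eq, Set.compl_inter, compl_compl]
    rw [h1]
    refine (lpn_restrict_union_le hp (hA _).compl (hDm _) (hf _)).trans ?_
    have h2 := hfA (φ i)
    have h3 := hN2 (φ i)
    rw [← hφs] at h3
    linarith [hpow i]

lemma exists_subseq_near {α e : ℕ → ℝ} {c C η : ℝ} (hc : 0 < c) (hη : 0 < η)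
    (hα : ∀ i, c ≤ α i + e i) (hα0 : ∀ i, 0 ≤ α i) (hαC : ∀ i, α i ≤ C)
    (he : Filter.Tendsto e Filter.atTop (nhds 0)) :
    ∃ l > 0, ∃ ψ : ℕ → ℕ, StrictMono ψ ∧
      ∀ n, |α (ψ n) - l| ≤ η * l / 2 ∧ e (ψ n) ≤ η * l * (1 / 2) ^ (n + 2) := by
  obtain ⟨l, -, φ, hφ, hl⟩ := tendsto_subseq_of_bounded (Metric.isBounded_Icc 0 C)
    fun n => Set.mem_Icc.2 ⟨hα0 n, hαC n⟩
  have heφ := he.comp hφ.tendsto_atTop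
  have hl0 : c ≤ l := by
    have h1 := hl.add heφ
    rw [add_zero] at h1
    exact ge_of_tendsto' h1 fun n => hα (φ n)
  have hlpos : 0 < l := hc.trans_le hl0
  have hev : ∀ n : ℕ, ∀ᶠ k in Filter.atTop,
      |α (φ k) - l| ≤ η * l / 2 ∧ e (φ k) ≤ η * l * (1 / 2) ^ (n + 2) := fun n => by
    have h1 : Filter.Tendsto (fun k => |α (φ k) - l|) Filter.atTop (nhds |l - l|) :=
      (hl.sub_const l).abs
    rw [sub_self, abs_zero] at h1
    exact (h1.eventually_le_const (by positivity)).and (heφ.eventually_le_const (by positivity))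
  obtain ⟨χ, hχ, h⟩ := Filter.extraction_forall_of_eventually hev
  exact ⟨l, hlpos, φ ∘ χ, hφ.comp hχ, h⟩

/-- On a subspace isometric to `ℓ_2`, an operator with Gaussian limit `f` concentrated on `S` is a
multiple of an isometry after restriction to `S`, and its range there is well complemented. -/
lemma exists_block (hp : 1 < p) (hp2 : p ≠ 2) {X : SeqL2 →L[ℝ] Lp ℝ (ENNReal.ofReal p) μ}
    {f : Ω → ℝ} (hX : IsGauss X f) {S : Set Ω} (hS : MeasurableSet S) {l η δ : ℝ} (hl : 0 < l)
    (hη : 0 < η) (hη1 : η < 1) (hδ : 0 < δ) (hδη : δ ≤ η * l / 2)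
    (h1 : |gaussNorm p * lpn p (μ.restrict S) f - l| ≤ η * l / 2)
    (h2 : gaussNorm p * lpn p (μ.restrict Sᶜ) f ≤ δ) :
    ∃ (ι : SeqL2 →ₗᵢ[ℝ] SeqL2) (V : Lp ℝ (ENNReal.ofReal p) μ →L[ℝ] SeqL2),
      (∀ a, l * (1 - η) * ‖a‖ ≤ ‖resLp p hS (X (ι a))‖) ∧
      (∀ a, ‖resLp p hS (X (ι a))‖ ≤ l * (1 + η) * ‖a‖) ∧
      (∀ a, ‖X (ι a) - resLp p hS (X (ι a))‖ ≤ 2 * δ * ‖a‖) ∧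
      ‖V‖ ≤ (gaussConst p / (1 - η) + η) / l ∧
      ∀ a, ‖V (resLp p hS (X (ι a))) - a‖ ≤ η * ‖a‖ := by
  obtain ⟨ι, hι⟩ := hX S hS δ hδ
  rw [abs_le] at h1
  have hlow : ∀ a, l * (1 - η) * ‖a‖ ≤ ‖resLp p hS (X (ι a))‖ := fun a => by
    rw [norm_resLp]
    have h3 := (abs_le.1 (hι a).1).1
    nlinarith [norm_nonneg a]
  have hup : ∀ a, ‖resLp p hS (X (ι a))‖ ≤ l * (1 + η) * ‖a‖ := fun a => by
    rw [norm_resLp]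
    have h3 := (abs_le.1 (hι a).1).2
    nlinarith [norm_nonneg a]
  have hoff : ∀ a, ‖X (ι a) - resLp p hS (X (ι a))‖ ≤ 2 * δ * ‖a‖ := fun a => by
    rw [norm_sub_resLp]
    have h3 := (abs_le.1 (hι a).2).2
    nlinarith [norm_nonneg a]
  have hη' : 0 < 1 - η := by linarith
  obtain ⟨ι', V, hV, hVX⟩ := exists_left_inverse hp hp2
    ((resLp p hS).comp (X.comp ι.toContinuousLinearMap)) (mul_pos hl hη') hlow
    (lt_min hη (div_pos hη hl))
  refine ⟨ι.comp ι', V, fun a => ?_, fun a => ?_, fun a => ?_, hV.trans ?_, fun a => ?_⟩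
  · simpa using hlow (ι' a)
  · simpa using hup (ι' a)
  · simpa using hoff (ι' a)
  · rw [add_div, div_div, mul_comm (1 - η)]
    linarith [min_le_right η (η / l)]
  · exact (hVX a).trans (mul_le_mul_of_nonneg_right (min_le_left _ _) (norm_nonneg _))

lemma gaussConst_pos (hp : 1 < p) : 0 < gaussConst p := by
  rw [gaussConst]
  split_ifs
  · exact gaussNorm_pos (by linarith)
  · exact gaussNorm_pos (div_pos (by linarith) (by linarith))

lemma exists_small_parameter {g ε : ℝ} (hg : 0 < g) (hε : 0 < ε) : ∃ η : ℝ, 0 < η ∧ η < 1 / 2 ∧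
    (1 + (g / (1 - η) + η)) * η < 1 ∧ (1 + 2 * η) / (1 - 2 * η) ≤ 1 + ε ∧
    (1 + 2 * η) * (g / (1 - η) + η) / (1 - (1 + (g / (1 - η) + η)) * η) ≤ (1 + ε) * g := by
  have hv : ContinuousAt (fun η : ℝ => g / (1 - η) + η) 0 := by
    refine ContinuousAt.add (ContinuousAt.div (by fun_prop) (by fun_prop) (by simp)) (by fun_prop)
  have h1 : ContinuousAt (fun η : ℝ => (1 + (g / (1 - η) + η)) * η) 0 := by fun_prop
  have h2 : ContinuousAt (fun η : ℝ => (1 + 2 * η) / (1 - 2 * η)) 0 :=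
    ContinuousAt.div (by fun_prop) (by fun_prop) (by simp)
  have h3 : ContinuousAt (fun η : ℝ => (1 + 2 * η) * (g / (1 - η) + η) /
      (1 - (1 + (g / (1 - η) + η)) * η)) 0 :=
    ContinuousAt.div (by fun_prop) (by fun_prop) (by simp)
  have e1 := h1.eventually_lt_const (u := 1) (by simp)
  have e2 := h2.eventually_lt_const (u := 1 + ε) (by simpa using hε)
  have e3 := h3.eventually_lt_const (u := (1 + ε) * g) (by simp; nlinarith)
  have e4 : ∀ᶠ η : ℝ in nhds 0, η < 1 / 2 := eventually_lt_nhds (by norm_num)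
  obtain ⟨η, ⟨⟨⟨h1, h2⟩, h3⟩, h4⟩, h5⟩ :=
    ((((e1.and e2).and e3).and e4).filter_mono nhdsWithin_le_nhds).and
      (self_mem_nhdsWithin (s := Set.Ioi (0 : ℝ))) |>.exists
  exact ⟨η, h5, h4, h1, h2.le, h3.le⟩

set_option maxHeartbeats 1000000 in
/-- The main construction, over an arbitrary finite measure. -/
theorem exists_stable_copy (hp : 1 < p) (hp2 : p ≠ 2)
    (T : lpl2 p →L[ℝ] Lp ℝ (ENNReal.ofReal p) μ) {c η : ℝ} (hc : 0 < c)
    (hT : ∀ h, c * ‖h‖ ≤ ‖T h‖) (hη : 0 < η) (hη1 : η < 1)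
    (hη2 : (1 + (gaussConst p / (1 - η) + η)) * η < 1) :
    ∃ l > 0, ∃ Θ : lpl2 p →L[ℝ] lpl2 p, (∀ h, ‖Θ h‖ = ‖h‖) ∧
      (∀ h, l * (1 - 2 * η) * ‖h‖ ≤ ‖T (Θ h)‖ ∧ ‖T (Θ h)‖ ≤ l * (1 + 2 * η) * ‖h‖) ∧
      ∃ P : Lp ℝ (ENNReal.ofReal p) μ →L[ℝ] Lp ℝ (ENNReal.ofReal p) μ,
        ‖P‖ ≤ (1 + 2 * η) * (gaussConst p / (1 - η) + η) /
          (1 - (1 + (gaussConst p / (1 - η) + η)) * η) ∧ (∀ g, ∃ h, P g = T (Θ h)) ∧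
        ∀ h, P (T (Θ h)) = T (Θ h) := by
  have hpair : ∀ t, Function.Injective (Nat.pair t) := fun t i j h => (Nat.pair_eq_pair.1 h).2
  choose U f A hUn hUc hf hA hμ hfA using fun t : ℕ =>
    exists_small_density hp hp2 T (hpair t) (show (0 : ℝ) < (1 / 2) ^ t by positivity)
  obtain ⟨φ, S, hφ, hS, hd, hfS⟩ :=
    exists_disjoint_sets hp.le (fun t => (hf t).fmemLp) hA hμ hfA
  have hG : ∀ t, IsGauss (T.comp (U t)) (f t) := fun t => (hf t).isGauss
  have hG0 := gaussNorm_nonneg p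
  have hlow : ∀ i, c ≤ gaussNorm p * lpn p (μ.restrict (S i)) (f (φ i)) +
      gaussNorm p * (2 * (1 / 2) ^ i) := fun i => by
    have h1 := le_gaussNorm_mul_of_isGauss (c := c) (hG (φ i)) fun a => by
      have := hT (U (φ i) a)
      rwa [hUn] at this
    have h2 := lpn_restrict_union_le hp.le (hS i) (hS i).compl (hf (φ i)).fmemLp
    rw [Set.union_compl_self, Measure.restrict_univ] at h2
    rw [← mul_add]
    exact h1.trans (mul_le_mul_of_nonneg_left (h2.trans (by linarith [hfS i])) hG0)
  have hup : ∀ i, gaussNorm p * lpn p (μ.restrict (S i)) (f (φ i)) ≤ ‖T‖ + 1 := fun i => by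
    obtain ⟨ι, hι⟩ := hG (φ i) (S i) (hS i) 1 one_pos
    have h1 := (abs_le.1 (hι (l2e 0)).1).1
    have h2 := lpn_restrict_le (Lp.memLp ((T.comp (U (φ i))) (ι (l2e 0)))) (S i)
    have h3 : ‖(T.comp (U (φ i))) (ι (l2e 0))‖ ≤ ‖T‖ * 1 := by
      refine (T.le_opNorm _).trans (le_of_eq ?_)
      exact congrArg (‖T‖ * ·) ((hUn _ _).trans ((ι.norm_map _).trans (norm_l2e 0)))
    rw [lpn_coeFn] at h2
    rw [norm_l2e] at h1
    linarith
  have he : Filter.Tendsto (fun i : ℕ => gaussNorm p * (2 * (1 / 2 : ℝ) ^ i)) Filter.atTop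
      (nhds 0) := by
    simpa using ((tendsto_pow_atTop_nhds_zero_of_lt_one (r := (1 / 2 : ℝ)) (by norm_num)
      (by norm_num)).const_mul 2).const_mul (gaussNorm p)
  obtain ⟨l, hl, ψ, hψ, hψl⟩ := exists_subseq_near hc hη hlow
    (fun i => mul_nonneg hG0 lpn_nonneg) hup he
  have hδ : ∀ n : ℕ, η * l * (1 / 2) ^ (n + 2) ≤ η * l / 2 := fun n => by
    have h1 : (1 / 2 : ℝ) ^ (n + 2) ≤ 1 / 2 :=
      pow_le_of_le_one (by norm_num) (by norm_num) (by omega)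
    have h2 := mul_le_mul_of_nonneg_left h1 (mul_pos hη hl).le
    linarith
  choose ι V h1 h2 h3 h4 h5 using fun n => exists_block hp hp2 (hG (φ (ψ n))) (hS (ψ n)) hl hη
    hη1 (by positivity) (hδ n) (hψl n).1
    ((mul_le_mul_of_nonneg_left (hfS (ψ n)) hG0).trans (hψl n).2)
  obtain ⟨Θ, hΘ⟩ := exists_projection_of_blocks (fun n => hS (ψ n))
    (fun i j hij => hd (hψ.injective.ne hij)) T
    (J := fun n => (U (φ (ψ n))).comp (ι n).toContinuousLinearMap) (V := V)
    (v := gaussConst p / (1 - η) + η) (l := l) (η := η)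
    (fun n a => (hUn _ _).trans ((ι n).norm_map a)) (fun i k hik a b j => by
      by_cases hj : j ∈ Set.range (Nat.pair (φ (ψ i)))
      · refine Or.inr (hUc _ _ j fun hj' => ?_)
        obtain ⟨m, rfl⟩ := hj
        obtain ⟨m', h⟩ := hj'
        exact hik (hψ.injective (hφ.injective (Nat.pair_eq_pair.1 h).1)).symm
      · exact Or.inl (hUc _ _ j hj)) hl hη.le hη1.le hη2 h1 h2
    (fun n a => (h3 n a).trans (le_of_eq (by rw [pow_succ _ (n + 1)]; ring))) h4 h5
  exact ⟨l, hl, Θ, hΘ⟩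

end construction

/-- Main theorem: any isomorphic embedding `T : ℓ_p(ℓ_2) → L_p[0,1]`, `1 < p ≠ 2 < ∞`,
restricts to a `(1+ε)`-isomorphism on a subspace `Y` which is `(1+ε)`-isomorphic to
`ℓ_p(ℓ_2)` and such that `T(Y)` is complemented by a projection of norm at most
`(1+ε)γ_p` if `p > 2`, resp. `(1+ε)γ_{p/(p-1)}` if `1 < p < 2`. -/
theorem stabilizing_embedding_lp_l2 (p : ℝ) (hp₁ : 1 < p) (hp₂ : p ≠ 2)
    [Fact (1 ≤ ENNReal.ofReal p)]
    (ε : ℝ) (hε : 0 < ε)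
    (T : lpl2 p →L[ℝ] Lp ℝ (ENNReal.ofReal p) μ01)
    (A B : ℝ) (hA : 0 < A) (hB : 0 < B)
    (hT : ∀ v : lpl2 p, A⁻¹ * ‖v‖ ≤ ‖T v‖ ∧ ‖T v‖ ≤ B * ‖v‖) :
    ∃ Y : Submodule ℝ (lpl2 p),
      -- `Y` is `(1+ε)`-isomorphic to `ℓ_p(ℓ_2)`
      (∃ (J : lpl2 p ≃ₗ[ℝ] Y) (A' B' : ℝ), 0 < A' ∧ 0 < B' ∧ A' * B' ≤ 1 + ε ∧
        ∀ v : lpl2 p, A'⁻¹ * ‖v‖ ≤ ‖(J v : lpl2 p)‖ ∧ ‖(J v : lpl2 p)‖ ≤ B' * ‖v‖) ∧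
      -- `T` restricted to `Y` is a `(1+ε)`-isomorphism
      (∃ A' B' : ℝ, 0 < A' ∧ 0 < B' ∧ A' * B' ≤ 1 + ε ∧
        ∀ y ∈ Y, A'⁻¹ * ‖y‖ ≤ ‖T y‖ ∧ ‖T y‖ ≤ B' * ‖y‖) ∧
      -- `T(Y)` is complemented by a projection of norm at most `(1+ε)γ_p`
      (∃ P : Lp ℝ (ENNReal.ofReal p) μ01 →L[ℝ] Lp ℝ (ENNReal.ofReal p) μ01,
        ‖P‖ ≤ (1 + ε) * (if 2 < p then gaussNorm p else gaussNorm (p / (p - 1))) ∧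
        (∀ f, P f ∈ (Y.map (T : lpl2 p →ₗ[ℝ] Lp ℝ (ENNReal.ofReal p) μ01)).topologicalClosure) ∧
        (∀ f ∈ Y.map (T : lpl2 p →ₗ[ℝ] Lp ℝ (ENNReal.ofReal p) μ01), P f = f)) := by
  obtain ⟨η, hη, hη2, h1, h2, h3⟩ := exists_small_parameter (gaussConst_pos hp₁) hε
  have : IsFiniteMeasure μ01 := by
    rw [μ01]
    infer_instance
  obtain ⟨l, hl, Θ, hΘ, hT', P, hP, hPT, hPfix⟩ := exists_stable_copy hp₁ hp₂ T (inv_pos.2 hA)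
    (fun h => (hT h).1) hη (by linarith) h1
  have hinj : Function.Injective (Θ : lpl2 p →ₗ[ℝ] lpl2 p) := by
    refine (injective_iff_map_eq_zero _).2 fun h hh => ?_
    rw [← norm_eq_zero, ← hΘ h, norm_eq_zero]
    exact hh
  have h2η : 0 < l * (1 - 2 * η) := mul_pos hl (by linarith)
  refine ⟨LinearMap.range (Θ : lpl2 p →ₗ[ℝ] lpl2 p),
    ⟨LinearEquiv.ofInjective _ hinj, 1, 1, one_pos, one_pos, by linarith, fun h => ?_⟩,
    ⟨(l * (1 - 2 * η))⁻¹, l * (1 + 2 * η), by positivity, by positivity, ?_, ?_⟩,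
    P, hP.trans h3, fun g => ?_, ?_⟩
  · rw [inv_one, one_mul]
    exact ⟨(hΘ h).ge, (hΘ h).le⟩
  · refine le_trans (le_of_eq ?_) h2
    rw [inv_mul_eq_div, mul_div_mul_left _ _ hl.ne']
  · rintro _ ⟨h, rfl⟩
    rw [inv_inv, ContinuousLinearMap.coe_coe, hΘ]
    exact hT' h
  · obtain ⟨h, hh⟩ := hPT g
    rw [hh]
    exact Submodule.le_topologicalClosure _ ⟨Θ h, ⟨h, rfl⟩, rfl⟩
  · rintro _ ⟨_, ⟨h, rfl⟩, rfl⟩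
    exact hPfix h
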